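/- There exists an integer n₀ such that the following holds. Suppose H is a 3-graph on n > n₀ vertices with n even and δ₁(H) ≥ C(n−1,2) − C(⌊3n/4⌋,2) + c, where c = 2 if n is divisible by 4 and c = 1 if n is even but not divisible by 4 (here C(a,2) denotes the binomial coefficient 'a choose 2'). Then H contains a loose Hamilton cycle. -/

import Mathlib

/-- The degree of a vertex in a 3-graph: the number of edges containing it. -/
def hdeg {α : Type*} [DecidableEq α] (H : Finset (Finset α)) (v : α) : ℕ :=
  (H.filter (fun e => v ∈ e)).card

/-- A 3-graph on vertex set `Fin n` contains a loose Hamilton cycle: there is a cyclic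
labeling `v₀, …, v_{n-1}` of the vertices (indices mod `n`) such that every triple
`{v_{2i}, v_{2i+1}, v_{2i+2}}`, `0 ≤ i < n/2`, is an edge. -/
def HasLooseHamCycle (n : ℕ) (H : Finset (Finset (Fin n))) : Prop :=
  ∃ f : ZMod n → Fin n, Function.Bijective f ∧
    ∀ i : ℕ, i < n / 2 →
      ({f ((2 * i : ℕ) : ZMod n), f ((2 * i + 1 : ℕ) : ZMod n),
        f ((2 * i + 2 : ℕ) : ZMod n)} : Finset (Fin n)) ∈ H

namespace LooseHam

set_option linter.unusedVariables false
set_option linter.unusedSectionVars false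

open Finset
open scoped Classical

/-- A symmetric irreflexive ternary relation: the edge relation of a 3-graph. -/
structure IsTri {V : Type*} (T : V → V → V → Prop) : Prop where
  swap₁₂ : ∀ {a b c}, T a b c → T b a c
  swap₂₃ : ∀ {a b c}, T a b c → T a c b
  ne : ∀ {a b c}, T a b c → a ≠ b

/-- `LPath T a b l`: the list `a :: l` is the vertex sequence of a loose walk from `a` to `b`. -/
inductive LPath {V : Type*} (T : V → V → V → Prop) : V → V → List V → Prop
  | nil (a : V) : LPath T a a []
  | cons {a x c b : V} {l : List V} : T a x c → LPath T c b l → LPath T a b (x :: c :: l)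

section Paths

variable {V : Type*} [DecidableEq V] {T : V → V → V → Prop}

theorem LPath.append {a b c : V} {l l' : List V} (h : LPath T a b l) (h' : LPath T b c l') :
    LPath T a c (l ++ l') := by
  induction h with
  | nil a => simpa using h'
  | cons ht _ ih => exact LPath.cons ht (ih h')

theorem LPath.even_length {a b : V} {l : List V} (h : LPath T a b l) : Even l.length := by
  induction h with
  | nil a => simp
  | cons ht _ ih => simpa [Nat.even_add_one] using ih

theorem LPath.getLast_eq {a b : V} {l : List V} (h : LPath T a b l) :
    (a :: l).getLast (by simp) = b := by
  induction h with
  | nil a => simp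
  | cons ht _ ih => simpa using ih

theorem LPath.rel_get {a b : V} {l : List V} (h : LPath T a b l) :
    ∀ i, (hi : 2 * i + 2 < (a :: l).length) →
      T ((a :: l)[2 * i]'(by omega)) ((a :: l)[2 * i + 1]'(by omega)) ((a :: l)[2 * i + 2]) := by
  induction h with
  | nil a => intro i hi; simp at hi
  | cons ht _ ih =>
    intro i hi
    rcases i with _ | i
    · simpa using ht
    · have := ih i (by simp at hi ⊢; omega)
      simpa [Nat.mul_add] using this

/-- `F` is the vertex set of a loose path from `a` to `b`. -/
def PathOn (T : V → V → V → Prop) (a b : V) (F : Finset V) : Prop :=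
  ∃ l, LPath T a b l ∧ (a :: l).Nodup ∧ (a :: l).toFinset = F

/-- `I` is the set of inner vertices of a loose path from `a` to `b`. -/
def PathIn (T : V → V → V → Prop) (a b : V) (I : Finset V) : Prop :=
  ∃ l, LPath T a b (l ++ [b]) ∧ l.Nodup ∧ l.toFinset = I

theorem PathOn.odd_card {a b : V} {F : Finset V} (h : PathOn T a b F) : Odd F.card := by
  obtain ⟨l, hl, hn, rfl⟩ := h
  rw [List.toFinset_card_of_nodup hn, List.length_cons]
  exact hl.even_length.add_one

theorem PathOn.join {a b c d : V} {F I G : Finset V} (h₁ : PathOn T a b F) (h₂ : PathIn T b c I)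
    (h₃ : PathOn T c d G) (d₁ : Disjoint F I) (d₂ : Disjoint F G) (d₃ : Disjoint I G) :
    PathOn T a d (F ∪ (I ∪ G)) := by
  obtain ⟨l, hl, hn, rfl⟩ := h₁
  obtain ⟨m, hm, hmn, rfl⟩ := h₂
  obtain ⟨k, hk, hkn, rfl⟩ := h₃
  refine ⟨l ++ ((m ++ [c]) ++ k), hl.append (hm.append hk), ?_, ?_⟩
  · have : a :: (l ++ ((m ++ [c]) ++ k)) = (a :: l) ++ (m ++ (c :: k)) := by simp
    rw [this, List.nodup_append', List.nodup_append']
    rw [List.disjoint_toFinset_iff_disjoint] at d₁ d₂ d₃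
    exact ⟨hn, ⟨hmn, hkn, d₃⟩, List.disjoint_append_right.2 ⟨d₁, d₂⟩⟩
  · ext v
    simp
    tauto

theorem PathOn.map {W : Type*} [DecidableEq W] {T' : W → W → W → Prop} (f : V ↪ W)
    (hT : ∀ a b c, T a b c → T' (f a) (f b) (f c)) {a b : V} {F : Finset V}
    (h : PathOn T a b F) : PathOn T' (f a) (f b) (F.map f) := by
  obtain ⟨l, hl, hn, rfl⟩ := h
  refine ⟨l.map f, ?_, ?_, ?_⟩
  · clear hn
    induction hl with
    | nil a => exact LPath.nil _
    | cons ht _ ih => exact LPath.cons (hT _ _ _ ht) ih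
  · rw [← List.map_cons]
    exact hn.map f.injective
  · ext v
    simp

theorem pathOn_three {a x b : V} (h : T a x b) (hn : [a, x, b].Nodup) :
    PathOn T a b {a, x, b} :=
  ⟨[x, b], LPath.cons h (LPath.nil _), hn, by ext; simp⟩

theorem pathOn_five {a x c y b : V} (h : T a x c) (h' : T c y b) (hn : [a, x, c, y, b].Nodup) :
    PathOn T a b {a, x, c, y, b} :=
  ⟨[x, c, y, b], LPath.cons h (LPath.cons h' (LPath.nil _)), hn, by ext; simp⟩

theorem pathIn_three {a x c y b : V} (h : T a x c) (h' : T c y b) (hn : [x, c, y].Nodup) :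
    PathIn T a b {x, c, y} :=
  ⟨[x, c, y], LPath.cons h (LPath.cons h' (LPath.nil _)), hn, by ext; simp⟩

/-- `F` is the vertex set of a family of disjoint loose paths with the listed ends. -/
def Sys (T : V → V → V → Prop) : List (V × V) → Finset V → Prop
  | [], F => F = ∅
  | p :: L, F => ∃ F₁ F₂, PathOn T p.1 p.2 F₁ ∧ Sys T L F₂ ∧ Disjoint F₁ F₂ ∧ F = F₁ ∪ F₂

theorem Sys.append {L L' : List (V × V)} {F F' : Finset V} (h : Sys T L F) (h' : Sys T L' F')
    (hd : Disjoint F F') : Sys T (L ++ L') (F ∪ F') := by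
  induction L generalizing F with
  | nil =>
    cases h
    simpa using h'
  | cons p L ih =>
    obtain ⟨F₁, F₂, h₁, h₂, h₃, rfl⟩ := h
    rw [disjoint_union_left] at hd
    exact ⟨F₁, F₂ ∪ F', h₁, ih h₂ hd.2, disjoint_union_right.2 ⟨h₃, hd.1⟩, by
      rw [union_assoc]⟩

theorem Sys.singleton {a b : V} {F : Finset V} (h : PathOn T a b F) : Sys T [(a, b)] F :=
  ⟨F, ∅, h, rfl, by simp, by simp⟩

theorem Sys.cons {a b : V} {F G : Finset V} {L : List (V × V)} (h : PathOn T a b F)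
    (h' : Sys T L G) (hd : Disjoint F G) : Sys T ((a, b) :: L) (F ∪ G) :=
  ⟨F, G, h, h', hd, rfl⟩

theorem Sys.map {W : Type*} [DecidableEq W] {T' : W → W → W → Prop} (f : V ↪ W)
    (hT : ∀ a b c, T a b c → T' (f a) (f b) (f c)) {L : List (V × V)} {F : Finset V}
    (h : Sys T L F) : Sys T' (L.map (Prod.map f f)) (F.map f) := by
  induction L generalizing F with
  | nil =>
    cases h
    simp [Sys]
  | cons p L ih =>
    obtain ⟨F₁, F₂, h₁, h₂, h₃, rfl⟩ := h
    exact ⟨F₁.map f, F₂.map f, h₁.map f hT, ih h₂, (disjoint_map f).2 h₃, map_union _ _⟩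

theorem Sys.flatMap {Ω : Type*} {ends : Ω → List (V × V)} {g : Ω → Finset V} (l : List Ω)
    (hl : l.Nodup) (h : ∀ w ∈ l, Sys T (ends w) (g w))
    (hd : ∀ w ∈ l, ∀ w' ∈ l, w ≠ w' → Disjoint (g w) (g w')) :
    Sys T (l.flatMap ends) (l.toFinset.biUnion g) := by
  induction l with
  | nil => simp [Sys]
  | cons w l ih =>
    rw [List.flatMap_cons, List.toFinset_cons, biUnion_insert]
    rw [List.nodup_cons] at hl
    refine Sys.append (h w (by simp)) (ih hl.2 (fun w' hw' => h w' (by simp [hw']))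
      (fun w₁ h₁ w₂ h₂ hne => hd w₁ (by simp [h₁]) w₂ (by simp [h₂]) hne)) ?_
    rw [disjoint_biUnion_right]
    intro w' hw'
    rw [List.mem_toFinset] at hw'
    exact hd w (by simp) w' (by simp [hw']) (by rintro rfl; exact hl.1 hw')

/-- Consecutive paths of a family can be joined, uniformly over all families with given ends, by
connectors whose numbers of vertices inside and outside a reference set `A` are prescribed. -/
theorem exists_link {A E Z : Finset V} {p q KA KB : ℕ}
    (hc : ∀ a ∈ E, ∀ b ∈ E, ∀ W : Finset V, (W ∩ A).card ≤ KA → (W \ A).card ≤ KB →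
      ∃ I, I ⊆ Z ∧ Disjoint I W ∧ (I ∩ A).card = p ∧ (I \ A).card = q ∧ PathIn T a b I)
    (L : List (V × V)) : ∀ (x : V × V) (W : Finset V), (∀ y ∈ x :: L, y.1 ∈ E ∧ y.2 ∈ E) →
      (W ∩ A).card + p * L.length ≤ KA → (W \ A).card + q * L.length ≤ KB →
      ∃ C e, C ⊆ Z ∧ Disjoint C W ∧ (C ∩ A).card = p * L.length ∧ (C \ A).card = q * L.length ∧
        e ∈ E ∧ ∀ F, Sys T (x :: L) F → Disjoint F C → PathOn T x.1 e (F ∪ C) := by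
  induction L with
  | nil =>
    intro x W hE _ _
    refine ⟨∅, x.2, by simp, by simp, by simp, by simp, (hE x (by simp)).2, ?_⟩
    rintro F ⟨F₁, F₂, h₁, h₂, _, rfl⟩ _
    cases h₂
    simpa using h₁
  | cons y L ih =>
    intro x W hE hA hB
    rw [List.length_cons, Nat.mul_add, Nat.mul_one] at hA hB
    obtain ⟨I, hIZ, hIW, hIA, hIB, hI⟩ := hc x.2 (hE x (by simp)).2 y.1 (hE y (by simp)).1 W
      (by omega) (by omega)
    have key : ∀ S : Finset V, ((W ∪ I) ∩ S).card ≤ (W ∩ S).card + (I ∩ S).card := fun S => by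
      rw [union_inter_distrib_right]; exact card_union_le _ _
    have key' : ((W ∪ I) \ A).card ≤ (W \ A).card + (I \ A).card := by
      rw [union_sdiff_distrib]; exact card_union_le _ _
    obtain ⟨C, e, hCZ, hCW, hCA, hCB, he, hC⟩ := ih y (W ∪ I)
      (fun z hz => hE z (List.mem_cons_of_mem _ hz)) (by have := key A; omega) (by omega)
    rw [disjoint_union_right] at hCW
    have hIC : Disjoint I C := hCW.2.symm
    refine ⟨I ∪ C, e, union_subset hIZ hCZ, disjoint_union_left.2 ⟨hIW, hCW.1⟩, ?_, ?_, he, ?_⟩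
    · rw [union_inter_distrib_right, card_union_of_disjoint
        (hIC.mono inter_subset_left inter_subset_left), hIA, hCA, List.length_cons]
      ring
    · rw [union_sdiff_distrib, card_union_of_disjoint
        (hIC.mono sdiff_subset sdiff_subset), hIB, hCB, List.length_cons]
      ring
    · rintro F ⟨F₁, F₂, h₁, h₂, h₁₂, rfl⟩ hF
      rw [disjoint_union_left, disjoint_union_right, disjoint_union_right] at hF
      have := h₁.join hI (hC F₂ h₂ hF.2.2) hF.1.1
        (disjoint_union_right.2 ⟨h₁₂, hF.1.2⟩) (disjoint_union_right.2 ⟨hF.2.1.symm, hIC⟩)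
      have e : F₁ ∪ F₂ ∪ (I ∪ C) = F₁ ∪ (I ∪ (F₂ ∪ C)) := by ext; simp; tauto
      rwa [e]

end Paths

theorem hasLooseHamCycle_of_closed {n : ℕ} {H : Finset (Finset (Fin n))} (a : Fin n)
    (l : List (Fin n)) (h : LPath (fun a b c => ({a, b, c} : Finset (Fin n)) ∈ H) a a l)
    (hn : l.Nodup) (hlen : l.length = n) : HasLooseHamCycle n H := by
  have hpos : 0 < n := a.pos
  have : NeZero n := ⟨hpos.ne'⟩
  have hval : ∀ z : ZMod n, z.val < l.length := fun z => by rw [hlen]; exact ZMod.val_lt z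
  set f : ZMod n → Fin n := fun z => l[(z - 1).val]'(hval _) with hf
  have hinj : Function.Injective f := by
    intro z z' hzz
    have := (List.Nodup.getElem_inj_iff hn).1 hzz
    have := ZMod.val_injective n this
    exact sub_left_injective this
  have hsucc : ∀ k, (hk : k < n) → f ((k + 1 : ℕ) : ZMod n) = l[k]'(by omega) := by
    intro k hk
    simp only [hf]
    congr 1
    push_cast
    rw [add_sub_cancel_right, ZMod.val_cast_of_lt hk]
  have hzero : f ((0 : ℕ) : ZMod n) = a := by
    have h1 := hsucc (n - 1) (by omega)
    rw [Nat.sub_add_cancel hpos] at h1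
    have h2 : ((n : ℕ) : ZMod n) = ((0 : ℕ) : ZMod n) := by simp
    rw [← h2, h1]
    have h3 := h.getLast_eq
    have hne : l ≠ [] := by rintro rfl; simp at hlen; omega
    rw [List.getLast_cons hne, List.getLast_eq_getElem] at h3
    simpa [hlen] using h3
  have hget : ∀ k, (hk : k ≤ n) → f (k : ZMod n) = (a :: l)[k]'(by simp; omega) := by
    intro k hk
    rcases k with _ | k
    · simpa using hzero
    · rw [hsucc k (by omega)]
      simp
  refine ⟨f, (Fintype.bijective_iff_injective_and_card f).2 ⟨hinj, by simp [ZMod.card]⟩, ?_⟩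
  intro i hi
  have := h.rel_get i (by simp; omega)
  rw [hget _ (by omega), hget _ (by omega), hget _ (by omega)]
  exact this

theorem hasLooseHamCycle_of_pathOn {n : ℕ} {H : Finset (Finset (Fin n))} {a b : Fin n}
    {F I : Finset (Fin n)} (h₁ : PathOn (fun a b c => ({a, b, c} : Finset (Fin n)) ∈ H) a b F)
    (h₂ : PathIn (fun a b c => ({a, b, c} : Finset (Fin n)) ∈ H) b a I) (hd : Disjoint F I)
    (hu : F ∪ I = univ) : HasLooseHamCycle n H := by
  obtain ⟨l, hl, hn, rfl⟩ := h₁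
  obtain ⟨m, hm, hmn, rfl⟩ := h₂
  have hp : List.Perm (l ++ (m ++ [a])) ((a :: l) ++ m) := by
    refine List.perm_iff_count.2 fun v => ?_
    simp [List.count_cons, List.count_append]
    ring
  have hnd : ((a :: l) ++ m).Nodup := by
    rw [List.nodup_append']
    exact ⟨hn, hmn, (List.disjoint_toFinset_iff_disjoint).1 hd⟩
  refine hasLooseHamCycle_of_closed a _ (hl.append hm) (hp.nodup_iff.2 hnd) ?_
  rw [hp.length_eq, ← List.toFinset_card_of_nodup hnd, List.toFinset_append, hu]
  simp

section Sampling

variable {V ι : Type*} [Fintype V] [Fintype ι]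

theorem card_collision_le {m : ℕ} {k l : Fin m} (hkl : k ≠ l) (i i' : ι) :
    Fintype.card V * #{ω : Fin m → ι → V | ω k i = ω l i'} ≤ Fintype.card (Fin m → ι → V) := by
  rw [← card_univ (α := V), ← card_product, ← card_univ]
  refine card_le_card_of_injOn
    (fun p => Function.update p.2 k (Function.update (p.2 k) i p.1)) (by simp) ?_
  rintro ⟨v, ω⟩ h ⟨v', ω'⟩ h' heq
  simp only [coe_product, coe_univ, coe_filter, Set.mem_prod, Set.mem_univ, mem_univ, true_and,
    Set.mem_ofPred_eq] at h h'
  have hk := congrFun heq k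
  simp only [Function.update_self] at hk
  have hv := congrFun hk i
  simp only [Function.update_self] at hv
  have ho : ∀ r, r ≠ k → ω r = ω' r := fun r hr => by
    have := congrFun heq r
    simpa [Function.update_of_ne hr] using this
  refine Prod.ext hv (funext fun r => ?_)
  by_cases hr : r = k
  · subst hr
    funext j
    by_cases hj : j = i
    · subst hj
      exact h.trans ((congrFun (ho l hkl.symm) i').trans h'.symm)
    · have := congrFun hk j
      simpa [Function.update_of_ne hj] using this
  · exact ho r hr

theorem sum_exp_neg_le {Ω : Type*} [Fintype Ω] (A : Finset Ω) {δ : ℝ}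
    (hA : δ * Fintype.card Ω ≤ #A) (m : ℕ) :
    ∑ ω : Fin m → Ω, Real.exp (-(#{k | ω k ∈ A} : ℝ)) ≤
      Real.exp (-(δ * m / 2)) * (Fintype.card Ω : ℝ) ^ m := by
  have h1 : ∀ ω : Fin m → Ω, Real.exp (-(#{k | ω k ∈ A} : ℝ)) =
      ∏ k, (if ω k ∈ A then Real.exp (-1) else 1) := fun ω => by
    rw [prod_ite, prod_const, prod_const_one, mul_one, ← Real.exp_nat_mul]
    simp
  have h2 := Fintype.sum_pow (fun o : Ω => if o ∈ A then Real.exp (-1) else 1) m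
  simp_rw [h1, ← h2]
  have h3 : ∑ o : Ω, (if o ∈ A then Real.exp (-1) else 1) =
      #A * Real.exp (-1) + (Fintype.card Ω - #A) := by
    rw [sum_ite]
    simp only [sum_const, nsmul_eq_mul, mul_one, filter_mem_eq_inter, univ_inter]
    congr 1
    have : (univ.filter fun o => o ∉ A) = Aᶜ := by ext; simp
    rw [this, card_compl, Nat.cast_sub (card_le_univ A)]
  have he : Real.exp (-1) ≤ 1 / 2 := by
    rw [Real.exp_neg, ← one_div]
    exact one_div_le_one_div_of_le (by norm_num) (by linarith [Real.add_one_le_exp (1 : ℝ)])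
  have h4 : #A * Real.exp (-1) + (Fintype.card Ω - #A) ≤
      Real.exp (-(δ / 2)) * (Fintype.card Ω : ℝ) := by
    have h5 := Real.add_one_le_exp (-(δ / 2))
    have h6 : (0 : ℝ) ≤ Fintype.card Ω := by positivity
    have h7 : (0 : ℝ) ≤ #A := by positivity
    nlinarith [mul_le_mul_of_nonneg_right h5 h6, mul_le_mul_of_nonneg_left he h7]
  have h8 : (0 : ℝ) ≤ #A * Real.exp (-1) + (Fintype.card Ω - #A) := by
    have : (#A : ℝ) ≤ Fintype.card Ω := by exact_mod_cast card_le_univ A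
    have := Real.exp_pos (-1)
    have : (0 : ℝ) ≤ #A * Real.exp (-1) := by positivity
    linarith
  rw [h3]
  calc _ ≤ (Real.exp (-(δ / 2)) * (Fintype.card Ω : ℝ)) ^ m := pow_le_pow_left₀ h8 h4 m
    _ = _ := by
      rw [mul_pow, ← Real.exp_nat_mul]
      congr 2
      ring

/-- A random choice of `m` tuples, with colliding tuples deleted, meets every dense family. -/
theorem exists_sample [Nonempty ι] {J : Type*} [Fintype J] (𝒜 : J → Finset (ι → V)) {δ : ℝ}
    {m : ℕ} (h𝒜 : ∀ j, δ * (Fintype.card V : ℝ) ^ Fintype.card ι ≤ #(𝒜 j))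
    (h₁ : 16 * m * (Fintype.card ι : ℝ) ^ 2 ≤ δ * Fintype.card V)
    (h₂ : Fintype.card J * Real.exp (-(δ * m / 4)) < 1 / 2) (hm : 0 < m)
    (hV : 0 < Fintype.card V) :
    ∃ 𝓕 : Finset (ι → V), #𝓕 ≤ m ∧
      (∀ ω ∈ 𝓕, ∀ ω' ∈ 𝓕, ω ≠ ω' → ∀ i i', ω i ≠ ω' i') ∧
      ∀ j, δ * m / 8 ≤ #{ω ∈ 𝓕 | ω ∈ 𝒜 j} := by
  set s := Fintype.card ι with hs
  set n := Fintype.card V with hn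
  have hs0 : 0 < s := Fintype.card_pos
  have hΩ : (Fintype.card (ι → V) : ℝ) = (n : ℝ) ^ s := by simp [hs, hn]
  have hn' : (0 : ℝ) < n := by exact_mod_cast hV
  have hs' : (0 : ℝ) < s := by exact_mod_cast hs0
  have hm' : (0 : ℝ) < m := by exact_mod_cast hm
  let col : (Fin m → ι → V) → Finset (Fin m × Fin m) := fun ω =>
    univ.filter fun p => p.1 ≠ p.2 ∧ ∃ i i', ω p.1 i = ω p.2 i'
  have hcol : ∑ ω, (#(col ω) : ℝ) ≤ m ^ 2 * s ^ 2 / n * (n ^ s : ℝ) ^ m := by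
    have h3 : ∀ ω, #(col ω) ≤ ∑ p : Fin m × Fin m, ∑ q : ι × ι,
        if p.1 ≠ p.2 ∧ ω p.1 q.1 = ω p.2 q.2 then 1 else 0 := by
      intro ω
      rw [card_filter]
      refine sum_le_sum fun p _ => ?_
      split_ifs with h
      · obtain ⟨hp, i, i', hi⟩ := h
        refine le_trans ?_ (single_le_sum (f := fun q : ι × ι =>
          if p.1 ≠ p.2 ∧ ω p.1 q.1 = ω p.2 q.2 then 1 else 0) (by simp) (mem_univ (i, i')))
        simp [hp, hi]
      · exact Nat.zero_le _
    have h4 : ∀ (p : Fin m × Fin m) (q : ι × ι),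
        ((∑ ω : Fin m → ι → V, if p.1 ≠ p.2 ∧ ω p.1 q.1 = ω p.2 q.2 then 1 else 0 : ℕ) : ℝ) ≤
          (n ^ s : ℝ) ^ m / n := by
      intro p q
      rw [le_div_iff₀ hn', ← card_filter, mul_comm]
      by_cases hp : p.1 = p.2
      · simp [hp]
      · have := card_collision_le (V := V) hp q.1 q.2
        have h5 : Fintype.card (Fin m → ι → V) = (n ^ s) ^ m := by simp [hs, hn]
        rw [h5] at this
        simp only [ne_eq, hp, not_false_eq_true, true_and]
        exact_mod_cast this
    calc ∑ ω, (#(col ω) : ℝ) ≤ ∑ ω : Fin m → ι → V, ((∑ p : Fin m × Fin m, ∑ q : ι × ι,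
        if p.1 ≠ p.2 ∧ ω p.1 q.1 = ω p.2 q.2 then 1 else 0 : ℕ) : ℝ) :=
          sum_le_sum fun ω _ => by exact_mod_cast h3 ω
      _ = ∑ p : Fin m × Fin m, ∑ q : ι × ι,
        ((∑ ω : Fin m → ι → V, if p.1 ≠ p.2 ∧ ω p.1 q.1 = ω p.2 q.2 then 1 else 0 : ℕ) : ℝ) := by
          push_cast
          rw [sum_comm]
          refine sum_congr rfl fun p _ => ?_
          exact sum_comm
      _ ≤ ∑ p : Fin m × Fin m, ∑ q : ι × ι, (n ^ s : ℝ) ^ m / n :=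
          sum_le_sum fun p _ => sum_le_sum fun q _ => h4 p q
      _ = _ := by
          simp only [sum_const, card_univ, Fintype.card_prod, Fintype.card_fin, nsmul_eq_mul,
            ← hs]
          push_cast
          ring
  let X : J → (Fin m → ι → V) → ℕ := fun j ω => #{k | ω k ∈ 𝒜 j}
  have hX : ∀ j, ∑ ω, Real.exp (δ * m / 4 - X j ω) ≤
      Real.exp (-(δ * m / 4)) * (n ^ s : ℝ) ^ m := by
    intro j
    have h3 := sum_exp_neg_le (𝒜 j) (δ := δ) (by rw [hΩ]; exact h𝒜 j) m
    rw [hΩ] at h3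
    calc ∑ ω, Real.exp (δ * m / 4 - X j ω) =
        Real.exp (δ * m / 4) * ∑ ω : Fin m → ι → V, Real.exp (-(#{k | ω k ∈ 𝒜 j} : ℝ)) := by
          rw [mul_sum]
          exact sum_congr rfl fun ω _ => by rw [← Real.exp_add]; rfl
      _ ≤ Real.exp (δ * m / 4) * (Real.exp (-(δ * m / 2)) * (n ^ s : ℝ) ^ m) :=
          mul_le_mul_of_nonneg_left (le_trans (le_of_eq (by congr!)) h3) (Real.exp_pos _).le
      _ = _ := by
          rw [← mul_assoc, ← Real.exp_add]
          congr 2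
          ring
  have hex : ∃ ω : Fin m → ι → V,
      ∑ j, Real.exp (δ * m / 4 - X j ω) + #(col ω) * (n / (2 * m ^ 2 * s ^ 2)) < 1 := by
    by_contra! hcon
    have h3 : ∑ ω : Fin m → ι → V, (1 : ℝ) ≤ ∑ ω : Fin m → ι → V,
        (∑ j, Real.exp (δ * m / 4 - X j ω) + #(col ω) * (n / (2 * m ^ 2 * s ^ 2))) :=
      sum_le_sum fun ω _ => hcon ω
    have hN : (0 : ℝ) < (n ^ s : ℝ) ^ m := by positivity
    have h4 : ∑ ω : Fin m → ι → V, (1 : ℝ) = (n ^ s : ℝ) ^ m := by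
      rw [sum_const, card_univ, Fintype.card_fun, nsmul_eq_mul, mul_one, Fintype.card_fin]
      push_cast
      rw [hΩ]
    rw [h4, sum_add_distrib, sum_comm, ← sum_mul] at h3
    have h5 : ∑ j, ∑ ω, Real.exp (δ * m / 4 - X j ω) ≤
        Fintype.card J * (Real.exp (-(δ * m / 4)) * (n ^ s : ℝ) ^ m) := by
      calc _ ≤ ∑ j : J, (Real.exp (-(δ * m / 4)) * (n ^ s : ℝ) ^ m) :=
            sum_le_sum fun j _ => hX j
        _ = _ := by simp
    have h6 : (∑ ω, (#(col ω) : ℝ)) * (n / (2 * m ^ 2 * s ^ 2)) ≤ 1 / 2 * (n ^ s : ℝ) ^ m := by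
      calc _ ≤ (m ^ 2 * s ^ 2 / n * (n ^ s : ℝ) ^ m) * (n / (2 * m ^ 2 * s ^ 2)) := by gcongr
        _ = _ := by field_simp
    nlinarith
  obtain ⟨ω, hω⟩ := hex
  have hsum0 : 0 ≤ ∑ j, Real.exp (δ * m / 4 - X j ω) :=
    sum_nonneg fun j _ => (Real.exp_pos _).le
  have hcolω : (#(col ω) : ℝ) ≤ δ * m / 8 := by
    have h3 : (#(col ω) : ℝ) * (n / (2 * m ^ 2 * s ^ 2)) < 1 := by linarith
    have h4 : (#(col ω) : ℝ) < 2 * m ^ 2 * s ^ 2 / n := by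
      rw [lt_div_iff₀ hn']
      rw [← mul_div_assoc, div_lt_one (by positivity)] at h3
      exact h3
    refine h4.le.trans ?_
    rw [div_le_iff₀ hn']
    nlinarith [mul_le_mul_of_nonneg_left h₁ hm'.le]
  have hXω : ∀ j, δ * m / 4 ≤ X j ω := by
    intro j
    by_contra! hlt
    have h3 : 1 < Real.exp (δ * m / 4 - X j ω) := Real.one_lt_exp_iff.2 (by linarith)
    have h4 := single_le_sum (f := fun j => Real.exp (δ * m / 4 - X j ω))
      (fun j _ => (Real.exp_pos _).le) (mem_univ j)
    have h5 : (0 : ℝ) ≤ #(col ω) * (n / (2 * m ^ 2 * s ^ 2)) := by positivity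
    linarith
  set D := (col ω).image Prod.fst with hD
  have hDc : #D ≤ #(col ω) := card_image_le
  have hgood : ∀ k ∉ D, ∀ l, k ≠ l → ∀ i i', ω k i ≠ ω l i' := by
    intro k hk l hkl i i' h
    exact hk (mem_image.2 ⟨(k, l), mem_filter.2 ⟨mem_univ _, hkl, i, i', h⟩, rfl⟩)
  have hinj : Set.InjOn ω (Dᶜ : Finset (Fin m)) := by
    intro k hk l hl hkl
    by_contra hne
    obtain ⟨i⟩ := ‹Nonempty ι›
    exact hgood k (by simpa using hk) l hne i i (congrFun hkl i)
  refine ⟨Dᶜ.image ω, card_image_le.trans ((card_le_univ _).trans (by simp)), ?_, ?_⟩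
  · intro o ho o' ho' hne
    obtain ⟨k, hk, rfl⟩ := mem_image.1 ho
    obtain ⟨l, hl, rfl⟩ := mem_image.1 ho'
    exact hgood k (by simpa using hk) l (by rintro rfl; exact hne rfl)
  · intro j
    rw [filter_image, card_image_of_injOn (hinj.mono (by
      intro k hk; exact (mem_filter.1 hk).1))]
    have h3 : X j ω ≤ #{k ∈ Dᶜ | ω k ∈ 𝒜 j} + #D := by
      refine le_trans (card_le_card ?_) (card_union_le _ _)
      intro k hk
      simp only [mem_filter, mem_univ, true_and, mem_union, mem_compl] at hk ⊢
      tauto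
    have h4 : (X j ω : ℝ) ≤ #{k ∈ Dᶜ | ω k ∈ 𝒜 j} + #D := by exact_mod_cast h3
    have h5 : (#D : ℝ) ≤ #(col ω) := by exact_mod_cast hDc
    linarith [hXω j]

end Sampling

section Absorb

variable {V Ω : Type*} {T : V → V → V → Prop} {ends : Ω → List (V × V)} {base : Ω → Finset V}
  {𝓕 : Finset Ω}

theorem exists_assignment {N : ℕ} (h₀ : ∀ ω ∈ 𝓕, Sys T (ends ω) (base ω)) (Us : List (Finset V))
    (hU : Us.Pairwise Disjoint) (hN : Us.length ≤ N)
    (hab : ∀ U ∈ Us, N ≤ #{ω ∈ 𝓕 | Sys T (ends ω) (base ω ∪ U)}) :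
    ∃ g : Ω → Finset V, (∀ ω ∈ 𝓕, Sys T (ends ω) (base ω ∪ g ω)) ∧
      (∀ ω ω', ω ≠ ω' → Disjoint (g ω) (g ω')) ∧
      𝓕.biUnion g = Us.toFinset.biUnion id ∧ (∀ ω, g ω ⊆ Us.toFinset.biUnion id) ∧
      #{ω ∈ 𝓕 | g ω ≠ ∅} ≤ Us.length := by
  induction Us with
  | nil => exact ⟨fun _ => ∅, by simpa using h₀, by simp,
    by ext; simp, by simp, by simp⟩
  | cons U Us ih =>
    rw [List.pairwise_cons] at hU
    rw [List.length_cons] at hN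
    obtain ⟨g, hg₁, hg₂, hg₃, hg₄, hg₅⟩ := ih hU.2 (by omega)
      (fun U' hU' => hab U' (List.mem_cons_of_mem _ hU'))
    obtain ⟨ω, hω, hω'⟩ : ∃ ω ∈ ({ω ∈ 𝓕 | Sys T (ends ω) (base ω ∪ U)} : Finset Ω),
        ω ∉ ({ω ∈ 𝓕 | g ω ≠ ∅} : Finset Ω) :=
      exists_mem_notMem_of_card_lt_card
        (lt_of_lt_of_le (by omega) (hab U (List.mem_cons_self)))
    rw [mem_filter] at hω
    have hgω : g ω = ∅ := by
      by_contra h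
      exact hω' (mem_filter.2 ⟨hω.1, h⟩)
    have hUd : ∀ ω', Disjoint U (g ω') := fun ω' => by
      refine Disjoint.mono_right (hg₄ ω') ?_
      rw [disjoint_biUnion_right]
      intro U' hU'
      exact hU.1 U' (by simpa using hU')
    refine ⟨Function.update g ω U, ?_, ?_, ?_, ?_, ?_⟩
    · intro ω₁ h₁
      by_cases h : ω₁ = ω
      · subst h; simpa using hω.2
      · simpa [Function.update_of_ne h] using hg₁ ω₁ h₁
    · intro ω₁ ω₂ hne
      by_cases h : ω₁ = ω
      · subst h
        simpa [Function.update_of_ne hne.symm] using hUd ω₂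
      · by_cases h' : ω₂ = ω
        · subst h'
          simpa [Function.update_of_ne h] using (hUd ω₁).symm
        · simpa [Function.update_of_ne h, Function.update_of_ne h'] using hg₂ ω₁ ω₂ hne
    · rw [List.toFinset_cons, biUnion_insert, ← hg₃]
      ext v
      simp only [mem_biUnion, mem_union, id]
      constructor
      · rintro ⟨ω₁, h₁, hv⟩
        by_cases h : ω₁ = ω
        · subst h; left; simpa using hv
        · right; exact ⟨ω₁, h₁, by simpa [Function.update_of_ne h] using hv⟩
      · rintro (hv | ⟨ω₁, h₁, hv⟩)
        · exact ⟨ω, hω.1, by simpa using hv⟩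
        · have h : ω₁ ≠ ω := by rintro rfl; simp [hgω] at hv
          exact ⟨ω₁, h₁, by simpa [Function.update_of_ne h] using hv⟩
    · intro ω₁
      rw [List.toFinset_cons, biUnion_insert]
      by_cases h : ω₁ = ω
      · subst h; simp
      · rw [Function.update_of_ne h]
        exact (hg₄ ω₁).trans subset_union_right
    · rw [List.length_cons]
      calc _ ≤ #(insert ω {ω ∈ 𝓕 | g ω ≠ ∅}) := by
            refine card_le_card fun ω₁ h₁ => ?_
            rw [mem_filter] at h₁
            by_cases h : ω₁ = ω
            · simp [h]
            · rw [Function.update_of_ne h] at h₁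
              exact mem_insert_of_mem (mem_filter.2 h₁)
        _ ≤ _ := (card_insert_le _ _).trans (by omega)

/-- Pairwise disjoint absorbers can swallow a short list of groups, each of which is compatible
with many of the absorbers. -/
theorem sys_absorb (h₀ : ∀ ω ∈ 𝓕, Sys T (ends ω) (base ω))
    (hd : ∀ ω ∈ 𝓕, ∀ ω' ∈ 𝓕, ω ≠ ω' → Disjoint (base ω) (base ω')) (Us : List (Finset V))
    (hU : Us.Pairwise Disjoint) (hb : ∀ ω ∈ 𝓕, ∀ U ∈ Us, Disjoint (base ω) U)
    (hab : ∀ U ∈ Us, Us.length ≤ #{ω ∈ 𝓕 | Sys T (ends ω) (base ω ∪ U)}) :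
    Sys T (𝓕.toList.flatMap ends) (𝓕.biUnion base ∪ Us.toFinset.biUnion id) := by
  obtain ⟨g, hg₁, hg₂, hg₃, hg₄, -⟩ := exists_assignment h₀ Us hU le_rfl hab
  have hbg : ∀ ω ∈ 𝓕, ∀ ω', Disjoint (base ω) (g ω') := fun ω hω ω' => by
    refine Disjoint.mono_right (hg₄ ω') ?_
    rw [disjoint_biUnion_right]
    intro U hU
    exact hb ω hω U (by simpa using hU)
  have := Sys.flatMap (T := T) (ends := ends) (g := fun ω => base ω ∪ g ω) 𝓕.toList
    𝓕.nodup_toList (fun ω hω => hg₁ ω (by simpa using hω)) (by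
      intro ω hω ω' hω' hne
      rw [mem_toList] at hω hω'
      rw [disjoint_union_left, disjoint_union_right, disjoint_union_right]
      exact ⟨⟨hd ω hω ω' hω' hne, hbg ω hω ω'⟩, (hbg ω' hω' ω).symm, hg₂ ω ω' hne⟩)
  rw [toList_toFinset] at this
  rw [← hg₃]
  convert this using 1
  ext v
  simp only [mem_union, mem_biUnion]
  constructor
  · rintro (⟨ω, h, hv⟩ | ⟨ω, h, hv⟩)
    · exact ⟨ω, h, Or.inl hv⟩
    · exact ⟨ω, h, Or.inr hv⟩
  · rintro ⟨ω, h, hv | hv⟩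
    · exact Or.inl ⟨ω, h, hv⟩
    · exact Or.inr ⟨ω, h, hv⟩

/-- A set can be split into groups with one vertex inside and `q` vertices outside `A`. -/
theorem exists_groups (A : Finset V) (q r : ℕ) : ∀ U : Finset V, #(U ∩ A) = r → #(U \ A) = q * r →
    ∃ Us : List (Finset V), Us.length = r ∧ Us.Pairwise Disjoint ∧ Us.toFinset.biUnion id = U ∧
      ∀ X ∈ Us, #(X ∩ A) = 1 ∧ #(X \ A) = q := by
  induction r with
  | zero =>
    intro U h h'
    refine ⟨[], rfl, List.Pairwise.nil, ?_, by simp⟩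
    have := card_inter_add_card_sdiff U A
    rw [h, h'] at this
    simpa [eq_comm] using this
  | succ r ih =>
    intro U h h'
    obtain ⟨a, ha⟩ : (U ∩ A).Nonempty := card_pos.1 (by omega)
    obtain ⟨B, hB, hBc⟩ := exists_subset_card_eq (s := U \ A) (n := q) (by
      rw [h']; exact Nat.le_mul_of_pos_right _ (by omega))
    rw [mem_inter] at ha
    have hBA : ∀ b ∈ B, b ∈ U ∧ b ∉ A := fun b hb => by simpa using hB hb
    have e₁ : insert a B ∩ A = {a} := by
      ext v
      simp only [mem_inter, mem_insert, mem_singleton]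
      constructor
      · rintro ⟨rfl | hv, hA⟩
        · rfl
        · exact absurd hA (hBA v hv).2
      · rintro rfl
        exact ⟨Or.inl rfl, ha.2⟩
    have e₂ : insert a B \ A = B := by
      ext v
      simp only [mem_sdiff, mem_insert]
      constructor
      · rintro ⟨rfl | hv, hA⟩
        · exact absurd ha.2 hA
        · exact hv
      · intro hv
        exact ⟨Or.inr hv, (hBA v hv).2⟩
    have hsub : insert a B ⊆ U := insert_subset ha.1 fun b hb => (hBA b hb).1
    have e₃ : (U \ insert a B) ∩ A = (U ∩ A) \ {a} := by
      rw [← e₁]; ext v; simp only [mem_inter, mem_sdiff]; tauto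
    have e₄ : (U \ insert a B) \ A = (U \ A) \ B := by
      conv_rhs => rw [← e₂]
      ext v; simp only [mem_sdiff]; tauto
    obtain ⟨Us, h₁, h₂, h₃, h₄⟩ := ih (U \ insert a B)
      (by rw [e₃, card_sdiff_of_subset (by simpa using ha), h]; simp)
      (by rw [e₄, card_sdiff_of_subset hB, h', hBc, Nat.mul_succ]; simp)
    refine ⟨insert a B :: Us, by simp [h₁], List.pairwise_cons.2 ⟨fun X hX => ?_, h₂⟩, ?_, ?_⟩
    · have : X ⊆ U \ insert a B := by
        rw [← h₃]
        exact subset_biUnion_of_mem id (by simpa using hX)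
      exact (disjoint_sdiff.mono_right this)
    · rw [List.toFinset_cons, biUnion_insert, h₃]
      exact union_sdiff_of_subset hsub
    · intro X hX
      rcases List.mem_cons.1 hX with rfl | hX
      · rw [e₁, e₂]; simp [hBc]
      · exact h₄ X hX

end Absorb

section Box

theorem box_pow {P Q ι : Type*} [Fintype P] [Fintype Q] [Fintype ι] [Nonempty ι]
    (R : P → Q → Prop) {δ : ℝ} (hδ : 0 ≤ δ)
    (h : δ * (Fintype.card P * Fintype.card Q) ≤ ∑ p, ∑ q, if R p q then (1 : ℝ) else 0) :
    δ ^ Fintype.card ι * (Fintype.card P * (Fintype.card Q : ℝ) ^ Fintype.card ι) ≤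
      ∑ p, ∑ f : ι → Q, if ∀ i, R p (f i) then (1 : ℝ) else 0 := by
  have h1 : ∀ p, (∑ f : ι → Q, if ∀ i, R p (f i) then (1 : ℝ) else 0) =
      (∑ q, if R p q then (1 : ℝ) else 0) ^ Fintype.card ι := by
    intro p
    rw [← card_univ, ← prod_const, prod_univ_sum, Fintype.piFinset_univ]
    refine sum_congr rfl fun f _ => ?_
    rw [prod_ite_zero]
    simp
  simp_rw [h1]
  obtain ⟨k, hk⟩ : ∃ k, Fintype.card ι = k + 1 :=
    ⟨Fintype.card ι - 1, (Nat.sub_add_cancel Fintype.card_pos).symm⟩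
  rw [hk]
  rcases Nat.eq_zero_or_pos (Fintype.card P) with hP | hP
  · rw [hP]
    simp only [Nat.cast_zero, zero_mul, mul_zero]
    exact sum_nonneg fun p _ => pow_nonneg (sum_nonneg fun q _ => by positivity) _
  ·
    have h2 := pow_sum_div_card_le_sum_pow (s := (univ : Finset P))
      (f := fun p => ∑ q, if R p q then (1 : ℝ) else 0)
      (fun p _ => sum_nonneg fun q _ => by positivity) k
    refine le_trans ?_ h2
    rw [card_univ, le_div_iff₀ (by positivity)]
    calc _ = (δ * (Fintype.card P * Fintype.card Q)) ^ (k + 1) := by ring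
      _ ≤ _ := by gcongr

theorem card_mul_card_filter_eq_le {V ι : Type*} [Fintype V] [Fintype ι] {i j : ι} (h : i ≠ j) :
    Fintype.card V * #{f : ι → V | f i = f j} ≤ Fintype.card V ^ Fintype.card ι := by
  rw [← Fintype.card_fun, ← card_univ (α := V), ← card_product, ← card_univ]
  refine card_le_card_of_injOn (fun p => Function.update p.2 i p.1) (by simp) ?_
  rintro ⟨v, f⟩ hf ⟨v', f'⟩ hf' heq
  simp only [coe_product, coe_univ, coe_filter, Set.mem_prod, Set.mem_univ, mem_univ, true_and,
    Set.mem_ofPred_eq] at hf hf'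
  have h1 : ∀ k, k ≠ i → f k = f' k := fun k hk => by
    simpa [Function.update_of_ne hk] using congrFun heq k
  refine Prod.ext (by simpa using congrFun heq i) (funext fun k => ?_)
  by_cases hk : k = i
  · subst hk
    exact hf.trans ((h1 j h.symm).trans hf'.symm)
  · exact h1 k hk

theorem card_not_injective_le {V ι : Type*} [Fintype V] [Fintype ι] :
    Fintype.card V * #{f : ι → V | ¬ Function.Injective f} ≤
      Fintype.card ι ^ 2 * Fintype.card V ^ Fintype.card ι := by
  have h1 : ({f : ι → V | ¬ Function.Injective f} : Finset (ι → V)) ⊆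
      ({p : ι × ι | p.1 ≠ p.2} : Finset (ι × ι)).biUnion fun p => {f : ι → V | f p.1 = f p.2} := by
    intro f hf
    rw [mem_filter] at hf
    simp only [Function.Injective, not_forall] at hf
    obtain ⟨-, i, j, hij, hne⟩ := hf
    exact mem_biUnion.2 ⟨(i, j), by simpa using hne, by simpa using hij⟩
  calc _ ≤ Fintype.card V * ∑ p ∈ ({p : ι × ι | p.1 ≠ p.2} : Finset (ι × ι)),
        #{f : ι → V | f p.1 = f p.2} := Nat.mul_le_mul_left _ ((card_le_card h1).trans card_biUnion_le)
    _ ≤ ∑ p ∈ ({p : ι × ι | p.1 ≠ p.2} : Finset (ι × ι)), Fintype.card V ^ Fintype.card ι := by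
        rw [mul_sum]
        exact sum_le_sum fun p hp => card_mul_card_filter_eq_le (mem_filter.1 hp).2
    _ ≤ _ := by
        rw [sum_const, smul_eq_mul]
        refine Nat.mul_le_mul_right _ ((card_le_univ _).trans ?_)
        rw [Fintype.card_prod, sq]

/-- A dense ternary relation contains many blow-ups of a single triple. -/
theorem box_triple {V ι₁ ι₂ ι₃ : Type*} [Fintype V] [Fintype ι₁] [Fintype ι₂] [Fintype ι₃]
    [Nonempty ι₁] [Nonempty ι₂] [Nonempty ι₃] (R : V → V → V → Prop) {δ : ℝ} (hδ : 0 ≤ δ)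
    (h : δ * (Fintype.card V : ℝ) ^ 3 ≤ #{p : V × V × V | R p.1 p.2.1 p.2.2}) :
    δ ^ (Fintype.card ι₁ * Fintype.card ι₂ * Fintype.card ι₃) *
      (Fintype.card V : ℝ) ^ (Fintype.card ι₁ + Fintype.card ι₂ + Fintype.card ι₃) ≤
      #{p : (ι₁ → V) × (ι₂ → V) × (ι₃ → V) | ∀ i j k, R (p.1 i) (p.2.1 j) (p.2.2 k)} := by
  rw [card_filter] at h ⊢
  push_cast at h ⊢
  set n := Fintype.card V
  have h1 := box_pow (ι := ι₁) (P := V × V) (Q := V) (fun p x => R x p.1 p.2) hδ (by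
    rw [sum_comm, ← Fintype.sum_prod_type']
    refine le_trans (le_of_eq ?_) h
    rw [Fintype.card_prod]
    push_cast
    ring)
  have h2 := box_pow (ι := ι₂) (P := V × (ι₁ → V)) (Q := V)
    (δ := δ ^ Fintype.card ι₁) (fun p y => ∀ i, R (p.2 i) y p.1) (by positivity) (by
    refine le_trans (le_of_eq ?_) (h1.trans (le_of_eq ?_))
    · rw [Fintype.card_prod, Fintype.card_prod, Fintype.card_fun]
      push_cast
      ring
    · simp_rw [Fintype.sum_prod_type]
      rw [sum_comm]
      refine sum_congr rfl fun z _ => ?_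
      rw [sum_comm]
      congr!)
  have h3 := box_pow (ι := ι₃) (P := (ι₁ → V) × (ι₂ → V)) (Q := V)
    (δ := (δ ^ Fintype.card ι₁) ^ Fintype.card ι₂) (fun p z => ∀ j i, R (p.1 i) (p.2 j) z)
    (by positivity) (by
    refine le_trans (le_of_eq ?_) (h2.trans (le_of_eq ?_))
    · rw [Fintype.card_prod, Fintype.card_prod, Fintype.card_fun, Fintype.card_fun]
      push_cast
      ring
    · simp_rw [Fintype.sum_prod_type]
      rw [sum_comm]
      refine sum_congr rfl fun z _ => ?_
      rw [sum_comm]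
      congr!)
  refine le_trans (le_of_eq ?_) (h3.trans (le_of_eq ?_))
  · rw [Fintype.card_prod, Fintype.card_fun, Fintype.card_fun]
    push_cast
    ring
  · simp_rw [Fintype.sum_prod_type]
    refine sum_congr rfl fun p _ => sum_congr rfl fun q _ => sum_congr rfl fun r _ => ?_
    congr 1
    exact propext ⟨fun h i j k => h k j i, fun h k j i => h i j k⟩

end Box

section Stability

theorem sum_threshold_le (k : ℕ) (hk : 0 < k) (x : ℝ) (hx : 0 ≤ x) :
    ∑ i ∈ Icc 1 (2 * k), ((if 1 - (i : ℝ) / (4 * k) < x then (1 : ℝ) else 0) +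
      (if (i : ℝ) / (4 * k) ≤ x then (1 : ℝ) else 0)) ≤ 4 * k * x + 1 := by
  have hk' : (0 : ℝ) < 4 * k := by positivity
  have e1 : ∀ i : ℕ, (i : ℝ) / (4 * k) ≤ x ↔ (i : ℝ) ≤ 4 * k * x := fun i => by
    rw [div_le_iff₀ hk', mul_comm]
  have e2 : ∀ i : ℕ, 1 - (i : ℝ) / (4 * k) < x ↔ 4 * k * (1 - x) < i := fun i => by
    rw [sub_lt_comm, lt_div_iff₀ hk', mul_comm]
  simp_rw [e1, e2]
  rw [sum_add_distrib, ← sum_filter, ← sum_filter]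
  simp only [sum_const, nsmul_eq_mul, mul_one]
  set IA := (Icc 1 (2 * k)).filter fun i : ℕ => (i : ℝ) ≤ 4 * k * x with hIA
  set IB := (Icc 1 (2 * k)).filter fun i : ℕ => 4 * k * (1 - x) < (i : ℝ) with hIB
  have hA : #IA ≤ min (2 * k) ⌊4 * k * x⌋₊ := by
    calc _ ≤ #(Icc 1 (min (2 * k) ⌊4 * k * x⌋₊)) := card_le_card fun i hi => by
          rw [hIA, mem_filter, mem_Icc] at hi
          rw [mem_Icc]
          exact ⟨hi.1.1, le_min hi.1.2 (Nat.le_floor hi.2)⟩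
      _ = _ := by simp
  have hB : #IB ≤ 2 * k - ⌊4 * k * (1 - x)⌋₊ := by
    calc _ ≤ #(Ioc ⌊4 * k * (1 - x)⌋₊ (2 * k)) := card_le_card fun i hi => by
          rw [hIB, mem_filter, mem_Icc] at hi
          rw [mem_Ioc]
          refine ⟨?_, hi.1.2⟩
          by_cases h : 0 ≤ 4 * k * (1 - x)
          · exact (Nat.floor_lt h).2 hi.2
          · rw [Nat.floor_of_nonpos (not_le.1 h).le]
            omega
      _ = _ := by simp
  have hA1 : (#IA : ℝ) ≤ 2 * k := by
    exact_mod_cast hA.trans (min_le_left _ _)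
  have hA2 : (#IA : ℝ) ≤ 4 * k * x :=
    (Nat.cast_le.2 (hA.trans (min_le_right _ _))).trans (Nat.floor_le (by positivity))
  have hB1 : (#IB : ℝ) ≤ 2 * k := by
    exact_mod_cast hB.trans (Nat.sub_le _ _)
  rcases le_total x 1 with h1 | h1
  · have hfl := Nat.lt_floor_add_one (4 * (k : ℝ) * (1 - x))
    rcases le_or_gt (2 * k) ⌊4 * (k : ℝ) * (1 - x)⌋₊ with h | h
    · have : #IB = 0 := by omega
      rw [this]
      push_cast
      linarith
    · have : (#IB : ℝ) ≤
          2 * k - ⌊4 * k * (1 - x)⌋₊ := by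
        have h3 : #IB + ⌊4 * k * (1 - x)⌋₊ ≤ 2 * k := by
          omega
        have : ((#IB + ⌊4 * k * (1 - x)⌋₊ : ℕ) : ℝ) ≤
          (2 * k : ℕ) := Nat.cast_le.2 h3
        push_cast at this
        linarith
      linarith
  · nlinarith

theorem le_of_quad {n γ a b : ℝ} (hn : 0 < n) (hγ : 0 < γ) (hγ1 : γ ≤ 1 / 1000) (ha : 0 ≤ a)
    (hab : a ≤ b) (h : (7 / 16 - γ) * n ^ 2 ≤ 2 * a * n - a ^ 2 + (b - a) ^ 2) :
    (1 / 2 - 2 * γ) * n ≤ a + b := by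
  by_contra! hlt
  obtain ⟨s, hs⟩ : ∃ s, s = (a + b) / 2 := ⟨_, rfl⟩
  obtain ⟨d, hd⟩ : ∃ d, d = b - a := ⟨_, rfl⟩
  have ha' : a = s - d / 2 := by rw [hs, hd]; ring
  have hb' : b = s + d / 2 := by rw [hs, hd]; ring
  subst ha' hb'
  have h1 : (7 / 16 - γ) * n ^ 2 ≤ n ^ 2 - (n - s) ^ 2 - d * (n - s - 3 / 4 * d) := by
    linarith
  have hγn : 0 < γ * n := mul_pos hγ hn
  have h2 : (3 / 4 + γ) * n < n - s := by linarith
  have h3 : 0 ≤ d * (n - s - 3 / 4 * d) := mul_nonneg (by linarith) (by linarith)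
  have h4 : ((3 / 4 + γ) * n) ^ 2 ≤ (n - s) ^ 2 := by gcongr
  have h5 : 0 < γ * n ^ 2 := by positivity
  nlinarith [sq_nonneg (γ * n)]

theorem le_of_quad' {n γ a b : ℝ} (hn : 0 < n) (hγ : 0 < γ) (hγ1 : γ ≤ 1 / 1000) (ha : 0 ≤ a)
    (hab : a ≤ b) (h : (7 / 16 - γ) * n ^ 2 ≤ 2 * a * n - a ^ 2 + (b - a) ^ 2)
    (hu : a + b ≤ (1 / 2 + 4 * γ) * n) : b ≤ (1 / 4 + 40 * γ) * n := by
  obtain ⟨s, hs⟩ : ∃ s, s = (a + b) / 2 := ⟨_, rfl⟩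
  obtain ⟨d, hd⟩ : ∃ d, d = b - a := ⟨_, rfl⟩
  have ha' : a = s - d / 2 := by rw [hs, hd]; ring
  have hb' : b = s + d / 2 := by rw [hs, hd]; ring
  subst ha' hb'
  have h1 : (7 / 16 - γ) * n ^ 2 ≤ n ^ 2 - (n - s) ^ 2 - d * (n - s - 3 / 4 * d) := by
    linarith
  have hγn : γ * n ≤ 1 / 1000 * n := by gcongr
  have h2 : (3 / 4 - 2 * γ) * n ≤ n - s := by linarith
  have h3 : d * (n / 4) ≤ d * (n - s - 3 / 4 * d) :=
    mul_le_mul_of_nonneg_left (by linarith) (by linarith)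
  have h4 : ((3 / 4 - 2 * γ) * n) ^ 2 ≤ (n - s) ^ 2 :=
    pow_le_pow_left₀ (mul_nonneg (by linarith) hn.le) h2 2
  have h5 : 0 < γ * n ^ 2 := by positivity
  have h6 : d * (n / 4) ≤ (4 * γ * n) * n := by nlinarith [sq_nonneg (γ * n)]
  have h7 : d / 4 ≤ 4 * γ * n := le_of_mul_le_mul_right (by linarith) hn
  linarith

variable {V : Type*} [Fintype V]

theorem card_pairs_le {x : V → ℝ} {S : Finset (V × V)} (hS : ∀ p ∈ S, 1 ≤ x p.1 + x p.2) {θ : ℝ}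
    (hθ : θ ≤ 1 / 2) :
    (#S : ℝ) ≤ 2 * #{v | 1 - θ < x v} * Fintype.card V - (#{v | 1 - θ < x v} : ℝ) ^ 2 +
      ((#{v | θ ≤ x v} : ℝ) - #{v | 1 - θ < x v}) ^ 2 := by
  set A : Finset V := {v | 1 - θ < x v} with hA
  set B : Finset V := {v | θ ≤ x v} with hB
  have hAB : A ⊆ B := fun v hv => by
    rw [hA, mem_filter] at hv
    rw [hB, mem_filter]
    exact ⟨mem_univ _, by linarith [hv.2]⟩
  have hsub : S ⊆ A ×ˢ univ ∪ (Aᶜ ×ˢ A ∪ (B \ A) ×ˢ (B \ A)) := by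
    rintro ⟨p, q⟩ hp
    have := hS _ hp
    simp only [mem_union, mem_product, mem_univ, and_true, mem_compl, mem_sdiff, hA, hB,
      mem_filter, true_and] at this ⊢
    by_cases h1 : 1 - θ < x p
    · exact Or.inl h1
    · by_cases h2 : 1 - θ < x q
      · exact Or.inr (Or.inl ⟨h1, h2⟩)
      · exact Or.inr (Or.inr ⟨⟨by linarith, h1⟩, by linarith, h2⟩)
  have h1 : #S ≤ #A * Fintype.card V + ((Fintype.card V - #A) * #A + (#B - #A) * (#B - #A)) := by
    refine (card_le_card hsub).trans ((card_union_le _ _).trans (Nat.add_le_add ?_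
      ((card_union_le _ _).trans (Nat.add_le_add ?_ ?_))))
    · rw [card_product, card_univ]
    · rw [card_product, card_compl]
    · rw [card_product, card_sdiff_of_subset hAB]
  have h2 : #A ≤ #B := card_le_card hAB
  have h3 : #A ≤ Fintype.card V := card_le_univ _
  have h4 : (#S : ℝ) ≤ ((#A * Fintype.card V + ((Fintype.card V - #A) * #A +
    (#B - #A) * (#B - #A)) : ℕ) : ℝ) := Nat.cast_le.2 h1
  push_cast [Nat.cast_sub h2, Nat.cast_sub h3] at h4
  linarith

/-- If the sum of `x` is about `n / 4` and about `7 / 16` of all pairs have `x`-weight at least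
one, then about `3 / 4` of all vertices have small weight. -/
theorem stability {ν : ℝ} (hν : 0 < ν) : ∃ γ : ℝ, 0 < γ ∧ ∀ (V : Type) [Fintype V] (x : V → ℝ)
    (S : Finset (V × V)), 0 < Fintype.card V → (∀ v, 0 ≤ x v) →
    ∑ v, x v ≤ (Fintype.card V : ℝ) / 4 → (7 / 16 - γ) * (Fintype.card V : ℝ) ^ 2 ≤ #S →
    (∀ p ∈ S, 1 ≤ x p.1 + x p.2) →
    (3 / 4 - ν) * Fintype.card V ≤ #{v | x v < 1 / 4} := by
  obtain ⟨γ, hγ, hγ1, hγν⟩ : ∃ γ : ℝ, 0 < γ ∧ γ ≤ 1 / 1000 ∧ 40 * γ ≤ ν :=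
    ⟨min (1 / 1000) (ν / 40), by positivity, min_le_left _ _, by
      have := min_le_right (1 / 1000 : ℝ) (ν / 40); linarith⟩
  refine ⟨γ, hγ, ?_⟩
  intro V _ x S hV hx hsum hS hS1
  set n : ℝ := (Fintype.card V : ℝ) with hn
  have hn0 : 0 < n := by rw [hn]; exact_mod_cast hV
  obtain ⟨k, hk⟩ := exists_nat_gt (1 / γ)
  have hk0 : (0 : ℝ) < k := lt_trans (by positivity) hk
  have hk1 : 0 < k := by exact_mod_cast hk0
  let a : ℕ → ℝ := fun i => #{v | 1 - (i : ℝ) / (4 * k) < x v}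
  let b : ℕ → ℝ := fun i => #{v | (i : ℝ) / (4 * k) ≤ x v}
  have hab : ∀ i ∈ Icc 1 (2 * k), a i ≤ b i := fun i hi => by
    refine Nat.cast_le.2 (card_le_card fun v hv => ?_)
    rw [mem_filter] at hv ⊢
    refine ⟨mem_univ _, ?_⟩
    have : (i : ℝ) / (4 * k) ≤ 1 / 2 := by
      rw [div_le_div_iff₀ (by positivity) (by norm_num)]
      have : (i : ℝ) ≤ 2 * k := by exact_mod_cast (mem_Icc.1 hi).2
      linarith
    linarith [hv.2]
  have hpairs : ∀ i ∈ Icc 1 (2 * k), (7 / 16 - γ) * n ^ 2 ≤ 2 * a i * n - a i ^ 2 +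
      (b i - a i) ^ 2 := fun i hi => by
    refine hS.trans (card_pairs_le hS1 ?_)
    rw [div_le_div_iff₀ (by positivity) (by norm_num)]
    have : (i : ℝ) ≤ 2 * k := by exact_mod_cast (mem_Icc.1 hi).2
    linarith
  have ha0 : ∀ i, 0 ≤ a i := fun i => Nat.cast_nonneg _
  have hb1 : ∀ i, b i ≤ n := fun i => Nat.cast_le.2 (card_le_univ _)
  have hlow : ∀ i ∈ Icc 1 (2 * k), (1 / 2 - 2 * γ) * n ≤ a i + b i := fun i hi => by
    exact le_of_quad hn0 hγ hγ1 (ha0 i) (hab i hi) (hpairs i hi)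
  have hsumab : ∑ i ∈ Icc 1 (2 * k), (a i + b i) ≤ 4 * k * (n / 4) + n := by
    have : ∀ i, a i + b i = ∑ v, ((if 1 - (i : ℝ) / (4 * k) < x v then (1 : ℝ) else 0) +
      (if (i : ℝ) / (4 * k) ≤ x v then (1 : ℝ) else 0)) := fun i => by
      rw [sum_add_distrib, ← sum_filter, ← sum_filter]
      simp [a, b]
    simp_rw [this]
    rw [sum_comm]
    calc _ ≤ ∑ v, (4 * k * x v + 1) := sum_le_sum fun v _ => sum_threshold_le k hk1 _ (hx v)
      _ = 4 * k * ∑ v, x v + n := by rw [sum_add_distrib, mul_sum]; simp [hn]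
      _ ≤ _ := by gcongr
  obtain ⟨i, hi, hik⟩ : ∃ i ∈ Icc 1 k, a i + b i ≤ (1 / 2 + 4 * γ) * n := by
    by_contra! hcon
    have hsplit : Icc 1 (2 * k) = Icc 1 k ∪ Icc (k + 1) (2 * k) := by
      ext i; simp only [mem_Icc, mem_union]; omega
    rw [hsplit, sum_union (by
      rw [disjoint_left]; intro i h1 h2; rw [mem_Icc] at h1 h2; omega)] at hsumab
    have h1 : ∑ i ∈ Icc 1 k, ((1 / 2 + 4 * γ) * n) ≤ ∑ i ∈ Icc 1 k, (a i + b i) :=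
      sum_le_sum fun i hi => (hcon i hi).le
    have h2 : ∑ i ∈ Icc (k + 1) (2 * k), ((1 / 2 - 2 * γ) * n) ≤
        ∑ i ∈ Icc (k + 1) (2 * k), (a i + b i) :=
      sum_le_sum fun i hi => hlow i (by rw [mem_Icc] at hi ⊢; omega)
    rw [sum_const, Nat.card_Icc, nsmul_eq_mul] at h1 h2
    have e1 : k + 1 - 1 = k := by omega
    have e2 : 2 * k + 1 - (k + 1) = k := by omega
    rw [e1] at h1
    rw [e2] at h2
    have hkγ : 1 < γ * k := by
      rw [div_lt_iff₀ hγ] at hk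
      linarith
    nlinarith
  have hi' : i ∈ Icc 1 (2 * k) := by rw [mem_Icc] at hi ⊢; omega
  have hfin : b i ≤ (1 / 4 + 40 * γ) * n := by
    exact le_of_quad' hn0 hγ hγ1 (ha0 i) (hab i hi') (hpairs i hi') hik
  have hle : n - b i ≤ #{v | x v < 1 / 4} := by
    have h1 : #(univ.filter fun v => (i : ℝ) / (4 * k) ≤ x v) +
        #(univ.filter fun v => ¬ (i : ℝ) / (4 * k) ≤ x v) = Fintype.card V := by
      rw [card_filter_add_card_filter_not, card_univ]
    have h2 : #(univ.filter fun v => ¬ (i : ℝ) / (4 * k) ≤ x v) ≤ #{v | x v < 1 / 4} := by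
      refine card_le_card fun v hv => ?_
      rw [mem_filter] at hv ⊢
      refine ⟨mem_univ _, (not_le.1 hv.2).trans_le ?_⟩
      rw [div_le_div_iff₀ (by positivity) (by norm_num)]
      have : (i : ℝ) ≤ k := by exact_mod_cast (mem_Icc.1 hi).2
      linarith
    have h3 : n = b i + #(univ.filter fun v => ¬ (i : ℝ) / (4 * k) ≤ x v) := by
      rw [hn, ← h1]; push_cast; rfl
    have h4 : (#(univ.filter fun v => ¬ (i : ℝ) / (4 * k) ≤ x v) : ℝ) ≤ #{v | x v < 1 / 4} :=
      Nat.cast_le.2 h2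
    linarith
  have hfν : 40 * γ * n ≤ ν * n := by gcongr
  linarith

end Stability

theorem lp_duality {κ G : Type} [Fintype κ] [Fintype G] (a : G → κ → ℝ) (μ : κ → ℝ)
    (hμ : ∀ l, 0 ≤ μ l) {τ : ℝ} (hτ : 0 < τ) :
    (∃ φ : G → ℝ, (∀ c, 0 ≤ φ c) ∧ (∀ l, ∑ c, φ c * a c l ≤ μ l) ∧ ∑ c, φ c = τ) ∨
    (∃ w : κ → ℝ, (∀ l, 0 ≤ w l) ∧ (∀ c, 1 ≤ ∑ l, w l * a c l) ∧ ∑ l, w l * μ l < τ) := by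
  rcases isEmpty_or_nonempty G with hG | hG
  · exact Or.inr ⟨0, by simp, by simp, by simpa using hτ⟩
  let L : (G → ℝ) →ₗ[ℝ] (κ → ℝ) := Fintype.linearCombination ℝ a
  have hL : ∀ φ l, L φ l = ∑ c, φ c * a c l := fun φ l => by
    simp [L, Fintype.linearCombination_apply]
  have hLc : Continuous L := L.continuous_of_finiteDimensional
  let D : Set (κ → ℝ) := {y | ∀ l, y l ≤ μ l / τ}
  have hDc : Convex ℝ D := by
    intro y hy z hz s t hs ht hst l
    have h1 := mul_le_mul_of_nonneg_left (hy l) hs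
    have h2 := mul_le_mul_of_nonneg_left (hz l) ht
    have h3 : s * (μ l / τ) + t * (μ l / τ) = μ l / τ := by rw [← add_mul, hst, one_mul]
    simp only [Pi.add_apply, Pi.smul_apply, smul_eq_mul]
    linarith
  have hDcl : IsClosed D := by
    have : D = ⋂ l, {y : κ → ℝ | y l ≤ μ l / τ} := by ext; simp [D]
    rw [this]
    exact isClosed_iInter fun l => isClosed_le (continuous_apply l) continuous_const
  by_cases hdis : Disjoint (L '' stdSimplex ℝ G) D
  · right
    obtain ⟨f, u, v, h1, huv, h2⟩ := geometric_hahn_banach_compact_closed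
      ((convex_stdSimplex ℝ G).linear_image L) ((isCompact_stdSimplex ℝ G).image hLc) hDc hDcl hdis
    let g : κ → ℝ := fun l => f (Pi.single l 1)
    have hf : ∀ y : κ → ℝ, f y = ∑ l, y l * g l := fun y => by
      conv_lhs => rw [← univ_sum_single y]
      rw [map_sum]
      refine sum_congr rfl fun l _ => ?_
      have : (Pi.single l (y l) : κ → ℝ) = y l • Pi.single l (1 : ℝ) := by
        rw [← Pi.single_smul, smul_eq_mul, mul_one]
      rw [this, map_smul, smul_eq_mul]
    let d : κ → ℝ := fun l => μ l / τ
    have hd : v < f d := h2 d fun l => le_rfl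
    have hg : ∀ l, g l ≤ 0 := by
      intro l
      by_contra! hgl
      have hr : (0 : ℝ) ≤ (f d - v) / g l := div_nonneg (by linarith) hgl.le
      have h3 := h2 (d - ((f d - v) / g l) • Pi.single l (1 : ℝ)) (by
        intro l'
        simp only [Pi.sub_apply, Pi.smul_apply, smul_eq_mul]
        have : (0 : ℝ) ≤ (Pi.single l (1 : ℝ) : κ → ℝ) l' := by
          by_cases h : l' = l
          · subst h; simp
          · simp [h]
        have := mul_nonneg hr this
        show μ l' / τ - _ ≤ μ l' / τ
        linarith)
      rw [map_sub, map_smul, smul_eq_mul] at h3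
      have h4 : (f d - v) / g l * f (Pi.single l 1) = f d - v := by
        show (f d - v) / g l * g l = f d - v
        field_simp
      rw [h4] at h3
      linarith
    have hdv : ∑ l, μ l * g l = τ * f d := by
      rw [hf, mul_sum]
      refine sum_congr rfl fun l _ => ?_
      simp only [d]
      field_simp
    have hv : v < 0 := by
      have h3 : f d ≤ 0 := by
        rw [hf]
        exact sum_nonpos fun l _ => mul_nonpos_of_nonneg_of_nonpos
          (div_nonneg (hμ l) hτ.le) (hg l)
      linarith
    have hv' : 0 < -v := by linarith
    refine ⟨fun l => g l / v, fun l => div_nonneg_of_nonpos (hg l) hv.le, ?_, ?_⟩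
    · intro c
      have h3 := h1 (L (Pi.single c 1)) ⟨_, single_mem_stdSimplex ℝ c, rfl⟩
      have h4 : L (Pi.single c 1) = a c := by simp [L, Fintype.linearCombination_apply_single]
      rw [h4, hf] at h3
      have h5 : ∑ l, g l / v * a c l = (∑ l, a c l * g l) / v := by
        rw [sum_div]
        exact sum_congr rfl fun l _ => by ring
      rw [h5, one_le_div_of_neg hv]
      linarith
    · have h5 : ∑ l, g l / v * μ l = (∑ l, μ l * g l) / v := by
        rw [sum_div]
        exact sum_congr rfl fun l _ => by ring
      rw [h5, hdv, div_lt_iff_of_neg hv]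
      exact mul_lt_mul_of_pos_left hd hτ
  · left
    rw [Set.not_disjoint_iff] at hdis
    obtain ⟨_, ⟨φ, hφ, rfl⟩, hD⟩ := hdis
    refine ⟨fun c => τ * φ c, fun c => mul_nonneg hτ.le (hφ.1 c), fun l => ?_, ?_⟩
    · have := hD l
      rw [hL, le_div_iff₀ hτ] at this
      calc _ = (∑ c, φ c * a c l) * τ := by
            rw [sum_mul]
            exact sum_congr rfl fun c _ => by ring
        _ ≤ _ := this
    · rw [← mul_sum, hφ.2, mul_one]

section Energy

variable {Ω γ γ' : Type*} [Fintype Ω]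

/-- The average of `f` over the fibre of `C` through a point. -/
noncomputable def fibreAvg (C : Ω → γ) (f : Ω → ℝ) (ω : Ω) : ℝ :=
  (∑ ω' with C ω' = C ω, f ω') / #{ω' | C ω' = C ω}

theorem fibreAvg_congr (C : Ω → γ) (f : Ω → ℝ) {ω ω' : Ω} (h : C ω = C ω') :
    fibreAvg C f ω = fibreAvg C f ω' := by
  rw [fibreAvg, fibreAvg, h]

theorem sum_mul_fibreAvg (C : Ω → γ) (f g : Ω → ℝ) (hg : ∀ ω ω', C ω = C ω' → g ω = g ω') :
    ∑ ω, g ω * fibreAvg C f ω = ∑ ω, g ω * f ω := by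
  have h1 : ∀ ω, g ω * fibreAvg C f ω =
      ∑ ω', if C ω' = C ω then g ω' * f ω' / #{ω'' | C ω'' = C ω'} else 0 := fun ω => by
    rw [fibreAvg, ← mul_div_assoc, mul_sum, sum_div, sum_filter]
    refine sum_congr rfl fun ω' _ => ?_
    split_ifs with h
    · rw [hg ω' ω h, h]
    · rfl
  simp_rw [h1]
  rw [sum_comm]
  refine sum_congr rfl fun ω' _ => ?_
  rw [← sum_filter, sum_const, nsmul_eq_mul]
  have h2 : (univ.filter fun ω => C ω' = C ω) = univ.filter fun ω => C ω = C ω' :=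
    filter_congr fun ω _ => eq_comm
  have h3 : (#{ω | C ω = C ω'} : ℝ) ≠ 0 :=
    Nat.cast_ne_zero.2 (card_ne_zero.2 ⟨ω', by simp⟩)
  rw [h2]
  field_simp

theorem energy_gain (C : Ω → γ) (C' : Ω → γ') (f : Ω → ℝ)
    (hC : ∀ ω ω', C' ω = C' ω' → C ω = C ω') (S : Finset Ω)
    (hS : ∀ ω ω', C' ω = C' ω' → ω ∈ S → ω' ∈ S) {ε : ℝ} (hε : 0 ≤ ε)
    (h : ∑ ω ∈ S, f ω ≤ ∑ ω ∈ S, (fibreAvg C f ω - ε)) :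
    ∑ ω, fibreAvg C f ω ^ 2 + ε ^ 2 * #S ≤ ∑ ω, fibreAvg C' f ω ^ 2 := by
  have h1 : ∑ ω, fibreAvg C f ω * fibreAvg C' f ω = ∑ ω, fibreAvg C f ω ^ 2 := by
    rw [sum_mul_fibreAvg C' f _ fun ω ω' hω => fibreAvg_congr C f (hC _ _ hω),
      ← sum_mul_fibreAvg C f _ fun ω ω' hω => fibreAvg_congr C f hω]
    exact sum_congr rfl fun ω _ => by ring
  have h2 : ∑ ω ∈ S, fibreAvg C' f ω = ∑ ω ∈ S, f ω := by
    have := sum_mul_fibreAvg C' f (fun ω => if ω ∈ S then 1 else 0) fun ω ω' hω => by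
      by_cases hm : ω ∈ S
      · simp [hm, hS _ _ hω hm]
      · have : ω' ∉ S := fun h' => hm (hS _ _ hω.symm h')
        simp [hm, this]
    simpa [← sum_filter] using this
  have h3 : ∑ ω ∈ S, (-(2 * ε) * (fibreAvg C' f ω - fibreAvg C f ω) - ε ^ 2) ≤
      ∑ ω, (fibreAvg C' f ω - fibreAvg C f ω) ^ 2 := by
    refine le_trans (sum_le_sum fun ω _ => ?_)
      (sum_le_univ_sum_of_nonneg fun ω => sq_nonneg _)
    nlinarith [sq_nonneg (fibreAvg C' f ω - fibreAvg C f ω + ε)]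
  have h4 : ∑ ω, (fibreAvg C' f ω - fibreAvg C f ω) ^ 2 =
      ∑ ω, fibreAvg C' f ω ^ 2 - ∑ ω, fibreAvg C f ω ^ 2 := by
    have : ∀ ω, (fibreAvg C' f ω - fibreAvg C f ω) ^ 2 =
      fibreAvg C' f ω ^ 2 - 2 * (fibreAvg C f ω * fibreAvg C' f ω) + fibreAvg C f ω ^ 2 :=
      fun ω => by ring
    simp_rw [this]
    rw [sum_add_distrib, sum_sub_distrib, ← mul_sum, h1]
    ring
  rw [sum_sub_distrib, ← mul_sum, sum_sub_distrib, h2, sum_const, nsmul_eq_mul] at h3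
  rw [sum_sub_distrib, sum_const, nsmul_eq_mul] at h
  nlinarith [mul_le_mul_of_nonneg_left h hε]

theorem energy_le (C : Ω → γ) (f : Ω → ℝ) (h0 : ∀ ω, 0 ≤ f ω) (h1 : ∀ ω, f ω ≤ 1) :
    ∑ ω, fibreAvg C f ω ^ 2 ≤ Fintype.card Ω := by
  calc _ ≤ ∑ ω : Ω, (1 : ℝ) := sum_le_sum fun ω _ => by
        have h2 : 0 ≤ fibreAvg C f ω := div_nonneg (sum_nonneg fun ω' _ => h0 ω') (by positivity)
        have h3 : fibreAvg C f ω ≤ 1 := by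
          refine div_le_one_of_le₀ ?_ (by positivity)
          calc _ ≤ ∑ ω' with C ω' = C ω, (1 : ℝ) := sum_le_sum fun ω' _ => h1 ω'
            _ = _ := by simp
        nlinarith
    _ = _ := by simp

end Energy

section Regularity

variable {V κ : Type} [Fintype V] [Fintype κ]

/-- The number of ordered triples of `X × Y × Z` related by `T`. -/
noncomputable def boxCount (T : V → V → V → Prop) (X Y Z : Finset V) : ℕ :=
  #{p ∈ X ×ˢ Y ×ˢ Z | T p.1 p.2.1 p.2.2}

/-- A colour class. -/
noncomputable def cls (P : V → κ) (i : κ) : Finset V := {v | P v = i}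

/-- The box `X × Y × Z` consists of large parts of three colour classes and is sparse. -/
def SparseBox (T : V → V → V → Prop) (ε : ℝ) (P : V → κ) (c : κ × κ × κ)
    (B : Finset V × Finset V × Finset V) : Prop :=
  (B.1 ⊆ cls P c.1 ∧ B.2.1 ⊆ cls P c.2.1 ∧ B.2.2 ⊆ cls P c.2.2) ∧
  (ε * #(cls P c.1) ≤ #B.1 ∧ ε * #(cls P c.2.1) ≤ #B.2.1 ∧ ε * #(cls P c.2.2) ≤ #B.2.2) ∧
  (boxCount T B.1 B.2.1 B.2.2 : ℝ) < ε * (#B.1 * #B.2.1 * #B.2.2)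

/-- A dense triple of colour classes is irregular if it contains a large sparse box. -/
def Irregular (T : V → V → V → Prop) (ε : ℝ) (P : V → κ) (c : κ × κ × κ) : Prop :=
  2 * ε * (#(cls P c.1) * #(cls P c.2.1) * #(cls P c.2.2)) ≤
    boxCount T (cls P c.1) (cls P c.2.1) (cls P c.2.2) ∧ ∃ B, SparseBox T ε P c B

/-- The colours of an ordered triple. -/
def cell (P : V → κ) (p : V × V × V) : κ × κ × κ := (P p.1, P p.2.1, P p.2.2)

/-- The indicator of a ternary relation. -/
noncomputable def ind (T : V → V → V → Prop) (p : V × V × V) : ℝ :=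
  if T p.1 p.2.1 p.2.2 then 1 else 0

/-- The energy of a colouring. -/
noncomputable def energy (T : V → V → V → Prop) (P : V → κ) : ℝ :=
  ∑ p, fibreAvg (cell P) (ind T) p ^ 2

theorem cell_fibre (P : V → κ) (c : κ × κ × κ) [DecidablePred fun p => cell P p = c] :
    (univ.filter fun p => cell P p = c) = cls P c.1 ×ˢ cls P c.2.1 ×ˢ cls P c.2.2 := by
  ext p
  simp [cell, cls, Prod.ext_iff]

/-- A box as a set of triples. -/
def boxSet (B : Finset V × Finset V × Finset V) : Finset (V × V × V) := B.1 ×ˢ B.2.1 ×ˢ B.2.2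

/-- Refine a colouring by a family of boxes. -/
noncomputable def refineBy {ι : Type} (P : V → κ) (B : ι → Finset V × Finset V × Finset V) (v : V) :
    κ × (ι → Bool × Bool × Bool) :=
  (P v, fun c => (decide (v ∈ (B c).1), decide (v ∈ (B c).2.1), decide (v ∈ (B c).2.2)))

theorem refineBy_eq {ι : Type} {P : V → κ} {B : ι → Finset V × Finset V × Finset V} {v w : V}
    (h : refineBy P B v = refineBy P B w) : P v = P w ∧
      ∀ c, (v ∈ (B c).1 → w ∈ (B c).1) ∧ (v ∈ (B c).2.1 → w ∈ (B c).2.1) ∧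
        (v ∈ (B c).2.2 → w ∈ (B c).2.2) := by
  rw [refineBy, refineBy, Prod.mk.injEq] at h
  refine ⟨h.1, fun c => ?_⟩
  have h1 := congrFun h.2 c
  simp only [Prod.mk.injEq, decide_eq_decide] at h1
  exact ⟨h1.1.1, h1.2.1.1, h1.2.2.1⟩

theorem cell_refineBy_eq {ι : Type} {P : V → κ} {B : ι → Finset V × Finset V × Finset V}
    {p p' : V × V × V} (h : cell (refineBy P B) p = cell (refineBy P B) p') :
    cell P p = cell P p' ∧ ∀ c, p ∈ boxSet (B c) → p' ∈ boxSet (B c) := by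
  rw [cell, cell] at h
  have h' := Prod.mk.inj h
  have h'' := Prod.mk.inj h'.2
  have h1 := refineBy_eq h'.1
  have h2 := refineBy_eq h''.1
  have h3 := refineBy_eq h''.2
  refine ⟨by rw [cell, cell, h1.1, h2.1, h3.1], fun c hc => ?_⟩
  rw [boxSet, mem_product, mem_product] at hc ⊢
  exact ⟨(h1.2 c).1 hc.1, (h2.2 c).2.1 hc.2.1, (h3.2 c).2.2 hc.2.2⟩

theorem SparseBox.cell_eq {T : V → V → V → Prop} {ε : ℝ} {P : V → κ} {c : κ × κ × κ}
    {B : Finset V × Finset V × Finset V} (h : SparseBox T ε P c B) {p : V × V × V}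
    (hp : p ∈ boxSet B) : cell P p = c := by
  rw [boxSet, mem_product, mem_product] at hp
  have : p ∈ univ.filter fun p => cell P p = c := by
    rw [cell_fibre, mem_product, mem_product]
    exact ⟨h.1.1 hp.1, h.1.2.1 hp.2.1, h.1.2.2 hp.2.2⟩
  exact (mem_filter.1 this).2

theorem card_boxSet (B : Finset V × Finset V × Finset V) :
    (#(boxSet B) : ℝ) = #B.1 * #B.2.1 * #B.2.2 := by
  rw [boxSet, card_product, card_product]
  push_cast
  ring

theorem sum_ind (T : V → V → V → Prop) (X Y Z : Finset V) :
    ∑ p ∈ X ×ˢ Y ×ˢ Z, ind T p = boxCount T X Y Z := by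
  rw [boxCount, card_filter]
  push_cast
  exact sum_congr rfl fun p _ => rfl

theorem Irregular.le_fibreAvg {T : V → V → V → Prop} {ε : ℝ} {P : V → κ} {p : V × V × V}
    (h : Irregular T ε P (cell P p)) : 2 * ε ≤ fibreAvg (cell P) (ind T) p := by
  have hpm : p ∈ univ.filter fun p' => cell P p' = cell P p := by simp
  rw [cell_fibre] at hpm
  rw [fibreAvg, cell_fibre, le_div_iff₀ (by exact_mod_cast card_pos.2 ⟨p, hpm⟩), sum_ind]
  refine le_trans (le_of_eq ?_) h.1
  rw [card_product, card_product]
  push_cast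
  ring

theorem SparseBox.sum_le {T : V → V → V → Prop} {ε : ℝ} {P : V → κ} {c : κ × κ × κ}
    {B : Finset V × Finset V × Finset V} (h : SparseBox T ε P c B) (hc : Irregular T ε P c) :
    ∑ p ∈ boxSet B, ind T p ≤ ∑ p ∈ boxSet B, (fibreAvg (cell P) (ind T) p - ε) := by
  have h4 : ∑ p ∈ boxSet B, ε ≤ ∑ p ∈ boxSet B, (fibreAvg (cell P) (ind T) p - ε) :=
    sum_le_sum fun p hp => by
      have := Irregular.le_fibreAvg (T := T) (ε := ε) (P := P) (p := p) (by rwa [h.cell_eq hp])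
      linarith
  rw [sum_const, nsmul_eq_mul, card_boxSet] at h4
  refine le_trans (le_of_eq (sum_ind T _ _ _)) ?_
  linarith [h.2.2]

theorem exists_energy_gain (T : V → V → V → Prop) {ε : ℝ} (hε : 0 < ε) (P : V → κ)
    (h : ε * (Fintype.card V : ℝ) ^ 3 < ∑ c with Irregular T ε P c,
      (#(cls P c.1) * #(cls P c.2.1) * #(cls P c.2.2) : ℝ)) :
    ∃ P' : V → κ × (κ × κ × κ → Bool × Bool × Bool),
      energy T P + ε ^ 6 * (Fintype.card V : ℝ) ^ 3 ≤ energy T P' := by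
  have hB : ∀ c, ∃ B, Irregular T ε P c → SparseBox T ε P c B := fun c => by
    by_cases hc : Irregular T ε P c
    · exact hc.2.imp fun B hB _ => hB
    · exact ⟨(∅, ∅, ∅), fun h => absurd h hc⟩
  choose B hB using hB
  obtain ⟨I, hIdef⟩ : ∃ I : Finset (κ × κ × κ), I = univ.filter fun c => Irregular T ε P c :=
    ⟨_, rfl⟩
  rw [← hIdef] at h
  have hI : ∀ c ∈ I, Irregular T ε P c := fun c hc => by
    rw [hIdef] at hc; exact (mem_filter.1 hc).2
  have hdisj : (I : Set (κ × κ × κ)).PairwiseDisjoint fun c => boxSet (B c) := by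
    intro c hc c' hc' hne
    rw [Function.onFun, disjoint_left]
    intro p hp hp'
    exact hne (((hB c (hI c hc)).cell_eq hp).symm.trans ((hB c' (hI c' hc')).cell_eq hp'))
  have hsat : ∀ p p', cell (refineBy P B) p = cell (refineBy P B) p' →
      p ∈ I.biUnion (fun c => boxSet (B c)) → p' ∈ I.biUnion (fun c => boxSet (B c)) := by
    intro p p' hp hpS
    rw [mem_biUnion] at hpS ⊢
    obtain ⟨c, hc, hpc⟩ := hpS
    exact ⟨c, hc, (cell_refineBy_eq hp).2 c hpc⟩
  have hsum : ∑ p ∈ I.biUnion (fun c => boxSet (B c)), ind T p ≤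
      ∑ p ∈ I.biUnion (fun c => boxSet (B c)), (fibreAvg (cell P) (ind T) p - ε) := by
    rw [sum_biUnion hdisj, sum_biUnion hdisj]
    exact sum_le_sum fun c hc => (hB c (hI c hc)).sum_le (hI c hc)
  have hgain := energy_gain (cell P) (cell (refineBy P B)) (ind T)
    (fun p p' hp => (cell_refineBy_eq hp).1) _ hsat hε.le hsum
  refine ⟨refineBy P B, le_trans ?_ hgain⟩
  have h5 : ε ^ 4 * (Fintype.card V : ℝ) ^ 3 ≤ #(I.biUnion fun c => boxSet (B c)) := by
    rw [card_biUnion hdisj]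
    push_cast
    calc _ = ε ^ 3 * (ε * (Fintype.card V : ℝ) ^ 3) := by ring
      _ ≤ ε ^ 3 * ∑ c ∈ I, (#(cls P c.1) * #(cls P c.2.1) * #(cls P c.2.2) : ℝ) := by
          gcongr
      _ ≤ _ := by
          rw [mul_sum]
          refine sum_le_sum fun c hc => ?_
          obtain ⟨h1, h2, h3⟩ := (hB c (hI c hc)).2.1
          rw [card_boxSet]
          calc _ = (ε * #(cls P c.1)) * (ε * #(cls P c.2.1)) * (ε * #(cls P c.2.2)) := by ring
            _ ≤ _ := by gcongr
  have h6 := mul_le_mul_of_nonneg_left h5 (sq_nonneg ε)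
  rw [energy]
  linarith

/-- The number of colours after `j` refinements. -/
def refCount : ℕ → ℕ
  | 0 => 1
  | j + 1 => refCount j * 8 ^ (refCount j ^ 3)

theorem refCount_le (j : ℕ) : refCount j ≤ refCount (j + 1) :=
  Nat.le_mul_of_pos_right _ (by positivity)

theorem exists_refinement (T : V → V → V → Prop) {ε : ℝ} (hε : 0 < ε) (j : ℕ) :
    ∃ (κ : Type) (_ : Fintype κ) (P : V → κ), Fintype.card κ ≤ refCount j ∧
      ((∑ c with Irregular T ε P c, (#(cls P c.1) * #(cls P c.2.1) * #(cls P c.2.2) : ℝ)) ≤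
        ε * (Fintype.card V : ℝ) ^ 3 ∨
      j * (ε ^ 6 * (Fintype.card V : ℝ) ^ 3) ≤ energy T P) := by
  induction j with
  | zero =>
    refine ⟨Unit, inferInstance, fun _ => (), by simp [refCount], Or.inr ?_⟩
    simp only [Nat.cast_zero, zero_mul]
    exact sum_nonneg fun p _ => sq_nonneg _
  | succ j ih =>
    obtain ⟨κ, _, P, hκ, h⟩ := ih
    by_cases h1 : (∑ c with Irregular T ε P c,
        (#(cls P c.1) * #(cls P c.2.1) * #(cls P c.2.2) : ℝ)) ≤ ε * (Fintype.card V : ℝ) ^ 3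
    · exact ⟨κ, inferInstance, P, hκ.trans (refCount_le j), Or.inl h1⟩
    · have h2 := h.resolve_left h1
      obtain ⟨P', hP'⟩ := exists_energy_gain T hε P (not_le.1 h1)
      refine ⟨_, inferInstance, P', ?_, Or.inr ?_⟩
      · have : Fintype.card (κ × (κ × κ × κ → Bool × Bool × Bool)) =
            Fintype.card κ * 8 ^ (Fintype.card κ ^ 3) := by
          simp only [Fintype.card_prod, Fintype.card_fun, Fintype.card_bool]
          congr 2
          ring
        rw [this, refCount]
        exact Nat.mul_le_mul hκ (Nat.pow_le_pow_right (by norm_num) (Nat.pow_le_pow_left hκ 3))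
      · push_cast
        linarith

theorem card_filter_cell (P : V → κ) (Q : V × V × V → Prop) (S : κ × κ × κ → Prop) :
    #{p | Q p ∧ S (cell P p)} =
      ∑ c with S c, #{p ∈ cls P c.1 ×ˢ cls P c.2.1 ×ˢ cls P c.2.2 | Q p} := by
  rw [card_eq_sum_card_fiberwise (f := cell P) (t := univ.filter S)
    (fun p hp => by simpa using (mem_filter.1 hp).2.2)]
  refine sum_congr rfl fun c hc => ?_
  rw [← cell_fibre]
  congr 1
  ext p
  simp only [mem_filter, mem_univ, true_and] at hc ⊢
  constructor
  · rintro ⟨h1, h2⟩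
    exact ⟨h2, h1.1⟩
  · rintro ⟨h1, h2⟩
    exact ⟨⟨h2, h1 ▸ hc⟩, h1⟩

theorem card_small_classes (P : V → κ) {ζ ε : ℝ} (h0 : 0 ≤ ζ) (hζ : Fintype.card κ * ζ ≤ ε) :
    (#{v | (#(cls P (P v)) : ℝ) < ζ * Fintype.card V} : ℝ) ≤ ε * Fintype.card V := by
  have h1 : #{v | (#(cls P (P v)) : ℝ) < ζ * Fintype.card V} =
      ∑ i with (#(cls P i) : ℝ) < ζ * Fintype.card V, #(cls P i) := by
    rw [card_eq_sum_card_fiberwise (f := P)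
      (t := univ.filter fun i => (#(cls P i) : ℝ) < ζ * Fintype.card V)
      (fun p hp => by simpa using hp)]
    refine sum_congr rfl fun i hi => ?_
    rw [cls]
    congr 1
    ext v
    simp only [mem_filter, mem_univ, true_and] at hi ⊢
    constructor
    · rintro ⟨-, h⟩
      exact h
    · rintro rfl
      exact ⟨hi, rfl⟩
  rw [h1]
  push_cast
  calc _ ≤ ∑ i with (#(cls P i) : ℝ) < ζ * Fintype.card V, ζ * Fintype.card V :=
        sum_le_sum fun i hi => (mem_filter.1 hi).2.le
    _ ≤ ∑ i : κ, ζ * Fintype.card V :=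
        sum_le_univ_sum_of_nonneg fun i => by positivity
    _ = Fintype.card κ * ζ * Fintype.card V := by
        rw [sum_const, nsmul_eq_mul, card_univ, mul_assoc]
    _ ≤ _ := by gcongr

theorem sum_card_cls (P : V → κ) :
    ∑ c : κ × κ × κ, (#(cls P c.1) * #(cls P c.2.1) * #(cls P c.2.2) : ℝ) =
      (Fintype.card V : ℝ) ^ 3 := by
  have h1 : (∑ i : κ, (#(cls P i) : ℝ)) = Fintype.card V := by
    have := card_eq_sum_card_fiberwise (f := P) (s := univ) (t := univ) (by simp)
    rw [card_univ] at this
    rw [this]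
    push_cast
    rfl
  rw [Fintype.sum_prod_type]
  simp_rw [Fintype.sum_prod_type, ← mul_sum, h1, ← sum_mul, ← mul_sum, h1, ← sum_mul, h1]
  ring

/-- A triple of colour classes of low density. -/
def LowDensity (T : V → V → V → Prop) (ε : ℝ) (P : V → κ) (c : κ × κ × κ) : Prop :=
  (boxCount T (cls P c.1) (cls P c.2.1) (cls P c.2.2) : ℝ) <
    2 * ε * (#(cls P c.1) * #(cls P c.2.1) * #(cls P c.2.2))

theorem card_lowDensity_le (T : V → V → V → Prop) {ε : ℝ} (hε : 0 ≤ ε) (P : V → κ) :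
    (#{p : V × V × V | T p.1 p.2.1 p.2.2 ∧ LowDensity T ε P (cell P p)} : ℝ) ≤
      2 * ε * (Fintype.card V : ℝ) ^ 3 := by
  rw [card_filter_cell P (fun p => T p.1 p.2.1 p.2.2) (LowDensity T ε P), ← sum_card_cls P, mul_sum]
  push_cast
  refine le_trans (sum_le_sum (g := fun c : κ × κ × κ =>
    2 * ε * (#(cls P c.1) * #(cls P c.2.1) * #(cls P c.2.2) : ℝ)) fun c hc => ?_)
    (sum_le_univ_sum_of_nonneg fun c => by positivity)
  have h := (mem_filter.1 hc).2.le
  exact h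

theorem card_irregular_le (T : V → V → V → Prop) {ε : ℝ} (P : V → κ) :
    (#{p : V × V × V | Irregular T ε P (cell P p)} : ℝ) ≤
      ∑ c with Irregular T ε P c, (#(cls P c.1) * #(cls P c.2.1) * #(cls P c.2.2) : ℝ) := by
  have h := card_filter_cell P (fun _ => True) (Irregular T ε P)
  simp only [true_and, filter_true, card_product] at h
  rw [h]
  push_cast
  exact le_of_eq (sum_congr rfl fun c _ => by ring)

theorem card_first_le (S : V → Prop) : #{p : V × V × V | S p.1} = #{v | S v} * Fintype.card V ^ 2 := by
  have : (univ.filter fun p : V × V × V => S p.1) = (univ.filter S) ×ˢ univ := by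
    ext p
    simp
  rw [this, card_product, card_univ, Fintype.card_prod, sq]

theorem card_second_le (S : V → Prop) :
    #{p : V × V × V | S p.2.1} = #{v | S v} * Fintype.card V ^ 2 := by
  have : (univ.filter fun p : V × V × V => S p.2.1) = univ ×ˢ (univ.filter S) ×ˢ univ := by
    ext p
    simp
  rw [this, card_product, card_product, card_univ]
  ring

theorem card_third_le (S : V → Prop) :
    #{p : V × V × V | S p.2.2} = #{v | S v} * Fintype.card V ^ 2 := by
  have : (univ.filter fun p : V × V × V => S p.2.2) = univ ×ˢ univ ×ˢ (univ.filter S) := by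
    ext p
    simp
  rw [this, card_product, card_product, card_univ]
  ring

theorem card_bad_subset (T : V → V → V → Prop) (ε z : ℝ) (P : V → κ) :
    (univ.filter fun p : V × V × V => T p.1 p.2.1 p.2.2 ∧
        ¬ ((z ≤ #(cls P (cell P p).1) ∧
        z ≤ #(cls P (cell P p).2.1) ∧ z ≤ #(cls P (cell P p).2.2)) ∧
          ¬ LowDensity T ε P (cell P p) ∧ ¬ Irregular T ε P (cell P p))) ⊆
        (univ.filter fun p : V × V × V => (#(cls P (P p.1)) : ℝ) < z) ∪
        ((univ.filter fun p : V × V × V => (#(cls P (P p.2.1)) : ℝ) < z) ∪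
        ((univ.filter fun p : V × V × V => (#(cls P (P p.2.2)) : ℝ) < z) ∪
        ((univ.filter fun p : V × V × V => T p.1 p.2.1 p.2.2 ∧ LowDensity T ε P (cell P p)) ∪
          univ.filter fun p : V × V × V => Irregular T ε P (cell P p)))) := by
  intro p hp
  simp only [mem_union, mem_filter, mem_univ, true_and] at hp ⊢
  simp only [← not_le]
  obtain ⟨hT, h⟩ := hp
  by_cases h1 : z ≤ #(cls P (P p.1))
  · by_cases h2 : z ≤ #(cls P (P p.2.1))
    · by_cases h3 : z ≤ #(cls P (P p.2.2))
      · by_cases h4 : LowDensity T ε P (cell P p)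
        · exact Or.inr (Or.inr (Or.inr (Or.inl ⟨hT, h4⟩)))
        · by_cases h5 : Irregular T ε P (cell P p)
          · exact Or.inr (Or.inr (Or.inr (Or.inr h5)))
          · exact absurd ⟨⟨h1, h2, h3⟩, h4, h5⟩ h
      · exact Or.inr (Or.inr (Or.inl h3))
    · exact Or.inr (Or.inl h2)
  · exact Or.inl h1

end Regularity

/-- A weak regularity lemma for ternary relations: up to few triples, the relation is supported on
triples of large colour classes all of whose large boxes are dense. -/
theorem regularity {ε : ℝ} (hε : 0 < ε) (hε1 : ε ≤ 1) : ∃ M : ℝ, 0 < M ∧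
    ∀ (V : Type) [Fintype V] (T : V → V → V → Prop), 0 < Fintype.card V →
      ∃ (κ : Type) (_ : Fintype κ) (P : V → κ) (G : κ × κ × κ → Prop), Fintype.card κ ≤ M ∧
        (#{p : V × V × V | T p.1 p.2.1 p.2.2 ∧ ¬ G (cell P p)} : ℝ) ≤
          6 * ε * (Fintype.card V : ℝ) ^ 3 ∧
        (∀ c, G c → ∀ X ⊆ cls P c.1, ∀ Y ⊆ cls P c.2.1, ∀ Z ⊆ cls P c.2.2,
          ε * #(cls P c.1) ≤ #X → ε * #(cls P c.2.1) ≤ #Y → ε * #(cls P c.2.2) ≤ #Z →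
            ε * (#X * #Y * #Z) ≤ boxCount T X Y Z) ∧
        ∀ c, G c → ε / M * Fintype.card V ≤ #(cls P c.1) ∧
          ε / M * Fintype.card V ≤ #(cls P c.2.1) ∧ ε / M * Fintype.card V ≤ #(cls P c.2.2) := by
  obtain ⟨j, hj⟩ := exists_nat_gt (1 / ε ^ 6)
  have hM : 0 < refCount j := by
    clear hj
    induction j with
    | zero => simp [refCount]
    | succ j ih => rw [refCount]; positivity
  refine ⟨refCount j, by exact_mod_cast hM, fun V _ T hV => ?_⟩
  obtain ⟨κ, _, P, hκ, h⟩ := exists_refinement T hε j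
  have hV' : (0 : ℝ) < Fintype.card V := by exact_mod_cast hV
  have hM' : (0 : ℝ) < refCount j := by exact_mod_cast hM
  have h1 : (∑ c with Irregular T ε P c, (#(cls P c.1) * #(cls P c.2.1) * #(cls P c.2.2) : ℝ)) ≤
        ε * (Fintype.card V : ℝ) ^ 3 := by
    refine h.resolve_right fun h2 => ?_
    have h3 := energy_le (cell P) (ind T) (fun p => by unfold ind; split_ifs <;> norm_num)
      (fun p => by unfold ind; split_ifs <;> norm_num)
    have h4 := h2.trans h3
    rw [Fintype.card_prod, Fintype.card_prod] at h4
    push_cast at h4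
    rw [div_lt_iff₀ (by positivity)] at hj
    have h5 : 0 < (Fintype.card V : ℝ) ^ 3 := by positivity
    nlinarith [mul_lt_mul_of_pos_right hj h5]
  set n : ℝ := (Fintype.card V : ℝ) with hn
  have hκ' : (Fintype.card κ : ℝ) ≤ refCount j := by exact_mod_cast hκ
  set ζ : ℝ := ε / refCount j with hζdef
  have hζ : Fintype.card κ * ζ ≤ ε := by
    rw [hζdef, mul_div_assoc', div_le_iff₀ hM', mul_comm]
    gcongr
  have hSm : (#{v | (#(cls P (P v)) : ℝ) < ζ * n} : ℝ) ≤ ε * n :=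
    card_small_classes P (by positivity) hζ
  have hLo := card_lowDensity_le T hε.le P
  have hIr := (card_irregular_le T P).trans h1
  have h3 : ((#{v | (#(cls P (P v)) : ℝ) < ζ * n} * Fintype.card V ^ 2 : ℕ) : ℝ) ≤ ε * n ^ 3 := by
    push_cast
    calc _ ≤ (ε * n) * n ^ 2 := by gcongr
      _ = _ := by ring
  refine ⟨κ, inferInstance, P, fun c => (ζ * n ≤ #(cls P c.1) ∧
    ζ * n ≤ #(cls P c.2.1) ∧ ζ * n ≤ #(cls P c.2.2)) ∧ ¬ LowDensity T ε P c ∧ ¬ Irregular T ε P c,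
    hκ', ?_, ?_, fun c hc => hc.1⟩
  · have h2 := (card_le_card (card_bad_subset T ε (ζ * n) P)).trans ((card_union_le _ _).trans
      (Nat.add_le_add_left
      ((card_union_le _ _).trans (Nat.add_le_add_left ((card_union_le _ _).trans
        (Nat.add_le_add_left (card_union_le _ _) _)) _)) _))
    rw [card_first_le fun v => (#(cls P (P v)) : ℝ) < ζ * n,
      card_second_le fun v => (#(cls P (P v)) : ℝ) < ζ * n,
      card_third_le fun v => (#(cls P (P v)) : ℝ) < ζ * n] at h2
    have h4 : (_ : ℝ) ≤ _ := Nat.cast_le.2 h2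
    refine le_trans (le_of_eq (by congr!)) (le_trans h4 ?_)
    rw [Nat.cast_add, Nat.cast_add, Nat.cast_add, Nat.cast_add]
    linarith
  · intro c hc X hX Y hY Z hZ h2 h3 h4
    by_contra hcon
    refine hc.2.2 ⟨not_lt.1 hc.2.1, (X, Y, Z), ⟨hX, hY, hZ⟩, ⟨h2, h3, h4⟩, not_le.1 hcon⟩

theorem exists_zigzag {V : Type*} {T : V → V → V → Prop} (hT : IsTri T) {x y z : ℕ → V} {m : ℕ}
    (hx : ∀ i < m, ∀ j < m, x i = x j → i = j) (hy : ∀ i < m, ∀ j < m, y i = y j → i = j)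
    (hz : ∀ i < 2 * m, ∀ j < 2 * m, z i = z j → i = j) (hxy : ∀ i < m, ∀ j < m, x i ≠ y j)
    (hxz : ∀ i < m, ∀ j < 2 * m, x i ≠ z j) (hyz : ∀ i < m, ∀ j < 2 * m, y i ≠ z j)
    (h : ∀ i < m, ∀ j < m, ∀ k < 2 * m, T (x i) (y j) (z k)) (j : ℕ) (hj : j < m) :
    ∃ l, LPath T (x 0) (x j) l ∧ l.length = 4 * j ∧ (x 0 :: l).Nodup ∧
      ∀ v ∈ x 0 :: l, (∃ i ≤ j, v = x i) ∨ (∃ i < j, v = y i) ∨ ∃ i < 2 * j, v = z i := by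
  induction j with
  | zero => exact ⟨[], LPath.nil _, rfl, by simp, by simp⟩
  | succ j ih =>
    obtain ⟨l, h1, h2, h3, h4⟩ := ih (by omega)
    refine ⟨l ++ [z (2 * j), y j, z (2 * j + 1), x (j + 1)], h1.append (LPath.cons
      (hT.swap₂₃ (h j (by omega) j (by omega) (2 * j) (by omega))) (LPath.cons
      (hT.swap₂₃ (hT.swap₁₂ (h (j + 1) hj j (by omega) (2 * j + 1) (by omega))))
      (LPath.nil _))), by simp [h2]; omega, ?_, ?_⟩
    · rw [← List.cons_append, List.nodup_append']
      refine ⟨h3, ?_, ?_⟩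
      · have e1 : z (2 * j) ≠ z (2 * j + 1) := fun h => by
          have := hz _ (by omega) _ (by omega) h
          omega
        have e2 := hyz j (by omega) (2 * j) (by omega)
        have e3 := hyz j (by omega) (2 * j + 1) (by omega)
        have e4 := hxz (j + 1) (by omega) (2 * j) (by omega)
        have e5 := hxz (j + 1) (by omega) (2 * j + 1) (by omega)
        have e6 := hxy (j + 1) (by omega) j (by omega)
        simp [e1, e2.symm, e3, e4.symm, e5.symm, e6.symm]
      · intro v hv hv'
        have h5 := h4 v hv
        simp only [List.mem_cons, List.not_mem_nil, or_false] at hv'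
        rcases hv' with rfl | rfl | rfl | rfl
        · rcases h5 with ⟨i, hi, h6⟩ | ⟨i, hi, h6⟩ | ⟨i, hi, h6⟩
          · exact hxz i (by omega) _ (by omega) h6.symm
          · exact hyz i (by omega) _ (by omega) h6.symm
          · have := hz _ (by omega) _ (by omega) h6
            omega
        · rcases h5 with ⟨i, hi, h6⟩ | ⟨i, hi, h6⟩ | ⟨i, hi, h6⟩
          · exact hxy i (by omega) _ (by omega) h6.symm
          · have := hy _ (by omega) _ (by omega) h6
            omega
          · exact hyz _ (by omega) i (by omega) h6
        · rcases h5 with ⟨i, hi, h6⟩ | ⟨i, hi, h6⟩ | ⟨i, hi, h6⟩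
          · exact hxz i (by omega) _ (by omega) h6.symm
          · exact hyz i (by omega) _ (by omega) h6.symm
          · have := hz _ (by omega) _ (by omega) h6
            omega
        · rcases h5 with ⟨i, hi, h6⟩ | ⟨i, hi, h6⟩ | ⟨i, hi, h6⟩
          · have := hx _ (by omega) _ (by omega) h6
            omega
          · exact hxy _ (by omega) i (by omega) h6
          · exact hxz _ (by omega) i (by omega) h6
    · intro v hv
      rw [← List.cons_append, List.mem_append] at hv
      rcases hv with hv | hv
      · rcases h4 v hv with ⟨i, hi, h6⟩ | ⟨i, hi, h6⟩ | ⟨i, hi, h6⟩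
        · exact Or.inl ⟨i, by omega, h6⟩
        · exact Or.inr (Or.inl ⟨i, by omega, h6⟩)
        · exact Or.inr (Or.inr ⟨i, by omega, h6⟩)
      · simp only [List.mem_cons, List.not_mem_nil, or_false] at hv
        rcases hv with rfl | rfl | rfl | rfl
        · exact Or.inr (Or.inr ⟨2 * j, by omega, rfl⟩)
        · exact Or.inr (Or.inl ⟨j, by omega, rfl⟩)
        · exact Or.inr (Or.inr ⟨2 * j + 1, by omega, rfl⟩)
        · exact Or.inl ⟨j + 1, by omega, rfl⟩

theorem le_card_injective {V ι : Type*} [Fintype V] [Fintype ι] (𝒜 : Finset (ι → V)) {δ : ℝ}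
    (hV : 2 * (Fintype.card ι : ℝ) ^ 2 ≤ δ * Fintype.card V) (hV0 : 0 < Fintype.card V)
    (h : δ * (Fintype.card V : ℝ) ^ Fintype.card ι ≤ #𝒜) :
    δ / 2 * (Fintype.card V : ℝ) ^ Fintype.card ι ≤ #{f ∈ 𝒜 | Function.Injective f} := by
  have h1 : (#𝒜 : ℝ) ≤ #{f ∈ 𝒜 | Function.Injective f} +
      #{f : ι → V | ¬ Function.Injective f} := by
    rw [← card_filter_add_card_filter_not (s := 𝒜) Function.Injective]
    push_cast
    gcongr
    exact subset_univ _
  have h2 : (Fintype.card V : ℝ) * #{f : ι → V | ¬ Function.Injective f} ≤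
      (Fintype.card ι : ℝ) ^ 2 * (Fintype.card V : ℝ) ^ Fintype.card ι := by
    exact_mod_cast card_not_injective_le (V := V) (ι := ι)
  have hVr : (0 : ℝ) < Fintype.card V := by exact_mod_cast hV0
  have h3 : (Fintype.card V : ℝ) * #{f : ι → V | ¬ Function.Injective f} ≤
      Fintype.card V * (δ / 2 * (Fintype.card V : ℝ) ^ Fintype.card ι) := by
    refine h2.trans ?_
    have h4 : 0 < (Fintype.card V : ℝ) ^ Fintype.card ι := by positivity
    nlinarith [mul_le_mul_of_nonneg_right hV h4.le]
  have h5 := le_of_mul_le_mul_left h3 hVr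
  linarith

theorem exists_injective_box {ι₁ ι₂ ι₃ : Type} [Fintype ι₁] [Fintype ι₂] [Fintype ι₃] [Nonempty ι₁]
    [Nonempty ι₂] [Nonempty ι₃] {δ : ℝ} (hδ : 0 < δ) : ∃ n₀ : ℕ,
    ∀ (V : Type) [Fintype V] (R : V → V → V → Prop), n₀ ≤ Fintype.card V →
      δ * (Fintype.card V : ℝ) ^ 3 ≤ #{p : V × V × V | R p.1 p.2.1 p.2.2} →
      ∃ (x : ι₁ → V) (y : ι₂ → V) (z : ι₃ → V), (∀ i j k, R (x i) (y j) (z k)) ∧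
        Function.Injective (Sum.elim (Sum.elim x y) z) := by
  set I : Type := (ι₁ ⊕ ι₂) ⊕ ι₃
  set δ' := δ ^ (Fintype.card ι₁ * Fintype.card ι₂ * Fintype.card ι₃) with hδ'
  have hδ'0 : 0 < δ' := by positivity
  obtain ⟨n₀, hn₀⟩ := exists_nat_gt (2 * (Fintype.card I : ℝ) ^ 2 / δ')
  refine ⟨n₀ + 1, fun V _ R hV h => ?_⟩
  have h1 := box_triple (ι₁ := ι₁) (ι₂ := ι₂) (ι₃ := ι₃) R hδ.le h
  have hVr : (n₀ : ℝ) ≤ Fintype.card V := by exact_mod_cast (by omega : n₀ ≤ Fintype.card V)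
  have h2 := le_card_injective (V := V) (ι := I) (δ := δ')
    ((univ.filter fun p : (ι₁ → V) × (ι₂ → V) × (ι₃ → V) =>
      ∀ i j k, R (p.1 i) (p.2.1 j) (p.2.2 k)).image fun p => Sum.elim (Sum.elim p.1 p.2.1) p.2.2)
    (by
      rw [div_lt_iff₀ hδ'0] at hn₀
      have := mul_le_mul_of_nonneg_right hVr hδ'0.le
      linarith) (by omega) (by
      rw [card_image_of_injective]
      · refine le_trans (le_of_eq ?_) h1
        rw [hδ', Fintype.card_sum, Fintype.card_sum]
      · rintro ⟨p1, p2, p3⟩ ⟨q1, q2, q3⟩ hpq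
        have e1 : p1 = q1 := funext fun i => congrFun hpq (Sum.inl (Sum.inl i))
        have e2 : p2 = q2 := funext fun i => congrFun hpq (Sum.inl (Sum.inr i))
        have e3 : p3 = q3 := funext fun i => congrFun hpq (Sum.inr i)
        rw [e1, e2, e3])
  have h3 : 0 < δ' / 2 * (Fintype.card V : ℝ) ^ Fintype.card I := by
    have : (0 : ℝ) < Fintype.card V := by exact_mod_cast (by omega : 0 < Fintype.card V)
    positivity
  obtain ⟨f, hf⟩ := card_pos.1 (Nat.cast_pos.1 (h3.trans_le h2))
  obtain ⟨hf1, hf2⟩ := mem_filter.1 hf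
  obtain ⟨p, hp, rfl⟩ := mem_image.1 hf1
  exact ⟨p.1, p.2.1, p.2.2, (mem_filter.1 hp).2, hf2⟩

theorem exists_tile {m : ℕ} (hm : 0 < m) {δ : ℝ} (hδ : 0 < δ) : ∃ n₀ : ℕ,
    ∀ (V : Type) [Fintype V] (T : V → V → V → Prop), IsTri T → n₀ ≤ Fintype.card V →
      ∀ X Y Z : Finset V, δ * (Fintype.card V : ℝ) ^ 3 ≤ boxCount T X Y Z →
        ∃ a b F Fx Fy Fz, PathOn T a b F ∧ F ⊆ Fx ∪ (Fy ∪ Fz) ∧ Fx ⊆ X ∧ Fy ⊆ Y ∧ Fz ⊆ Z ∧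
          #Fx ≤ m ∧ #Fy ≤ m ∧ #Fz ≤ 2 * m ∧ #F = 4 * m - 3 := by
  have h0 : 0 < 2 * m := by omega
  have : Nonempty (Fin m) := ⟨⟨0, hm⟩⟩
  have : Nonempty (Fin (2 * m)) := ⟨⟨0, h0⟩⟩
  obtain ⟨n₀, hn₀⟩ := exists_injective_box (ι₁ := Fin m) (ι₂ := Fin m) (ι₃ := Fin (2 * m)) hδ
  refine ⟨n₀, fun V _ T hT hV X Y Z h => ?_⟩
  obtain ⟨x, y, z, hf, hinj⟩ := hn₀ V (fun a b c => T a b c ∧ a ∈ X ∧ b ∈ Y ∧ c ∈ Z) hV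
    (h.trans (by
      unfold boxCount
      exact_mod_cast card_le_card fun p hp => by
        simp only [mem_filter, mem_product, mem_univ, true_and] at hp ⊢
        tauto))
  have hi : ∀ s t, Sum.elim (Sum.elim x y) z s = Sum.elim (Sum.elim x y) z t → s = t :=
    fun s t h => hinj h
  obtain ⟨l, e1, e2, e3, e4⟩ := exists_zigzag hT (m := m)
    (x := fun i => if h : i < m then x ⟨i, h⟩ else x ⟨0, hm⟩)
    (y := fun i => if h : i < m then y ⟨i, h⟩ else y ⟨0, hm⟩)
    (z := fun i => if h : i < 2 * m then z ⟨i, h⟩ else z ⟨0, h0⟩)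
    (fun i h j h' e => by
      simp only [h, h', dif_pos] at e
      simpa using hi (Sum.inl (Sum.inl ⟨i, h⟩)) (Sum.inl (Sum.inl ⟨j, h'⟩)) e)
    (fun i h j h' e => by
      simp only [h, h', dif_pos] at e
      simpa using hi (Sum.inl (Sum.inr ⟨i, h⟩)) (Sum.inl (Sum.inr ⟨j, h'⟩)) e)
    (fun i h j h' e => by
      simp only [h, h', dif_pos] at e
      simpa using hi (Sum.inr ⟨i, h⟩) (Sum.inr ⟨j, h'⟩) e)
    (fun i h j h' e => by
      simp only [h, h', dif_pos] at e
      simpa using hi (Sum.inl (Sum.inl ⟨i, h⟩)) (Sum.inl (Sum.inr ⟨j, h'⟩)) e)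
    (fun i h j h' e => by
      simp only [h, h', dif_pos] at e
      simpa using hi (Sum.inl (Sum.inl ⟨i, h⟩)) (Sum.inr ⟨j, h'⟩) e)
    (fun i h j h' e => by
      simp only [h, h', dif_pos] at e
      simpa using hi (Sum.inl (Sum.inr ⟨i, h⟩)) (Sum.inr ⟨j, h'⟩) e)
    (fun i h j h' k h'' => by
      simp only [h, h', h'', dif_pos]
      exact (hf _ _ _).1) (m - 1) (by omega)
  refine ⟨_, _, _, univ.image x, univ.image y, univ.image z, ⟨l, e1, e3, rfl⟩, ?_, ?_, ?_, ?_,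
    ?_, ?_, ?_, ?_⟩
  · intro v hv
    rw [List.mem_toFinset] at hv
    simp only [mem_union, mem_image, mem_univ, true_and]
    rcases e4 v hv with ⟨i, hi, rfl⟩ | ⟨i, hi, rfl⟩ | ⟨i, hi, rfl⟩
    · left; split_ifs <;> exact ⟨_, rfl⟩
    · right; left; split_ifs <;> exact ⟨_, rfl⟩
    · right; right; split_ifs <;> exact ⟨_, rfl⟩
  · intro v hv
    obtain ⟨i, -, rfl⟩ := mem_image.1 hv
    exact (hf i ⟨0, hm⟩ ⟨0, h0⟩).2.1
  · intro v hv
    obtain ⟨i, -, rfl⟩ := mem_image.1 hv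
    exact (hf ⟨0, hm⟩ i ⟨0, h0⟩).2.2.1
  · intro v hv
    obtain ⟨i, -, rfl⟩ := mem_image.1 hv
    exact (hf ⟨0, hm⟩ ⟨0, hm⟩ i).2.2.2
  · exact card_image_le.trans (by simp)
  · exact card_image_le.trans (by simp)
  · exact card_image_le.trans (by simp)
  · rw [List.toFinset_card_of_nodup e3, List.length_cons, e2]
    omega

/-- The number of vertices used in a colour class by a normalised tile. -/
noncomputable def wt {κ : Type} (c : κ × κ × κ) (l : κ) : ℕ :=
  (if c.1 = l then 1 else 0) + (if c.2.1 = l then 1 else 0) + 2 * (if c.2.2 = l then 1 else 0)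

theorem wt_single_tile {V κ : Type} [Fintype V] (P : V → κ) {c : κ × κ × κ} {F Fx Fy Fz : Finset V}
    {m : ℕ} (hF : F ⊆ Fx ∪ (Fy ∪ Fz)) (hx : Fx ⊆ cls P c.1) (hy : Fy ⊆ cls P c.2.1)
    (hz : Fz ⊆ cls P c.2.2) (hx' : #Fx ≤ m) (hy' : #Fy ≤ m) (hz' : #Fz ≤ 2 * m) (l : κ) :
    #(F ∩ cls P l) ≤ m * wt c l := by
  have h1 : ∀ (X : Finset V) (i : κ) (k : ℕ), X ⊆ cls P i → #X ≤ k →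
      #(X ∩ cls P l) ≤ k * if i = l then 1 else 0 := by
    intro X i k hX hk
    split_ifs with h
    · exact (card_le_card inter_subset_left).trans (by omega)
    · rw [mul_zero, Nat.le_zero, card_eq_zero]
      ext v
      simp only [mem_inter, notMem_empty, iff_false, not_and]
      intro hv hv'
      have h2 := hX hv
      simp only [cls, mem_filter, mem_univ, true_and] at h2 hv'
      exact h (h2.symm.trans hv')
  calc #(F ∩ cls P l) ≤ #((Fx ∩ cls P l) ∪ ((Fy ∩ cls P l) ∪ (Fz ∩ cls P l))) := by
        refine card_le_card ?_
        rw [← union_inter_distrib_right, ← union_inter_distrib_right]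
        exact inter_subset_inter_right hF
    _ ≤ #(Fx ∩ cls P l) + (#(Fy ∩ cls P l) + #(Fz ∩ cls P l)) :=
        (card_union_le _ _).trans (Nat.add_le_add_left (card_union_le _ _) _)
    _ ≤ _ := by
        have e1 := h1 Fx c.1 m hx hx'
        have e2 := h1 Fy c.2.1 m hy hy'
        have e3 := h1 Fz c.2.2 (2 * m) hz hz'
        rw [wt, mul_add, mul_add, ← mul_assoc m 2, mul_comm m 2]
        omega

theorem exists_packing {m : ℕ} (hm : 0 < m) {ε z : ℝ} (hε : 0 < ε) (hz : 0 < z) : ∃ n₀ : ℕ,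
    ∀ (V : Type) [Fintype V] (T : V → V → V → Prop), IsTri T → n₀ ≤ Fintype.card V →
      ∀ (κ : Type) [Fintype κ] (P : V → κ) (G : κ × κ × κ → Prop),
      (∀ c, G c → ∀ X ⊆ cls P c.1, ∀ Y ⊆ cls P c.2.1, ∀ Z ⊆ cls P c.2.2,
        ε * #(cls P c.1) ≤ #X → ε * #(cls P c.2.1) ≤ #Y → ε * #(cls P c.2.2) ≤ #Z →
          ε * (#X * #Y * #Z) ≤ boxCount T X Y Z) →
      (∀ c, G c → z * Fintype.card V ≤ #(cls P c.1) ∧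
        z * Fintype.card V ≤ #(cls P c.2.1) ∧ z * Fintype.card V ≤ #(cls P c.2.2)) →
      ∀ (k : ℕ) (N : κ × κ × κ → ℕ), ∑ c, N c = k → (∀ c, N c ≠ 0 → G c) →
        (∀ l, ((m * ∑ c, N c * wt c l : ℕ) : ℝ) ≤ (1 - ε) * #(cls P l)) →
        ∃ L F, Sys T L F ∧ L.length = k ∧ #F = (4 * m - 3) * k ∧
          ∀ l, #(F ∩ cls P l) ≤ m * ∑ c, N c * wt c l := by
  obtain ⟨n₀, hn₀⟩ := exists_tile hm (δ := ε ^ 4 * z ^ 3) (by positivity)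
  refine ⟨n₀, fun V _ T hT hV κ _ P G hb hc k => ?_⟩
  induction k with
  | zero =>
    intro N hN hG hl
    exact ⟨[], ∅, rfl, rfl, by simp, by simp⟩
  | succ k ih =>
    intro N hN hG hl
    obtain ⟨c, hcN⟩ : ∃ c, N c ≠ 0 := by
      by_contra h
      push Not at h
      simp [h] at hN
    obtain ⟨N', rfl⟩ : ∃ N' : κ × κ × κ → ℕ, N = N' + Pi.single c 1 := by
      refine ⟨N - Pi.single c 1, funext fun d => ?_⟩
      by_cases h : d = c
      · subst h
        simp
        omega
      · simp [h]
    have hsum : ∀ l, ∑ d, (N' + Pi.single c 1 : κ × κ × κ → ℕ) d * wt d l = ∑ d, N' d * wt d l + wt c l := by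
      intro l
      simp only [Pi.add_apply, add_mul, sum_add_distrib, Pi.single_apply, ite_mul, one_mul,
        zero_mul, sum_ite_eq', mem_univ, if_true]
    simp only [Pi.add_apply, sum_add_distrib, Pi.single_apply, sum_ite_eq', mem_univ, if_true,
      add_left_inj] at hN
    obtain ⟨L, F, h1, h2, h3, h4⟩ := ih N' hN (fun d hd => hG d (by simp [hd])) (fun l =>
      le_trans (Nat.cast_le.2 (Nat.mul_le_mul_left m (by rw [hsum]; omega))) (hl l))
    have hbig : ∀ l, ε * #(cls P l) ≤ #(cls P l \ F) := by
      intro l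
      have e1 : #(cls P l \ F) + #(F ∩ cls P l) = #(cls P l) := by
        rw [inter_comm, card_sdiff_add_card_inter]
      have e2 : (#(F ∩ cls P l) : ℝ) ≤ (1 - ε) * #(cls P l) := by
        refine le_trans (Nat.cast_le.2 ((h4 l).trans ?_)) (hl l)
        rw [hsum]
        exact Nat.mul_le_mul_left m (by omega)
      have e3 : (#(cls P l \ F) : ℝ) + #(F ∩ cls P l) = #(cls P l) := by exact_mod_cast e1
      linarith
    have hGc := hG c hcN
    obtain ⟨z1, z2, z3⟩ := hc c hGc
    have hbox := hb c hGc _ sdiff_subset _ sdiff_subset _ sdiff_subset (hbig c.1) (hbig c.2.1)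
      (hbig c.2.2)
    obtain ⟨a, b, F', Fx, Fy, Fz, g1, g2, g3, g4, g5, g6, g7, g8, g9⟩ := hn₀ V T hT hV _ _ _
      (le_trans (by
        calc ε ^ 4 * z ^ 3 * (Fintype.card V : ℝ) ^ 3 = ε * ((ε * (z * Fintype.card V)) *
              (ε * (z * Fintype.card V)) * (ε * (z * Fintype.card V))) := by ring
          _ ≤ ε * ((ε * #(cls P c.1)) * (ε * #(cls P c.2.1)) * (ε * #(cls P c.2.2))) := by gcongr
          _ ≤ ε * (#(cls P c.1 \ F) * #(cls P c.2.1 \ F) * #(cls P c.2.2 \ F)) := by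
              have := hbig c.1
              have := hbig c.2.1
              have := hbig c.2.2
              gcongr) hbox)
    have hd : Disjoint F' F := by
      rw [disjoint_left]
      intro v hv hvF
      have := g2 hv
      simp only [mem_union] at this
      rcases this with h | h | h
      · exact (mem_sdiff.1 (g3 h)).2 hvF
      · exact (mem_sdiff.1 (g4 h)).2 hvF
      · exact (mem_sdiff.1 (g5 h)).2 hvF
    refine ⟨(a, b) :: L, F' ∪ F, Sys.cons g1 h1 hd, by simp [h2], ?_, fun l => ?_⟩
    · rw [card_union_of_disjoint hd, g9, h3]
      ring
    · rw [hsum, mul_add, union_inter_distrib_right, add_comm]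
      have := wt_single_tile P g2 (g3.trans sdiff_subset) (g4.trans sdiff_subset)
        (g5.trans sdiff_subset) g6 g7 g8 l
      exact (card_union_le _ _).trans (Nat.add_le_add this (h4 l))

/-- The ordered pairs forming an edge with a given vertex. -/
noncomputable def lk {V : Type} [Fintype V] (T : V → V → V → Prop) (a : V) : Finset (V × V) :=
  {p | T a p.1 p.2}

theorem dual_infeasible {V : Type} [Fintype V] {T : V → V → V → Prop} (hT : IsTri T)
    {ν γ γ₁ ε θ : ℝ} (hV : 0 < Fintype.card V) (hγ₁ : 0 < γ₁) (hθ : 0 < θ) (hθ1 : θ ≤ 1 / 8)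
    (hε : 6 * ε ≤ γ₁ * θ) (hεν : 6 * ε ≤ ν)
    (hstab : ∀ (x : V → ℝ) (S : Finset (V × V)), (∀ v, 0 ≤ x v) → ∑ v, x v ≤ (Fintype.card V : ℝ) / 4 →
      (7 / 16 - γ - γ₁) * (Fintype.card V : ℝ) ^ 2 ≤ #S → (∀ p ∈ S, 1 ≤ x p.1 + x p.2) →
      (3 / 4 - ν) * Fintype.card V ≤ #{v | x v < 1 / 4})
    (hdeg : ∀ a, (7 / 16 - γ) * (Fintype.card V : ℝ) ^ 2 ≤ #(lk T a))
    (hex : ∀ B : Finset V, (3 / 4 - ν) * Fintype.card V ≤ #B →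
      ν * (Fintype.card V : ℝ) ^ 3 < boxCount T B B B)
    (Gp : V × V × V → Prop)
    (hGp : (#{p : V × V × V | T p.1 p.2.1 p.2.2 ∧ ¬ Gp p} : ℝ) ≤ 6 * ε * (Fintype.card V : ℝ) ^ 3)
    (w : V → ℝ) (hw : ∀ v, 0 ≤ w v) (hG : ∀ p, Gp p → 1 ≤ w p.1 + w p.2.1 + 2 * w p.2.2)
    (hsum : ∑ v, w v < (Fintype.card V : ℝ) / 4 - θ * Fintype.card V) : False := by
  set n : ℝ := (Fintype.card V : ℝ) with hn
  have hn0 : 0 < n := by rw [hn]; exact_mod_cast hV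
  obtain ⟨bd, hbd⟩ : ∃ bd : V → Finset (V × V), ∀ v, bd v =
    univ.filter fun p : V × V => T p.1 p.2 v ∧ ¬ Gp (p.1, p.2, v) := ⟨_, fun _ => rfl⟩
  obtain ⟨Bd, hBd⟩ : ∃ Bd : Finset V, Bd = univ.filter fun v => γ₁ * n ^ 2 < #(bd v) := ⟨_, rfl⟩
  have h1 : (#Bd : ℝ) ≤ θ * n := by
    have e1 : ∑ v, (#(bd v) : ℝ) = #{p : V × V × V | T p.1 p.2.1 p.2.2 ∧ ¬ Gp p} := by
      rw [← Nat.cast_sum, Nat.cast_inj, card_eq_sum_card_fiberwise (f := fun p => p.2.2)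
        (t := univ) (by simp)]
      refine sum_congr rfl fun v _ => ?_
      refine card_bij (fun p _ => (p.1, p.2, v)) ?_ ?_ ?_
      · intro p hp
        rw [hbd] at hp
        simpa using hp
      · rintro ⟨p1, p2⟩ _ ⟨q1, q2⟩ _ h
        simpa using h
      · rintro ⟨p1, p2, p3⟩ hp
        simp only [mem_filter, mem_univ, true_and] at hp
        obtain ⟨hp1, rfl⟩ := hp
        exact ⟨(p1, p2), by rw [hbd]; simpa using hp1, rfl⟩
    have e2 : γ₁ * n ^ 2 * #Bd ≤ ∑ v, (#(bd v) : ℝ) := by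
      calc _ = ∑ v ∈ Bd, γ₁ * n ^ 2 := by rw [sum_const, nsmul_eq_mul, mul_comm]
        _ ≤ ∑ v ∈ Bd, (#(bd v) : ℝ) := sum_le_sum fun v hv => by
            rw [hBd] at hv
            exact (mem_filter.1 hv).2.le
        _ ≤ _ := sum_le_univ_sum_of_nonneg fun v => by positivity
    rw [e1] at e2
    have e3 : γ₁ * n ^ 2 * #Bd ≤ γ₁ * n ^ 2 * (θ * n) := by
      refine (e2.trans hGp).trans ?_
      have : 6 * ε * n ^ 3 ≤ γ₁ * θ * n ^ 3 := by gcongr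
      linarith
    exact le_of_mul_le_mul_left e3 (by positivity)
  have hty : (univ \ Bd).Nonempty := by
    rw [← card_pos]
    by_contra h
    have e1 := card_sdiff_add_card_inter (univ : Finset V) Bd
    rw [univ_inter, card_univ] at e1
    have : (Fintype.card V : ℝ) = #Bd := by exact_mod_cast (by omega : Fintype.card V = #Bd)
    nlinarith
  obtain ⟨v₀, hv₀, hmin⟩ := exists_min_image (univ \ Bd) w hty
  set t := w v₀ with ht
  have ht0 : 0 ≤ t := hw v₀
  have hcT : (#(univ \ Bd) : ℝ) = n - #Bd := by
    have e1 := card_sdiff_add_card_inter (univ : Finset V) Bd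
    rw [univ_inter, card_univ] at e1
    have : (#(univ \ Bd) : ℝ) + #Bd = (Fintype.card V : ℝ) := by exact_mod_cast e1
    linarith
  have h2 : t * (n - #Bd) ≤ ∑ v, w v := by
    calc t * (n - #Bd) = ∑ v ∈ univ \ Bd, t := by rw [sum_const, nsmul_eq_mul, hcT, mul_comm]
      _ ≤ ∑ v ∈ univ \ Bd, w v := sum_le_sum fun v hv => hmin v hv
      _ ≤ _ := sum_le_univ_sum_of_nonneg hw
  have h3 : t < 1 / 4 := by
    by_contra hcon
    have : 1 / 4 * (n - #Bd) ≤ t * (n - #Bd) := by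
      refine mul_le_mul_of_nonneg_right (not_lt.1 hcon) ?_
      rw [← hcT]; positivity
    nlinarith
  have h4 : 0 < 1 - 4 * t := by linarith
  have hstab' := hstab (fun v => (max (w v) t - t) / (1 - 4 * t))
    ((lk T v₀).filter fun p => Gp (p.1, p.2, v₀))
    (fun v => div_nonneg (by linarith [le_max_right (w v) t]) h4.le) (by
      rw [← sum_div, div_le_iff₀ h4, sum_sub_distrib, sum_const, card_univ, nsmul_eq_mul]
      have e1 : ∑ v, max (w v) t ≤ ∑ v, (w v + if v ∈ Bd then t else 0) := by
        refine sum_le_sum fun v _ => ?_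
        split_ifs with h
        · exact max_le (by linarith) (by linarith [hw v])
        · rw [add_zero]
          exact max_le le_rfl (hmin v (by simp [h]))
      have e2 : ∑ v, (if v ∈ Bd then t else 0) = #Bd * t := by
        rw [← sum_filter, sum_const, nsmul_eq_mul]
        congr 2
        simp
      rw [sum_add_distrib, e2] at e1
      have e3 : (#Bd : ℝ) * t ≤ θ * n * (1 / 4) := by gcongr
      nlinarith [mul_pos hθ hn0]) (by
      have e1 := card_filter_add_card_filter_not (s := lk T v₀) fun p => Gp (p.1, p.2, v₀)
      have e2 : (#((lk T v₀).filter fun p => ¬ Gp (p.1, p.2, v₀)) : ℝ) ≤ γ₁ * n ^ 2 := by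
        have e3 : v₀ ∉ Bd := (mem_sdiff.1 hv₀).2
        have e4 : (#(bd v₀) : ℝ) ≤ γ₁ * n ^ 2 := by
          by_contra h
          exact e3 (by rw [hBd]; exact mem_filter.2 ⟨mem_univ _, not_le.1 h⟩)
        refine le_trans (Nat.cast_le.2 (card_le_card fun p hp => ?_)) e4
        rw [hbd]
        simp only [lk, mem_filter, mem_univ, true_and] at hp ⊢
        exact ⟨hT.swap₂₃ (hT.swap₁₂ hp.1), hp.2⟩
      have e5 : (#((lk T v₀).filter fun p => Gp (p.1, p.2, v₀)) : ℝ) +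
        #((lk T v₀).filter fun p => ¬ Gp (p.1, p.2, v₀)) = #(lk T v₀) := by exact_mod_cast e1
      have := hdeg v₀
      linarith) (fun p hp => by
      have e1 := hG _ (mem_filter.1 hp).2
      simp only [← ht] at e1
      rw [← add_div, le_div_iff₀ h4]
      linarith [le_max_left (w p.1) t, le_max_left (w p.2) t])
  have h5 := hex _ hstab'
  have h6 : (boxCount T (univ.filter fun v => (max (w v) t - t) / (1 - 4 * t) < 1 / 4)
      (univ.filter fun v => (max (w v) t - t) / (1 - 4 * t) < 1 / 4)
      (univ.filter fun v => (max (w v) t - t) / (1 - 4 * t) < 1 / 4) : ℝ) ≤ 6 * ε * n ^ 3 := by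
    refine le_trans (Nat.cast_le.2 (card_le_card fun p hp => ?_)) hGp
    simp only [mem_filter, mem_product, mem_univ, true_and] at hp ⊢
    refine ⟨hp.2, fun hg => ?_⟩
    have e0 : ∀ v, (max (w v) t - t) / (1 - 4 * t) < 1 / 4 → w v < 1 / 4 := by
      intro v hv
      rw [div_lt_iff₀ h4] at hv
      linarith [le_max_left (w v) t]
    have e1 := hG _ hg
    linarith [e0 _ hp.1.1, e0 _ hp.1.2.1, e0 _ hp.1.2.2]
  have h7 : 6 * ε * n ^ 3 ≤ ν * n ^ 3 := by gcongr
  linarith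

theorem sum_wt {κ : Type} [Fintype κ] (w : κ → ℝ) (c : κ × κ × κ) :
    ∑ l, w l * wt c l = w c.1 + w c.2.1 + 2 * w c.2.2 := by
  simp only [wt]
  push_cast
  simp only [mul_add, sum_add_distrib, mul_ite, mul_one, mul_zero, sum_ite_eq, mem_univ, if_true]
  ring

theorem sum_comp_cls {V κ : Type} [Fintype V] [Fintype κ] (P : V → κ) (w : κ → ℝ) :
    ∑ v, w (P v) = ∑ l, w l * #(cls P l) := by
  rw [← sum_fiberwise_of_maps_to (s := univ) (t := univ) (g := P) (by simp)]
  refine sum_congr rfl fun l _ => ?_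
  rw [cls, mul_comm, ← nsmul_eq_mul, ← sum_const]
  refine sum_congr rfl fun v hv => ?_
  rw [(mem_filter.1 hv).2]

/-- Integral rounding of a fractional tiling. -/
theorem exists_rounding {κ : Type} [Fintype κ] (G : κ × κ × κ → Prop) (s : κ → ℝ) {m : ℕ}
    (hm : 0 < m) {ε τ : ℝ} (hε : 0 < ε) (hε1 : ε ≤ 1) (φ : {c // G c} → ℝ) (h0 : ∀ c, 0 ≤ φ c)
    (hl : ∀ l, ∑ c, φ c * wt c.1 l ≤ s l) (hτ : ∑ c, φ c = τ) :
    ∃ N : κ × κ × κ → ℕ, (∀ c, N c ≠ 0 → G c) ∧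
      (∀ l, ((m * ∑ c, N c * wt c l : ℕ) : ℝ) ≤ (1 - ε) * s l) ∧
      ((∑ c, N c : ℕ) : ℝ) ≤ τ / m ∧
      (1 - ε) * τ / m - (Fintype.card κ : ℝ) ^ 3 ≤ ((∑ c, N c : ℕ) : ℝ) := by
  have hmr : (0 : ℝ) < m := by exact_mod_cast hm
  let N : κ × κ × κ → ℕ := fun c => if h : G c then ⌊(1 - ε) * φ ⟨c, h⟩ / m⌋₊ else 0
  have hN : ∀ f : κ × κ × κ → ℝ, ∑ c, (N c : ℝ) * f c =
      ∑ c : {c // G c}, (⌊(1 - ε) * φ c / m⌋₊ : ℝ) * f c.1 := by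
    intro f
    rw [← sum_filter_of_ne (p := G) fun c _ hc => ?_, sum_subtype (p := G) _ (by simp)]
    · exact sum_congr rfl fun c _ => by simp only [N, dif_pos c.2]
    · by_contra h
      exact hc (by simp only [N, dif_neg h, Nat.cast_zero, zero_mul])
  have hpos : ∀ c, 0 ≤ (1 - ε) * φ c / m := fun c =>
    div_nonneg (mul_nonneg (by linarith) (h0 c)) hmr.le
  have hfl : ∀ c, (⌊(1 - ε) * φ c / m⌋₊ : ℝ) ≤ (1 - ε) * φ c / m := fun c =>
    Nat.floor_le (hpos c)
  have hsum : ((∑ c, N c : ℕ) : ℝ) = ∑ c : {c // G c}, (⌊(1 - ε) * φ c / m⌋₊ : ℝ) := by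
    have := hN fun _ => 1
    simpa using this
  refine ⟨N, fun c hc => ?_, fun l => ?_, ?_, ?_⟩
  · by_contra h
    exact hc (by simp only [N, dif_neg h])
  · push_cast
    rw [hN]
    calc (m : ℝ) * ∑ c : {c // G c}, (⌊(1 - ε) * φ c / m⌋₊ : ℝ) * wt c.1 l ≤
        m * ∑ c : {c // G c}, ((1 - ε) * φ c / m) * wt c.1 l := by
          gcongr with c _
          exact hfl c
      _ = (1 - ε) * ∑ c, φ c * wt c.1 l := by
          rw [mul_sum, mul_sum]
          refine sum_congr rfl fun c _ => ?_
          field_simp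
      _ ≤ _ := mul_le_mul_of_nonneg_left (hl l) (by linarith)
  · rw [hsum, ← hτ, sum_div]
    refine sum_le_sum fun c _ => (hfl c).trans ?_
    gcongr
    nlinarith [h0 c]
  · have h1 : ∑ c : {c // G c}, ((1 - ε) * φ c / m - 1) ≤
        ∑ c : {c // G c}, (⌊(1 - ε) * φ c / m⌋₊ : ℝ) :=
      sum_le_sum fun c _ => by linarith [Nat.lt_floor_add_one ((1 - ε) * φ c / m)]
    rw [sum_sub_distrib, ← sum_div, ← mul_sum, hτ, sum_const, nsmul_eq_mul, mul_one] at h1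
    have h2 : Fintype.card {c // G c} ≤ Fintype.card κ ^ 3 := by
      refine (Fintype.card_subtype_le _).trans (le_of_eq ?_)
      rw [Fintype.card_prod, Fintype.card_prod]
      ring
    have h3 : (Fintype.card {c // G c} : ℝ) ≤ (Fintype.card κ : ℝ) ^ 3 := by exact_mod_cast h2
    rw [card_univ] at h1
    rw [hsum]
    linarith

/-- If the minimum degree is almost `7/16` and no set of about three quarters of the vertices is
sparse, then almost all vertices can be covered by few loose paths. -/
theorem exists_cover {ν : ℝ} (hν : 0 < ν) : ∃ γ : ℝ, 0 < γ ∧ ∀ θ : ℝ, 0 < θ → θ ≤ 1 → ∃ n₀ : ℕ,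
    ∀ (V : Type) [Fintype V] (T : V → V → V → Prop), IsTri T → n₀ ≤ Fintype.card V →
      (∀ a, (7 / 16 - γ) * (Fintype.card V : ℝ) ^ 2 ≤ #(lk T a)) →
      (∀ B : Finset V, (3 / 4 - ν) * Fintype.card V ≤ #B →
        ν * (Fintype.card V : ℝ) ^ 3 < boxCount T B B B) →
      ∃ L F, Sys T L F ∧ (L.length : ℝ) ≤ θ * Fintype.card V ∧
        (1 - θ) * Fintype.card V ≤ #F := by
  obtain ⟨γs, hγs, hstab⟩ := stability hν
  refine ⟨γs / 2, by positivity, fun θ hθ hθ1 => ?_⟩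
  obtain ⟨ε, hε, hε1, hε2, hε3⟩ : ∃ ε : ℝ, 0 < ε ∧ 6 * ε ≤ γs / 2 * (θ / 16) ∧ 6 * ε ≤ ν ∧
      ε ≤ θ / 4 := by
    refine ⟨min (γs / 2 * (θ / 16) / 6) (min (ν / 6) (θ / 4)), by positivity, ?_, ?_, ?_⟩
    · linarith [min_le_left (γs / 2 * (θ / 16) / 6) (min (ν / 6) (θ / 4))]
    · linarith [min_le_right (γs / 2 * (θ / 16) / 6) (min (ν / 6) (θ / 4)),
        min_le_left (ν / 6) (θ / 4)]
    · linarith [min_le_right (γs / 2 * (θ / 16) / 6) (min (ν / 6) (θ / 4)),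
        min_le_right (ν / 6) (θ / 4)]
  obtain ⟨M, hM, hreg⟩ := regularity hε (by linarith)
  obtain ⟨m, hm⟩ := exists_nat_gt (3 / θ)
  have hmr : (0 : ℝ) < m := lt_trans (by positivity) hm
  have hm0 : 0 < m := by exact_mod_cast hmr
  obtain ⟨n₁, hn₁⟩ := exists_packing hm0 (z := ε / M) hε (by positivity)
  obtain ⟨n₂, hn₂⟩ := exists_nat_gt (16 * m * M ^ 3 / θ)
  refine ⟨n₁ + n₂ + 1, fun V _ T hT hV hdeg hex => ?_⟩
  have hV0 : 0 < Fintype.card V := by omega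
  obtain ⟨κ, _, P, G, hκ, hGp, hb, hc⟩ := hreg V T hV0
  set n : ℝ := (Fintype.card V : ℝ) with hn
  have hn0 : 0 < n := by rw [hn]; exact_mod_cast hV0
  have hn2 : 16 * m * M ^ 3 ≤ θ * n := by
    rw [div_lt_iff₀ hθ] at hn₂
    have : (n₂ : ℝ) ≤ n := by rw [hn]; exact_mod_cast (by omega : n₂ ≤ Fintype.card V)
    nlinarith
  rcases lp_duality (fun (c : {c // G c}) l => (wt c.1 l : ℝ)) (fun l => (#(cls P l) : ℝ))
    (fun l => by positivity) (τ := n / 4 - θ / 16 * n) (by nlinarith) with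
    ⟨φ, h0, hl, hτ⟩ | ⟨w, h0, hw, hτ⟩
  · obtain ⟨N, hN1, hN2, hN3, hN4⟩ := exists_rounding G _ hm0 hε (by linarith) φ h0 hl hτ
    obtain ⟨L, F, h1, h2, h3, -⟩ := hn₁ V T hT (by omega) κ P G hb hc _ N rfl hN1 hN2
    refine ⟨L, F, h1, ?_, ?_⟩
    · rw [h2]
      refine hN3.trans ?_
      rw [div_le_iff₀ hmr]
      rw [div_lt_iff₀ hθ] at hm
      nlinarith
    · rw [h3]
      set k := ∑ c, N c with hk
      have e1 : ((4 * m - 3 : ℕ) : ℝ) = 4 * m - 3 := by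
        rw [Nat.cast_sub (by omega)]
        push_cast
        ring
      rw [Nat.cast_mul, e1]
      have e2 : (Fintype.card κ : ℝ) ^ 3 ≤ M ^ 3 := by gcongr
      have e3 : (1 - ε) * (n / 4 - θ / 16 * n) - m * M ^ 3 ≤ m * (k : ℝ) := by
        have : (1 - ε) * (n / 4 - θ / 16 * n) / m - M ^ 3 ≤ k := by linarith
        have e4 := mul_le_mul_of_nonneg_left this hmr.le
        rw [mul_sub, mul_div_cancel₀ _ hmr.ne'] at e4
        exact e4
      have e5 : 3 * (k : ℝ) ≤ θ * n / 4 := by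
        rw [div_lt_iff₀ hθ] at hm
        rw [le_div_iff₀ hmr] at hN3
        have e6 : 3 * (k : ℝ) ≤ θ * (k * m) := by nlinarith [(Nat.cast_nonneg k : (0 : ℝ) ≤ k)]
        nlinarith
      nlinarith [mul_pos hε hn0, mul_pos hθ hn0, mul_pos (mul_pos hε hθ) hn0]
  · exfalso
    refine dual_infeasible hT (γ := γs / 2) (γ₁ := γs / 2) (θ := θ / 16) hV0 (by positivity)
      (by positivity) (by linarith) hε1 hε2 (fun x S hx hxs hS hp => hstab V x S hV0 hx hxs
        (le_trans (by rw [show γs = γs / 2 + γs / 2 by ring]; rw [sub_sub]; ring_nf; rfl) hS) hp) hdeg hex (fun p => G (cell P p)) hGp (fun v => w (P v))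
      (fun v => h0 _) (fun p hp => ?_) ?_
    · have := hw ⟨_, hp⟩
      rw [sum_wt] at this
      exact this
    · rw [sum_comp_cls]
      exact hτ

theorem pathOn_seven {V : Type*} [DecidableEq V] {T : V → V → V → Prop} {a x c y d z b : V}
    (h₁ : T a x c) (h₂ : T c y d) (h₃ : T d z b) (hn : [a, x, c, y, d, z, b].Nodup) :
    PathOn T a b {a, x, c, y, d, z, b} :=
  ⟨[x, c, y, d, z, b], LPath.cons h₁ (LPath.cons h₂ (LPath.cons h₃ (LPath.nil _))), hn, by
    ext; simp⟩

/-- The list of ends of an absorber for a pair of vertices. -/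
def absEnds {V : Type} (ω : Fin 11 → V) : List (V × V) := [(ω 0, ω 4), (ω 7, ω 8), (ω 9, ω 10)]

/-- The vertices of the tuple support the initial paths of an absorber. -/
def AbsBase {V : Type} (T : V → V → V → Prop) (ω : Fin 11 → V) : Prop :=
  T (ω 0) (ω 1) (ω 2) ∧ T (ω 2) (ω 3) (ω 4) ∧ T (ω 7) (ω 5) (ω 8) ∧ T (ω 9) (ω 6) (ω 10)

/-- The tuple can absorb the pair `x, y`. -/
def AbsPair {V : Type} (T : V → V → V → Prop) (x y : V) (ω : Fin 11 → V) : Prop :=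
  AbsBase T ω ∧
  ((T (ω 0) x (ω 1) ∧ T (ω 1) y (ω 3) ∧ T (ω 3) (ω 2) (ω 4)) ∨
  (T (ω 0) (ω 5) (ω 1) ∧ T (ω 1) (ω 6) (ω 3) ∧ T (ω 3) (ω 2) (ω 4) ∧
    T (ω 7) x (ω 8) ∧ T (ω 9) y (ω 10)) ∨
  (T (ω 0) (ω 5) (ω 1) ∧ T (ω 1) (ω 6) (ω 2) ∧ T (ω 7) x (ω 8) ∧ T (ω 9) y (ω 10)))

theorem AbsBase.sys {V : Type} {T : V → V → V → Prop} {ω : Fin 11 → V} (h : AbsBase T ω)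
    (hω : Function.Injective ω) : Sys T (absEnds ω) (univ.image ω) := by
  obtain ⟨h1, h2, h3, h4⟩ := h
  have h5 : Sys (fun a b c => T (ω a) (ω b) (ω c)) [(0, 4), (7, 8), (9, 10)] univ := by
    have := Sys.cons (T := fun a b c => T (ω a) (ω b) (ω c)) (pathOn_five h1 h2 (by decide))
      (Sys.cons (pathOn_three h3 (by decide)) (Sys.singleton (pathOn_three h4 (by decide)))
      (by decide)) (by decide)
    exact (congrArg _ (by decide)).mp this
  have h6 := h5.map (T' := T) ⟨ω, hω⟩ fun _ _ _ h => h
  rw [map_eq_image] at h6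
  exact h6

theorem sys_thirteen {T : Fin 13 → Fin 13 → Fin 13 → Prop} {a x c y d z b p q : Fin 13}
    (h₁ : T a x c) (h₂ : T c y d) (h₃ : T d z b) (h₄ : T 9 p 10) (h₅ : T 11 q 12)
    (hn : [a, x, c, y, d, z, b].Nodup) (hp : [9, p, 10].Nodup) (hq : [11, q, 12].Nodup)
    (hd : Disjoint ({9, p, 10} : Finset (Fin 13)) {11, q, 12})
    (hd' : Disjoint ({a, x, c, y, d, z, b} : Finset (Fin 13)) ({9, p, 10} ∪ {11, q, 12}))
    (hu : ({a, x, c, y, d, z, b} : Finset (Fin 13)) ∪ ({9, p, 10} ∪ {11, q, 12}) = univ) :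
    Sys T [(a, b), (9, 10), (11, 12)] univ := by
  rw [← hu]
  refine Sys.cons ?_ (Sys.cons ?_ (Sys.singleton ?_) ?_) ?_
  · convert pathOn_seven h₁ h₂ h₃ hn
  · convert pathOn_three h₄ hp
  · convert pathOn_three h₅ hq
  · convert hd
  · convert hd'

theorem sys_of_absPair {V : Type} {T : V → V → V → Prop} {g : Fin 13 → V}
    (h : AbsPair T (g 0) (g 1) (fun i => g i.succ.succ)) :
    Sys (fun a b c => T (g a) (g b) (g c)) [(2, 6), (9, 10), (11, 12)] univ := by
  obtain ⟨⟨h1, h2, h3, h4⟩, h | h | h⟩ := h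
  · exact sys_thirteen (T := fun a b c => T (g a) (g b) (g c)) (a := 2) (x := 0) (c := 3)
      (y := 1) (d := 5) (z := 4) (b := 6) (p := 7) (q := 8) h.1 h.2.1 h.2.2 h3 h4
      (by decide) (by decide) (by decide) (by decide) (by decide) (by decide)
  · exact sys_thirteen (T := fun a b c => T (g a) (g b) (g c)) (a := 2) (x := 7) (c := 3)
      (y := 8) (d := 5) (z := 4) (b := 6) (p := 0) (q := 1) h.1 h.2.1 h.2.2.1 h.2.2.2.1 h.2.2.2.2
      (by decide) (by decide) (by decide) (by decide) (by decide) (by decide)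
  · exact sys_thirteen (T := fun a b c => T (g a) (g b) (g c)) (a := 2) (x := 7) (c := 3)
      (y := 8) (d := 4) (z := 5) (b := 6) (p := 0) (q := 1) h.1 h.2.1 h2 h.2.2.1 h.2.2.2
      (by decide) (by decide) (by decide) (by decide) (by decide) (by decide)

theorem AbsPair.sys {V : Type} {T : V → V → V → Prop} {x y : V} {ω : Fin 11 → V}
    (h : AbsPair T x y ω) (hω : Function.Injective ω) (hxy : x ≠ y) (hx : x ∉ univ.image ω)
    (hy : y ∉ univ.image ω) : Sys T (absEnds ω) (univ.image ω ∪ {x, y}) := by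
  obtain ⟨g, hg⟩ : ∃ g : Fin 13 → V, g = Fin.cons x (Fin.cons y ω) := ⟨_, rfl⟩
  have hinj : Function.Injective g := by
    rw [hg, Fin.cons_injective_iff, Fin.cons_injective_iff]
    simp only [mem_image, mem_univ, true_and] at hx hy
    refine ⟨?_, hy, hω⟩
    rw [Fin.range_cons]
    rintro (h | h)
    · exact hxy h
    · exact hx h
  obtain ⟨hg0, hg1, hgs⟩ : g 0 = x ∧ g 1 = y ∧ ∀ i : Fin 11, g i.succ.succ = ω i := by
    rw [hg]
    exact ⟨rfl, rfl, fun i => rfl⟩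
  clear hg
  have himg : (univ : Finset (Fin 13)).map ⟨g, hinj⟩ = univ.image ω ∪ {x, y} := by
    ext v
    rw [mem_map, mem_union, mem_image, mem_insert, mem_singleton]
    constructor
    · rintro ⟨a, -, rfl⟩
      refine Fin.cases (Or.inr (Or.inl hg0)) (fun a => ?_) a
      refine Fin.cases (Or.inr (Or.inr hg1)) (fun a => ?_) a
      exact Or.inl ⟨a, mem_univ _, (hgs a).symm⟩
    · rintro (⟨a, -, rfl⟩ | rfl | rfl)
      · exact ⟨a.succ.succ, mem_univ _, hgs a⟩
      · exact ⟨0, mem_univ _, hg0⟩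
      · exact ⟨1, mem_univ _, hg1⟩
  have h7 : Sys (fun a b c => T (g a) (g b) (g c)) [(2, 6), (9, 10), (11, 12)] univ := by
    refine sys_of_absPair ?_
    rw [hg0, hg1, funext hgs]
    exact h
  have h6 := h7.map (T' := T) ⟨g, hinj⟩ fun _ _ _ h => h
  rw [himg] at h6
  have h8 : absEnds ω = [(g 2, g 6), (g 9, g 10), (g 11, g 12)] := by
    rw [absEnds, ← hgs, ← hgs, ← hgs, ← hgs, ← hgs, ← hgs]
    rfl
  rw [h8]
  exact h6

/-- The list of ends of a two-level absorber for a pair of vertices. -/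
def absEnds' {V : Type} (ω : Fin 11 ⊕ Fin 6 → V) : List (V × V) :=
  absEnds (fun i => ω (Sum.inl i)) ++
    [(ω (Sum.inr 2), ω (Sum.inr 3)), (ω (Sum.inr 4), ω (Sum.inr 5))]

/-- The tuple supports the initial paths of a two-level absorber. -/
def AbsBase' {V : Type} (T : V → V → V → Prop) (ω : Fin 11 ⊕ Fin 6 → V) : Prop :=
  AbsBase T (fun i => ω (Sum.inl i)) ∧
    T (ω (Sum.inr 2)) (ω (Sum.inr 0)) (ω (Sum.inr 3)) ∧
    T (ω (Sum.inr 4)) (ω (Sum.inr 1)) (ω (Sum.inr 5))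

/-- The tuple can absorb the pair `x, y` in two steps: `x, y` replace two vertices which are
absorbed in turn. -/
def AbsPair' {V : Type} (T : V → V → V → Prop) (x y : V) (ω : Fin 11 ⊕ Fin 6 → V) : Prop :=
  AbsBase' T ω ∧ AbsPair T (ω (Sum.inr 0)) (ω (Sum.inr 1)) (fun i => ω (Sum.inl i)) ∧
    T (ω (Sum.inr 2)) x (ω (Sum.inr 3)) ∧ T (ω (Sum.inr 4)) y (ω (Sum.inr 5))

theorem Sys.congr {V : Type} {T : V → V → V → Prop} {L : List (V × V)} {F G : Finset V}
    (h : Sys T L F) (hG : ∀ v, v ∈ G ↔ v ∈ F) : Sys T L G := by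
  rwa [Finset.ext hG]

theorem sys_pair {V : Type} {T : V → V → V → Prop} {a x b c y d : V} (h : T a x b) (h' : T c y d)
    (hn : [a, x, b, c, y, d].Nodup) : Sys T [(a, b), (c, d)] ({a, x, b} ∪ {c, y, d}) := by
  simp only [List.nodup_cons, List.mem_cons, not_or, List.not_mem_nil, not_false_eq_true,
    List.nodup_nil, and_true] at hn
  refine Sys.cons (pathOn_three h ?_) (Sys.singleton (pathOn_three h' ?_)) ?_
  · simp; tauto
  · simp; tauto
  · rw [disjoint_left]
    intro v hv hv'
    simp only [mem_insert, mem_singleton] at hv hv'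
    rcases hv with rfl | rfl | rfl <;> tauto

theorem image_sum {V : Type} {α β : Type} [Fintype α] [Fintype β] (ω : α ⊕ β → V) :
    univ.image ω = univ.image (fun i => ω (Sum.inl i)) ∪ univ.image (fun i => ω (Sum.inr i)) := by
  ext v
  simp

theorem image_fin_six {V : Type} (g : Fin 6 → V) :
    univ.image g = {g 0, g 1, g 2, g 3, g 4, g 5} := by
  have : (univ : Finset (Fin 6)) = {0, 1, 2, 3, 4, 5} := by decide
  rw [this]
  simp only [image_insert, image_singleton]

theorem AbsBase'.sys {V : Type} {T : V → V → V → Prop} {ω : Fin 11 ⊕ Fin 6 → V}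
    (h : AbsBase' T ω) (hω : Function.Injective ω) : Sys T (absEnds' ω) (univ.image ω) := by
  have hr : Function.Injective fun i => ω (Sum.inr i) := hω.comp Sum.inr_injective
  have hn : ∀ i j : Fin 6, i ≠ j → ω (Sum.inr i) ≠ ω (Sum.inr j) := fun i j hij => hr.ne hij
  have h2 := sys_pair h.2.1 h.2.2 (by
    have : [2, 0, 3, 4, 1, 5].Nodup (α := Fin 6) := by decide
    exact this.map hr)
  have h1 := (h.1.sys (hω.comp Sum.inl_injective)).append h2 (by
    rw [disjoint_left]
    intro v hv hv'
    rw [mem_image] at hv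
    obtain ⟨i, -, rfl⟩ := hv
    simp only [mem_insert, mem_singleton, mem_union, hω.eq_iff] at hv'
    simp at hv')
  rw [image_sum, image_fin_six]
  refine h1.congr fun v => ?_
  simp only [mem_insert, mem_singleton, mem_union]
  generalize (v ∈ univ.image (fun i => ω (Sum.inl i))) = P
  generalize (v = ω (Sum.inr 0)) = P0, (v = ω (Sum.inr 1)) = P1, (v = ω (Sum.inr 2)) = P2,
    (v = ω (Sum.inr 3)) = P3, (v = ω (Sum.inr 4)) = P4, (v = ω (Sum.inr 5)) = P5
  clear * -
  tauto

theorem AbsPair'.sys {V : Type} {T : V → V → V → Prop} {x y : V} {ω : Fin 11 ⊕ Fin 6 → V}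
    (h : AbsPair' T x y ω) (hω : Function.Injective ω) (hxy : x ≠ y) (hx : x ∉ univ.image ω)
    (hy : y ∉ univ.image ω) : Sys T (absEnds' ω) (univ.image ω ∪ {x, y}) := by
  have hr : Function.Injective fun i => ω (Sum.inr i) := hω.comp Sum.inr_injective
  have hx' : ∀ i, ω i ≠ x := fun i hi => hx (mem_image.2 ⟨i, mem_univ _, hi⟩)
  have hy' : ∀ i, ω i ≠ y := fun i hi => hy (mem_image.2 ⟨i, mem_univ _, hi⟩)
  have h2 := sys_pair h.2.2.1 h.2.2.2 (by
    simp only [List.nodup_cons, List.mem_cons, not_or, List.not_mem_nil, not_false_eq_true,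
      List.nodup_nil, and_true, hω.eq_iff, hx', hy', Sum.inr.injEq, Ne.symm (hx' _),
      Ne.symm (hy' _), hxy]
    decide)
  have h1 := (h.2.1.sys (hω.comp Sum.inl_injective) (hr.ne (by decide)) (by simp [hω.eq_iff])
    (by simp [hω.eq_iff])).append h2 (by
    rw [disjoint_left]
    intro v hv hv'
    simp only [mem_insert, mem_singleton, mem_union, mem_image, mem_univ, true_and] at hv hv'
    rcases hv with ⟨i, rfl⟩ | rfl | rfl
    · simp only [hω.eq_iff, hx', hy'] at hv'
      simp at hv'
    · simp only [hω.eq_iff, hx', hy'] at hv'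
      revert hv'
      decide
    · simp only [hω.eq_iff, hx', hy'] at hv'
      revert hv'
      decide)
  rw [image_sum, image_fin_six]
  refine h1.congr fun v => ?_
  simp only [mem_insert, mem_singleton, mem_union]
  generalize (v ∈ univ.image (fun i => ω (Sum.inl i))) = P
  generalize (v = ω (Sum.inr 0)) = P0, (v = ω (Sum.inr 1)) = P1, (v = ω (Sum.inr 2)) = P2,
    (v = ω (Sum.inr 3)) = P3, (v = ω (Sum.inr 4)) = P4, (v = ω (Sum.inr 5)) = P5
  clear * -
  tauto

section Counts

variable {V : Type} [Fintype V] {T : V → V → V → Prop}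

theorem IsTri.rot (hT : IsTri T) {a b c : V} (h : T a b c) : T c a b := hT.swap₁₂ (hT.swap₂₃ h)

/-- The codegree of a pair. -/
noncomputable def cdeg (T : V → V → V → Prop) (p q : V) : ℕ := #{z | T p q z}

/-- The pairs of large codegree in the link of `x`. -/
noncomputable def gl (T : V → V → V → Prop) (κ : ℝ) (x : V) : Finset (V × V) :=
  {p | T x p.1 p.2 ∧ κ * (Fintype.card V : ℝ) ≤ cdeg T p.1 p.2}

/-- The pairs of large codegree in the common link of `x` and `z`. -/
noncomputable def sl (T : V → V → V → Prop) (κ : ℝ) (x z : V) : Finset (V × V) :=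
  {p | T x p.1 p.2 ∧ T z p.1 p.2 ∧ κ * (Fintype.card V : ℝ) ≤ cdeg T p.1 p.2}

/-- The vertices whose link has a large intersection with the link of `x`. -/
noncomputable def nb (T : V → V → V → Prop) (κ δ : ℝ) (x : V) : Finset V :=
  {z | δ * (Fintype.card V : ℝ) ^ 2 ≤ #(sl T κ x z)}

theorem sl_eq_inter (κ : ℝ) (x z : V) : sl T κ x z = gl T κ x ∩ gl T κ z := by
  ext p
  simp only [sl, gl, mem_filter, mem_univ, true_and, mem_inter]
  tauto

theorem sum_card_sl (hT : IsTri T) (κ : ℝ) (x : V) :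
    ∑ p ∈ gl T κ x, cdeg T p.1 p.2 = ∑ z, #(sl T κ x z) := by
  have h := sum_card_bipartiteAbove_eq_sum_card_bipartiteBelow (s := gl T κ x)
    (t := (univ : Finset V)) (fun p z => T p.1 p.2 z)
  have h1 : ∀ z, bipartiteBelow (fun (p : V × V) z => T p.1 p.2 z) (gl T κ x) z = sl T κ x z := by
    intro z
    ext p
    simp only [bipartiteBelow, gl, sl, mem_filter, mem_univ, true_and]
    constructor
    · rintro ⟨⟨h1, h2⟩, h3⟩
      exact ⟨h1, hT.rot h3, h2⟩
    · rintro ⟨h1, h2, h3⟩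
      exact ⟨⟨h1, h3⟩, hT.rot (hT.rot h2)⟩
  simp only [h1] at h
  exact h

theorem le_card_nb (hT : IsTri T) {κ α δ : ℝ} (hκ : 0 ≤ κ) (hδ : 0 ≤ δ) (x : V)
    (hV : 0 < Fintype.card V)
    (h : α * (Fintype.card V : ℝ) ^ 2 ≤ #(gl T κ x)) :
    (α * κ - δ) * (Fintype.card V : ℝ) ≤ #(nb T κ δ x) := by
  set n : ℝ := (Fintype.card V : ℝ) with hn
  have hn0 : 0 < n := by rw [hn]; exact_mod_cast hV
  have h1 : (#(gl T κ x) : ℝ) * (κ * n) ≤ ∑ p ∈ gl T κ x, (cdeg T p.1 p.2 : ℝ) := by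
    rw [← nsmul_eq_mul]
    refine card_nsmul_le_sum _ _ _ fun p hp => ?_
    exact (mem_filter.1 hp).2.2
  have h2 : ∑ p ∈ gl T κ x, (cdeg T p.1 p.2 : ℝ) = ∑ z, (#(sl T κ x z) : ℝ) := by
    exact_mod_cast sum_card_sl hT κ x
  have h3 : ∀ z, (#(sl T κ x z) : ℝ) ≤ (if z ∈ nb T κ δ x then n ^ 2 else 0) + δ * n ^ 2 := by
    intro z
    split_ifs with hz
    · have : (#(sl T κ x z) : ℝ) ≤ n ^ 2 := by
        have := card_le_univ (sl T κ x z)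
        rw [Fintype.card_prod] at this
        rw [hn, sq]
        exact_mod_cast this
      nlinarith [sq_nonneg n]
    · have : ¬ δ * n ^ 2 ≤ #(sl T κ x z) := fun h => hz (mem_filter.2 ⟨mem_univ _, h⟩)
      linarith
  have h4 : ∑ z, (#(sl T κ x z) : ℝ) ≤ #(nb T κ δ x) * n ^ 2 + n * (δ * n ^ 2) := by
    refine (sum_le_sum fun z _ => h3 z).trans ?_
    rw [sum_add_distrib, ← sum_filter, sum_const, sum_const, nsmul_eq_mul, nsmul_eq_mul,
      filter_mem_eq_inter, univ_inter, card_univ]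
  have h5 : α * n ^ 2 * (κ * n) ≤ #(nb T κ δ x) * n ^ 2 + n * (δ * n ^ 2) :=
    (mul_le_mul_of_nonneg_right h (by positivity)).trans (h1.trans (h2.le.trans h4))
  have h6 : n ^ 2 * ((α * κ - δ) * n) ≤ n ^ 2 * #(nb T κ δ x) := by nlinarith
  exact le_of_mul_le_mul_left h6 (by positivity)

theorem mem_nb_of_not {κ α δ : ℝ} (h : 1 < 3 * α - 3 * δ) {x y z : V} (hV : 0 < Fintype.card V)
    (hx : α * (Fintype.card V : ℝ) ^ 2 ≤ #(gl T κ x))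
    (hy : α * (Fintype.card V : ℝ) ^ 2 ≤ #(gl T κ y))
    (hz : α * (Fintype.card V : ℝ) ^ 2 ≤ #(gl T κ z)) (hxy : y ∉ nb T κ δ x) :
    z ∈ nb T κ δ x ∨ z ∈ nb T κ δ y := by
  by_contra hc
  rw [not_or] at hc
  simp only [nb, mem_filter, mem_univ, true_and, not_le] at hc hxy
  set n : ℝ := (Fintype.card V : ℝ) with hn
  have hn0 : 0 < n := by rw [hn]; exact_mod_cast hV
  rw [sl_eq_inter, sl_eq_inter] at hc
  rw [sl_eq_inter] at hxy
  have h1 := card_union_add_card_inter (gl T κ x) (gl T κ y)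
  have h2 := card_union_add_card_inter (gl T κ x ∪ gl T κ y) (gl T κ z)
  have h3 : #((gl T κ x ∪ gl T κ y) ∩ gl T κ z) ≤ #(gl T κ x ∩ gl T κ z) + #(gl T κ y ∩ gl T κ z) := by
    rw [union_inter_distrib_right]
    exact card_union_le _ _
  have h4 := card_le_univ (gl T κ x ∪ gl T κ y ∪ gl T κ z)
  rw [Fintype.card_prod] at h4
  have h4' : (#(gl T κ x ∪ gl T κ y ∪ gl T κ z) : ℝ) ≤ n ^ 2 := by
    rw [hn, sq]; exact_mod_cast h4
  have h1' : (#(gl T κ x ∪ gl T κ y) : ℝ) + #(gl T κ x ∩ gl T κ y) = #(gl T κ x) + #(gl T κ y) := by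
    exact_mod_cast h1
  have h2' : (#(gl T κ x ∪ gl T κ y ∪ gl T κ z) : ℝ) + #((gl T κ x ∪ gl T κ y) ∩ gl T κ z)
    = #(gl T κ x ∪ gl T κ y) + #(gl T κ z) := by exact_mod_cast h2
  have h3' : (#((gl T κ x ∪ gl T κ y) ∩ gl T κ z) : ℝ)
    ≤ #(gl T κ x ∩ gl T κ z) + #(gl T κ y ∩ gl T κ z) := by exact_mod_cast h3
  have : n ^ 2 < (3 * α - 3 * δ) * n ^ 2 := by
    have := mul_lt_mul_of_pos_right h (by positivity : 0 < n ^ 2)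
    linarith
  linarith

/-- Few vertices have many pairs of small codegree in their links. -/
theorem card_bad_le (hT : IsTri T) {κ ε : ℝ} (hκ : 0 ≤ κ) (hε : 0 < ε) (hV : 0 < Fintype.card V)
    (B : Finset V)
    (hB : ∀ x ∈ B, (#(gl T κ x) : ℝ) + ε * (Fintype.card V : ℝ) ^ 2 ≤ #(lk T x)) :
    (#B : ℝ) ≤ κ / ε * (Fintype.card V : ℝ) := by
  set n : ℝ := (Fintype.card V : ℝ) with hn
  have hn0 : 0 < n := by rw [hn]; exact_mod_cast hV
  set P : Finset (V × V) := {p | ¬ κ * n ≤ cdeg T p.1 p.2} with hP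
  have h := sum_card_bipartiteAbove_eq_sum_card_bipartiteBelow (s := B) (t := P)
    (fun x p => T x p.1 p.2)
  have h1 : ∀ x ∈ B, ε * n ^ 2 ≤ (#(bipartiteAbove (fun x (p : V × V) => T x p.1 p.2) P x) : ℝ) := by
    intro x hx
    have h1 : lk T x = gl T κ x ∪ bipartiteAbove (fun x (p : V × V) => T x p.1 p.2) P x := by
      ext p
      simp only [lk, gl, bipartiteAbove, hP, mem_filter, mem_univ, true_and, mem_union]
      tauto
    have h2 := hB x hx
    rw [h1] at h2
    have h3 := card_union_le (gl T κ x) (bipartiteAbove (fun x (p : V × V) => T x p.1 p.2) P x)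
    have h3' : (#(gl T κ x ∪ bipartiteAbove (fun x (p : V × V) => T x p.1 p.2) P x) : ℝ) ≤
      #(gl T κ x) + #(bipartiteAbove (fun x (p : V × V) => T x p.1 p.2) P x) := by exact_mod_cast h3
    linarith
  have h2 : ∀ p ∈ P, (#(bipartiteBelow (fun x (p : V × V) => T x p.1 p.2) B p) : ℝ) ≤ κ * n := by
    intro p hp
    have h3 : bipartiteBelow (fun x (p : V × V) => T x p.1 p.2) B p ⊆ ({z | T p.1 p.2 z} : Finset V) := by
      intro z hz
      exact mem_filter.2 ⟨mem_univ _, hT.rot (hT.rot (mem_filter.1 hz).2)⟩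
    have h4 : #(bipartiteBelow (fun x (p : V × V) => T x p.1 p.2) B p) ≤ cdeg T p.1 p.2 :=
      card_le_card h3
    have h5 := (mem_filter.1 hp).2
    have h6 : (#(bipartiteBelow (fun x (p : V × V) => T x p.1 p.2) B p) : ℝ) ≤ cdeg T p.1 p.2 := by
      exact_mod_cast h4
    linarith
  have h3 := card_nsmul_le_sum B _ _ h1
  have h4 := sum_le_card_nsmul P _ _ h2
  have h5 : (#P : ℝ) ≤ n ^ 2 := by
    have := card_le_univ P
    rw [Fintype.card_prod] at this
    rw [hn, sq]
    exact_mod_cast this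
  rw [nsmul_eq_mul] at h3 h4
  have h6 : (#B : ℝ) * (ε * n ^ 2) ≤ n ^ 2 * (κ * n) := by
    refine h3.trans (le_trans (le_of_eq ?_) (h4.trans (mul_le_mul_of_nonneg_right h5 (by positivity))))
    exact_mod_cast h
  rw [div_mul_eq_mul_div, le_div_iff₀ hε]
  have h7 : n ^ 2 * (#B * ε) ≤ n ^ 2 * (κ * n) := by linarith
  exact le_of_mul_le_mul_left h7 (by positivity)

/-- The vertices forming a pair of large codegree with `x`. -/
noncomputable def gn (T : V → V → V → Prop) (κ : ℝ) (x : V) : Finset V :=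
  {q | κ * (Fintype.card V : ℝ) ≤ cdeg T x q}

theorem le_card_gn (hT : IsTri T) {κ α : ℝ} (hκ : 0 ≤ κ) (hV : 0 < Fintype.card V) (x : V)
    (h : α * (Fintype.card V : ℝ) ^ 2 ≤ #(lk T x)) :
    (α - 2 * κ) * (Fintype.card V : ℝ) ^ 2 ≤ (#(gn T κ x) : ℝ) ^ 2 := by
  set n : ℝ := (Fintype.card V : ℝ) with hn
  have hn0 : 0 < n := by rw [hn]; exact_mod_cast hV
  set D := gn T κ x with hD
  have h1 : lk T x ⊆ (D ×ˢ D) ∪ (({p ∈ lk T x | p.1 ∉ D}) ∪ ({p ∈ lk T x | p.2 ∉ D})) := by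
    intro p hp
    simp only [mem_union, mem_product, mem_filter, hp, true_and]
    tauto
  have h2 : (#{p ∈ lk T x | p.1 ∉ D} : ℝ) ≤ n * (κ * n) := by
    have h3 : #{p ∈ lk T x | p.1 ∉ D} = ∑ q ∈ univ.filter (· ∉ D), #{p ∈ {p ∈ lk T x | p.1 ∉ D} | p.1 = q} := by
      refine card_eq_sum_card_fiberwise fun p hp => ?_
      rw [mem_coe, mem_filter] at hp
      exact mem_coe.2 (mem_filter.2 ⟨mem_univ _, hp.2⟩)
    have h4 : ∀ q ∈ univ.filter (· ∉ D), (#{p ∈ {p ∈ lk T x | p.1 ∉ D} | p.1 = q} : ℝ) ≤ κ * n := by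
      intro q hq
      have hq' : ¬ κ * n ≤ cdeg T x q := fun h => (mem_filter.1 hq).2 (mem_filter.2 ⟨mem_univ _, h⟩)
      have : #{p ∈ {p ∈ lk T x | p.1 ∉ D} | p.1 = q} ≤ cdeg T x q := by
        refine card_le_card_of_injOn Prod.snd ?_ ?_
        · rintro ⟨a, b⟩ hp
          simp only [lk, mem_coe, mem_filter, mem_univ, true_and] at hp ⊢
          obtain ⟨⟨hp, -⟩, rfl⟩ := hp
          exact hp
        · rintro ⟨a, b⟩ hp ⟨c, d⟩ hp' h
          simp only [mem_coe, mem_filter] at hp hp'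
          obtain ⟨-, rfl⟩ := hp
          obtain ⟨-, rfl⟩ := hp'
          exact Prod.ext rfl h
      have : (#{p ∈ {p ∈ lk T x | p.1 ∉ D} | p.1 = q} : ℝ) ≤ cdeg T x q := by exact_mod_cast this
      linarith
    rw [h3, Nat.cast_sum]
    refine (sum_le_card_nsmul _ _ _ h4).trans ?_
    rw [nsmul_eq_mul]
    refine mul_le_mul_of_nonneg_right ?_ (by positivity)
    rw [hn]
    exact_mod_cast card_le_univ _
  have h3 : #{p ∈ lk T x | p.2 ∉ D} = #{p ∈ lk T x | p.1 ∉ D} := by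
    refine card_nbij' Prod.swap Prod.swap ?_ ?_ (fun _ _ => Prod.swap_swap _)
      (fun _ _ => Prod.swap_swap _)
    · intro p hp
      simp only [lk, coe_filter, mem_filter, mem_univ, true_and, Set.mem_ofPred_eq] at hp ⊢
      exact ⟨hT.swap₂₃ hp.1, hp.2⟩
    · intro p hp
      simp only [lk, coe_filter, mem_filter, mem_univ, true_and, Set.mem_ofPred_eq] at hp ⊢
      exact ⟨hT.swap₂₃ hp.1, hp.2⟩
  have h4 := (card_le_card h1).trans ((card_union_le _ _).trans
    (Nat.add_le_add_left (card_union_le _ _) _))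
  rw [h3, card_product] at h4
  have h4' : (#(lk T x) : ℝ) ≤ #D * #D + (#{p ∈ lk T x | p.1 ∉ D} + #{p ∈ lk T x | p.1 ∉ D}) := by
    exact_mod_cast h4
  nlinarith

end Counts

section Counts

variable {V : Type} [Fintype V] {T : V → V → V → Prop}

theorem le_card_gl (hT : IsTri T) {κ α β : ℝ} (x : V)
    (hβ : ∀ p, β * (Fintype.card V : ℝ) ≤ #(gn T κ p))
    (h : α * (Fintype.card V : ℝ) ^ 2 ≤ #(lk T x)) :
    (α + β - 1) * (Fintype.card V : ℝ) ^ 2 ≤ #(gl T κ x) := by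
  set n : ℝ := (Fintype.card V : ℝ) with hn
  set G : Finset (V × V) := {p | κ * n ≤ cdeg T p.1 p.2} with hG
  have h1 : gl T κ x = lk T x ∩ G := by
    ext p
    simp only [gl, lk, hG, mem_filter, mem_univ, true_and, mem_inter]
    rfl
  have h2 : #G = ∑ p, #(gn T κ p) := by
    have : #G = ∑ q, #({p ∈ G | p.1 = q}) :=
      card_eq_sum_card_fiberwise fun p _ => mem_coe.2 (mem_univ _)
    rw [this]
    refine sum_congr rfl fun q _ => (card_bij (fun z _ => (q, z)) ?_ ?_ ?_).symm
    · intro z hz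
      simpa [hG, gn] using hz
    · intro a _ b _ h
      exact (Prod.mk.inj h).2
    · rintro ⟨a, b⟩ h
      simp only [hG, mem_filter, mem_univ, true_and] at h
      obtain ⟨h, rfl⟩ := h
      exact ⟨b, by simpa [gn] using h, rfl⟩
  have h3 : β * n ^ 2 ≤ #G := by
    rw [h2, Nat.cast_sum]
    have := card_nsmul_le_sum univ (fun p => (#(gn T κ p) : ℝ)) _ fun p _ => hβ p
    rw [nsmul_eq_mul, card_univ, ← hn] at this
    linarith
  have h4 := card_union_add_card_inter (lk T x) G
  have h5 := card_le_univ (lk T x ∪ G)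
  rw [Fintype.card_prod] at h5
  have h5' : (#(lk T x ∪ G) : ℝ) ≤ n ^ 2 := by rw [hn, sq]; exact_mod_cast h5
  have h4' : (#(lk T x ∪ G) : ℝ) + #(lk T x ∩ G) = #(lk T x) + #G := by exact_mod_cast h4
  rw [h1]
  linarith

theorem card_extend {σ ι : Type} [Fintype ι] {δ c : ℝ} (hδ : 0 ≤ δ) (hc : 0 ≤ c) (S : Finset σ)
    (hS : c ≤ #S) (L M : σ → Finset (V × V))
    (hL : ∀ s ∈ S, δ ≤ #(L s)) (hM : ∀ s ∈ S, δ ≤ #(M s))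
    (enc : σ → V × V → V × V → ι → V)
    (henc : ∀ s p q s' p' q', enc s p q = enc s' p' q' → s = s' ∧ p = p' ∧ q = q')
    (𝒜 : Finset (ι → V)) (h𝒜 : ∀ s ∈ S, ∀ p ∈ L s, ∀ q ∈ M s, enc s p q ∈ 𝒜) :
    c * δ ^ 2 ≤ #𝒜 := by
  have h1 : #(S.sigma fun s => L s ×ˢ M s) ≤ #𝒜 := by
    refine card_le_card_of_injOn (fun t => enc t.1 t.2.1 t.2.2) ?_ ?_
    · rintro ⟨s, p, q⟩ h
      rw [mem_coe, mem_sigma, mem_product] at h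
      exact h𝒜 s h.1 p h.2.1 q h.2.2
    · rintro ⟨s, p, q⟩ _ ⟨s', p', q'⟩ _ h
      obtain ⟨rfl, rfl, rfl⟩ := henc _ _ _ _ _ _ h
      rfl
  have h2 : (#(S.sigma fun s => L s ×ˢ M s) : ℝ) = ∑ s ∈ S, (#(L s) : ℝ) * #(M s) := by
    rw [card_sigma]
    push_cast [card_product]
    rfl
  have h3 : (#S : ℝ) * δ ^ 2 ≤ ∑ s ∈ S, (#(L s) : ℝ) * #(M s) := by
    rw [← nsmul_eq_mul]
    refine card_nsmul_le_sum _ _ _ fun s hs => ?_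
    rw [sq]
    exact mul_le_mul (hL s hs) (hM s hs) hδ (by positivity)
  have h4 : (#(S.sigma fun s => L s ×ˢ M s) : ℝ) ≤ #𝒜 := by exact_mod_cast h1
  have h5 : c * δ ^ 2 ≤ #S * δ ^ 2 := mul_le_mul_of_nonneg_right hS (by positivity)
  linarith

/-- Assembling a tuple of eleven vertices from tuples indexed by the classes `2, 2, 3`. -/
def enc₂₂₃ (s : (Fin 2 → V) × (Fin 2 → V) × (Fin 3 → V)) (p q : V × V) : Fin 11 → V :=
  ![s.1 0, s.2.1 0, s.2.2 0, s.1 1, s.2.1 1, s.2.2 1, s.2.2 2, p.1, p.2, q.1, q.2]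

/-- Assembling a tuple of eleven vertices from tuples indexed by the classes `3, 2, 2`. -/
def enc₃₂₂ (s : (Fin 3 → V) × (Fin 2 → V) × (Fin 2 → V)) (p q : V × V) : Fin 11 → V :=
  ![s.1 0, s.2.1 0, s.2.2 0, s.1 1, s.2.1 1, s.2.2 1, s.1 2, p.1, p.2, q.1, q.2]

theorem enc₂₂₃_inj (s p q s' p' q') (h : enc₂₂₃ (V := V) s p q = enc₂₂₃ s' p' q') :
    s = s' ∧ p = p' ∧ q = q' := by
  obtain ⟨s1, s2, s3⟩ := s
  obtain ⟨t1, t2, t3⟩ := s'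
  obtain ⟨p1, p2⟩ := p
  obtain ⟨q1, q2⟩ := q
  obtain ⟨p1', p2'⟩ := p'
  obtain ⟨q1', q2'⟩ := q'
  have h' := fun i => congrFun h i
  have e0 : s1 0 = t1 0 := h' 0
  have e1 : s2 0 = t2 0 := h' 1
  have e2 : s3 0 = t3 0 := h' 2
  have e3 : s1 1 = t1 1 := h' 3
  have e4 : s2 1 = t2 1 := h' 4
  have e5 : s3 1 = t3 1 := h' 5
  have e6 : s3 2 = t3 2 := h' 6
  have e7 : p1 = p1' := h' 7
  have e8 : p2 = p2' := h' 8
  have e9 : q1 = q1' := h' 9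
  have e10 : q2 = q2' := h' 10
  have f1 : s1 = t1 := funext (Fin.forall_fin_two.2 ⟨e0, e3⟩)
  have f2 : s2 = t2 := funext (Fin.forall_fin_two.2 ⟨e1, e4⟩)
  have f3 : s3 = t3 := by
    funext i
    fin_cases i
    exacts [e2, e5, e6]
  subst f1 f2 f3 e7 e8 e9 e10
  exact ⟨rfl, rfl, rfl⟩

theorem enc₃₂₂_inj (s p q s' p' q') (h : enc₃₂₂ (V := V) s p q = enc₃₂₂ s' p' q') :
    s = s' ∧ p = p' ∧ q = q' := by
  obtain ⟨s1, s2, s3⟩ := s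
  obtain ⟨t1, t2, t3⟩ := s'
  obtain ⟨p1, p2⟩ := p
  obtain ⟨q1, q2⟩ := q
  obtain ⟨p1', p2'⟩ := p'
  obtain ⟨q1', q2'⟩ := q'
  have h' := fun i => congrFun h i
  have e0 : s1 0 = t1 0 := h' 0
  have e1 : s2 0 = t2 0 := h' 1
  have e2 : s3 0 = t3 0 := h' 2
  have e3 : s1 1 = t1 1 := h' 3
  have e4 : s2 1 = t2 1 := h' 4
  have e5 : s3 1 = t3 1 := h' 5
  have e6 : s1 2 = t1 2 := h' 6
  have e7 : p1 = p1' := h' 7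
  have e8 : p2 = p2' := h' 8
  have e9 : q1 = q1' := h' 9
  have e10 : q2 = q2' := h' 10
  have f3 : s3 = t3 := funext (Fin.forall_fin_two.2 ⟨e2, e5⟩)
  have f2 : s2 = t2 := funext (Fin.forall_fin_two.2 ⟨e1, e4⟩)
  have f1 : s1 = t1 := by
    funext i
    fin_cases i
    exacts [e0, e3, e6]
  subst f1 f2 f3 e7 e8 e9 e10
  exact ⟨rfl, rfl, rfl⟩

/-- The tuples that can absorb the pair `x, y`. -/
noncomputable def absSet (T : V → V → V → Prop) (x y : V) : Finset (Fin 11 → V) :=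
  {ω | AbsPair T x y ω}

theorem card_absSet_of_adj (hT : IsTri T) {d δ : ℝ} (hd : 0 ≤ d) (hδ : 0 ≤ δ) (x y : V)
    (hlk : ∀ z, δ * (Fintype.card V : ℝ) ^ 2 ≤ #(lk T z))
    (h : d * (Fintype.card V : ℝ) ^ 3 ≤ #({p : V × V × V | T p.1 p.2.1 p.2.2 ∧
      T x p.1 p.2.1 ∧ T y p.1 p.2.1})) :
    d ^ 12 * (Fintype.card V : ℝ) ^ 7 * (δ * (Fintype.card V : ℝ) ^ 2) ^ 2 ≤ #(absSet T x y) := by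
  have h1 := box_triple (ι₁ := Fin 2) (ι₂ := Fin 2) (ι₃ := Fin 3)
    (fun p q l => T p q l ∧ T x p q ∧ T y p q) hd (le_trans h (le_of_eq (by congr!)))
  simp only [Fintype.card_fin] at h1
  refine card_extend (by positivity) (by positivity) _ h1 (fun s => lk T (s.2.2 1))
    (fun s => lk T (s.2.2 2)) (fun s _ => hlk _) (fun s _ => hlk _) enc₂₂₃ enc₂₂₃_inj _ ?_
  rintro ⟨f, g, k⟩ hs ⟨p1, p2⟩ hp ⟨q1, q2⟩ hq
  have hs' : ∀ i j l, T (f i) (g j) (k l) ∧ T x (f i) (g j) ∧ T y (f i) (g j) := by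
    simpa only [mem_filter, mem_univ, true_and] using hs
  simp only [lk, mem_filter, mem_univ, true_and] at hp hq
  refine mem_filter.2 ⟨mem_univ _, ⟨?_, ?_, ?_, ?_⟩, Or.inl ⟨?_, ?_, ?_⟩⟩
  · exact (hs' 0 0 0).1
  · exact hT.rot (hs' 1 1 0).1
  · exact hT.swap₁₂ hp
  · exact hT.swap₁₂ hq
  · exact hT.swap₁₂ (hs' 0 0 0).2.1
  · exact hT.rot (hs' 1 0 0).2.2
  · exact hT.swap₂₃ (hs' 1 1 0).1

theorem card_absSet_of_inter (hT : IsTri T) {d δ κ : ℝ} (hd : 0 ≤ d) (hδ : 0 ≤ δ) (x y : V)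
    (h : d * (Fintype.card V : ℝ) ^ 3 ≤ #({p : V × V × V | T p.1 p.2.1 p.2.2 ∧
      p.2.2 ∈ nb T κ δ x ∧ p.2.2 ∈ nb T κ δ y})) :
    d ^ 12 * (Fintype.card V : ℝ) ^ 7 * (δ * (Fintype.card V : ℝ) ^ 2) ^ 2 ≤ #(absSet T x y) := by
  have h1 := box_triple (ι₁ := Fin 2) (ι₂ := Fin 2) (ι₃ := Fin 3)
    (fun p q l => T p q l ∧ l ∈ nb T κ δ x ∧ l ∈ nb T κ δ y) hd
    (le_trans h (le_of_eq (by congr!)))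
  simp only [Fintype.card_fin] at h1
  refine card_extend (by positivity) (by positivity) _ h1 (fun s => sl T κ x (s.2.2 1))
    (fun s => sl T κ y (s.2.2 2)) ?_ ?_ enc₂₂₃ enc₂₂₃_inj _ ?_
  · rintro ⟨f, g, k⟩ hs
    simp only [mem_filter, mem_univ, true_and] at hs
    exact (mem_filter.1 (hs 0 0 1).2.1).2
  · rintro ⟨f, g, k⟩ hs
    simp only [mem_filter, mem_univ, true_and] at hs
    exact (mem_filter.1 (hs 0 0 2).2.2).2
  rintro ⟨f, g, k⟩ hs ⟨p1, p2⟩ hp ⟨q1, q2⟩ hq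
  simp only [mem_filter, mem_univ, true_and] at hs
  simp only [sl, mem_filter, mem_univ, true_and] at hp hq
  refine mem_filter.2 ⟨mem_univ _, ⟨?_, ?_, ?_, ?_⟩, Or.inr (Or.inl ⟨?_, ?_, ?_, ?_, ?_⟩)⟩
  · exact (hs 0 0 0).1
  · exact hT.rot (hs 1 1 0).1
  · exact hT.swap₁₂ hp.2.1
  · exact hT.swap₁₂ hq.2.1
  · exact hT.swap₂₃ (hs 0 0 1).1
  · exact hT.rot (hT.rot (hs 1 0 2).1)
  · exact hT.swap₂₃ (hs 1 1 0).1
  · exact hT.swap₁₂ hp.1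
  · exact hT.swap₁₂ hq.1

theorem card_absSet_of_triples (hT : IsTri T) {d δ κ : ℝ} (hd : 0 ≤ d) (hδ : 0 ≤ δ) (x y : V)
    (h : d * (Fintype.card V : ℝ) ^ 3 ≤ #({p : V × V × V | T p.1 p.2.1 p.2.2 ∧
      p.1 ∈ nb T κ δ y ∧ p.2.2 ∈ nb T κ δ x})) :
    d ^ 12 * (Fintype.card V : ℝ) ^ 7 * (δ * (Fintype.card V : ℝ) ^ 2) ^ 2 ≤ #(absSet T x y) := by
  have h1 := box_triple (ι₁ := Fin 3) (ι₂ := Fin 2) (ι₃ := Fin 2)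
    (fun p q l => T p q l ∧ p ∈ nb T κ δ y ∧ l ∈ nb T κ δ x) hd
    (le_trans h (le_of_eq (by congr!)))
  simp only [Fintype.card_fin] at h1
  refine card_extend (by positivity) (by positivity) _ h1 (fun s => sl T κ x (s.2.2 1))
    (fun s => sl T κ y (s.1 2)) ?_ ?_ enc₃₂₂ enc₃₂₂_inj _ ?_
  · rintro ⟨f, g, k⟩ hs
    simp only [mem_filter, mem_univ, true_and] at hs
    exact (mem_filter.1 (hs 0 0 1).2.2).2
  · rintro ⟨f, g, k⟩ hs
    simp only [mem_filter, mem_univ, true_and] at hs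
    exact (mem_filter.1 (hs 2 0 0).2.1).2
  rintro ⟨f, g, k⟩ hs ⟨p1, p2⟩ hp ⟨q1, q2⟩ hq
  simp only [mem_filter, mem_univ, true_and] at hs
  simp only [sl, mem_filter, mem_univ, true_and] at hp hq
  refine mem_filter.2 ⟨mem_univ _, ⟨?_, ?_, ?_, ?_⟩, Or.inr (Or.inr ⟨?_, ?_, ?_, ?_⟩)⟩
  · exact (hs 0 0 0).1
  · exact hT.rot (hs 1 1 0).1
  · exact hT.swap₁₂ hp.2.1
  · exact hT.swap₁₂ hq.2.1
  · exact hT.swap₂₃ (hs 0 0 1).1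
  · exact hT.swap₁₂ (hs 2 0 0).1
  · exact hT.swap₁₂ hp.1
  · exact hT.swap₁₂ hq.1

end Counts

section Counts

variable {V : Type} [Fintype V] {T : V → V → V → Prop}

theorem sq_card_ge_of_few (hT : IsTri T) {α d γ ρ : ℝ} (hd : 0 ≤ d) (hγ : 0 < γ) (hρ : 0 ≤ ρ)
    (hV : 0 < Fintype.card V)
    (hlk : ∀ a, α * (Fintype.card V : ℝ) ^ 2 ≤ #(lk T a)) (B C R : Finset V)
    (hcov : ∀ v, v ∈ B ∨ v ∈ C ∨ v ∈ R)
    (hX : (#({p : V × V × V | T p.1 p.2.1 p.2.2 ∧ p.1 ∈ B ∧ p.2.2 ∈ C}) : ℝ)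
      ≤ d * (Fintype.card V : ℝ) ^ 3)
    (hC : γ * (Fintype.card V : ℝ) ≤ #C) (hR : (#R : ℝ) ≤ ρ * (Fintype.card V : ℝ)) :
    (α - 2 * d / γ - 2 * ρ) * (Fintype.card V : ℝ) ^ 2 ≤ (#C : ℝ) ^ 2 := by
  set n : ℝ := (Fintype.card V : ℝ) with hn
  have hn0 : 0 < n := by rw [hn]; exact_mod_cast hV
  have hC0 : (0 : ℝ) < #C := lt_of_lt_of_le (by positivity) hC
  have h1 : ∀ c, #(lk T c) ≤ #C * #C + 2 * #({p ∈ lk T c | p.1 ∈ B}) + 2 * (#R * Fintype.card V) := by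
    intro c
    have h1 : lk T c ⊆ ((C ×ˢ C) ∪ ({p ∈ lk T c | p.1 ∈ B} ∪ {p ∈ lk T c | p.2 ∈ B})) ∪
        ((R ×ˢ univ) ∪ (univ ×ˢ R)) := by
      intro p hp
      simp only [mem_union, mem_product, mem_filter, hp, true_and, mem_univ, and_true]
      have h1 := hcov p.1
      have h2 := hcov p.2
      tauto
    have h2 : #{p ∈ lk T c | p.2 ∈ B} = #{p ∈ lk T c | p.1 ∈ B} := by
      refine card_nbij' Prod.swap Prod.swap ?_ ?_ (fun _ _ => Prod.swap_swap _)
        (fun _ _ => Prod.swap_swap _)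
      · intro p hp
        simp only [lk, coe_filter, mem_filter, mem_univ, true_and, Set.mem_ofPred_eq] at hp ⊢
        exact ⟨hT.swap₂₃ hp.1, hp.2⟩
      · intro p hp
        simp only [lk, coe_filter, mem_filter, mem_univ, true_and, Set.mem_ofPred_eq] at hp ⊢
        exact ⟨hT.swap₂₃ hp.1, hp.2⟩
    have h3 := card_le_card h1
    have h4 := card_union_le ((C ×ˢ C) ∪ ({p ∈ lk T c | p.1 ∈ B} ∪ {p ∈ lk T c | p.2 ∈ B}))
      ((R ×ˢ univ) ∪ (univ ×ˢ R))
    have h5 := card_union_le (C ×ˢ C) ({p ∈ lk T c | p.1 ∈ B} ∪ {p ∈ lk T c | p.2 ∈ B})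
    have h6 := card_union_le {p ∈ lk T c | p.1 ∈ B} {p ∈ lk T c | p.2 ∈ B}
    have h7 := card_union_le (R ×ˢ (univ : Finset V)) ((univ : Finset V) ×ˢ R)
    rw [card_product, card_product, card_univ, mul_comm (Fintype.card V)] at h7
    rw [card_product] at h5
    omega
  have h2 : ∑ c ∈ C, #({p ∈ lk T c | p.1 ∈ B}) ≤
      #({p : V × V × V | T p.1 p.2.1 p.2.2 ∧ p.1 ∈ B ∧ p.2.2 ∈ C}) := by
    rw [← card_sigma]
    refine card_le_card_of_injOn (fun t => (t.2.1, t.2.2, t.1)) ?_ ?_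
    · rintro ⟨c, p⟩ h
      simp only [mem_coe, mem_sigma, lk, mem_filter, mem_univ, true_and] at h ⊢
      exact ⟨hT.rot (hT.rot h.2.1), h.2.2, h.1⟩
    · rintro ⟨c, p, q⟩ _ ⟨c', p', q'⟩ _ h
      simp only [Prod.mk.injEq] at h
      obtain ⟨rfl, rfl, rfl⟩ := h
      rfl
  have h2' : ∑ c ∈ C, (#({p ∈ lk T c | p.1 ∈ B}) : ℝ) ≤ d * n ^ 3 := by
    refine le_trans ?_ hX
    exact_mod_cast h2
  have h3 : ∑ c ∈ C, α * n ^ 2 ≤ ∑ c ∈ C, ((#C : ℝ) * #C + 2 * #({p ∈ lk T c | p.1 ∈ B}) +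
      2 * (ρ * n * n)) := by
    refine sum_le_sum fun c _ => (hlk c).trans ?_
    have : (#(lk T c) : ℝ) ≤ #C * #C + 2 * #({p ∈ lk T c | p.1 ∈ B}) + 2 * (#R * n) := by
      rw [hn]
      exact_mod_cast h1 c
    nlinarith
  rw [sum_add_distrib, sum_add_distrib, sum_const, sum_const, sum_const, ← mul_sum,
    nsmul_eq_mul, nsmul_eq_mul, nsmul_eq_mul] at h3
  have h4 : 2 * (d * n ^ 3) ≤ #C * (2 * d / γ * n ^ 2) := by
    have : γ * n * (2 * d / γ * n ^ 2) = 2 * (d * n ^ 3) := by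
      field_simp
    rw [← this]
    exact mul_le_mul_of_nonneg_right hC (by positivity)
  have h5 : (#C : ℝ) * ((α - 2 * d / γ - 2 * ρ) * n ^ 2) ≤ #C * (#C : ℝ) ^ 2 := by
    nlinarith
  exact le_of_mul_le_mul_left h5 hC0

theorem card_rev_triples (hT : IsTri T) (B C : Finset V) :
    #({p : V × V × V | T p.1 p.2.1 p.2.2 ∧ p.1 ∈ C ∧ p.2.2 ∈ B}) ≤
      #({p : V × V × V | T p.1 p.2.1 p.2.2 ∧ p.1 ∈ B ∧ p.2.2 ∈ C}) := by
  refine card_le_card_of_injOn (fun p => (p.2.2, p.2.1, p.1)) ?_ ?_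
  · rintro ⟨a, b, c⟩ h
    simp only [mem_coe, mem_filter, mem_univ, true_and] at h ⊢
    exact ⟨hT.swap₂₃ (hT.rot h.1), h.2.2, h.2.1⟩
  · rintro ⟨a, b, c⟩ _ ⟨a', b', c'⟩ _ h
    simp only [Prod.mk.injEq] at h
    obtain ⟨rfl, rfl, rfl⟩ := h
    rfl

theorem card_triples_of_adj (hT : IsTri T) {κ δ : ℝ} (hκ : 0 ≤ κ) (x y : V)
    (h : δ * (Fintype.card V : ℝ) ^ 2 ≤ #(sl T κ x y)) :
    δ * κ * (Fintype.card V : ℝ) ^ 3 ≤ #({p : V × V × V | T p.1 p.2.1 p.2.2 ∧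
      T x p.1 p.2.1 ∧ T y p.1 p.2.1}) := by
  set n : ℝ := (Fintype.card V : ℝ) with hn
  have h1 : ∑ p ∈ sl T κ x y, cdeg T p.1 p.2 ≤ #({p : V × V × V | T p.1 p.2.1 p.2.2 ∧
      T x p.1 p.2.1 ∧ T y p.1 p.2.1}) := by
    simp only [cdeg]
    rw [← card_sigma]
    refine card_le_card_of_injOn (fun t => (t.1.1, t.1.2, t.2)) ?_ ?_
    · rintro ⟨c, p⟩ h
      simp only [mem_coe, mem_sigma, sl, mem_filter, mem_univ, true_and] at h ⊢
      exact ⟨h.2, h.1.1, h.1.2.1⟩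
    · rintro ⟨⟨c, p⟩, q⟩ _ ⟨⟨c', p'⟩, q'⟩ _ h
      simp only [Prod.mk.injEq] at h
      obtain ⟨rfl, rfl, rfl⟩ := h
      rfl
  have h2 : (#(sl T κ x y) : ℝ) * (κ * n) ≤ ∑ p ∈ sl T κ x y, (cdeg T p.1 p.2 : ℝ) := by
    rw [← nsmul_eq_mul]
    exact card_nsmul_le_sum _ _ _ fun p hp => (mem_filter.1 hp).2.2.2
  have h3 : ∑ p ∈ sl T κ x y, (cdeg T p.1 p.2 : ℝ) ≤ #({p : V × V × V | T p.1 p.2.1 p.2.2 ∧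
      T x p.1 p.2.1 ∧ T y p.1 p.2.1}) := by exact_mod_cast h1
  have h4 : δ * n ^ 2 * (κ * n) ≤ #(sl T κ x y) * (κ * n) :=
    mul_le_mul_of_nonneg_right h (by positivity)
  linarith

theorem card_triples_of_third (hT : IsTri T) {α η : ℝ} (hα : 0 ≤ α) (N : Finset V)
    (hlk : ∀ a, α * (Fintype.card V : ℝ) ^ 2 ≤ #(lk T a))
    (hN : η * (Fintype.card V : ℝ) ≤ #N) :
    η * α * (Fintype.card V : ℝ) ^ 3 ≤ #({p : V × V × V | T p.1 p.2.1 p.2.2 ∧ p.2.2 ∈ N}) := by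
  set n : ℝ := (Fintype.card V : ℝ) with hn
  have h1 : ∑ c ∈ N, #(lk T c) ≤ #({p : V × V × V | T p.1 p.2.1 p.2.2 ∧ p.2.2 ∈ N}) := by
    rw [← card_sigma]
    refine card_le_card_of_injOn (fun t => (t.2.1, t.2.2, t.1)) ?_ ?_
    · rintro ⟨c, p⟩ h
      simp only [mem_coe, mem_sigma, lk, mem_filter, mem_univ, true_and] at h ⊢
      exact ⟨hT.rot (hT.rot h.2), h.1⟩
    · rintro ⟨c, p, q⟩ _ ⟨c', p', q'⟩ _ h
      simp only [Prod.mk.injEq] at h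
      obtain ⟨rfl, rfl, rfl⟩ := h
      rfl
  have h2 : (#N : ℝ) * (α * n ^ 2) ≤ ∑ c ∈ N, (#(lk T c) : ℝ) := by
    rw [← nsmul_eq_mul]
    exact card_nsmul_le_sum _ _ _ fun p hp => hlk p
  have h3 : ∑ c ∈ N, (#(lk T c) : ℝ) ≤ #({p : V × V × V | T p.1 p.2.1 p.2.2 ∧ p.2.2 ∈ N}) := by
    exact_mod_cast h1
  have h4 : η * n * (α * n ^ 2) ≤ #N * (α * n ^ 2) :=
    mul_le_mul_of_nonneg_right hN (by positivity)
  linarith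

/-- Vertices whose links contain almost only pairs of large codegree can be absorbed together. -/
theorem card_absSet (hT : IsTri T) (hV : 0 < Fintype.card V)
    (hlk : ∀ a, 0.4325 * (Fintype.card V : ℝ) ^ 2 ≤ #(lk T a)) (x y : V)
    (hx : 0.43 * (Fintype.card V : ℝ) ^ 2 ≤ #(gl T (1 / 10 ^ 7) x))
    (hy : 0.43 * (Fintype.card V : ℝ) ^ 2 ≤ #(gl T (1 / 10 ^ 7) y)) :
    (1 / 10 ^ 17) ^ 12 * (Fintype.card V : ℝ) ^ 7 *
      (3 / 10 ^ 9 * (Fintype.card V : ℝ) ^ 2) ^ 2 ≤ #(absSet T x y) := by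
  set n : ℝ := (Fintype.card V : ℝ) with hn
  have hn0 : 0 < n := by rw [hn]; exact_mod_cast hV
  set κ : ℝ := 1 / 10 ^ 7 with hκ
  set δ : ℝ := 3 / 10 ^ 9 with hδ
  have hκ0 : 0 ≤ κ := by rw [hκ]; positivity
  have hδ0 : 0 ≤ δ := by rw [hδ]; positivity
  by_cases hadj : y ∈ nb T κ δ x
  · refine card_absSet_of_adj hT (by positivity) hδ0 x y (fun z => ?_) ?_
    · refine le_trans ?_ (hlk z)
      rw [← hn, hδ]
      nlinarith [sq_nonneg n]
    · refine le_trans ?_ (card_triples_of_adj hT hκ0 x y (mem_filter.1 hadj).2)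
      refine mul_le_mul_of_nonneg_right ?_ (by positivity)
      rw [hδ, hκ]
      norm_num
  by_cases hinter : 2 / 10 ^ 8 * n ≤ #(nb T κ δ x ∩ nb T κ δ y)
  · refine card_absSet_of_inter hT (κ := κ) (by positivity) hδ0 x y ?_
    have h1 := card_triples_of_third hT (by norm_num) _ hlk hinter
    simp only [mem_inter] at h1
    refine le_trans ?_ h1
    refine mul_le_mul_of_nonneg_right ?_ (by positivity)
    norm_num
  by_cases hden : 1 / 10 ^ 17 * n ^ 3 ≤ #({p : V × V × V | T p.1 p.2.1 p.2.2 ∧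
      p.1 ∈ nb T κ δ y ∧ p.2.2 ∈ nb T κ δ x})
  · exact card_absSet_of_triples hT (by positivity) hδ0 x y hden
  exfalso
  rw [not_le] at hinter hden
  have hNx := le_card_nb hT hκ0 hδ0 x hV hx
  have hNy := le_card_nb hT hκ0 hδ0 y hV hy
  set Nx := nb T κ δ x with hNx'
  set Ny := nb T κ δ y with hNy'
  have hbad : (#(univ \ (Nx ∪ Ny)) : ℝ) ≤ κ / 0.0025 * n := by
    refine card_bad_le hT hκ0 (by norm_num) hV _ fun z hz => ?_
    rw [mem_sdiff, mem_union] at hz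
    by_contra hc
    refine hz.2 (mem_nb_of_not (α := 0.43) ?_ hV hx hy ?_ hadj)
    · rw [hδ]; norm_num
    · have := hlk z
      linarith
  have hcov : ∀ v, v ∈ Ny \ Nx ∨ v ∈ Nx \ Ny ∨ v ∈ (univ \ (Nx ∪ Ny)) ∪ (Nx ∩ Ny) := by
    intro v
    simp only [mem_sdiff, mem_union, mem_inter, mem_univ, true_and]
    tauto
  have hcov' : ∀ v, v ∈ Nx \ Ny ∨ v ∈ Ny \ Nx ∨ v ∈ (univ \ (Nx ∪ Ny)) ∪ (Nx ∩ Ny) := by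
    intro v
    simp only [mem_sdiff, mem_union, mem_inter, mem_univ, true_and]
    tauto
  have hR : (#((univ \ (Nx ∪ Ny)) ∪ (Nx ∩ Ny)) : ℝ) ≤ 41 / 10 ^ 6 * n := by
    have := card_union_le (univ \ (Nx ∪ Ny)) (Nx ∩ Ny)
    have : (#((univ \ (Nx ∪ Ny)) ∪ (Nx ∩ Ny)) : ℝ) ≤ #(univ \ (Nx ∪ Ny)) + #(Nx ∩ Ny) := by
      exact_mod_cast this
    rw [hκ] at hbad
    norm_num at hbad hinter ⊢
    linarith
  have hX1 : (#({p : V × V × V | T p.1 p.2.1 p.2.2 ∧ p.1 ∈ Ny \ Nx ∧ p.2.2 ∈ Nx \ Ny}) : ℝ)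
      ≤ 1 / 10 ^ 17 * n ^ 3 := by
    refine le_trans ?_ hden.le
    refine Nat.cast_le.2 (card_le_card fun p hp => ?_)
    simp only [mem_filter, mem_univ, true_and, mem_sdiff] at hp ⊢
    exact ⟨hp.1, hp.2.1.1, hp.2.2.1⟩
  have hX2 : (#({p : V × V × V | T p.1 p.2.1 p.2.2 ∧ p.1 ∈ Nx \ Ny ∧ p.2.2 ∈ Ny \ Nx}) : ℝ)
      ≤ 1 / 10 ^ 17 * n ^ 3 :=
    le_trans (Nat.cast_le.2 (card_rev_triples hT _ _)) hX1
  have e1 : (#(Nx \ Ny) : ℝ) + #(Nx ∩ Ny) = #Nx := by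
    exact_mod_cast card_sdiff_add_card_inter Nx Ny
  have e2 : (#(Ny \ Nx) : ℝ) + #(Nx ∩ Ny) = #Ny := by
    rw [inter_comm]
    exact_mod_cast card_sdiff_add_card_inter Ny Nx
  have hs1 : 2 / 10 ^ 8 * n ≤ #(Nx \ Ny) := by
    rw [hδ, hκ] at hNx
    norm_num at hNx hinter ⊢
    linarith
  have hs2 : 2 / 10 ^ 8 * n ≤ #(Ny \ Nx) := by
    rw [hδ, hκ] at hNy
    norm_num at hNy hinter ⊢
    linarith
  have h1 := sq_card_ge_of_few hT (by positivity) (by positivity) (by positivity) hV hlk _ _ _ hcov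
    hX1 hs1 hR
  have h2 := sq_card_ge_of_few hT (by positivity) (by positivity) (by positivity) hV hlk _ _ _ hcov'
    hX2 hs2 hR
  have h3 : #(Nx \ Ny) + #(Ny \ Nx) ≤ Fintype.card V := by
    rw [← card_union_of_disjoint (disjoint_sdiff_sdiff)]
    exact card_le_univ _
  have h3' : (#(Nx \ Ny) : ℝ) + #(Ny \ Nx) ≤ n := by rw [hn]; exact_mod_cast h3
  rw [← hn] at h1 h2
  have h4 : ∀ s : ℝ, 0 ≤ s → 0.43 * n ^ 2 ≤ s ^ 2 → 0.6 * n ≤ s := by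
    intro s hs h
    nlinarith
  have h5 := h4 _ (Nat.cast_nonneg _) (le_trans (mul_le_mul_of_nonneg_right (by norm_num)
    (by positivity)) h1)
  have h6 := h4 _ (Nat.cast_nonneg _) (le_trans (mul_le_mul_of_nonneg_right (by norm_num)
    (by positivity)) h2)
  linarith

end Counts

section Counts

variable {V : Type} [Fintype V] {T : V → V → V → Prop}

/-- Assembling the vertices of a two-level absorber. -/
def encSum (s : V × V × (Fin 11 → V)) (p q : V × V) : Fin 11 ⊕ Fin 6 → V :=
  Sum.elim s.2.2 ![s.1, s.2.1, p.1, p.2, q.1, q.2]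

theorem encSum_inj (s p q s' p' q') (h : encSum (V := V) s p q = encSum s' p' q') :
    s = s' ∧ p = p' ∧ q = q' := by
  obtain ⟨s1, s2, s3⟩ := s
  obtain ⟨t1, t2, t3⟩ := s'
  obtain ⟨p1, p2⟩ := p
  obtain ⟨q1, q2⟩ := q
  obtain ⟨p1', p2'⟩ := p'
  obtain ⟨q1', q2'⟩ := q'
  have h' := fun i => congrFun h i
  have e0 : s1 = t1 := h' (Sum.inr 0)
  have e1 : s2 = t2 := h' (Sum.inr 1)
  have e2 : p1 = p1' := h' (Sum.inr 2)
  have e3 : p2 = p2' := h' (Sum.inr 3)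
  have e4 : q1 = q1' := h' (Sum.inr 4)
  have e5 : q2 = q2' := h' (Sum.inr 5)
  have e6 : s3 = t3 := funext fun i => h' (Sum.inl i)
  subst e0 e1 e2 e3 e4 e5 e6
  exact ⟨rfl, rfl, rfl⟩

theorem gn_ge (hT : IsTri T) (hV : 0 < Fintype.card V)
    (hlk : ∀ a, 0.4325 * (Fintype.card V : ℝ) ^ 2 ≤ #(lk T a)) (x : V) :
    0.65 * (Fintype.card V : ℝ) ≤ #(gn T (1 / 400) x) := by
  have h := le_card_gn (κ := 1 / 400) hT (by norm_num) hV x (hlk x)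
  have hn0 : (0 : ℝ) < (Fintype.card V : ℝ) := by exact_mod_cast hV
  have h2 : (0 : ℝ) ≤ #(gn T (1 / 400) x) := Nat.cast_nonneg _
  nlinarith

theorem card_absSet' (hT : IsTri T) (hV : 0 < Fintype.card V)
    (hlk : ∀ a, 0.4325 * (Fintype.card V : ℝ) ^ 2 ≤ #(lk T a)) (x y : V) :
    (5 / 10 ^ 5 * (Fintype.card V : ℝ)) ^ 2 * ((1 / 10 ^ 17) ^ 12 * (Fintype.card V : ℝ) ^ 7 *
      (3 / 10 ^ 9 * (Fintype.card V : ℝ) ^ 2) ^ 2) * (1 / 10 ^ 4 * (Fintype.card V : ℝ) ^ 2) ^ 2 ≤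
      #({ω : Fin 11 ⊕ Fin 6 → V | AbsPair' T x y ω}) := by
  set n : ℝ := (Fintype.card V : ℝ) with hn
  have hn0 : 0 < n := by rw [hn]; exact_mod_cast hV
  set good : Finset V := {z | 0.43 * n ^ 2 ≤ #(gl T (1 / 10 ^ 7) z)} with hgood
  set N : V → Finset V := fun x => nb T (1 / 400) (1 / 10 ^ 4) x ∩ good with hN
  have hNcard : ∀ x, 5 / 10 ^ 5 * n ≤ #(N x) := by
    intro x
    have h1 := le_card_gl hT x (gn_ge hT hV hlk) (hlk x)
    have h2 := le_card_nb (δ := 1 / 10 ^ 4) hT (by norm_num) (by norm_num) x hV h1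
    have h3 : (#(univ \ good) : ℝ) ≤ 1 / 10 ^ 7 / 0.0025 * n := by
      refine card_bad_le hT (by norm_num) (by norm_num) hV _ fun z hz => ?_
      have hz' : ¬ 0.43 * n ^ 2 ≤ #(gl T (1 / 10 ^ 7) z) := fun h =>
        (mem_sdiff.1 hz).2 (mem_filter.2 ⟨mem_univ _, h⟩)
      have := hlk z
      linarith
    have h4 : #(nb T (1 / 400) (1 / 10 ^ 4) x) ≤ #(N x) + #(univ \ good) := by
      have : nb T (1 / 400) (1 / 10 ^ 4) x ⊆ N x ∪ (univ \ good) := by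
        intro v hv
        simp only [hN, mem_union, mem_inter, mem_sdiff, mem_univ, true_and]
        tauto
      exact (card_le_card this).trans (card_union_le _ _)
    have h4' : (#(nb T (1 / 400) (1 / 10 ^ 4) x) : ℝ) ≤ #(N x) + #(univ \ good) := by
      exact_mod_cast h4
    rw [← hn] at h2
    norm_num at h2 h3 ⊢
    linarith
  set c : ℝ := (1 / 10 ^ 17) ^ 12 * n ^ 7 * (3 / 10 ^ 9 * n ^ 2) ^ 2 with hc
  set S : Finset (V × V × (Fin 11 → V)) := {s | s.1 ∈ N x ∧ s.2.1 ∈ N y ∧ AbsPair T s.1 s.2.1 s.2.2}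
    with hS
  have hScard : (5 / 10 ^ 5 * n) ^ 2 * c ≤ #S := by
    have h1 : #((N x ×ˢ N y).sigma fun p => absSet T p.1 p.2) ≤ #S := by
      refine card_le_card_of_injOn (fun t => (t.1.1, t.1.2, t.2)) ?_ ?_
      · rintro ⟨⟨z, w⟩, ω⟩ h
        simp only [mem_coe, mem_sigma, mem_product, absSet, hS, mem_filter, mem_univ,
          true_and] at h ⊢
        exact ⟨h.1.1, h.1.2, h.2⟩
      · rintro ⟨⟨z, w⟩, q⟩ _ ⟨⟨c', p'⟩, q'⟩ _ h
        simp only [Prod.mk.injEq] at h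
        obtain ⟨rfl, rfl, rfl⟩ := h
        rfl
    rw [card_sigma] at h1
    have h2 : (#(N x ×ˢ N y) : ℝ) * c ≤ ∑ p ∈ N x ×ˢ N y, (#(absSet T p.1 p.2) : ℝ) := by
      rw [← nsmul_eq_mul]
      refine card_nsmul_le_sum _ _ _ fun p hp => ?_
      rw [mem_product] at hp
      exact card_absSet hT hV hlk p.1 p.2 (mem_filter.1 (mem_inter.1 hp.1).2).2
        (mem_filter.1 (mem_inter.1 hp.2).2).2
    have h3 : ∑ p ∈ N x ×ˢ N y, (#(absSet T p.1 p.2) : ℝ) ≤ #S := by exact_mod_cast h1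
    refine le_trans (mul_le_mul_of_nonneg_right ?_ (by positivity)) (h2.trans h3)
    rw [card_product, Nat.cast_mul, sq]
    exact mul_le_mul (hNcard x) (hNcard y) (by positivity) (by positivity)
  refine card_extend (by positivity) (by positivity) S hScard (fun s => sl T (1 / 400) x s.1)
    (fun s => sl T (1 / 400) y s.2.1) ?_ ?_ encSum encSum_inj _ ?_
  · rintro ⟨z, w, ω⟩ hs
    exact (mem_filter.1 (mem_inter.1 (mem_filter.1 hs).2.1).1).2
  · rintro ⟨z, w, ω⟩ hs
    exact (mem_filter.1 (mem_inter.1 (mem_filter.1 hs).2.2.1).1).2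
  · rintro ⟨z, w, ω⟩ hs ⟨p1, p2⟩ hp ⟨q1, q2⟩ hq
    have hs' := (mem_filter.1 hs).2.2.2
    simp only [sl, mem_filter, mem_univ, true_and] at hp hq
    exact mem_filter.2 ⟨mem_univ _, ⟨hs'.1, hT.swap₁₂ hp.2.1, hT.swap₁₂ hq.2.1⟩, hs',
      hT.swap₁₂ hp.1, hT.swap₁₂ hq.1⟩

/-- The density of absorbers. -/
noncomputable def cabs : ℝ :=
  (5 / 10 ^ 5) ^ 2 * ((1 / 10 ^ 17) ^ 12 * (3 / 10 ^ 9) ^ 2) * (1 / 10 ^ 4) ^ 2 / 2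

theorem cabs_pos : 0 < cabs := by
  unfold cabs
  positivity

/-- Every pair of vertices has many absorbers. -/
theorem card_absorbers (hT : IsTri T) (hV : 0 < Fintype.card V)
    (hV' : (289 : ℝ) ≤ cabs * Fintype.card V)
    (hlk : ∀ a, 0.4325 * (Fintype.card V : ℝ) ^ 2 ≤ #(lk T a)) (x y : V) :
    cabs * (Fintype.card V : ℝ) ^ Fintype.card (Fin 11 ⊕ Fin 6) ≤
      #({ω : Fin 11 ⊕ Fin 6 → V | AbsPair' T x y ω ∧ Function.Injective ω}) := by
  have h1 := card_absSet' hT hV hlk x y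
  have hc : (2 : ℝ) * cabs =
      (5 / 10 ^ 5) ^ 2 * ((1 / 10 ^ 17) ^ 12 * (3 / 10 ^ 9) ^ 2) * (1 / 10 ^ 4) ^ 2 := by
    unfold cabs
    ring
  have e : Fintype.card (Fin 11 ⊕ Fin 6) = 17 := by simp
  have h2 := le_card_injective (δ := 2 * cabs)
    ({ω : Fin 11 ⊕ Fin 6 → V | AbsPair' T x y ω} : Finset _) (by
      rw [e]
      push_cast
      linarith) hV (by
      refine le_trans (le_of_eq ?_) h1
      rw [e, hc]
      ring)
  rw [filter_filter] at h2
  refine le_trans (le_of_eq ?_) h2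
  ring

end Counts

section Counts

variable {V : Type} [Fintype V] {T : V → V → V → Prop}

theorem card_hit_one {ι : Type} [Fintype ι] (W : Finset V) (i : ι) :
    #({ω : ι → V | ω i ∈ W}) * Fintype.card V = #W * Fintype.card V ^ Fintype.card ι := by
  have h1 : ({ω : ι → V | ω i ∈ W} : Finset _) =
      Fintype.piFinset fun j => if j = i then W else univ := by
    ext ω
    rw [Fintype.mem_piFinset, mem_filter]
    constructor
    · rintro ⟨-, h⟩ j
      split_ifs with hj
      · rwa [hj]
      · exact mem_univ _
    · intro h
      have := h i
      rw [if_pos rfl] at this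
      exact ⟨mem_univ _, this⟩
  rw [h1, Fintype.card_piFinset, ← mul_prod_erase univ _ (mem_univ i), if_pos rfl]
  have h2 : ∏ j ∈ univ.erase i, #(if j = i then W else univ) = Fintype.card V ^ (Fintype.card ι - 1) := by
    rw [prod_congr rfl (g := fun _ => Fintype.card V)]
    · rw [prod_const, card_erase_of_mem (mem_univ _), card_univ]
    · intro j hj
      rw [if_neg (ne_of_mem_erase hj), card_univ]
  rw [h2, mul_assoc, ← pow_succ, Nat.sub_add_cancel]
  exact Fintype.card_pos_iff.2 ⟨i⟩

/-- Few tuples meet a small set. -/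
theorem card_hit {ι : Type} [Fintype ι] (W : Finset V) :
    #({ω : ι → V | ∃ i, ω i ∈ W}) * Fintype.card V ≤
      Fintype.card ι * (#W * Fintype.card V ^ Fintype.card ι) := by
  have h1 : ({ω : ι → V | ∃ i, ω i ∈ W} : Finset _) ⊆ univ.biUnion fun i => {ω : ι → V | ω i ∈ W} := by
    intro ω h
    obtain ⟨i, hi⟩ := (mem_filter.1 h).2
    exact mem_biUnion.2 ⟨i, mem_univ _, mem_filter.2 ⟨mem_univ _, hi⟩⟩
  refine (Nat.mul_le_mul_right _ ((card_le_card h1).trans card_biUnion_le)).trans ?_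
  rw [sum_mul, sum_congr rfl fun i _ => card_hit_one W i, sum_const, card_univ, smul_eq_mul]

/-- A dense family of tuples remains dense after removing the tuples that meet a small set. -/
theorem card_avoid {ι : Type} [Fintype ι] {c : ℝ} (hV : 0 < Fintype.card V) (𝒜 : Finset (ι → V))
    (h : c * (Fintype.card V : ℝ) ^ Fintype.card ι ≤ #𝒜) (W : Finset V)
    (hW : (Fintype.card ι : ℝ) * #W ≤ c / 2 * Fintype.card V) :
    c / 2 * (Fintype.card V : ℝ) ^ Fintype.card ι ≤ #({ω ∈ 𝒜 | ∀ i, ω i ∉ W}) := by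
  set n : ℝ := (Fintype.card V : ℝ) with hn
  have hn0 : 0 < n := by rw [hn]; exact_mod_cast hV
  have h1 : 𝒜 ⊆ {ω ∈ 𝒜 | ∀ i, ω i ∉ W} ∪ ({ω : ι → V | ∃ i, ω i ∈ W} : Finset _) := by
    intro ω hω
    simp only [mem_union, mem_filter, hω, mem_univ, true_and]
    by_cases h : ∃ i, ω i ∈ W
    · exact Or.inr h
    · exact Or.inl (not_exists.1 h)
  have h2 := (card_le_card h1).trans (card_union_le _ _)
  have h2' : (#𝒜 : ℝ) ≤ #({ω ∈ 𝒜 | ∀ i, ω i ∉ W}) + #({ω : ι → V | ∃ i, ω i ∈ W} : Finset _) := by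
    exact_mod_cast h2
  have h3 : (#({ω : ι → V | ∃ i, ω i ∈ W} : Finset _) : ℝ) * n ≤
      Fintype.card ι * (#W * n ^ Fintype.card ι) := by
    rw [hn]
    exact_mod_cast card_hit (ι := ι) W
  have h4 : (Fintype.card ι : ℝ) * (#W * n ^ Fintype.card ι) ≤ c / 2 * n ^ Fintype.card ι * n := by
    have := mul_le_mul_of_nonneg_right hW (by positivity : 0 ≤ n ^ Fintype.card ι)
    linarith
  have h5 := le_of_mul_le_mul_right (h3.trans h4) hn0
  linarith

/-- The connectors between two vertices. -/
noncomputable def conSet (T : V → V → V → Prop) (a b : V) : Finset (Fin 3 → V) :=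
  {ω | (T a (ω 0) (ω 1) ∧ T (ω 1) (ω 2) b) ∧ Function.Injective ω}

theorem pathIn_of_mem_conSet {a b : V} {ω : Fin 3 → V} (h : ω ∈ conSet T a b) :
    PathIn T a b (univ.image ω) ∧ #(univ.image ω) = 3 := by
  obtain ⟨-, ⟨h1, h2⟩, h3⟩ := mem_filter.1 h
  have e : univ.image ω = {ω 0, ω 1, ω 2} := by
    have : (univ : Finset (Fin 3)) = {0, 1, 2} := by decide
    rw [this]
    simp only [image_insert, image_singleton]
  constructor
  · rw [e]
    refine pathIn_three h1 h2 ?_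
    have : [(0 : Fin 3), 1, 2].Nodup := by decide
    exact this.map h3
  · rw [card_image_of_injective _ h3]
    rfl

/-- Any two vertices have many connectors. -/
theorem card_conSet (hT : IsTri T) (hV : 10 ^ 8 ≤ Fintype.card V)
    (hlk : ∀ a, 0.4325 * (Fintype.card V : ℝ) ^ 2 ≤ #(lk T a)) (a b : V) :
    9 / 10 ^ 7 * (Fintype.card V : ℝ) ^ Fintype.card (Fin 3) ≤ #(conSet T a b) := by
  have hV0 : 0 < Fintype.card V := by omega
  set n : ℝ := (Fintype.card V : ℝ) with hn
  have hn8 : (10 : ℝ) ^ 8 ≤ n := by rw [hn]; exact_mod_cast hV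
  have hn0 : 0 < n := by rw [hn]; exact_mod_cast hV0
  have h1 := gn_ge hT hV0 hlk a
  have h2 := gn_ge hT hV0 hlk b
  rw [← hn] at h1 h2
  set N := gn T (1 / 400) a ∩ gn T (1 / 400) b with hN
  have h3 : 0.3 * n ≤ #N := by
    have h4 := card_union_add_card_inter (gn T (1 / 400) a) (gn T (1 / 400) b)
    have h5 := card_le_univ (gn T (1 / 400) a ∪ gn T (1 / 400) b)
    have h5' : (#(gn T (1 / 400) a ∪ gn T (1 / 400) b) : ℝ) ≤ n := by rw [hn]; exact_mod_cast h5
    have h4' : (#(gn T (1 / 400) a ∪ gn T (1 / 400) b) : ℝ) + #N =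
      #(gn T (1 / 400) a) + #(gn T (1 / 400) b) := by exact_mod_cast h4
    linarith
  have h4 : 0.3 * n * (1 / 400 * n) ^ 2 ≤
      #({ω : Fin 3 → V | T a (ω 0) (ω 1) ∧ T (ω 1) (ω 2) b} : Finset _) := by
    have h5 : #(N.sigma fun t => ({z | T a t z} : Finset V) ×ˢ ({z | T b t z} : Finset V)) ≤
        #({ω : Fin 3 → V | T a (ω 0) (ω 1) ∧ T (ω 1) (ω 2) b} : Finset _) := by
      refine card_le_card_of_injOn (fun s => ![s.2.1, s.1, s.2.2]) ?_ ?_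
      · rintro ⟨t, p, q⟩ h
        simp only [mem_coe, mem_sigma, mem_product, mem_filter, mem_univ, true_and] at h ⊢
        exact ⟨hT.swap₂₃ h.2.1, hT.rot (hT.rot h.2.2)⟩
      · rintro ⟨t, p, q⟩ _ ⟨t', p', q'⟩ _ h
        have e0 : p = p' := congrFun h 0
        have e1 : t = t' := congrFun h 1
        have e2 : q = q' := congrFun h 2
        subst e0 e1 e2
        rfl
    have h6 : (#N : ℝ) * (1 / 400 * n) ^ 2 ≤ ∑ t ∈ N, (cdeg T a t : ℝ) * cdeg T b t := by
      rw [← nsmul_eq_mul]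
      refine card_nsmul_le_sum _ _ _ fun t ht => ?_
      rw [hN, mem_inter] at ht
      rw [sq]
      exact mul_le_mul (mem_filter.1 ht.1).2 (mem_filter.1 ht.2).2 (by positivity) (by positivity)
    have h7 : ∑ t ∈ N, (cdeg T a t : ℝ) * cdeg T b t ≤
        #({ω : Fin 3 → V | T a (ω 0) (ω 1) ∧ T (ω 1) (ω 2) b} : Finset _) := by
      rw [card_sigma] at h5
      simp only [card_product] at h5
      unfold cdeg
      exact_mod_cast h5
    exact le_trans (mul_le_mul_of_nonneg_right h3 (by positivity)) (h6.trans h7)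
  have h8 := le_card_injective (δ := 18 / 10 ^ 7)
    ({ω : Fin 3 → V | T a (ω 0) (ω 1) ∧ T (ω 1) (ω 2) b} : Finset _) (by
      rw [Fintype.card_fin, ← hn]
      norm_num at hn8 ⊢
      linarith) hV0 (by
      refine le_trans ?_ h4
      rw [Fintype.card_fin, ← hn]
      have : (0 : ℝ) ≤ n ^ 3 := by positivity
      nlinarith)
  rw [filter_filter] at h8
  refine le_trans (le_of_eq ?_) h8
  rw [← hn]
  ring

end Counts

/-- Linear-size version of the sampling lemma. -/
theorem exists_sample_linear {δ μ : ℝ} (hδ : 0 < δ) (hμ : 0 < μ) (k s : ℕ)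
    (hs : 16 * μ * (s : ℝ) ^ 2 ≤ δ) : ∃ n₀ : ℕ, ∀ (V : Type) [Fintype V], n₀ ≤ Fintype.card V →
      ∀ (ι J : Type) [Fintype ι] [Fintype J] [Nonempty ι], Fintype.card ι = s →
      Fintype.card J ≤ Fintype.card V ^ k → ∀ (G : (ι → V) → Prop) (𝒜 : J → Finset (ι → V)),
      (∀ j, ∀ ω ∈ 𝒜 j, G ω) →
      (∀ j, δ * (Fintype.card V : ℝ) ^ Fintype.card ι ≤ #(𝒜 j)) →
      ∃ 𝓕 : Finset (ι → V), (#𝓕 : ℝ) ≤ μ * Fintype.card V ∧ (∀ ω ∈ 𝓕, G ω) ∧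
        (∀ ω ∈ 𝓕, ∀ ω' ∈ 𝓕, ω ≠ ω' → Disjoint (univ.image ω) (univ.image ω')) ∧
        ∀ j, δ * μ / 16 * Fintype.card V ≤ #{ω ∈ 𝓕 | ω ∈ 𝒜 j} := by
  have hlim : Filter.Tendsto (fun n : ℕ => (n : ℝ) ^ k * Real.exp (-(δ * μ / 8) * n))
      Filter.atTop (nhds 0) := by
    have := (tendsto_rpow_mul_exp_neg_mul_atTop_nhds_zero k (δ * μ / 8) (by positivity)).comp
      (tendsto_natCast_atTop_atTop (R := ℝ))
    refine this.congr fun n => ?_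
    simp
  have hev := hlim.eventually (gt_mem_nhds (show (0 : ℝ) < 1 / 2 by norm_num))
  obtain ⟨n₁, hn₁⟩ := Filter.eventually_atTop.1 hev
  obtain ⟨n₂, hn₂⟩ := exists_nat_ge (2 / μ)
  refine ⟨max n₁ (n₂ + 1), fun V _ hV ι J _ _ _ hι hJ G 𝒜 hG h𝒜 => ?_⟩
  set n : ℝ := (Fintype.card V : ℝ) with hn
  have hV1 : n₁ ≤ Fintype.card V := le_trans (le_max_left _ _) hV
  have hV2 : n₂ + 1 ≤ Fintype.card V := le_trans (le_max_right _ _) hV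
  have hV0 : 0 < Fintype.card V := by omega
  have hn2 : 2 / μ ≤ n := hn₂.trans (by rw [hn]; exact_mod_cast by omega)
  have hμn : 2 ≤ μ * n := by rwa [div_le_iff₀' hμ] at hn2
  have hm1 : (⌊μ * n⌋₊ : ℝ) ≤ μ * n := Nat.floor_le (by linarith)
  have hm2 : μ * n / 2 ≤ (⌊μ * n⌋₊ : ℝ) := by
    have := Nat.lt_floor_add_one (μ * n)
    linarith
  obtain ⟨𝓕, h1, h2, h3⟩ := exists_sample 𝒜 (δ := δ) (m := ⌊μ * n⌋₊) h𝒜 (by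
      rw [hι]
      have h4 : 16 * (⌊μ * n⌋₊ : ℝ) * (s : ℝ) ^ 2 ≤ 16 * (μ * n) * (s : ℝ) ^ 2 := by gcongr
      have h5 := mul_le_mul_of_nonneg_right hs (show 0 ≤ n by rw [hn]; positivity)
      linarith) (by
      refine lt_of_le_of_lt ?_ (hn₁ _ hV1)
      rw [← hn]
      have h4 : (Fintype.card J : ℝ) ≤ n ^ k := by rw [hn]; exact_mod_cast hJ
      refine mul_le_mul h4 (Real.exp_le_exp.2 ?_) (Real.exp_pos _).le (by rw [hn]; positivity)
      have := mul_le_mul_of_nonneg_left hm2 hδ.le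
      linarith) (by
      have : (0 : ℝ) < (⌊μ * n⌋₊ : ℝ) := by linarith
      exact_mod_cast this) hV0
  refine ⟨𝓕.filter G, ?_, fun ω hω => (mem_filter.1 hω).2, ?_, fun j => ?_⟩
  · have h4 : #(𝓕.filter G) ≤ ⌊μ * n⌋₊ := (card_filter_le _ _).trans h1
    have h5 : (#(𝓕.filter G) : ℝ) ≤ (⌊μ * n⌋₊ : ℝ) := by exact_mod_cast h4
    linarith
  · intro ω hω ω' hω' hne
    rw [disjoint_left]
    intro v hv hv'
    obtain ⟨i, -, rfl⟩ := mem_image.1 hv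
    obtain ⟨i', -, h⟩ := mem_image.1 hv'
    exact h2 ω (mem_filter.1 hω).1 ω' (mem_filter.1 hω').1 hne i i' h.symm
  · have h4 := h3 j
    have h5 : {ω ∈ 𝓕.filter G | ω ∈ 𝒜 j} = {ω ∈ 𝓕 | ω ∈ 𝒜 j} := by
      ext ω
      simp only [mem_filter]
      exact ⟨fun h => ⟨h.1.1, h.2⟩, fun h => ⟨⟨h.1, hG j ω h.2⟩, h.2⟩⟩
    rw [h5]
    refine le_trans ?_ h4
    have := mul_le_mul_of_nonneg_left hm2 hδ.le
    linarith

/-- Linking a family of paths by connectors of a fixed size. -/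
theorem exists_link_uniform {V : Type*} {T : V → V → V → Prop} {E Z : Finset V} {q K : ℕ}
    (hc : ∀ a ∈ E, ∀ b ∈ E, ∀ W : Finset V, #W ≤ K →
      ∃ I, I ⊆ Z ∧ Disjoint I W ∧ #I = q ∧ PathIn T a b I)
    (x : V × V) (L : List (V × V)) (W : Finset V) (hE : ∀ y ∈ x :: L, y.1 ∈ E ∧ y.2 ∈ E)
    (hK : #W + q * L.length ≤ K) :
      ∃ C e, C ⊆ Z ∧ Disjoint C W ∧ #C = q * L.length ∧
        e ∈ E ∧ ∀ F, Sys T (x :: L) F → Disjoint F C → PathOn T x.1 e (F ∪ C) := by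
  obtain ⟨C, e, h1, h2, h3, h4, h5, h6⟩ := exists_link (T := T) (A := ∅) (E := E) (Z := Z) (p := 0)
    (q := q) (KA := 0) (KB := K) (fun a ha b hb W _ hW => by
      obtain ⟨I, h1, h2, h3, h4⟩ := hc a ha b hb W (by simpa using hW)
      exact ⟨I, h1, h2, by simp, by simpa using h3, h4⟩) L x W hE (by simp) (by simpa using hK)
  exact ⟨C, e, h1, h2, by simpa using h4, h5, h6⟩

theorem card_sup_family {V ι : Type} [Fintype ι] (𝓕 : Finset (ι → V)) :
    #(𝓕.biUnion fun ω => univ.image ω) ≤ #𝓕 * Fintype.card ι := by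
  refine card_biUnion_le_card_mul _ _ _ fun ω _ => ?_
  exact card_image_le

/-- Few members of a disjoint family meet a given set. -/
theorem card_meet_le {V ι : Type} [Fintype ι] (𝓖 : Finset (ι → V)) (W : Finset V)
    (hd : ∀ ω ∈ 𝓖, ∀ ω' ∈ 𝓖, ω ≠ ω' → Disjoint (univ.image ω) (univ.image ω'))
    (hW : #W < #𝓖) : ∃ ω ∈ 𝓖, Disjoint (univ.image ω) W := by
  by_contra! h
  have h1 : ∀ ω ∈ 𝓖, ∃ v ∈ W, v ∈ univ.image ω := fun ω hω => by
    obtain ⟨v, hv, hv'⟩ := not_disjoint_iff.1 (h ω hω)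
    exact ⟨v, hv', hv⟩
  have : Nonempty V := by
    obtain ⟨ω, hω⟩ := card_pos.1 (show 0 < #𝓖 by omega)
    exact ⟨(h1 ω hω).choose⟩
  choose! f hf using h1
  obtain ⟨ω, hω, ω', hω', hne, he⟩ := exists_ne_map_eq_of_card_lt_of_maps_to hW
    (f := f) fun ω hω => (hf ω hω).1
  refine disjoint_left.1 (hd ω hω ω' hω' hne) (hf ω hω).2 ?_
  rw [he]
  exact (hf ω' hω').2

/-- The connectors between two vertices avoiding a set. -/
noncomputable def conAvoid {V : Type} [Fintype V] (T : V → V → V → Prop) (a b : V)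
    (W : Finset V) : Finset (Fin 3 → V) :=
  {ω ∈ conSet T a b | ∀ i, ω i ∉ W}

theorem mem_conAvoid {V : Type} [Fintype V] {T : V → V → V → Prop} {a b : V} {W : Finset V}
    {ω : Fin 3 → V} : ω ∈ conAvoid T a b W ↔ ω ∈ conSet T a b ∧ ∀ i, ω i ∉ W :=
  mem_filter

theorem exists_connector {V : Type} [Fintype V] {T : V → V → V → Prop} (hT : IsTri T)
    (hV : 10 ^ 8 ≤ Fintype.card V) (hlk : ∀ a, 0.4325 * (Fintype.card V : ℝ) ^ 2 ≤ #(lk T a))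
    (W : Finset V) (hW : (#W : ℝ) ≤ 1 / 10 ^ 7 * Fintype.card V) (a b : V) :
    9 / 10 ^ 7 / 2 * (Fintype.card V : ℝ) ^ Fintype.card (Fin 3) ≤
      #(conAvoid T a b W) := by
  refine le_trans (card_avoid (by omega) _ (card_conSet hT hV hlk a b) W ?_)
    (le_of_eq (by unfold conAvoid; congr!))
  have : (Fintype.card (Fin 3) : ℝ) = 3 := by simp
  rw [this]
  have : (0 : ℝ) ≤ Fintype.card V := by positivity
  linarith

/-- There is a small set of vertices supporting a path that absorbs any small even set. -/
theorem exists_absorbing_path {μ : ℝ} (hμ : 0 < μ) (hμ₁ : μ ≤ cabs / 5000)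
    (hμ₂ : μ ≤ 1 / 10 ^ 9) : ∃ n₀ : ℕ, ∀ (V : Type) [Fintype V] (T : V → V → V → Prop), IsTri T →
      n₀ ≤ Fintype.card V → (∀ a, 0.4325 * (Fintype.card V : ℝ) ^ 2 ≤ #(lk T a)) →
      ∃ W₀ s e, (#W₀ : ℝ) ≤ 32 * μ * Fintype.card V ∧ ∀ U, Disjoint U W₀ → Even #U →
        (#U : ℝ) ≤ cabs * μ / 16 * Fintype.card V → PathOn T s e (W₀ ∪ U) := by
  obtain ⟨n₁, hn₁⟩ := exists_sample_linear (δ := cabs) cabs_pos hμ 2 17 (by norm_num; linarith)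
  obtain ⟨n₂, hn₂⟩ := exists_nat_ge (289 / cabs)
  obtain ⟨n₃, hn₃⟩ := exists_nat_ge (16 / (cabs * μ))
  refine ⟨max n₁ (n₂ + n₃ + 10 ^ 8), fun V _ T hT hV hlk => ?_⟩
  have hV1 : n₁ ≤ Fintype.card V := le_trans (le_max_left _ _) hV
  have hV2 : n₂ + n₃ + 10 ^ 8 ≤ Fintype.card V := le_trans (le_max_right _ _) hV
  set n : ℝ := (Fintype.card V : ℝ) with hn
  have hn2 : (n₂ : ℝ) ≤ n := by rw [hn]; exact_mod_cast by omega
  have hn3 : (n₃ : ℝ) ≤ n := by rw [hn]; exact_mod_cast by omega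
  have hn0 : (10 : ℝ) ^ 8 ≤ n := by rw [hn]; exact_mod_cast by omega
  have hc := cabs_pos
  have h289 : 289 ≤ cabs * n := by
    have := hn₂.trans hn2
    rwa [div_le_iff₀' hc] at this
  have h16 : 16 ≤ cabs * μ * n := by
    have := hn₃.trans hn3
    rwa [div_le_iff₀' (by positivity)] at this
  obtain ⟨𝓕, hF1, hF2, hF3, hF4⟩ := hn₁ V hV1 (Fin 11 ⊕ Fin 6) (V × V) (by simp)
    (by rw [Fintype.card_prod, sq]) (fun ω => AbsBase' T ω ∧ Function.Injective ω)
    (fun p => {ω | AbsPair' T p.1 p.2 ω ∧ Function.Injective ω})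
    (fun p ω h => ⟨(mem_filter.1 h).2.1.1, (mem_filter.1 h).2.2⟩)
    (fun p => card_absorbers hT (by omega) h289 hlk p.1 p.2)
  rw [← hn] at hF1 hF4
  obtain ⟨W₁, hW₁⟩ : ∃ W₁, W₁ = 𝓕.biUnion fun ω => univ.image ω := ⟨_, rfl⟩
  have hW₁c : (#W₁ : ℝ) ≤ 17 * μ * n := by
    have h1 : #W₁ ≤ #𝓕 * 17 := by
      have := card_sup_family 𝓕
      rw [← hW₁] at this
      simpa using this
    have h2 : (#W₁ : ℝ) ≤ #𝓕 * 17 := by exact_mod_cast h1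
    linarith
  obtain ⟨L, hL⟩ : ∃ L, L = 𝓕.toList.flatMap absEnds' := ⟨_, rfl⟩
  have hLlen : L.length = 5 * #𝓕 := by
    rw [hL, List.length_flatMap, List.map_congr_left (g := fun _ => 5)
      (fun ω _ => by simp [absEnds', absEnds])]
    simp [mul_comm]
  have hsys : ∀ U, Disjoint U W₁ → Even #U → (#U : ℝ) ≤ cabs * μ / 16 * n → Sys T L (W₁ ∪ U) := by
    intro U hU hUe hUc
    obtain ⟨r, hr⟩ := hUe
    obtain ⟨A, hAU, hA⟩ := exists_subset_card_eq (show r ≤ #U by omega)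
    obtain ⟨Us, h1, h2, h3, h4⟩ := exists_groups A 1 r U
      (by rw [inter_eq_right.2 hAU, hA]) (by rw [card_sdiff_of_subset hAU, hA]; omega)
    have h5 : ∀ X ∈ Us, X ⊆ U := fun X hX => by
      rw [← h3]
      exact subset_biUnion_of_mem id (List.mem_toFinset.2 hX)
    rw [← h3, hW₁, hL]
    refine sys_absorb (fun ω hω => (hF2 ω hω).1.sys (hF2 ω hω).2) hF3 Us h2 ?_ ?_
    · intro ω hω X hX
      refine (disjoint_of_subset_left (h5 X hX) (disjoint_of_subset_right ?_ hU)).symm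
      rw [hW₁]
      exact subset_biUnion_of_mem (fun ω => univ.image ω) hω
    · intro X hX
      have h6 : #X = 2 := by
        have := card_inter_add_card_sdiff X A
        have := h4 X hX
        omega
      obtain ⟨x, y, hxy, rfl⟩ := card_eq_two.1 h6
      have h7 : #{ω ∈ 𝓕 | ω ∈ ({ω | AbsPair' T x y ω ∧ Function.Injective ω} : Finset _)} ≤
          #{ω ∈ 𝓕 | Sys T (absEnds' ω) (univ.image ω ∪ {x, y})} := by
        refine card_le_card fun ω hω => ?_
        rw [mem_filter] at hω ⊢
        refine ⟨hω.1, ?_⟩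
        have h8 := (mem_filter.1 hω.2).2
        have h9 : ∀ z ∈ ({x, y} : Finset V), z ∉ univ.image ω := fun z hz hz' => by
          refine disjoint_left.1 hU (h5 _ hX hz) ?_
          rw [hW₁]
          exact mem_biUnion.2 ⟨ω, hω.1, hz'⟩
        exact h8.1.sys h8.2 hxy (h9 x (by simp)) (h9 y (by simp))
      refine le_trans ?_ h7
      have h10 := hF4 (x, y)
      have h11 : (Us.length : ℝ) ≤ cabs * μ / 16 * n := by
        rw [h1]
        refine le_trans ?_ hUc
        exact_mod_cast by omega
      exact_mod_cast h11.trans h10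
  have hFpos : 𝓕.Nonempty := by
    obtain ⟨v⟩ : Nonempty V := Fintype.card_pos_iff.1 (by omega)
    have h1 := hF4 (v, v)
    rw [← card_pos]
    have h2 : #{ω ∈ 𝓕 | ω ∈ ({ω | AbsPair' T v v ω ∧ Function.Injective ω} : Finset _)} ≤ #𝓕 :=
      card_filter_le _ _
    have h3 : (0 : ℝ) < #{ω ∈ 𝓕 | ω ∈ ({ω | AbsPair' T v v ω ∧ Function.Injective ω} : Finset _)} := by
      refine lt_of_lt_of_le ?_ h1
      linarith
    have h4 : 0 < #{ω ∈ 𝓕 | ω ∈ ({ω | AbsPair' T v v ω ∧ Function.Injective ω} : Finset _)} := by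
      exact_mod_cast h3
    omega
  rcases L with _ | ⟨x, L⟩
  · have := card_pos.2 hFpos
    simp at hLlen
    rw [hLlen] at this
    simp at this
  have hlen : L.length ≤ 5 * #𝓕 := by simp at hLlen; omega
  obtain ⟨C, e, -, hC1, hC2, -, hC3⟩ := exists_link_uniform (T := T) (E := univ) (Z := univ)
    (q := 3) (K := ⌊1 / 10 ^ 7 * n⌋₊) (fun a _ b _ W hW => by
      have hW' : (#W : ℝ) ≤ 1 / 10 ^ 7 * n :=
        (Nat.le_floor_iff (by positivity)).1 hW
      have h1 := exists_connector hT (by omega) hlk W hW' a b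
      have h2 : (0 : ℝ) < #(conAvoid T a b W) := lt_of_lt_of_le (by positivity) h1
      obtain ⟨ω, hω⟩ := card_pos.1 (by exact_mod_cast h2)
      rw [mem_conAvoid] at hω
      refine ⟨univ.image ω, subset_univ _, ?_, (pathIn_of_mem_conSet hω.1).2,
        (pathIn_of_mem_conSet hω.1).1⟩
      rw [disjoint_left]
      intro v hv
      obtain ⟨i, -, rfl⟩ := mem_image.1 hv
      exact hω.2 i) x L W₁ (by simp) (by
      refine Nat.le_floor ?_
      push_cast
      have h1 : (L.length : ℝ) ≤ 5 * #𝓕 := by exact_mod_cast hlen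
      have h2 := mul_le_mul_of_nonneg_right hμ₂ (show 0 ≤ n by linarith)
      linarith)
  refine ⟨W₁ ∪ C, x.1, e, ?_, fun U hU hUe hUc => ?_⟩
  · have h1 : #(W₁ ∪ C) ≤ #W₁ + 3 * L.length := hC2 ▸ card_union_le _ _
    have h2 : (#(W₁ ∪ C) : ℝ) ≤ #W₁ + 3 * L.length := by exact_mod_cast h1
    have h3 : (L.length : ℝ) ≤ 5 * #𝓕 := by exact_mod_cast hlen
    linarith
  · rw [disjoint_union_right] at hU
    have := hC3 _ (hsys U hU.1 hUe hUc) (disjoint_union_left.2 ⟨hC1.symm, hU.2⟩)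
    rwa [union_right_comm] at this

/-- A small random set contains many connectors for every pair of vertices. -/
theorem exists_reservoir {ρ : ℝ} (hρ : 0 < ρ) (hρ₁ : ρ ≤ 1 / 10 ^ 9) : ∃ n₀ : ℕ,
    ∀ (V : Type) [Fintype V] (T : V → V → V → Prop), IsTri T →
      n₀ ≤ Fintype.card V → (∀ a, 0.4325 * (Fintype.card V : ℝ) ^ 2 ≤ #(lk T a)) →
      ∀ W₀ : Finset V, (#W₀ : ℝ) ≤ 1 / 10 ^ 7 * Fintype.card V →
      ∃ R : Finset V, Disjoint R W₀ ∧ (#R : ℝ) ≤ 3 * ρ * Fintype.card V ∧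
        ∀ a b, ∀ W : Finset V, (#W : ℝ) < ρ / 10 ^ 8 * Fintype.card V →
          ∃ I, I ⊆ R ∧ Disjoint I W ∧ #I = 3 ∧ PathIn T a b I := by
  obtain ⟨n₁, hn₁⟩ := exists_sample_linear (δ := 9 / 10 ^ 7 / 2) (by norm_num) hρ 2 3
    (by norm_num at hρ₁ ⊢; linarith)
  refine ⟨max n₁ (10 ^ 8), fun V _ T hT hV hlk W₀ hW₀ => ?_⟩
  have hV1 : n₁ ≤ Fintype.card V := le_trans (le_max_left _ _) hV
  have hV2 : 10 ^ 8 ≤ Fintype.card V := le_trans (le_max_right _ _) hV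
  set n : ℝ := (Fintype.card V : ℝ) with hn
  have hn0 : 0 ≤ n := by rw [hn]; positivity
  obtain ⟨𝓕, hF1, hF2, hF3, hF4⟩ := hn₁ V hV1 (Fin 3) (V × V) (by simp)
    (by rw [Fintype.card_prod, sq]) (fun ω => ∀ i, ω i ∉ W₀)
    (fun p => conAvoid T p.1 p.2 W₀)
    (fun p ω h => (mem_conAvoid.1 h).2)
    (fun p => exists_connector hT hV2 hlk W₀ hW₀ p.1 p.2)
  rw [← hn] at hF1 hF4
  refine ⟨𝓕.biUnion fun ω => univ.image ω, ?_, ?_, fun a b W hW => ?_⟩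
  · rw [disjoint_biUnion_left]
    intro ω hω
    rw [disjoint_left]
    intro v hv
    obtain ⟨i, -, rfl⟩ := mem_image.1 hv
    exact hF2 ω hω i
  · have h1 := card_sup_family 𝓕
    rw [Fintype.card_fin] at h1
    have h2 : (#(𝓕.biUnion fun ω => univ.image ω) : ℝ) ≤ #𝓕 * 3 := by exact_mod_cast h1
    linarith
  · obtain ⟨ω, hω, hd⟩ := card_meet_le
      {ω ∈ 𝓕 | ω ∈ conAvoid T a b W₀} W
      (fun ω hω ω' hω' => hF3 ω (mem_filter.1 hω).1 ω' (mem_filter.1 hω').1) (by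
        have h1 := hF4 (a, b)
        have h2 : (#W : ℝ) < #{ω ∈ 𝓕 | ω ∈ conAvoid T a b W₀} := by
          refine lt_of_lt_of_le hW (le_trans ?_ h1)
          have := mul_nonneg hρ.le hn0
          norm_num at this ⊢
          linarith
        exact_mod_cast h2)
    rw [mem_filter, mem_conAvoid] at hω
    exact ⟨univ.image ω, subset_biUnion_of_mem (fun ω => univ.image ω) hω.1, hd,
      (pathIn_of_mem_conSet hω.2.1).2, (pathIn_of_mem_conSet hω.2.1).1⟩

section Restrict

variable {V : Type} [Fintype V] {T : V → V → V → Prop}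

theorem card_lk_restrict (W : Finset V) (a : {v // v ∉ W}) :
    #(lk T (a : V)) ≤ #(lk (fun x y z : {v // v ∉ W} => T x y z) a) +
      2 * (#W * Fintype.card V) := by
  have h1 : lk T (a : V) ⊆ ((lk (fun x y z : {v // v ∉ W} => T x y z) a).image
      fun p => ((p.1 : V), (p.2 : V))) ∪ (W ×ˢ univ ∪ univ ×ˢ W) := by
    rintro ⟨x, y⟩ h
    simp only [mem_union, mem_product, mem_univ, true_and, and_true, mem_image]
    by_cases hx : x ∈ W
    · exact Or.inr (Or.inl hx)
    by_cases hy : y ∈ W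
    · exact Or.inr (Or.inr hy)
    · exact Or.inl ⟨(⟨x, hx⟩, ⟨y, hy⟩), mem_filter.2 ⟨mem_univ _, (mem_filter.1 h).2⟩, rfl⟩
  refine (card_le_card h1).trans ((card_union_le _ _).trans (add_le_add card_image_le ?_))
  refine (card_union_le _ _).trans ?_
  rw [card_product, card_product, card_univ]
  linarith [mul_comm #W (Fintype.card V)]

theorem boxCount_map {W : Finset V} (B : Finset {v // v ∉ W}) :
    boxCount T (B.map (Function.Embedding.subtype _)) (B.map (Function.Embedding.subtype _))
      (B.map (Function.Embedding.subtype _)) ≤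
      boxCount (fun x y z : {v // v ∉ W} => T x y z) B B B := by
  unfold boxCount
  refine card_le_card_of_surjOn (fun p => ((p.1 : V), (p.2.1 : V), (p.2.2 : V))) ?_
  rintro ⟨x, y, z⟩ h
  simp only [coe_filter, mem_product, mem_map, Set.mem_ofPred_eq] at h
  obtain ⟨⟨⟨x, hx, rfl⟩, ⟨y, hy, rfl⟩, ⟨z, hz, rfl⟩⟩, h⟩ := h
  exact ⟨(x, y, z), by simpa using ⟨⟨hx, hy, hz⟩, h⟩, rfl⟩

end Restrict

/-- Almost all vertices outside a small set can be covered by few paths. -/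
theorem exists_cover_avoiding {ν : ℝ} (hν : 0 < ν) : ∃ γ : ℝ, 0 < γ ∧ ∀ θ : ℝ, 0 < θ → θ ≤ 1 →
    ∃ n₀ : ℕ, ∀ (V : Type) [Fintype V] (T : V → V → V → Prop), IsTri T → n₀ ≤ Fintype.card V →
      (∀ a, (7 / 16 - γ) * (Fintype.card V : ℝ) ^ 2 ≤ #(lk T a)) →
      (∀ B : Finset V, (3 / 4 - ν) * Fintype.card V ≤ #B →
        ν * (Fintype.card V : ℝ) ^ 3 < boxCount T B B B) →
      ∀ W : Finset V, (#W : ℝ) ≤ γ * Fintype.card V →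
      ∃ L F, Sys T L F ∧ (L.length : ℝ) ≤ θ * Fintype.card V ∧ Disjoint F W ∧
        (#(univ \ (W ∪ F)) : ℝ) ≤ θ * Fintype.card V := by
  obtain ⟨γ₀, hγ₀, hcov⟩ := exists_cover (show 0 < ν / 2 by positivity)
  obtain ⟨γ, hγ, hγ1, hγ2, hγ3⟩ : ∃ γ : ℝ, 0 < γ ∧ γ ≤ γ₀ / 4 ∧ γ ≤ ν / 4 ∧ γ ≤ 1 / 2 := by
    refine ⟨min (γ₀ / 4) (min (ν / 4) (1 / 2)), by positivity, min_le_left _ _, ?_, ?_⟩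
    · exact (min_le_right _ _).trans (min_le_left _ _)
    · exact (min_le_right _ _).trans (min_le_right _ _)
  refine ⟨γ, hγ, fun θ hθ hθ1 => ?_⟩
  obtain ⟨n₀, hn₀⟩ := hcov θ hθ hθ1
  refine ⟨2 * n₀, fun V _ T hT hV hlk hbox W hW => ?_⟩
  set n : ℝ := (Fintype.card V : ℝ) with hn
  have hn0 : 0 ≤ n := by rw [hn]; positivity
  obtain ⟨T', hT'⟩ : ∃ T' : {v // v ∉ W} → {v // v ∉ W} → {v // v ∉ W} → Prop,
    T' = fun x y z : {v // v ∉ W} => T x y z := ⟨_, rfl⟩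
  have hc : Fintype.card {v // v ∉ W} + #W = Fintype.card V := by
    have h1 := Fintype.card_subtype (fun v => v ∉ W)
    have h2 : ({v | v ∉ W} : Finset V) = univ \ W := by ext; simp
    rw [h2] at h1
    have h3 := card_sdiff_add_card_eq_card (subset_univ W)
    rw [card_univ] at h3
    omega
  set n' : ℝ := (Fintype.card {v // v ∉ W} : ℝ) with hn'
  have hc' : n' + #W = n := by rw [hn, hn']; exact_mod_cast hc
  have hw0 : (0 : ℝ) ≤ #W := by positivity
  have hn'0 : 0 ≤ n' := by rw [hn']; positivity
  have hle : n' ≤ n := by linarith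
  have hγn : γ * n ≤ 1 / 2 * n := mul_le_mul_of_nonneg_right hγ3 hn0
  have hTri : IsTri T' := by
    subst hT'
    exact ⟨fun h => hT.swap₁₂ h, fun h => hT.swap₂₃ h, fun h => fun e => hT.ne h (by rw [e])⟩
  obtain ⟨L, F, h1, h2, h3⟩ := hn₀ {v // v ∉ W} T' hTri (by
      have h1 : (2 * n₀ : ℝ) ≤ n := by rw [hn]; exact_mod_cast hV
      have h2 : (n₀ : ℝ) ≤ n' := by linarith
      rw [hn'] at h2
      exact_mod_cast h2) (by
    intro a
    rw [← hn']
    by_cases hg : 7 / 16 - γ₀ ≤ 0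
    · exact (mul_nonpos_of_nonpos_of_nonneg hg (by positivity)).trans (by positivity)
    have h1 : (#(lk T (a : V)) : ℝ) ≤ #(lk T' a) + 2 * (#W * n) := by
      rw [hn, hT']
      exact_mod_cast card_lk_restrict W a
    have h2 := hlk a
    have h3 : #W * n ≤ γ * n * n := mul_le_mul_of_nonneg_right hW hn0
    have h4 : (7 / 16 - γ₀) * n' ^ 2 ≤ (7 / 16 - γ₀) * n ^ 2 := by
      push Not at hg
      gcongr
    have h5 : γ * n ^ 2 ≤ γ₀ / 4 * n ^ 2 := mul_le_mul_of_nonneg_right hγ1 (by positivity)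
    nlinarith) (by
    intro B hB
    rw [← hn'] at hB ⊢
    have h1 := hbox (B.map (Function.Embedding.subtype _)) (by
      rw [card_map]
      refine le_trans ?_ hB
      have h2 : γ * n ≤ ν / 4 * n := mul_le_mul_of_nonneg_right hγ2 hn0
      have h3 : 0 ≤ ν * #W := by positivity
      have h4 : 0 ≤ ν * n := by positivity
      have h5 : n' = n - #W := by linarith
      rw [h5]
      nlinarith)
    have h2 : boxCount T (B.map (Function.Embedding.subtype _))
      (B.map (Function.Embedding.subtype _)) (B.map (Function.Embedding.subtype _)) ≤
      boxCount T' B B B := by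
      rw [hT']
      exact boxCount_map B
    have h3 : (boxCount T (B.map (Function.Embedding.subtype _))
      (B.map (Function.Embedding.subtype _)) (B.map (Function.Embedding.subtype _)) : ℝ) ≤
      boxCount T' B B B := by exact_mod_cast h2
    have h4 : n' ^ 3 ≤ n ^ 3 := by gcongr
    have h5 : ν / 2 * n' ^ 3 ≤ ν * n ^ 3 := by
      have := mul_le_mul_of_nonneg_left h4 hν.le
      have : 0 ≤ ν * n' ^ 3 := by positivity
      linarith
    linarith)
  rw [← hn'] at h2 h3
  have h4 : θ * n' ≤ θ * n := mul_le_mul_of_nonneg_left hle hθ.le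
  have h5 : Disjoint (F.map (Function.Embedding.subtype _)) W := by
    rw [disjoint_left]
    intro v hv
    obtain ⟨w, -, rfl⟩ := mem_map.1 hv
    exact w.2
  have h1' : Sys T' L F := by convert h1
  refine ⟨_, _, h1'.map (T' := T) (Function.Embedding.subtype _)
    (fun _ _ _ h => by rw [hT'] at h; exact h), ?_, ?_, ?_⟩
  · rw [List.length_map]
    linarith
  · convert h5
  · have h6 := card_sdiff_add_card_eq_card (subset_univ (W ∪ F.map (Function.Embedding.subtype _)))
    rw [card_union_of_disjoint h5.symm, card_map, card_univ] at h6
    have h7 : (#(univ \ (W ∪ F.map (Function.Embedding.subtype _))) : ℝ) + (#W + #F) = n := by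
      rw [hn]
      exact_mod_cast h6
    refine le_trans (b := (#(univ \ (W ∪ F.map (Function.Embedding.subtype _))) : ℝ))
      (le_of_eq (by congr!)) ?_
    linarith

/-- The nonextremal case. -/
theorem exists_closed_of_nonextremal {ν : ℝ} (hν : 0 < ν) : ∃ γ : ℝ, 0 < γ ∧ ∃ n₀ : ℕ,
    ∀ (V : Type) [Fintype V] (T : V → V → V → Prop), IsTri T → n₀ ≤ Fintype.card V →
      Even (Fintype.card V) →
      (∀ a, (7 / 16 - γ) * (Fintype.card V : ℝ) ^ 2 ≤ #(lk T a)) →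
      (∀ B : Finset V, (3 / 4 - ν) * Fintype.card V ≤ #B →
        ν * (Fintype.card V : ℝ) ^ 3 < boxCount T B B B) →
      ∃ a b F I, PathOn T a b F ∧ PathIn T b a I ∧ Disjoint F I ∧ F ∪ I = univ := by
  obtain ⟨γ₀, hγ₀, hcov⟩ := exists_cover_avoiding hν
  have hcabs := cabs_pos
  obtain ⟨μ, hμ, hμ1, hμ2, hμ3⟩ : ∃ μ : ℝ, 0 < μ ∧ μ ≤ cabs / 5000 ∧ μ ≤ 1 / 10 ^ 9 ∧
      μ ≤ γ₀ / 100 := by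
    refine ⟨min (cabs / 5000) (min (1 / 10 ^ 9) (γ₀ / 100)), by positivity, min_le_left _ _, ?_, ?_⟩
    · exact (min_le_right _ _).trans (min_le_left _ _)
    · exact (min_le_right _ _).trans (min_le_right _ _)
  obtain ⟨ρ, hρ, hρ1, hρ2, hρ3⟩ : ∃ ρ : ℝ, 0 < ρ ∧ ρ ≤ 1 / 10 ^ 9 ∧ ρ ≤ μ ∧
      4 * ρ ≤ cabs * μ / 16 := by
    refine ⟨min (1 / 10 ^ 9) (min μ (cabs * μ / 64)), by positivity, min_le_left _ _, ?_, ?_⟩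
    · exact (min_le_right _ _).trans (min_le_left _ _)
    · linarith [(min_le_right (1 / 10 ^ 9) (min μ (cabs * μ / 64))).trans (min_le_right _ _)]
  obtain ⟨n₁, hn₁⟩ := exists_absorbing_path hμ hμ1 hμ2
  obtain ⟨n₂, hn₂⟩ := exists_reservoir hρ hρ1
  obtain ⟨n₃, hn₃⟩ := hcov (ρ / 10 ^ 9) (by positivity) (by linarith)
  obtain ⟨n₄, hn₄⟩ := exists_nat_ge (10 ^ 10 / ρ)
  refine ⟨min γ₀ (1 / 400), by positivity, n₁ + n₂ + n₃ + n₄, fun V _ T hT hV hev hlk hbox => ?_⟩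
  set n : ℝ := (Fintype.card V : ℝ) with hn
  have hn0 : 0 ≤ n := by rw [hn]; positivity
  have hnρ : 10 ^ 10 ≤ ρ * n := by
    have h1 : (n₄ : ℝ) ≤ n := by rw [hn]; exact_mod_cast by omega
    have := hn₄.trans h1
    rwa [div_le_iff₀' hρ] at this
  have hlk1 : ∀ a, 0.4325 * n ^ 2 ≤ #(lk T a) := fun a => by
    refine le_trans ?_ (hlk a)
    gcongr
    have := min_le_right γ₀ (1 / 400)
    linarith
  have hlk2 : ∀ a, (7 / 16 - γ₀) * n ^ 2 ≤ #(lk T a) := fun a => by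
    refine le_trans ?_ (hlk a)
    gcongr
    exact min_le_left _ _
  obtain ⟨W₀, s, e, hW₀, habs⟩ := hn₁ V T hT (by omega) hlk1
  rw [← hn] at hW₀
  have hμn : μ * n ≤ 1 / 10 ^ 9 * n := mul_le_mul_of_nonneg_right hμ2 hn0
  obtain ⟨R, hRW, hRc, hR⟩ := hn₂ V T hT (by omega) hlk1 W₀ (by rw [← hn]; linarith)
  rw [← hn] at hRc hR
  have hρn : ρ * n ≤ μ * n := mul_le_mul_of_nonneg_right hρ2 hn0
  have hγn : μ * n ≤ γ₀ / 100 * n := mul_le_mul_of_nonneg_right hμ3 hn0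
  have hμn0 : 0 ≤ μ * n := by positivity
  obtain ⟨L, F, hLF, hL, hFd, hF⟩ := hn₃ V T hT (by omega) hlk2 hbox (W₀ ∪ R) (by
    have h1 : (#(W₀ ∪ R) : ℝ) ≤ #W₀ + #R := by exact_mod_cast card_union_le _ _
    rw [← hn]
    linarith)
  rw [← hn] at hL hF
  rw [disjoint_union_right] at hFd
  obtain ⟨K, hK⟩ : ∃ K, K = 3 * (L.length + 1) := ⟨_, rfl⟩
  have hKlt : (K : ℝ) < ρ / 10 ^ 8 * n := by
    rw [hK]
    push_cast
    linarith
  have hconn : ∀ a b, ∀ W : Finset V, #W ≤ K →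
      ∃ I, I ⊆ R ∧ Disjoint I W ∧ #I = 3 ∧ PathIn T a b I := fun a b W hW =>
    hR a b W (lt_of_le_of_lt (by exact_mod_cast hW) hKlt)
  obtain ⟨C, e', hCR, -, hCc, -, hC⟩ := exists_link_uniform (T := T) (E := univ) (Z := R)
    (fun a _ b _ W hW => hconn a b W hW) (s, e) L ∅ (by simp) (by rw [card_empty]; omega)
  obtain ⟨I, hIR, hIC, hIc, hI⟩ := hconn e' s C (by omega)
  have hall : ∀ U, Disjoint U (W₀ ∪ F ∪ C) → Even #U → (#U : ℝ) ≤ cabs * μ / 16 * n →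
      PathOn T s e' ((W₀ ∪ U) ∪ F ∪ C) := by
    intro U hU hUe hUc
    rw [disjoint_union_right, disjoint_union_right] at hU
    refine hC _ (Sys.cons (habs U hU.1.1 hUe hUc) hLF ?_) ?_
    · exact disjoint_union_left.2 ⟨hFd.1.symm, hU.1.2⟩
    · refine disjoint_union_left.2 ⟨disjoint_union_left.2 ⟨?_, hU.2⟩, ?_⟩
      · exact disjoint_of_subset_right hCR hRW.symm
      · exact disjoint_of_subset_right hCR hFd.2
  obtain ⟨X, hX⟩ : ∃ X, X = W₀ ∪ F ∪ C := ⟨_, rfl⟩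
  have hXodd : Odd #X := by
    have := (hall ∅ (by simp) (by simp) (by rw [card_empty, Nat.cast_zero]; positivity)).odd_card
    rwa [union_empty, ← hX] at this
  have hXI : Disjoint X I := by
    rw [hX]
    refine disjoint_union_left.2 ⟨disjoint_union_left.2 ⟨?_, ?_⟩, hIC.symm⟩
    · exact disjoint_of_subset_right hIR hRW.symm
    · exact disjoint_of_subset_right hIR hFd.2
  obtain ⟨U, hU⟩ : ∃ U, U = univ \ (X ∪ I) := ⟨_, rfl⟩
  have hUX : Disjoint U (X ∪ I) := by rw [hU]; exact sdiff_disjoint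
  rw [disjoint_union_right] at hUX
  have hcard : #U + (#X + 3) = Fintype.card V := by
    have := card_sdiff_add_card_eq_card (subset_univ (X ∪ I))
    rwa [card_univ, card_union_of_disjoint hXI, hIc, ← hU] at this
  have hUe : Even #U := by
    obtain ⟨a, ha⟩ := hXodd
    obtain ⟨b, hb⟩ := hev
    exact ⟨b - a - 2, by omega⟩
  have hUc : (#U : ℝ) ≤ cabs * μ / 16 * n := by
    have h1 : U ⊆ R ∪ (univ \ (W₀ ∪ R ∪ F)) := by
      intro v hv
      rw [hU, hX] at hv
      simp only [mem_sdiff, mem_univ, mem_union, true_and, not_or] at hv ⊢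
      tauto
    have h2 : (#U : ℝ) ≤ #R + #(univ \ (W₀ ∪ R ∪ F)) := by
      exact_mod_cast (card_le_card h1).trans (card_union_le _ _)
    have h3 := mul_le_mul_of_nonneg_right hρ3 hn0
    have h4 : ρ / 10 ^ 9 * n ≤ ρ * n := by linarith
    linarith
  refine ⟨s, e', X ∪ U, I, ?_, hI, disjoint_union_left.2 ⟨hXI, hUX.2⟩, ?_⟩
  · have := hall U (hX ▸ hUX.1) hUe hUc
    rwa [union_right_comm W₀ U F, union_right_comm _ U C, ← hX] at this
  · rw [hU]
    ext v
    simp only [mem_union, mem_sdiff, mem_univ, true_and, iff_true]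
    tauto

section Greedy

variable {V : Type} {T : V → V → V → Prop}

theorem card_split {P S F B : Finset V} (hF : F = P ∪ S) (hP : P ⊆ B) (hS : Disjoint S B) :
    #(F ∩ B) = #P ∧ #(F \ B) = #S := by
  subst hF
  constructor
  · rw [union_inter_distrib_right, inter_eq_left.2 hP, disjoint_iff_inter_eq_empty.1 hS, union_empty]
  · rw [union_sdiff_distrib, sdiff_eq_empty_iff_subset.2 hP, sdiff_eq_self_of_disjoint hS, empty_union]

theorem card_union_split {F G B : Finset V} (h : Disjoint F G) :
    #((F ∪ G) ∩ B) = #(F ∩ B) + #(G ∩ B) ∧ #((F ∪ G) \ B) = #(F \ B) + #(G \ B) := by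
  constructor
  · rw [union_inter_distrib_right, card_union_of_disjoint
      (h.mono inter_subset_left inter_subset_left)]
  · rw [union_sdiff_distrib, card_union_of_disjoint (h.mono sdiff_subset sdiff_subset)]

/-- Disjoint paths of a fixed type can be chosen greedily. -/
theorem exists_greedy {B E : Finset V} {p q KA KB : ℕ}
    (hc : ∀ W : Finset V, #(W ∩ B) ≤ KA → #(W \ B) ≤ KB →
      ∃ a b F, a ∈ E ∧ b ∈ E ∧ Disjoint F W ∧ #(F ∩ B) = p ∧ #(F \ B) = q ∧ PathOn T a b F)
    (N : ℕ) : ∀ W : Finset V, #(W ∩ B) + p * N ≤ KA → #(W \ B) + q * N ≤ KB →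
      ∃ L F, L.length = N ∧ (∀ y ∈ L, y.1 ∈ E ∧ y.2 ∈ E) ∧ Sys T L F ∧ Disjoint F W ∧
        #(F ∩ B) = p * N ∧ #(F \ B) = q * N := by
  induction N with
  | zero =>
    intro W _ _
    exact ⟨[], ∅, rfl, by simp, rfl, by simp, by simp, by simp⟩
  | succ N ih =>
    intro W hA hB
    rw [Nat.mul_add, Nat.mul_one] at hA hB
    obtain ⟨a, b, F, ha, hb, hF, hp, hq, hP⟩ := hc W (by omega) (by omega)
    obtain ⟨h1, h2⟩ := card_union_split (B := B) hF
    obtain ⟨L, G, hL, hE, hG, hGW, hGp, hGq⟩ := ih (F ∪ W) (by omega) (by omega)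
    rw [disjoint_union_right] at hGW
    obtain ⟨h3, h4⟩ := card_union_split (B := B) hGW.1.symm
    refine ⟨(a, b) :: L, F ∪ G, by simp [hL], ?_, Sys.cons hP hG hGW.1.symm,
      disjoint_union_left.2 ⟨hF, hGW.2⟩, ?_, ?_⟩
    · intro y hy
      rcases List.mem_cons.1 hy with rfl | hy
      · exact ⟨ha, hb⟩
      · exact hE y hy
    · rw [h3, hp, hGp]; ring
    · rw [h4, hq, hGq]; ring

end Greedy

/-- The vertex set is partitioned into `A`, `B` and a small exceptional set `S`, such that almost
all triples with one vertex in `A` and two in `B` are edges, and few triples inside `B` are. -/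
structure Ext {V : Type} [Fintype V] (T : V → V → V → Prop) (A B S : Finset V) (ε : ℝ) : Prop where
  tri : IsTri T
  disj_AB : Disjoint A B
  disj_SB : Disjoint S B
  disj_AS : Disjoint A S
  cover : ∀ v, v ∈ A ∨ v ∈ B ∨ v ∈ S
  le_B : (3 / 4 - 4 * ε ^ 2) * (Fintype.card V : ℝ) ≤ #B
  B_le : (#B : ℝ) ≤ (3 / 4 + 4 * ε ^ 2) * (Fintype.card V : ℝ)
  S_le : (#S : ℝ) ≤ 4 * ε ^ 2 * (Fintype.card V : ℝ)
  miss_B : ∀ b ∈ B, (#{p ∈ A ×ˢ B | ¬ T b p.1 p.2} : ℝ) ≤ 3 * ε * (Fintype.card V : ℝ) ^ 2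
  miss_A : ∀ a ∈ A, (#{p ∈ B ×ˢ B | ¬ T a p.1 p.2} : ℝ) ≤ 3 * ε * (Fintype.card V : ℝ) ^ 2
  deg_S : ∀ v ∈ S, ε / 2 * (Fintype.card V : ℝ) ^ 2 ≤ (#{p ∈ B ×ˢ B | T v p.1 p.2} : ℝ)
  deg_B : ∀ b ∈ B, (#{p ∈ B ×ˢ B | T b p.1 p.2} : ℝ) ≤ 2 * ε * (Fintype.card V : ℝ) ^ 2

namespace Ext

variable {V : Type} [Fintype V] {T : V → V → V → Prop} {A B S : Finset V} {ε : ℝ}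

theorem exists_pair (h : Ext T A B S ε) {a : V} (ha : a ∈ A) {Z : Finset V} (hZ : Z ⊆ B)
    (hc : 3 * ε * (Fintype.card V : ℝ) ^ 2 < (#Z : ℝ) ^ 2) : ∃ p ∈ Z, ∃ q ∈ Z, T a p q := by
  by_contra! hn
  have h1 : Z ×ˢ Z ⊆ {p ∈ B ×ˢ B | ¬ T a p.1 p.2} := by
    rintro ⟨x, y⟩ hp
    rw [mem_product] at hp
    exact mem_filter.2 ⟨mem_product.2 ⟨hZ hp.1, hZ hp.2⟩, hn x hp.1 y hp.2⟩
  have h2 := card_le_card h1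
  rw [card_product] at h2
  have h3 : (#Z : ℝ) * #Z ≤ #{p ∈ B ×ˢ B | ¬ T a p.1 p.2} := by exact_mod_cast h2
  have := h.miss_A a ha
  rw [sq (#Z : ℝ)] at hc
  linarith

theorem card_mul_le (h : Ext T A B S ε) {b : V} (hb : b ∈ B) {X Z : Finset V} (hX : X ⊆ A)
    (hZ : Z ⊆ B) (hn : ∀ c ∈ X, ∀ x ∈ Z, ¬ T b c x) :
    (#X : ℝ) * #Z ≤ 3 * ε * (Fintype.card V : ℝ) ^ 2 := by
  have h1 : X ×ˢ Z ⊆ {p ∈ A ×ˢ B | ¬ T b p.1 p.2} := by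
    rintro ⟨x, y⟩ hp
    rw [mem_product] at hp
    exact mem_filter.2 ⟨mem_product.2 ⟨hX hp.1, hZ hp.2⟩, hn x hp.1 y hp.2⟩
  have h2 := card_le_card h1
  rw [card_product] at h2
  have h3 : (#X : ℝ) * #Z ≤ #{p ∈ A ×ˢ B | ¬ T b p.1 p.2} := by exact_mod_cast h2
  exact h3.trans (h.miss_B b hb)

theorem exists_common (h : Ext T A B S ε) {b b' : V} (hb : b ∈ B) (hb' : b' ∈ B)
    {X Z₁ Z₂ : Finset V} (hX : X ⊆ A) (h₁ : Z₁ ⊆ B) (h₂ : Z₂ ⊆ B) {z : ℝ}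
    (hz₁ : z ≤ #Z₁) (hz₂ : z ≤ #Z₂)
    (hc : 6 * ε * (Fintype.card V : ℝ) ^ 2 < (#X : ℝ) * z) :
    ∃ c ∈ X, ∃ x ∈ Z₁, ∃ y ∈ Z₂, T b c x ∧ T b' c y := by
  by_contra! hn
  have h1 := h.card_mul_le hb (X := {c ∈ X | ∀ x ∈ Z₁, ¬ T b c x}) ((filter_subset _ _).trans hX) h₁
    fun c hc => (mem_filter.1 hc).2
  have h2 := h.card_mul_le hb' (X := {c ∈ X | ¬ ∀ x ∈ Z₁, ¬ T b c x})
    ((filter_subset _ _).trans hX) h₂ fun c hc y hy => by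
      rw [mem_filter] at hc
      push Not at hc
      obtain ⟨hc, x, hx, hbx⟩ := hc
      exact hn c hc x hx y hy hbx
  have h3 := card_filter_add_card_filter_not (s := X) (fun c => ∀ x ∈ Z₁, ¬ T b c x)
  have h4 : (#{c ∈ X | ∀ x ∈ Z₁, ¬ T b c x} : ℝ) + #{c ∈ X | ¬ ∀ x ∈ Z₁, ¬ T b c x} = #X := by
    exact_mod_cast h3
  have h5 := mul_le_mul_of_nonneg_left hz₁
    (show (0 : ℝ) ≤ #{c ∈ X | ∀ x ∈ Z₁, ¬ T b c x} by positivity)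
  have h6 := mul_le_mul_of_nonneg_left hz₂
    (show (0 : ℝ) ≤ #{c ∈ X | ¬ ∀ x ∈ Z₁, ¬ T b c x} by positivity)
  rw [← h4] at hc
  linarith

/-- Two vertices of `B` can be connected through one new vertex of `A` and two of `B`. -/
theorem exists_connector (h : Ext T A B S ε) {σ : ℝ} (hσ : 0 < σ) (hε : 24 * ε < σ ^ 2)
    (hn : 8 ≤ σ * Fintype.card V) {W : Finset V} (hA : σ * Fintype.card V ≤ #(A \ W))
    (hB : σ * Fintype.card V ≤ #(B \ W)) {a b : V} (ha : a ∈ B) (hb : b ∈ B) :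
    ∃ I, Disjoint I W ∧ #(I ∩ B) = 2 ∧ #(I \ B) = 1 ∧ PathIn T a b I := by
  set n : ℝ := (Fintype.card V : ℝ) with hn'
  obtain ⟨Z₁, hZ₁, hZc⟩ := exists_subset_card_eq (show #(B \ W) / 2 ≤ #(B \ W) by omega)
  have hc := card_sdiff_add_card_eq_card hZ₁
  have h1 : #(B \ W) ≤ 2 * #Z₁ + 1 := by omega
  have h2 : #(B \ W) ≤ 2 * #((B \ W) \ Z₁) + 1 := by omega
  have h1' : (#(B \ W) : ℝ) ≤ 2 * #Z₁ + 1 := by exact_mod_cast h1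
  have h2' : (#(B \ W) : ℝ) ≤ 2 * #((B \ W) \ Z₁) + 1 := by exact_mod_cast h2
  obtain ⟨c, hcA, x, hx, y, hy, hT₁, hT₂⟩ := h.exists_common ha hb (X := A \ W) (Z₁ := Z₁)
    (Z₂ := (B \ W) \ Z₁) (z := σ * n / 4) sdiff_subset (hZ₁.trans sdiff_subset)
    (sdiff_subset.trans sdiff_subset) (by linarith) (by linarith) (by
      have h3 : (σ * n) * (σ * n / 4) ≤ #(A \ W) * (σ * n / 4) := by gcongr
      have hn0 : 0 < n := by
        by_contra hneg
        push Not at hneg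
        nlinarith
      have h4 : 24 * ε * n ^ 2 < σ ^ 2 * n ^ 2 := by gcongr
      nlinarith)
  have hx' := hZ₁ hx
  rw [mem_sdiff] at hx' hcA
  rw [mem_sdiff, mem_sdiff] at hy
  have hcB : c ∉ B := disjoint_left.1 h.disj_AB hcA.1
  have hxy : x ≠ y := fun e => hy.2 (e ▸ hx)
  have hxc : x ≠ c := fun e => hcB (e ▸ hx'.1)
  have hcy : c ≠ y := fun e => hcB (e ▸ hy.1.1)
  obtain ⟨e1, e2⟩ := card_split (P := {x, y}) (S := {c}) (F := {x, c, y}) (B := B)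
    (by ext; simp; tauto) (by
      intro v hv
      rcases mem_insert.1 hv with rfl | hv
      · exact hx'.1
      · rw [mem_singleton.1 hv]; exact hy.1.1) (by simpa using hcB)
  refine ⟨{x, c, y}, ?_, ?_, ?_, pathIn_three (h.tri.swap₂₃ hT₁) ?_ ?_⟩
  · rw [disjoint_left]
    intro v hv
    simp only [mem_insert, mem_singleton] at hv
    rcases hv with rfl | rfl | rfl
    · exact hx'.2
    · exact hcA.2
    · exact hy.1.2
  · rw [e1, card_pair hxy]
  · rw [e2, card_singleton]
  · exact h.tri.rot (h.tri.rot hT₂)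
  · simp [hxc, hxy, hcy]

/-- A path with one vertex of `A` and four of `B`, with a given middle vertex. -/
theorem exists_five (h : Ext T A B S ε) {v : V} (hv : v ∉ B) {Z : Finset V} (hZ : Z ⊆ B)
    (hp : ∀ Y ⊆ Z, #Z ≤ #Y + 2 → ∃ p ∈ Y, ∃ q ∈ Y, T v p q) :
    ∃ a b P, a ∈ P ∧ b ∈ P ∧ P ⊆ Z ∧ #P = 4 ∧ PathOn T a b (insert v P) := by
  obtain ⟨p, hpZ, q, hq, h1⟩ := hp Z subset_rfl (by omega)
  obtain ⟨p', hp', q', hq', h2⟩ := hp (Z \ {p, q}) sdiff_subset (by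
    have := le_card_sdiff {p, q} Z
    have := card_le_two (a := p) (b := q)
    omega)
  simp only [mem_sdiff, mem_insert, mem_singleton, not_or] at hp' hq'
  have h1' : T p q v := h.tri.rot (h.tri.rot h1)
  have e1 : p ≠ q := h.tri.ne h1'
  have e2 : p' ≠ q' := h.tri.ne (h.tri.rot (h.tri.rot h2))
  have hnP : [p, q, p', q'].Nodup := by
    simp only [List.nodup_cons, List.mem_cons, not_or, List.not_mem_nil, not_false_eq_true,
      List.nodup_nil, and_true]
    exact ⟨⟨e1, Ne.symm hp'.2.1, Ne.symm hq'.2.1⟩, ⟨Ne.symm hp'.2.2, Ne.symm hq'.2.2⟩, e2⟩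
  have hPZ : ({p, q, p', q'} : Finset V) ⊆ Z := by
    intro x hx
    simp only [mem_insert, mem_singleton] at hx
    rcases hx with rfl | rfl | rfl | rfl
    exacts [hpZ, hq, hp'.1, hq'.1]
  have hvP : ∀ x ∈ ({p, q, p', q'} : Finset V), x ≠ v := fun x hx e => hv (e ▸ hZ (hPZ hx))
  refine ⟨p, q', {p, q, p', q'}, by simp, by simp, hPZ, ?_, ?_⟩
  · have h3 := List.toFinset_card_of_nodup hnP
    simpa using h3
  · have h3 := pathOn_five h1' h2 (by
      simp only [List.nodup_cons, List.mem_cons, not_or, List.not_mem_nil, not_false_eq_true,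
        List.nodup_nil, and_true] at hnP ⊢
      exact ⟨⟨e1, hvP p (by simp), hnP.1.2⟩, ⟨hvP q (by simp), hnP.2.1⟩,
        ⟨(hvP p' (by simp)).symm, (hvP q' (by simp)).symm⟩, e2⟩)
    convert h3 using 1
    ext x
    simp only [mem_insert, mem_singleton]
    tauto

end Ext

namespace Ext

variable {V : Type} [Fintype V] {T : V → V → V → Prop} {A B S : Finset V} {ε : ℝ}

theorem card_add (h : Ext T A B S ε) : #A + #B + #S = Fintype.card V := by
  rw [← card_univ, ← card_union_of_disjoint h.disj_AB, ← card_union_of_disjoint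
    (disjoint_union_left.2 ⟨h.disj_AS, h.disj_SB.symm⟩)]
  congr 1
  ext v
  simpa [or_assoc] using h.cover v

/-- Lower bound for the degree inside `B`. -/
theorem card_lk_add_le (b : V) (hb : b ∈ B) (hT : IsTri T) :
    #(lk T b) + (#B - 1) * (#B - 2) ≤
      #{p ∈ B ×ˢ B | T b p.1 p.2} + (Fintype.card V - 1) * (Fintype.card V - 2) := by
  have h1 : lk T b ⊆ {p ∈ B ×ˢ B | T b p.1 p.2} ∪
      ((univ.erase b).offDiag \ (B.erase b).offDiag) := by
    rintro ⟨p, q⟩ hp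
    have hp : T b p q := (mem_filter.1 hp).2
    have e1 : b ≠ p := hT.ne hp
    have e2 : b ≠ q := hT.ne (hT.swap₂₃ hp)
    have e3 : p ≠ q := hT.ne (hT.rot (hT.rot hp))
    simp only [mem_union, mem_filter, mem_product, mem_sdiff, mem_offDiag, mem_erase, mem_univ]
    by_cases hpq : p ∈ B ∧ q ∈ B
    · exact Or.inl ⟨hpq, hp⟩
    · refine Or.inr ⟨⟨⟨e1.symm, trivial⟩, ⟨e2.symm, trivial⟩, e3⟩, fun h => hpq ⟨h.1.2, h.2.1.2⟩⟩
  have h2 : (B.erase b).offDiag ⊆ (univ.erase b).offDiag :=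
    offDiag_mono (erase_subset_erase _ (subset_univ _))
  have h3 := card_sdiff_add_card_eq_card h2
  have h4 := (card_le_card h1).trans (card_union_le _ _)
  have h5 : ∀ C : Finset V, b ∈ C → #(C.erase b).offDiag = (#C - 1) * (#C - 2) := by
    intro C hC
    rw [offDiag_card, card_erase_of_mem hC]
    have : #C - 2 = (#C - 1) - 1 := by omega
    rw [this]
    generalize #C - 1 = k
    rw [Nat.mul_sub k k 1, mul_one]
  rw [h5 B hb, h5 univ (mem_univ _), card_univ] at h3
  omega

/-- If no edge lies in `B \ W`, then the edges of `B` meet `W`. -/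
theorem sum_le_of_no_edge (hT : IsTri T) (W : Finset V)
    (hn : ∀ a ∈ B \ W, ∀ b ∈ B \ W, ∀ c ∈ B \ W, ¬ T a b c) :
    ∑ b ∈ B \ W, #{p ∈ B ×ˢ B | T b p.1 p.2} ≤
      2 * ∑ w ∈ W ∩ B, #{p ∈ B ×ˢ B | T w p.1 p.2} := by
  obtain ⟨Y, hY⟩ : ∃ Y : Finset (Σ _ : V, V × V),
    Y = (W ∩ B).sigma fun w => {p ∈ B ×ˢ B | T w p.1 p.2} := ⟨_, rfl⟩
  have h1 : ((B \ W).sigma fun b => {p ∈ B ×ˢ B | T b p.1 p.2}) ⊆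
      Y.image (fun s => (⟨s.2.1, s.1, s.2.2⟩ : Σ _ : V, V × V)) ∪
      Y.image (fun s => (⟨s.2.1, s.2.2, s.1⟩ : Σ _ : V, V × V)) := by
    rintro ⟨b, p, q⟩ hs
    simp only [mem_sigma, mem_filter, mem_product] at hs
    obtain ⟨hb, ⟨hp, hq⟩, ht⟩ := hs
    rw [mem_union, mem_image, mem_image]
    by_cases hpW : p ∈ W
    · left
      refine ⟨⟨p, b, q⟩, ?_, rfl⟩
      rw [hY]
      simp only [mem_sigma, mem_filter, mem_product, mem_inter]
      exact ⟨⟨hpW, hp⟩, ⟨(mem_sdiff.1 hb).1, hq⟩, hT.swap₁₂ ht⟩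
    by_cases hqW : q ∈ W
    · right
      refine ⟨⟨q, b, p⟩, ?_, rfl⟩
      rw [hY]
      simp only [mem_sigma, mem_filter, mem_product, mem_inter]
      exact ⟨⟨hqW, hq⟩, ⟨(mem_sdiff.1 hb).1, hp⟩, hT.rot ht⟩
    · exact absurd ht (hn b hb p (mem_sdiff.2 ⟨hp, hpW⟩) q (mem_sdiff.2 ⟨hq, hqW⟩))
  have h2 := (card_le_card h1).trans (card_union_le _ _)
  have h3 : #Y = ∑ w ∈ W ∩ B, #{p ∈ B ×ˢ B | T w p.1 p.2} := by rw [hY, card_sigma]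
  rw [card_sigma] at h2
  have h4 := card_image_le (s := Y) (f := fun s => (⟨s.2.1, s.1, s.2.2⟩ : Σ _ : V, V × V))
  have h5 := card_image_le (s := Y) (f := fun s => (⟨s.2.1, s.2.2, s.1⟩ : Σ _ : V, V × V))
  omega

/-- Two edges inside `B` meeting in at most one vertex. -/
theorem exists_two_edges (hT : IsTri T) (hB : 5 ≤ #B)
    (hd : ∀ b ∈ B, 4 ≤ #{p ∈ B ×ˢ B | T b p.1 p.2}) :
    ∃ L F, Sys T L F ∧ (∀ y ∈ L, y.1 ∈ B ∧ y.2 ∈ B) ∧ F ⊆ B ∧ #F = L.length + 4 ∧ #F ≤ 6 := by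
  obtain ⟨ℰ, hℰ⟩ : ∃ ℰ : Finset V → Prop, ∀ e, ℰ e ↔ ∃ a ∈ B, ∃ b ∈ B, ∃ c ∈ B, T a b c ∧
    e = {a, b, c} := ⟨_, fun _ => Iff.rfl⟩
  have hc3 : ∀ e, ℰ e → #e = 3 ∧ e ⊆ B := by
    intro e he
    obtain ⟨a, ha, b, hb, c, hc, ht, rfl⟩ := (hℰ e).1 he
    refine ⟨card_eq_three.2 ⟨a, b, c, hT.ne ht, hT.ne (hT.swap₂₃ ht),
      hT.ne (hT.rot (hT.rot ht)), rfl⟩, ?_⟩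
    intro x hx
    simp only [mem_insert, mem_singleton] at hx
    rcases hx with rfl | rfl | rfl <;> assumption
  have hend : ∀ e, ℰ e → ∃ a b, a ∈ e ∧ b ∈ e ∧ PathOn T a b e := by
    intro e he
    obtain ⟨a, ha, b, hb, c, hc, ht, rfl⟩ := (hℰ e).1 he
    refine ⟨a, c, by simp, by simp, pathOn_three ht ?_⟩
    simp [hT.ne ht, hT.ne (hT.swap₂₃ ht), hT.ne (hT.rot (hT.rot ht))]
  have hmid : ∀ e, ℰ e → ∀ x ∈ e, ∃ p q, T p q x ∧ e = {p, q, x} := by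
    intro e he x hx
    obtain ⟨a, ha, b, hb, c, hc, ht, rfl⟩ := (hℰ e).1 he
    simp only [mem_insert, mem_singleton] at hx
    rcases hx with rfl | rfl | rfl
    · exact ⟨b, c, hT.rot (hT.rot ht), by ext; simp; tauto⟩
    · exact ⟨a, c, hT.swap₂₃ ht, by ext; simp; tauto⟩
    · exact ⟨a, b, ht, rfl⟩
  have htwo : ∀ b ∈ B, ∃ e f, ℰ e ∧ ℰ f ∧ b ∈ e ∧ b ∈ f ∧ e ≠ f := by
    intro b hb
    obtain ⟨⟨p, q⟩, hpq⟩ := card_pos.1 (lt_of_lt_of_le (by norm_num) (hd b hb))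
    have h1 : 2 < #{p ∈ B ×ˢ B | T b p.1 p.2} := lt_of_lt_of_le (by norm_num) (hd b hb)
    obtain ⟨⟨p', q'⟩, hpq', hne⟩ := exists_mem_notMem_of_card_lt_card
      (s := {(p, q), (q, p)}) (lt_of_le_of_lt card_le_two h1)
    simp only [mem_filter, mem_product] at hpq hpq'
    refine ⟨{b, p, q}, {b, p', q'}, (hℰ _).2 ⟨b, hb, p, hpq.1.1, q, hpq.1.2, hpq.2, rfl⟩,
      (hℰ _).2 ⟨b, hb, p', hpq'.1.1, q', hpq'.1.2, hpq'.2, rfl⟩, by simp, by simp, fun he => hne ?_⟩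
    have e1 : b ≠ p := hT.ne hpq.2
    have e2 : b ≠ q := hT.ne (hT.swap₂₃ hpq.2)
    have e1' : b ≠ p' := hT.ne hpq'.2
    have e2' : b ≠ q' := hT.ne (hT.swap₂₃ hpq'.2)
    have e3' : p' ≠ q' := hT.ne (hT.rot (hT.rot hpq'.2))
    have h3 : p' ∈ ({b, p, q} : Finset V) := by rw [he]; simp
    have h4 : q' ∈ ({b, p, q} : Finset V) := by rw [he]; simp
    simp only [mem_insert, mem_singleton, Prod.mk.injEq] at h3 h4 ⊢
    rcases h3 with h3 | h3 | h3 <;> rcases h4 with h4 | h4 | h4 <;> subst h3 <;>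
      first | exact absurd h4.symm e2' | exact absurd rfl e1' | exact absurd h4.symm e3' | tauto
  have key : ∃ e f, ℰ e ∧ ℰ f ∧ #(e ∩ f) ≤ 1 := by
    by_contra! hno
    obtain ⟨b₀, hb₀⟩ := card_pos.1 (show 0 < #B by omega)
    obtain ⟨g, -, hg, -⟩ := htwo b₀ hb₀
    have h5 : 2 ≤ #(B \ g) := by
      have := le_card_sdiff g B
      have := (hc3 g hg).1
      omega
    obtain ⟨b, hb, b', hb', hbb⟩ := one_lt_card.1 h5
    rw [mem_sdiff] at hb hb'
    have hform : ∀ x, x ∉ g → ∀ e, ℰ e → x ∈ e → ∃ P ⊆ g, #P = 2 ∧ e = insert x P := by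
      intro x hx e he hxe
      refine ⟨e.erase x, ?_, by rw [card_erase_of_mem hxe, (hc3 e he).1], (insert_erase hxe).symm⟩
      have h6 : e ∩ g ⊆ e.erase x := fun y hy =>
        mem_erase.2 ⟨fun h => hx (h ▸ (mem_inter.1 hy).2), (mem_inter.1 hy).1⟩
      have h7 : e ∩ g = e.erase x := by
        refine eq_of_subset_of_card_le h6 ?_
        rw [card_erase_of_mem hxe, (hc3 e he).1]
        exact hno e g he hg
      rw [← h7]
      exact inter_subset_right
    obtain ⟨e, f, he, hf, hbe, hbf, hef⟩ := htwo b hb.1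
    obtain ⟨e', -, he', -, hbe', -, -⟩ := htwo b' hb'.1
    obtain ⟨P', hP'g, hP'c, rfl⟩ := hform b' hb'.2 e' he' hbe'
    have huse : ∀ e, ℰ e → b ∈ e → e = insert b P' := by
      intro e he hbe
      obtain ⟨P, hPg, hPc, rfl⟩ := hform b hb.2 e he hbe
      have h8 : insert b P ∩ insert b' P' ⊆ P ∩ P' := by
        intro y hy
        simp only [mem_inter, mem_insert] at hy ⊢
        rcases hy with ⟨rfl | h1, rfl | h2⟩
        · exact absurd rfl hbb
        · exact absurd (hP'g h2) hb.2
        · exact absurd (hPg h1) hb'.2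
        · exact ⟨h1, h2⟩
      have h9 := (hno _ _ he he').trans_le (card_le_card h8)
      have h10 : P ∩ P' = P := eq_of_subset_of_card_le inter_subset_left (by omega)
      have h11 : P ∩ P' = P' := eq_of_subset_of_card_le inter_subset_right (by omega)
      rw [← h10, h11]
    exact hef ((huse e he hbe).trans (huse f hf hbf).symm)
  obtain ⟨e, f, he, hf, hef⟩ := key
  obtain ⟨he3, heB⟩ := hc3 e he
  obtain ⟨hf3, hfB⟩ := hc3 f hf
  have hun := card_union_add_card_inter e f
  rcases Nat.lt_or_ge 0 #(e ∩ f) with hpos | hz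
  · obtain ⟨x, hx⟩ := card_pos.1 hpos
    have huniq : ∀ y, y ∈ e → y ∈ f → y = x := fun y hy hy' =>
      card_le_one.1 hef y (mem_inter.2 ⟨hy, hy'⟩) x hx
    rw [mem_inter] at hx
    obtain ⟨p, q, h1, rfl⟩ := hmid e he x hx.1
    obtain ⟨r, s, h2, rfl⟩ := hmid f hf x hx.2
    have n1 := hT.ne h1
    have n2 := hT.ne (hT.swap₂₃ h1)
    have n3 := hT.ne (hT.rot (hT.rot h1))
    have n4 := hT.ne h2
    have n5 := hT.ne (hT.swap₂₃ h2)
    have n6 := hT.ne (hT.rot (hT.rot h2))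
    have n7 : ∀ y ∈ ({p, q} : Finset V), ∀ z ∈ ({r, s} : Finset V), y ≠ z := by
      intro y hy z hz e
      subst e
      have := huniq y (by simp at hy ⊢; tauto) (by simp at hz ⊢; tauto)
      simp at hy
      subst this
      rcases hy with h | h
      exacts [n2 h.symm, n3 h.symm]
    have hnd : [p, q, x, r, s].Nodup := by
      simp only [List.nodup_cons, List.mem_cons, not_or, List.not_mem_nil, not_false_eq_true,
        List.nodup_nil, and_true]
      exact ⟨⟨n1, n2, n7 p (by simp) r (by simp), n7 p (by simp) s (by simp)⟩,
        ⟨n3, n7 q (by simp) r (by simp), n7 q (by simp) s (by simp)⟩, ⟨n5.symm, n6.symm⟩, n4⟩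
    have hsub : ({p, q, x, r, s} : Finset V) ⊆ B := by
      intro y hy
      simp only [mem_insert, mem_singleton] at hy
      rcases hy with rfl | rfl | rfl | rfl | rfl
      · exact heB (by simp)
      · exact heB (by simp)
      · exact heB (by simp)
      · exact hfB (by simp)
      · exact hfB (by simp)
    have h5 : #({p, q, x, r, s} : Finset V) = 5 := by
      simpa using List.toFinset_card_of_nodup hnd
    refine ⟨[(p, s)], {p, q, x, r, s}, Sys.singleton (pathOn_five h1 (hT.rot h2) hnd), ?_, hsub,
      by rw [h5]; rfl, by rw [h5]; norm_num⟩
    intro y hy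
    rw [List.mem_singleton.1 hy]
    exact ⟨hsub (by simp), hsub (by simp)⟩
  · have hd : Disjoint e f := by
      rw [disjoint_iff_inter_eq_empty, ← card_eq_zero]
      omega
    obtain ⟨a, b, ha, hb, h1⟩ := hend e he
    obtain ⟨a', b', ha', hb', h2⟩ := hend f hf
    refine ⟨[(a, b), (a', b')], e ∪ f, Sys.cons h1 (Sys.singleton h2) hd, ?_, union_subset heB hfB,
      ?_, by omega⟩
    · intro y hy
      simp only [List.mem_cons, List.not_mem_nil, or_false] at hy
      rcases hy with rfl | rfl
      exacts [⟨heB ha, heB hb⟩, ⟨hfB ha', hfB hb'⟩]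
    · simp
      omega

end Ext

namespace Ext

variable {V : Type} [Fintype V] {T : V → V → V → Prop} {A B S : Finset V} {ε : ℝ}

theorem le_A (h : Ext T A B S ε) : (1 / 4 - 8 * ε ^ 2) * (Fintype.card V : ℝ) ≤ #A := by
  have h1 : (#A : ℝ) + #B + #S = Fintype.card V := by exact_mod_cast h.card_add
  linarith [h.B_le, h.S_le]

theorem card_inter_S (h : Ext T A B S ε) : #(S ∩ B) = 0 ∧ #(S \ B) = #S := by
  rw [disjoint_iff_inter_eq_empty.1 h.disj_SB, sdiff_eq_self_of_disjoint h.disj_SB]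
  exact ⟨rfl, rfl⟩

theorem card_le_A (h : Ext T A B S ε) (W : Finset V) : #A ≤ #(A \ W) + #(W \ B) := by
  have h1 : A ⊆ (A \ W) ∪ (W \ B) := by
    intro v hv
    have := disjoint_left.1 h.disj_AB hv
    simp only [mem_union, mem_sdiff]
    tauto
  exact (card_le_card h1).trans (card_union_le _ _)

theorem card_le_B (W : Finset V) : #B ≤ #(B \ W) + #(W ∩ B) := by
  have := card_sdiff_add_card_inter B W
  rw [inter_comm] at this
  omega

/-- Blocks with one vertex of `A` and two of `B`. -/
theorem exists_blocks_A (h : Ext T A B S ε) (hε0 : 0 < ε) (hε : ε ≤ 1 / 1000)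
    (hn : 0 < Fintype.card V) {s : ℕ} (hs : (s : ℝ) ≤ 8 * ε ^ 2 * (Fintype.card V : ℝ)) :
    ∃ L F, L.length = s ∧ (∀ y ∈ L, y.1 ∈ B ∧ y.2 ∈ B) ∧ Sys T L F ∧ Disjoint F S ∧
      #(F ∩ B) = 2 * s ∧ #(F \ B) = 1 * s := by
  obtain ⟨hS1, hS2⟩ := h.card_inter_S
  refine exists_greedy (KA := 2 * s) (KB := #S + s) ?_ s S (by omega) (by omega)
  intro W hWA hWB
  have hn' : (0 : ℝ) < Fintype.card V := by exact_mod_cast hn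
  have e2 : ε ^ 2 * (Fintype.card V : ℝ) ≤ 1 / 1000 * (Fintype.card V : ℝ) := by
    gcongr
    nlinarith
  have hA : 0 < #(A \ W) := by
    by_contra hz
    have h1 := h.card_le_A W
    have h2 : #A ≤ #S + s := by omega
    have h3 : (#A : ℝ) ≤ #S + s := by exact_mod_cast h2
    linarith [h.le_A, h.S_le]
  have hB : 1 / 2 * (Fintype.card V : ℝ) ≤ #(B \ W) := by
    have h1 := card_le_B (B := B) W
    have h2 : #B ≤ #(B \ W) + 2 * s := by omega
    have h3 : (#B : ℝ) ≤ #(B \ W) + 2 * s := by exact_mod_cast h2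
    linarith [h.le_B]
  obtain ⟨a, ha⟩ := card_pos.1 hA
  rw [mem_sdiff] at ha
  obtain ⟨p, hp, q, hq, ht⟩ := h.exists_pair ha.1 (Z := B \ W) sdiff_subset (by
    have : (1 / 2 * (Fintype.card V : ℝ)) ^ 2 ≤ (#(B \ W) : ℝ) ^ 2 := by gcongr
    nlinarith [sq_nonneg (Fintype.card V : ℝ), pow_pos hn' 2])
  rw [mem_sdiff] at hp hq
  have haB := disjoint_left.1 h.disj_AB ha.1
  have e1 := h.tri.ne ht
  have e2 := h.tri.ne (h.tri.swap₂₃ ht)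
  have e3 := h.tri.ne (h.tri.rot (h.tri.rot ht))
  obtain ⟨c1, c2⟩ := card_split (P := {p, q}) (S := {a}) (F := {p, a, q}) (B := B)
    (by ext; simp; tauto) (by
      intro v hv
      rcases mem_insert.1 hv with rfl | hv
      · exact hp.1
      · rw [mem_singleton.1 hv]; exact hq.1) (by simpa using haB)
  refine ⟨p, q, {p, a, q}, hp.1, hq.1, ?_, ?_, ?_, pathOn_three (h.tri.swap₁₂ ht) (by
    simp [e1.symm, e2, e3])⟩
  · rw [disjoint_left]
    intro v hv
    simp only [mem_insert, mem_singleton] at hv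
    rcases hv with rfl | rfl | rfl
    exacts [hp.2, ha.2, hq.2]
  · rw [c1, card_pair e3]
  · rw [c2, card_singleton]

theorem pathOn_edge (hT : IsTri T) {a b c : V} (ht : T a b c) :
    PathOn T a c {a, b, c} ∧ #({a, b, c} : Finset V) = 3 := by
  have e1 := hT.ne ht
  have e2 := hT.ne (hT.swap₂₃ ht)
  have e3 := hT.ne (hT.rot (hT.rot ht))
  exact ⟨pathOn_three ht (by simp [e1, e2, e3]), card_eq_three.2 ⟨a, b, c, e1, e2, e3, rfl⟩⟩

theorem edge_subset {a b c : V} (ha : a ∈ B) (hb : b ∈ B) (hc : c ∈ B) :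
    ({a, b, c} : Finset V) ⊆ B := by
  intro x hx
  simp only [mem_insert, mem_singleton] at hx
  rcases hx with rfl | rfl | rfl <;> assumption

/-- Disjoint edges inside `B`. -/
theorem exists_blocks_B (h : Ext T A B S ε) (hε0 : 0 < ε) (hε : ε ≤ 1 / 1000)
    (hn : 0 < Fintype.card V) {t u m : ℕ} (ht : (t : ℝ) ≤ 8 * ε ^ 2 * (Fintype.card V : ℝ))
    (htu : t ≤ 4 * u) (hu : 0 < u) (hm : (Fintype.card V : ℝ) / 2 ≤ m)
    (hd : ∀ b ∈ B, 2 * u * m ≤ #{p ∈ B ×ˢ B | T b p.1 p.2}) :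
    ∃ L F, L.length = t ∧ (∀ y ∈ L, y.1 ∈ B ∧ y.2 ∈ B) ∧ Sys T L F ∧ Disjoint F ∅ ∧
      #(F ∩ B) = 3 * t ∧ #(F \ B) = 0 * t := by
  refine exists_greedy (KA := 3 * t) (KB := 0) ?_ t ∅ (by simp) (by simp)
  intro W hWA hWB
  have hn' : (0 : ℝ) < Fintype.card V := by exact_mod_cast hn
  obtain ⟨n, hnn⟩ : ∃ n : ℝ, n = Fintype.card V := ⟨_, rfl⟩
  by_cases hne : ∀ a ∈ B \ W, ∀ b ∈ B \ W, ∀ c ∈ B \ W, ¬ T a b c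
  · exfalso
    have h1 := sum_le_of_no_edge h.tri W hne
    have h2 : #(B \ W) * (2 * u * m) ≤ ∑ b ∈ B \ W, #{p ∈ B ×ˢ B | T b p.1 p.2} := by
      rw [← smul_eq_mul]
      exact card_nsmul_le_sum _ _ _ fun b hb => hd b (mem_sdiff.1 hb).1
    have h3 : (∑ w ∈ W ∩ B, (#{p ∈ B ×ˢ B | T w p.1 p.2} : ℝ)) ≤
        #(W ∩ B) • (2 * ε * (Fintype.card V : ℝ) ^ 2) :=
      sum_le_card_nsmul _ _ _ fun w hw => h.deg_B w (mem_inter.1 hw).2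
    rw [nsmul_eq_mul] at h3
    have h4 : ((#(B \ W) * (2 * u * m) : ℕ) : ℝ) ≤
        2 * ∑ w ∈ W ∩ B, (#{p ∈ B ×ˢ B | T w p.1 p.2} : ℝ) := by
      exact_mod_cast h2.trans h1
    have h5 := card_le_B (B := B) W
    have h6 : #B ≤ #(B \ W) + 3 * t := by omega
    have h6' : (#B : ℝ) ≤ #(B \ W) + 3 * t := by exact_mod_cast h6
    have h7 : (#(W ∩ B) : ℝ) ≤ 12 * u := by
      have : #(W ∩ B) ≤ 12 * u := by omega
      exact_mod_cast this
    have e2 : ε ^ 2 * (Fintype.card V : ℝ) ≤ 1 / 1000 * (Fintype.card V : ℝ) := by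
      gcongr
      nlinarith
    have h8 : 1 / 2 * (Fintype.card V : ℝ) ≤ #(B \ W) := by linarith [h.le_B]
    have hu' : (0 : ℝ) < u := by exact_mod_cast hu
    push_cast at h4
    rw [← hnn] at hn' hm h8 h3
    have h9 : (1 / 2 * n) * (2 * u * (n / 2)) ≤ #(B \ W) * (2 * u * m) := by gcongr
    have h10 : #(W ∩ B) * (2 * ε * n ^ 2) ≤ 12 * u * (2 * ε * n ^ 2) := by gcongr
    have h11 : u * n ^ 2 * (1 / 2 - 48 * ε) ≤ 0 := by nlinarith
    have h12 : 0 < u * n ^ 2 * (1 / 2 - 48 * ε) :=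
      mul_pos (mul_pos hu' (pow_pos hn' 2)) (by linarith)
    linarith
  · push Not at hne
    obtain ⟨a, ha, b, hb, c, hc, hT⟩ := hne
    rw [mem_sdiff] at ha hb hc
    obtain ⟨hP, hc3⟩ := pathOn_edge h.tri hT
    have hsub := edge_subset ha.1 hb.1 hc.1
    refine ⟨a, c, {a, b, c}, ha.1, hc.1, ?_, ?_, ?_, hP⟩
    · rw [disjoint_left]
      intro x hx
      simp only [mem_insert, mem_singleton] at hx
      rcases hx with rfl | rfl | rfl
      exacts [ha.2, hb.2, hc.2]
    · rw [inter_eq_left.2 hsub, hc3]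
    · rw [sdiff_eq_empty_iff_subset.2 hsub, card_empty]

/-- A small path system which corrects the sizes of the parts. -/
theorem exists_balancing (h : Ext T A B S ε) (hε0 : 0 < ε) (hε : ε ≤ 1 / 1000)
    (hn : 1 ≤ ε ^ 2 * (Fintype.card V : ℝ)) (heven : Even (Fintype.card V))
    (hdeg : ∀ b, (Fintype.card V - 1) * (Fintype.card V - 2) +
      2 * (if 4 ∣ Fintype.card V then 2 else 1) ≤
        #(lk T b) + (3 * Fintype.card V / 4) * (3 * Fintype.card V / 4 - 1)) :
    ∃ L F, Sys T L F ∧ (∀ y ∈ L, y.1 ∈ B ∧ y.2 ∈ B) ∧ Disjoint F S ∧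
      #(F ∩ B) + 3 * Fintype.card V = 3 * #(F \ B) + L.length + 4 * #B ∧
      (#F : ℝ) ≤ 24 * ε ^ 2 * (Fintype.card V : ℝ) := by
  have hnbig : (1000000 : ℝ) ≤ Fintype.card V := by
    have : ε ^ 2 * (Fintype.card V : ℝ) ≤ (1 / 1000) ^ 2 * (Fintype.card V : ℝ) := by gcongr
    linarith
  have hnn : 1000000 ≤ Fintype.card V := by exact_mod_cast hnbig
  obtain ⟨k, hk⟩ := heven
  have hsplit : ∀ F : Finset V, (#F : ℝ) = #(F ∩ B) + #(F \ B) := fun F => by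
    exact_mod_cast (card_inter_add_card_sdiff F B).symm
  rcases lt_or_ge (3 * Fintype.card V) (4 * #B) with hlt | hge
  · obtain ⟨u, hu⟩ : ∃ u, #B = 3 * Fintype.card V / 4 + 1 + u :=
      ⟨#B - (3 * Fintype.card V / 4 + 1), by omega⟩
    obtain ⟨m, hm⟩ : ∃ m, m = 3 * Fintype.card V / 4 := ⟨_, rfl⟩
    obtain ⟨c, hc⟩ : ∃ c, c = if 4 ∣ Fintype.card V then 2 else 1 := ⟨_, rfl⟩
    have hc' : c = 2 ∧ 4 ∣ Fintype.card V ∨ c = 1 ∧ ¬ 4 ∣ Fintype.card V := by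
      by_cases h4 : 4 ∣ Fintype.card V
      · left; rw [hc, if_pos h4]; exact ⟨rfl, h4⟩
      · right; rw [hc, if_neg h4]; exact ⟨rfl, h4⟩
    rw [← hm] at hu
    rw [← hm, ← hc] at hdeg
    have hd : ∀ b ∈ B, 2 * u * m + 2 * c ≤ #{p ∈ B ×ˢ B | T b p.1 p.2} := by
      intro b hb
      have h1 := card_lk_add_le b hb h.tri
      have h2 := hdeg b
      rw [hu] at h1
      obtain ⟨m', rfl⟩ : ∃ m', m = m' + 1 := ⟨m - 1, by omega⟩
      have e1 : (m' + 1 + 1 + u - 1) * (m' + 1 + 1 + u - 2) = (m' + 1 + u) * (m' + u) := by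
        congr 1 <;> omega
      rw [e1] at h1
      have e2 : (m' + 1) * (m' + 1 - 1) = (m' + 1) * m' := rfl
      rw [e2] at h2
      have e3 : (m' + 1 + u) * (m' + u) + u = (m' + 1) * m' + 2 * u * (m' + 1) + u * u := by ring
      have e4 : u ≤ u * u := Nat.le_mul_self u
      omega
    have hcnt : 3 * Fintype.card V + 2 * (2 * u + c) = 4 * #B := by omega
    rcases Nat.eq_zero_or_pos u with rfl | hupos
    · rcases hc' with ⟨hc2, h4⟩ | ⟨hc1, h4⟩
      · obtain ⟨L, F, hS, hE, hF, hFc, hF6⟩ := exists_two_edges (B := B) h.tri (by omega)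
          fun b hb => le_trans (by omega) (hd b hb)
        refine ⟨L, F, hS, hE, h.disj_SB.symm.mono_left hF, ?_, ?_⟩
        · rw [inter_eq_left.2 hF, sdiff_eq_empty_iff_subset.2 hF, card_empty]
          omega
        · have : (#F : ℝ) ≤ 6 := by exact_mod_cast hF6
          linarith
      · obtain ⟨b, hb⟩ := card_pos.1 (show 0 < #B by omega)
        obtain ⟨⟨p, q⟩, hpq⟩ := card_pos.1 (lt_of_lt_of_le (by omega) (hd b hb))
        simp only [mem_filter, mem_product] at hpq
        obtain ⟨hP, hc3⟩ := pathOn_edge h.tri hpq.2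
        have hF := edge_subset hb hpq.1.1 hpq.1.2
        refine ⟨[(b, q)], {b, p, q}, Sys.singleton hP, ?_, h.disj_SB.symm.mono_left hF, ?_, ?_⟩
        · intro y hy
          rw [List.mem_singleton.1 hy]
          exact ⟨hb, hpq.1.2⟩
        · rw [inter_eq_left.2 hF, sdiff_eq_empty_iff_subset.2 hF, card_empty, hc3]
          simp
          omega
        · rw [hc3]
          norm_num
          linarith
    · have ht : ((2 * u + c : ℕ) : ℝ) ≤ 8 * ε ^ 2 * (Fintype.card V : ℝ) := by
        have : (3 * (Fintype.card V : ℝ) + 2 * ((2 * u + c : ℕ) : ℝ)) = 4 * #B := by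
          exact_mod_cast hcnt
        linarith [h.B_le]
      obtain ⟨L, F, hL, hE, hS, -, h1, h2⟩ := h.exists_blocks_B hε0 hε (by omega) ht
        (u := u) (m := m) (by omega) hupos (by
          have : Fintype.card V ≤ 2 * m := by omega
          have : (Fintype.card V : ℝ) ≤ 2 * m := by exact_mod_cast this
          linarith) fun b hb => le_trans (by omega) (hd b hb)
      refine ⟨L, F, hS, hE, h.disj_SB.symm.mono_left ?_, by omega, ?_⟩
      · rw [← sdiff_eq_empty_iff_subset, ← card_eq_zero]
        omega
      · rw [hsplit, h1, h2]
        push_cast at ht ⊢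
        linarith
  · obtain ⟨s, hs⟩ : ∃ s, 3 * Fintype.card V = 4 * #B + 2 * s :=
      ⟨(3 * Fintype.card V - 4 * #B) / 2, by omega⟩
    have hs' : (s : ℝ) ≤ 8 * ε ^ 2 * (Fintype.card V : ℝ) := by
      have : 3 * (Fintype.card V : ℝ) = 4 * #B + 2 * s := by exact_mod_cast hs
      linarith [h.le_B]
    obtain ⟨L, F, hL, hE, hS, hFS, h1, h2⟩ := h.exists_blocks_A hε0 hε (by omega) hs'
    refine ⟨L, F, hS, hE, hFS, by omega, ?_⟩
    rw [hsplit, h1, h2]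
    push_cast
    linarith

end Ext

namespace Ext

variable {V : Type} [Fintype V] {T : V → V → V → Prop} {A B S : Finset V} {ε : ℝ}

theorem exists_pair_S (h : Ext T A B S ε) {v : V} (hv : v ∈ S) {Y : Finset V}
    (hY : 2 * (#(B \ Y) : ℝ) < ε / 2 * (Fintype.card V : ℝ)) : ∃ p ∈ Y, ∃ q ∈ Y, T v p q := by
  by_contra! hn
  have h1 : ({p ∈ B ×ˢ B | T v p.1 p.2} : Finset (V × V)) ⊆ (B \ Y) ×ˢ B ∪ B ×ˢ (B \ Y) := by
    rintro ⟨p, q⟩ hpq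
    simp only [mem_filter, mem_product, mem_union, mem_sdiff] at hpq ⊢
    by_cases hp : p ∈ Y
    · exact Or.inr ⟨hpq.1.1, hpq.1.2, fun hq => hn p hp q hq hpq.2⟩
    · exact Or.inl ⟨⟨hpq.1.1, hp⟩, hpq.1.2⟩
  have h2 := (card_le_card h1).trans (card_union_le _ _)
  rw [card_product, card_product] at h2
  have h3 : (#{p ∈ B ×ˢ B | T v p.1 p.2} : ℝ) ≤ #(B \ Y) * #B + #B * #(B \ Y) := by
    exact_mod_cast h2
  have h4 := h.deg_S v hv
  have h5 : (#B : ℝ) ≤ Fintype.card V := by exact_mod_cast card_le_univ B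
  have h6 : (#(B \ Y) : ℝ) * #B ≤ #(B \ Y) * Fintype.card V := by gcongr
  have h7 : (0 : ℝ) < Fintype.card V := by
    have : (0 : ℝ) < #S := by exact_mod_cast card_pos.2 ⟨v, hv⟩
    have h8 : (#S : ℝ) ≤ Fintype.card V := by exact_mod_cast card_le_univ S
    linarith
  have h8 : 2 * (#(B \ Y) : ℝ) * Fintype.card V < ε / 2 * Fintype.card V * Fintype.card V := by
    gcongr
  nlinarith

/-- Disjoint paths through the vertices of `S`, avoiding a given small set. -/
theorem exists_blocks_S (h : Ext T A B S ε) (hε0 : 0 < ε) (hε : ε ≤ 1 / 1000)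
    (hn : 1 ≤ ε ^ 2 * (Fintype.card V : ℝ)) {W : Finset V}
    (hW : (#W : ℝ) ≤ 24 * ε ^ 2 * (Fintype.card V : ℝ)) (hWS : Disjoint W S) (S' : Finset V) :
    S' ⊆ S → ∃ L F, L.length = #S' ∧ (∀ y ∈ L, y.1 ∈ B ∧ y.2 ∈ B) ∧ Sys T L F ∧ Disjoint F W ∧
      Disjoint F (S \ S') ∧ S' ⊆ F ∧ #(F ∩ B) = 4 * #S' ∧ #(F \ B) = #S' := by
  induction S' using Finset.induction with
  | empty => exact fun _ => ⟨[], ∅, rfl, by simp, rfl, by simp, by simp, by simp, by simp, by simp⟩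
  | insert v S' hvS' ih =>
    intro hsub
    rw [insert_subset_iff] at hsub
    obtain ⟨L, F, hL, hE, hF, hFW, hFS, hSF, h1, h2⟩ := ih hsub.2
    have hvB : v ∉ B := disjoint_left.1 h.disj_SB hsub.1
    have hvF : v ∉ F := disjoint_right.1 hFS (mem_sdiff.2 ⟨hsub.1, hvS'⟩)
    have hvW : v ∉ W := disjoint_right.1 hWS hsub.1
    have hn' : (0 : ℝ) < Fintype.card V := by
      by_contra hneg
      push Not at hneg
      nlinarith [sq_nonneg ε]
    have hcS : #S' ≤ #S := card_le_card hsub.2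
    obtain ⟨a, b, P, ha, hb, hPZ, hPc, hP⟩ := h.exists_five hvB (Z := B \ (F ∪ W)) sdiff_subset (by
      intro Y hY hYc
      refine h.exists_pair_S hsub.1 ?_
      have e1 : B \ Y ⊆ (F ∩ B) ∪ W ∪ ((B \ (F ∪ W)) \ Y) := by
        intro x hx
        simp only [mem_union, mem_sdiff, mem_inter] at hx ⊢
        tauto
      have e2 := (card_le_card e1).trans ((card_union_le _ _).trans
        (Nat.add_le_add_right (card_union_le _ _) _))
      have e3 := card_sdiff_add_card_eq_card hY
      have e4 : #(B \ Y) ≤ 4 * #S + #W + 2 := by omega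
      have e5 : (#(B \ Y) : ℝ) ≤ 4 * #S + #W + 2 := by exact_mod_cast e4
      have e6 := h.S_le
      have e7 : ε * (ε * (Fintype.card V : ℝ)) ≤ 1 / 1000 * (ε * (Fintype.card V : ℝ)) := by gcongr
      have e8 : 0 < ε * (Fintype.card V : ℝ) := by positivity
      nlinarith)
    have hPB : P ⊆ B := hPZ.trans sdiff_subset
    have hPd : ∀ x ∈ P, x ∉ F ∧ x ∉ W := fun x hx => by
      have := (mem_sdiff.1 (hPZ hx)).2
      rw [mem_union, not_or] at this
      exact this
    have hd : Disjoint (insert v P) F := by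
      rw [disjoint_left]
      intro x hx
      rcases mem_insert.1 hx with rfl | hx
      exacts [hvF, (hPd x hx).1]
    obtain ⟨c1, c2⟩ := card_split (P := P) (S := {v}) (F := insert v P) (B := B)
      (by ext; simp) hPB (by simpa using hvB)
    obtain ⟨c3, c4⟩ := card_union_split (B := B) hd
    refine ⟨(a, b) :: L, insert v P ∪ F, ?_, ?_, Sys.cons hP hF hd, ?_, ?_, ?_, ?_, ?_⟩
    · rw [List.length_cons, hL, card_insert_of_notMem hvS']
    · intro y hy
      rcases List.mem_cons.1 hy with rfl | hy
      · exact ⟨hPB ha, hPB hb⟩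
      · exact hE y hy
    · rw [disjoint_union_left]
      refine ⟨?_, hFW⟩
      rw [disjoint_left]
      intro x hx
      rcases mem_insert.1 hx with rfl | hx
      exacts [hvW, (hPd x hx).2]
    · rw [disjoint_union_left]
      refine ⟨?_, hFS.mono_right (sdiff_subset_sdiff subset_rfl (subset_insert _ _))⟩
      rw [disjoint_left]
      intro x hx hx'
      rw [mem_sdiff, mem_insert, not_or] at hx'
      rcases mem_insert.1 hx with rfl | hx
      · exact hx'.2.1 rfl
      · exact disjoint_left.1 h.disj_SB hx'.1 (hPB hx)
    · exact insert_subset (by simp) (hSF.trans subset_union_right)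
    · rw [c3, c1, hPc, h1, card_insert_of_notMem hvS']; ring
    · rw [c4, c2, card_singleton, h2, card_insert_of_notMem hvS']; ring

/-- A small path system covering `S` which balances the sizes of the parts. -/
theorem exists_special (h : Ext T A B S ε) (hε0 : 0 < ε) (hε : ε ≤ 1 / 1000)
    (hn : 1 ≤ ε ^ 2 * (Fintype.card V : ℝ)) (heven : Even (Fintype.card V))
    (hdeg : ∀ b, (Fintype.card V - 1) * (Fintype.card V - 2) +
      2 * (if 4 ∣ Fintype.card V then 2 else 1) ≤
        #(lk T b) + (3 * Fintype.card V / 4) * (3 * Fintype.card V / 4 - 1)) :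
    ∃ L F, Sys T L F ∧ (∀ y ∈ L, y.1 ∈ B ∧ y.2 ∈ B) ∧ S ⊆ F ∧
      #(F ∩ B) + 3 * Fintype.card V = 3 * #(F \ B) + L.length + 4 * #B ∧
      (#F : ℝ) ≤ 44 * ε ^ 2 * (Fintype.card V : ℝ) := by
  obtain ⟨L, F, hS, hE, hFS, hcnt, hF⟩ := h.exists_balancing hε0 hε hn heven hdeg
  obtain ⟨L', F', hL', hE', hS', hFF, -, hSF, h1, h2⟩ :=
    h.exists_blocks_S hε0 hε hn hF hFS S subset_rfl
  obtain ⟨c3, c4⟩ := card_union_split (B := B) hFF.symm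
  refine ⟨L ++ L', F ∪ F', hS.append hS' hFF.symm, ?_, hSF.trans subset_union_right, ?_, ?_⟩
  · intro y hy
    rcases List.mem_append.1 hy with hy | hy
    exacts [hE y hy, hE' y hy]
  · rw [c3, c4, List.length_append, h1, h2, hL']
    omega
  · have e1 : #(F ∪ F') ≤ #F + 5 * #S := by
      have := card_union_le F F'
      have := card_inter_add_card_sdiff F' B
      omega
    have e2 : (#(F ∪ F') : ℝ) ≤ #F + 5 * #S := by exact_mod_cast e1
    linarith [h.S_le]

end Ext

section Projections

variable {V : Type} [Fintype V]

theorem card_filter_forall {α κ : Type*} {s s' : Finset α} (K : Finset κ) (p : κ → α → Prop)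
    (hs : ∀ x ∈ s, (∀ k ∈ K, p k x) → x ∈ s') : #s ≤ #s' + ∑ k ∈ K, #{x ∈ s | ¬ p k x} := by
  have h1 : s ⊆ s' ∪ K.biUnion fun k => {x ∈ s | ¬ p k x} := by
    intro x hx
    simp only [mem_union, mem_filter, mem_biUnion]
    by_cases h : ∀ k ∈ K, p k x
    · exact Or.inl (hs x hx h)
    · push Not at h
      obtain ⟨k, hk, hp⟩ := h
      exact Or.inr ⟨k, hk, hx, hp⟩
  exact (card_le_card h1).trans ((card_union_le _ _).trans (Nat.add_le_add_left card_biUnion_le _))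

theorem card_comp_mul_le {σ ι : Type} [Fintype σ] [Fintype ι] {e : σ → ι} (he : Function.Injective e)
    (P : Finset (σ → V)) : #({ω : ι → V | ω ∘ e ∈ P} : Finset (ι → V)) * Fintype.card V ^ Fintype.card σ ≤
      #P * Fintype.card V ^ Fintype.card ι := by
  have h1 : Fintype.card V ^ Fintype.card σ = #(univ : Finset (σ → V)) := by
    rw [card_univ, Fintype.card_fun]
  have h2 : Fintype.card V ^ Fintype.card ι = #(univ : Finset (ι → V)) := by
    rw [card_univ, Fintype.card_fun]
  rw [h1, h2, ← card_product, ← card_product]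
  refine card_le_card_of_injOn (fun t => (t.1 ∘ e, Function.extend e t.2 t.1)) ?_ ?_
  · rintro ⟨ω, f⟩ h
    rw [mem_coe, mem_product, mem_filter] at h
    exact mem_coe.2 (mem_product.2 ⟨h.1.2, mem_univ _⟩)
  · rintro ⟨ω, f⟩ - ⟨ω', f'⟩ - h
    rw [Prod.mk.injEq] at h
    obtain ⟨h3, h4⟩ := h
    have h5 : f = f' := by
      funext s
      have := congrFun h4 (e s)
      rwa [he.extend_apply, he.extend_apply] at this
    have h6 : ω = ω' := by
      funext i
      by_cases hi : ∃ s, e s = i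
      · obtain ⟨s, rfl⟩ := hi
        exact congrFun h3 s
      · have := congrFun h4 i
        rwa [Function.extend_apply' _ _ _ hi, Function.extend_apply' _ _ _ hi] at this
    rw [h5, h6]

theorem card_comp_le {σ ι : Type} [Fintype σ] [Fintype ι] (hV : 0 < Fintype.card V) {e : σ → ι}
    (he : Function.Injective e) {δ : ℝ} (P : Finset (σ → V))
    (hP : (#P : ℝ) ≤ δ * (Fintype.card V : ℝ) ^ Fintype.card σ) :
    (#({ω : ι → V | ω ∘ e ∈ P} : Finset (ι → V)) : ℝ) ≤ δ * (Fintype.card V : ℝ) ^ Fintype.card ι := by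
  have h1 : (#({ω : ι → V | ω ∘ e ∈ P} : Finset (ι → V)) : ℝ) * (Fintype.card V : ℝ) ^ Fintype.card σ ≤
      #P * (Fintype.card V : ℝ) ^ Fintype.card ι := by exact_mod_cast card_comp_mul_le he P
  have hV' : (0 : ℝ) < Fintype.card V := by exact_mod_cast hV
  have h2 : 0 < (Fintype.card V : ℝ) ^ Fintype.card σ := by positivity
  refine le_of_mul_le_mul_right (h1.trans ?_) h2
  calc (#P : ℝ) * (Fintype.card V : ℝ) ^ Fintype.card ι ≤
      δ * (Fintype.card V : ℝ) ^ Fintype.card σ * (Fintype.card V : ℝ) ^ Fintype.card ι := by gcongr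
    _ = _ := by ring

theorem card_pair_le {ι : Type} [Fintype ι] (hV : 0 < Fintype.card V) {i j : ι} (hij : i ≠ j)
    {δ : ℝ} (P : Finset (V × V)) (hP : (#P : ℝ) ≤ δ * (Fintype.card V : ℝ) ^ 2) :
    (#({ω : ι → V | (ω i, ω j) ∈ P} : Finset (ι → V)) : ℝ) ≤ δ * (Fintype.card V : ℝ) ^ Fintype.card ι := by
  have he : Function.Injective ![i, j] := by
    intro a b h
    fin_cases a <;> fin_cases b <;> simp_all
  have h1 : #({f : Fin 2 → V | (f 0, f 1) ∈ P} : Finset (Fin 2 → V)) ≤ #P := by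
    refine card_le_card_of_injOn (fun f => (f 0, f 1)) (fun f hf => by simpa using hf) ?_
    intro f _ g _ h
    rw [Prod.mk.injEq] at h
    funext a
    fin_cases a
    exacts [h.1, h.2]
  refine le_trans (le_of_eq ?_) (card_comp_le hV he ({f : Fin 2 → V | (f 0, f 1) ∈ P} : Finset (Fin 2 → V))
    ((Nat.cast_le.2 h1).trans (hP.trans_eq (by rw [Fintype.card_fin]))))
  congr 2
  ext ω
  simp

theorem card_triple_le {ι : Type} [Fintype ι] (hV : 0 < Fintype.card V) {i j k : ι} (hij : i ≠ j)
    (hik : i ≠ k) (hjk : j ≠ k) {δ : ℝ} (P : Finset (V × V × V))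
    (hP : (#P : ℝ) ≤ δ * (Fintype.card V : ℝ) ^ 3) :
    (#({ω : ι → V | (ω i, ω j, ω k) ∈ P} : Finset (ι → V)) : ℝ) ≤
      δ * (Fintype.card V : ℝ) ^ Fintype.card ι := by
  have he : Function.Injective ![i, j, k] := by
    intro a b h
    fin_cases a <;> fin_cases b <;> simp_all
  have h1 : #({f : Fin 3 → V | (f 0, f 1, f 2) ∈ P} : Finset (Fin 3 → V)) ≤ #P := by
    refine card_le_card_of_injOn (fun f => (f 0, f 1, f 2)) (fun f hf => by simpa using hf) ?_
    intro f _ g _ h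
    rw [Prod.mk.injEq, Prod.mk.injEq] at h
    funext a
    fin_cases a
    exacts [h.1, h.2.1, h.2.2]
  refine le_trans (le_of_eq ?_) (card_comp_le hV he
    ({f : Fin 3 → V | (f 0, f 1, f 2) ∈ P} : Finset (Fin 3 → V))
    ((Nat.cast_le.2 h1).trans (hP.trans_eq (by rw [Fintype.card_fin]))))
  congr 2
  ext ω
  simp

end Projections

section BalancedAbsorber

variable {V : Type} [Fintype V] {T : V → V → V → Prop}

/-- The index triples whose images must be edges, for the edges inside the tuple. -/
def coreIdx : Finset (Fin 13 × Fin 13 × Fin 13) :=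
  {(10, 0, 1), (10, 2, 3), (10, 1, 2), (11, 3, 4), (11, 5, 6), (12, 5, 6), (12, 6, 7), (12, 8, 9)}

/-- The index triples for the edges which contain an absorbed vertex of the large part. -/
def sideIdx : Finset (Fin 4 × Fin 13 × Fin 13) := {(1, 10, 0), (2, 11, 2), (3, 12, 4)}

/-- The index pairs for the edges which contain the absorbed vertex of the small part. -/
def tipIdx : Finset (Fin 13 × Fin 13) := {(6, 7), (8, 9)}

/-- The edges inside the tuple are present. -/
def Core (T : V → V → V → Prop) (ω : Fin 13 → V) : Prop :=
  ∀ t ∈ coreIdx, T (ω t.1) (ω t.2.1) (ω t.2.2)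

/-- The tuple can absorb the four vertices `j`. -/
def AbsFour (T : V → V → V → Prop) (j : Fin 4 → V) (ω : Fin 13 → V) : Prop :=
  (∀ t ∈ sideIdx, T (j t.1) (ω t.2.1) (ω t.2.2)) ∧ ∀ t ∈ tipIdx, T (j 0) (ω t.1) (ω t.2)

theorem Core.sys (hT : IsTri T) {ω : Fin 13 → V} (h : Core T ω) (hω : Function.Injective ω) :
    Sys T [(ω 0, ω 9)] (univ.image ω) := by
  have h1 : PathOn (fun a b c => T (ω a) (ω b) (ω c)) 0 9 (univ : Finset (Fin 13)) := by
    refine ⟨[1, 10, 2, 3, 4, 11, 5, 6, 7, 12, 8, 9], ?_, by decide, by decide⟩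
    exact .cons (hT.rot (hT.rot (h (10, 0, 1) (by decide)))) <|
      .cons (h (10, 2, 3) (by decide)) <| .cons (hT.rot (hT.rot (h (11, 3, 4) (by decide)))) <|
      .cons (h (11, 5, 6) (by decide)) <| .cons (hT.rot (hT.rot (h (12, 6, 7) (by decide)))) <|
      .cons (h (12, 8, 9) (by decide)) <| .nil _
  have h2 := h1.map (T' := T) ⟨ω, hω⟩ fun _ _ _ h => h
  rw [map_eq_image] at h2
  exact Sys.singleton h2

theorem AbsFour.sys (hT : IsTri T) {j : Fin 4 → V} {ω : Fin 13 → V} (h : Core T ω)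
    (h' : AbsFour T j ω) (hω : Function.Injective ω) (hj : Function.Injective j)
    (hd : Disjoint (univ.image ω) (univ.image j)) :
    Sys T [(ω 0, ω 9)] (univ.image ω ∪ univ.image j) := by
  obtain ⟨hs, ht⟩ := h'
  obtain ⟨g, hg⟩ : ∃ g : Fin 13 ⊕ Fin 4 → V, g = Sum.elim ω j := ⟨_, rfl⟩
  have hinj : Function.Injective g := by
    rw [hg]
    refine hω.sumElim hj fun a b hab => ?_
    exact disjoint_left.1 hd (mem_image_of_mem ω (mem_univ a)) (hab ▸ mem_image_of_mem j (mem_univ b))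
  have hl : ∀ i, g (Sum.inl i) = ω i := fun i => by rw [hg]; rfl
  have hr : ∀ i, g (Sum.inr i) = j i := fun i => by rw [hg]; rfl
  have h1 : PathOn (fun a b c => T (g a) (g b) (g c)) (.inl 0) (.inl 9)
      (univ : Finset (Fin 13 ⊕ Fin 4)) := by
    refine ⟨[.inr 1, .inl 10, .inl 1, .inl 2, .inr 2, .inl 11, .inl 3, .inl 4, .inr 3, .inl 12,
      .inl 5, .inl 6, .inl 7, .inr 0, .inl 8, .inl 9], ?_, by decide, by decide⟩
    refine .cons ?_ (.cons ?_ (.cons ?_ (.cons ?_ (.cons ?_ (.cons ?_ (.cons ?_ (.cons ?_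
      (.nil _)))))))) <;> simp only [hl, hr]
    · exact hT.rot (hs (1, 10, 0) (by decide))
    · exact h (10, 1, 2) (by decide)
    · exact hT.rot (hs (2, 11, 2) (by decide))
    · exact h (11, 3, 4) (by decide)
    · exact hT.rot (hs (3, 12, 4) (by decide))
    · exact h (12, 5, 6) (by decide)
    · exact hT.rot (hT.rot (ht (6, 7) (by decide)))
    · exact ht (8, 9) (by decide)
  have h2 := h1.map (T' := T) ⟨g, hinj⟩ fun _ _ _ h => h
  rw [map_eq_image] at h2
  have h3 := Sys.singleton h2
  simp only [Function.Embedding.coeFn_mk, hl] at h3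
  refine h3.congr fun v => ?_
  simp only [mem_union, mem_image, mem_univ, true_and, Sum.exists, hl, hr]

/-- The tuples with ten vertices in `B` and three in `A`. -/
noncomputable def tupleBox (A B : Finset V) : Finset (Fin 13 → V) :=
  Fintype.piFinset fun i => if i < 10 then B else A

theorem mem_tupleBox {A B : Finset V} {ω : Fin 13 → V} :
    ω ∈ tupleBox A B ↔ ∀ i, (i < 10 → ω i ∈ B) ∧ (¬ i < 10 → ω i ∈ A) := by
  rw [tupleBox, Fintype.mem_piFinset]
  refine forall_congr' fun i => ?_
  split_ifs with h <;> simp [h]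

theorem card_tupleBox (A B : Finset V) : #(tupleBox A B) = #B ^ 10 * #A ^ 3 := by
  rw [tupleBox, Fintype.card_piFinset]
  have h1 : ∀ i : Fin 13, #(if i < 10 then B else A) = if i < 10 then #B else #A := fun i => by
    split_ifs <;> rfl
  rw [prod_congr rfl fun i _ => h1 i, prod_ite, prod_const, prod_const]
  have h2 : #{x : Fin 13 | x < 10} = 10 := by decide
  have h3 : #{x : Fin 13 | ¬ x < 10} = 3 := by decide
  congr 2

variable {A B S : Finset V} {ε : ℝ}

theorem Ext.card_missing_le (h : Ext T A B S ε) (hε : 0 ≤ ε) :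
    (#({p : V × V × V | p.1 ∈ A ∧ p.2.1 ∈ B ∧ p.2.2 ∈ B ∧ ¬ T p.1 p.2.1 p.2.2} :
      Finset (V × V × V)) : ℝ) ≤ 3 * ε * (Fintype.card V : ℝ) ^ 3 := by
  have h1 : #({p : V × V × V | p.1 ∈ A ∧ p.2.1 ∈ B ∧ p.2.2 ∈ B ∧ ¬ T p.1 p.2.1 p.2.2} :
      Finset (V × V × V)) = ∑ a ∈ A, #{p ∈ B ×ˢ B | ¬ T a p.1 p.2} := by
    rw [← card_sigma]
    refine card_bij (fun p _ => ⟨p.1, p.2⟩) ?_ ?_ ?_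
    · rintro ⟨a, p, q⟩ hp
      simpa [and_assoc] using hp
    · rintro ⟨a, p, q⟩ _ ⟨a', p', q'⟩ _ he
      simpa using he
    · rintro ⟨a, p, q⟩ hp
      exact ⟨(a, p, q), by simpa [and_assoc] using hp, rfl⟩
  rw [h1, Nat.cast_sum]
  have h2 := sum_le_card_nsmul A (fun a => (#{p ∈ B ×ˢ B | ¬ T a p.1 p.2} : ℝ)) _ h.miss_A
  rw [nsmul_eq_mul] at h2
  have h3 : (0 : ℝ) ≤ 3 * ε * (Fintype.card V : ℝ) ^ 2 := by positivity
  have h4 : (#A : ℝ) ≤ Fintype.card V := by exact_mod_cast card_le_univ A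
  have h5 := mul_le_mul_of_nonneg_right h4 h3
  exact h2.trans (h5.trans_eq (by ring))

/-- There are many tuples that absorb given vertices. -/
theorem Ext.card_absFour (h : Ext T A B S ε) (hV : 0 < Fintype.card V) (hε0 : 0 < ε)
    (hε : ε ≤ 2 / 10 ^ 6) {j : Fin 4 → V} (hj : ∀ i, i ≠ 0 → j i ∈ B) (hj0 : j 0 ∈ A) :
    1 / 10 ^ 4 * (Fintype.card V : ℝ) ^ Fintype.card (Fin 13) ≤
      #({ω ∈ tupleBox A B | Core T ω ∧ AbsFour T j ω} : Finset (Fin 13 → V)) := by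
  have hn : (0 : ℝ) < Fintype.card V := by exact_mod_cast hV
  have hcore : ∀ t ∈ coreIdx, (#{ω ∈ tupleBox A B | ¬ T (ω t.1) (ω t.2.1) (ω t.2.2)} : ℝ) ≤
      3 * ε * (Fintype.card V : ℝ) ^ Fintype.card (Fin 13) := by
    rintro ⟨a, b, c⟩ ht
    have hd : ∀ t ∈ coreIdx, ¬ t.1 < 10 ∧ t.2.1 < 10 ∧ t.2.2 < 10 ∧ t.1 ≠ t.2.1 ∧ t.1 ≠ t.2.2 ∧
      t.2.1 ≠ t.2.2 := by simp [coreIdx]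
    obtain ⟨e1, e2, e3, e4, e5, e6⟩ := hd _ ht
    have hP := card_triple_le (ι := Fin 13) hV e4 e5 e6 _ (h.card_missing_le hε0.le)
    refine le_trans (Nat.cast_le.2 (card_le_card ?_)) hP
    intro ω hω
    rw [mem_filter, mem_tupleBox] at hω
    simp only [mem_filter, mem_univ, true_and]
    exact ⟨(hω.1 _).2 e1, (hω.1 _).1 e2, (hω.1 _).1 e3, hω.2⟩
  have hside : ∀ t ∈ sideIdx, (#{ω ∈ tupleBox A B | ¬ T (j t.1) (ω t.2.1) (ω t.2.2)} : ℝ) ≤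
      3 * ε * (Fintype.card V : ℝ) ^ Fintype.card (Fin 13) := by
    rintro ⟨a, b, c⟩ ht
    have hd : ∀ t ∈ sideIdx, t.1 ≠ 0 ∧ ¬ t.2.1 < 10 ∧ t.2.2 < 10 ∧ t.2.1 ≠ t.2.2 := by simp [sideIdx]
    obtain ⟨e1, e2, e3, e4⟩ := hd _ ht
    have hP := card_pair_le (ι := Fin 13) hV e4 _ (h.miss_B _ (hj a e1))
    refine le_trans (Nat.cast_le.2 (card_le_card ?_)) hP
    intro ω hω
    rw [mem_filter, mem_tupleBox] at hω
    simp only [mem_filter, mem_univ, true_and, mem_product]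
    exact ⟨⟨(hω.1 _).2 e2, (hω.1 _).1 e3⟩, hω.2⟩
  have htip : ∀ t ∈ tipIdx, (#{ω ∈ tupleBox A B | ¬ T (j 0) (ω t.1) (ω t.2)} : ℝ) ≤
      3 * ε * (Fintype.card V : ℝ) ^ Fintype.card (Fin 13) := by
    rintro ⟨b, c⟩ ht
    have hd : ∀ t ∈ tipIdx, t.1 < 10 ∧ t.2 < 10 ∧ t.1 ≠ t.2 := by simp [tipIdx]
    obtain ⟨e2, e3, e4⟩ := hd _ ht
    have hP := card_pair_le (ι := Fin 13) hV e4 _ (h.miss_A _ hj0)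
    refine le_trans (Nat.cast_le.2 (card_le_card ?_)) hP
    intro ω hω
    rw [mem_filter, mem_tupleBox] at hω
    simp only [mem_filter, mem_univ, true_and, mem_product]
    exact ⟨⟨(hω.1 _).1 e2, (hω.1 _).1 e3⟩, hω.2⟩
  obtain ⟨𝒜, h𝒜⟩ : ∃ 𝒜, 𝒜 = tupleBox A B := ⟨_, rfl⟩
  rw [← h𝒜] at hcore hside htip ⊢
  obtain ⟨𝒜₁, h₁⟩ : ∃ 𝒜₁, 𝒜₁ = {ω ∈ 𝒜 | ∀ t ∈ coreIdx, T (ω t.1) (ω t.2.1) (ω t.2.2)} := ⟨_, rfl⟩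
  obtain ⟨𝒜₂, h₂⟩ : ∃ 𝒜₂, 𝒜₂ = {ω ∈ 𝒜₁ | ∀ t ∈ sideIdx, T (j t.1) (ω t.2.1) (ω t.2.2)} := ⟨_, rfl⟩
  obtain ⟨𝒜₃, h₃⟩ : ∃ 𝒜₃, 𝒜₃ = {ω ∈ 𝒜₂ | ∀ t ∈ tipIdx, T (j 0) (ω t.1) (ω t.2)} := ⟨_, rfl⟩
  have s1 : 𝒜₁ ⊆ 𝒜 := h₁ ▸ filter_subset _ _
  have s2 : 𝒜₂ ⊆ 𝒜 := (h₂ ▸ filter_subset _ _ : 𝒜₂ ⊆ 𝒜₁).trans s1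
  have k1 := card_filter_forall (s := 𝒜) (s' := 𝒜₁) coreIdx
    (fun t ω => T (ω t.1) (ω t.2.1) (ω t.2.2)) fun x hx hp => h₁ ▸ mem_filter.2 ⟨hx, hp⟩
  have k2 := card_filter_forall (s := 𝒜₁) (s' := 𝒜₂) sideIdx
    (fun t ω => T (j t.1) (ω t.2.1) (ω t.2.2)) fun x hx hp => h₂ ▸ mem_filter.2 ⟨hx, hp⟩
  have k3 := card_filter_forall (s := 𝒜₂) (s' := 𝒜₃) tipIdx
    (fun t ω => T (j 0) (ω t.1) (ω t.2)) fun x hx hp => h₃ ▸ mem_filter.2 ⟨hx, hp⟩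
  obtain ⟨N, hN⟩ : ∃ N : ℝ, N = (Fintype.card V : ℝ) ^ Fintype.card (Fin 13) := ⟨_, rfl⟩
  have k1' : (#𝒜 : ℝ) ≤ #𝒜₁ + 8 * (3 * ε * N) := by
    have e1 := sum_le_card_nsmul _ _ _ hcore
    rw [show #coreIdx = 8 by decide, nsmul_eq_mul, ← hN] at e1
    refine (Nat.cast_le.2 k1).trans ?_
    push_cast
    exact add_le_add le_rfl (by exact_mod_cast e1)
  have k2' : (#𝒜₁ : ℝ) ≤ #𝒜₂ + 3 * (3 * ε * N) := by
    have e1 := sum_le_card_nsmul _ _ _ fun t ht => (Nat.cast_le.2 (card_le_card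
      (filter_subset_filter _ s1))).trans (hside t ht)
    rw [show #sideIdx = 3 by decide, nsmul_eq_mul, ← hN] at e1
    refine (Nat.cast_le.2 k2).trans ?_
    push_cast
    exact add_le_add le_rfl (by exact_mod_cast e1)
  have k3' : (#𝒜₂ : ℝ) ≤ #𝒜₃ + 2 * (3 * ε * N) := by
    have e1 := sum_le_card_nsmul _ _ _ fun t ht => (Nat.cast_le.2 (card_le_card
      (filter_subset_filter _ s2))).trans (htip t ht)
    rw [show #tipIdx = 2 by decide, nsmul_eq_mul, ← hN] at e1
    refine (Nat.cast_le.2 k3).trans ?_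
    push_cast
    exact add_le_add le_rfl (by exact_mod_cast e1)
  have hgood : (#𝒜₃ : ℝ) ≤ #({ω ∈ 𝒜 | Core T ω ∧ AbsFour T j ω} : Finset (Fin 13 → V)) := by
    refine Nat.cast_le.2 (card_le_card fun ω hω => ?_)
    rw [h₃, mem_filter, h₂, mem_filter, h₁, mem_filter] at hω
    exact mem_filter.2 ⟨hω.1.1.1, hω.1.1.2, hω.1.2, hω.2⟩
  have hbox : 2 / 10 ^ 4 * N ≤ #𝒜 := by
    rw [h𝒜, card_tupleBox, hN, Fintype.card_fin]
    push_cast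
    have e2 : ε ^ 2 ≤ 1 / 1000 := by nlinarith
    have e1 : 0.7 * (Fintype.card V : ℝ) ≤ #B := by
      refine le_trans ?_ h.le_B
      gcongr
      linarith
    have e3 : 0.2 * (Fintype.card V : ℝ) ≤ #A := by
      refine le_trans ?_ h.le_A
      gcongr
      linarith
    calc 2 / 10 ^ 4 * (Fintype.card V : ℝ) ^ 13 ≤ (0.7 ^ 10 * 0.2 ^ 3) * (Fintype.card V : ℝ) ^ 13 := by
          gcongr; norm_num
      _ = (0.7 * (Fintype.card V : ℝ)) ^ 10 * (0.2 * (Fintype.card V : ℝ)) ^ 3 := by ring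
      _ ≤ _ := by gcongr
  rw [← hN]
  have hN0 : 0 < N := by rw [hN]; positivity
  have : ε * N ≤ 2 / 10 ^ 6 * N := by gcongr
  linarith

end BalancedAbsorber

section BalancedFamily

variable {V : Type} [Fintype V] {T : V → V → V → Prop} {A B S : Finset V} {ε : ℝ}

theorem Ext.exists_absFour_family (h : Ext T A B S ε) (hV : 5 * 10 ^ 7 ≤ Fintype.card V)
    (hε0 : 0 < ε) (hε : ε ≤ 2 / 10 ^ 6) {W : Finset V}
    (hW : 13 * (#W : ℝ) ≤ 1 / 10 ^ 4 / 2 * Fintype.card V) {j : Fin 4 → V}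
    (hj : ∀ i, i ≠ 0 → j i ∈ B) (hj0 : j 0 ∈ A) :
    ∃ 𝒜 : Finset (Fin 13 → V), (∀ ω ∈ 𝒜, ω ∈ tupleBox A B ∧ Core T ω ∧ AbsFour T j ω ∧
      (∀ i, ω i ∉ W) ∧ Function.Injective ω) ∧
      1 / (4 * 10 ^ 4) * (Fintype.card V : ℝ) ^ Fintype.card (Fin 13) ≤ #𝒜 := by
  have hV0 : 0 < Fintype.card V := by omega
  have h1 := h.card_absFour hV0 hε0 hε hj hj0
  have h2 := card_avoid hV0 _ h1 W (by simpa using hW)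
  have h3 := le_card_injective _ (by
    have : (5 * 10 ^ 7 : ℝ) ≤ Fintype.card V := by exact_mod_cast hV
    simp only [Fintype.card_fin]
    push_cast
    linarith) hV0 h2
  refine ⟨_, fun ω hω => ?_, le_trans (le_of_eq (by norm_num)) h3⟩
  simp only [mem_filter] at hω
  exact ⟨hω.1.1.1, hω.1.1.2.1, hω.1.1.2.2, hω.1.2, hω.2⟩

theorem card_image_tupleBox (hAB : Disjoint A B) {ω : Fin 13 → V} (hω : ω ∈ tupleBox A B)
    (hi : Function.Injective ω) : #(univ.image ω ∩ B) = 10 ∧ #(univ.image ω \ B) = 3 := by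
  rw [mem_tupleBox] at hω
  have h1 : univ.image ω ∩ B = ({i | i < 10} : Finset (Fin 13)).image ω := by
    ext v
    simp only [mem_inter, mem_image, mem_univ, true_and, mem_filter]
    constructor
    · rintro ⟨⟨i, rfl⟩, hb⟩
      refine ⟨i, ?_, rfl⟩
      by_contra hc
      exact disjoint_left.1 hAB ((hω i).2 hc) hb
    · rintro ⟨i, hi, rfl⟩
      exact ⟨⟨i, rfl⟩, (hω i).1 hi⟩
  have h2 : #(univ.image ω ∩ B) = 10 := by
    rw [h1, card_image_of_injective _ hi]
    decide
  have h3 := card_inter_add_card_sdiff (univ.image ω) B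
  rw [card_image_of_injective _ hi, card_univ, Fintype.card_fin] at h3
  exact ⟨h2, by omega⟩

theorem exists_tuple_of_card {X : Finset V} (hA : #(X \ B) = 1) (hB : #(X ∩ B) = 3) :
    ∃ j : Fin 4 → V, Function.Injective j ∧ univ.image j = X ∧ j 0 ∈ X \ B ∧
      ∀ i, i ≠ 0 → j i ∈ B := by
  obtain ⟨a, ha⟩ := card_eq_one.1 hA
  obtain ⟨x, y, z, hxy, hxz, hyz, hx⟩ := card_eq_three.1 hB
  have ha' : a ∈ X \ B := ha ▸ mem_singleton_self a
  have hb : ∀ v ∈ ({x, y, z} : Finset V), v ∈ B := fun v hv =>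
    (mem_inter.1 (hx ▸ hv : v ∈ X ∩ B)).2
  have haB := (mem_sdiff.1 ha').2
  have hX : X = insert a {x, y, z} := by
    rw [← hx, insert_eq, ← ha, sdiff_union_inter]
  have hX' : univ.image ![a, x, y, z] = X := by
    rw [hX]
    ext v
    simp [Fin.exists_fin_succ, eq_comm]
  refine ⟨![a, x, y, z], ?_, hX', by simpa using ha', ?_⟩
  · have h1 := card_inter_add_card_sdiff X B
    have h2 : #(univ.image ![a, x, y, z]) = #(univ : Finset (Fin 4)) := by
      rw [hX', card_univ, Fintype.card_fin]
      omega
    have h3 := card_image_iff.1 h2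
    rwa [coe_univ, Set.injOn_univ] at h3
  · intro i hi
    fin_cases i
    · exact absurd rfl hi
    · exact hb x (by simp)
    · exact hb y (by simp)
    · exact hb z (by simp)

/-- There is a small system of paths which can absorb every small balanced set. -/
theorem exists_balanced_absorber {μ : ℝ} (hμ : 0 < μ) (hμ₁ : μ ≤ 1 / 10 ^ 9) : ∃ n₀ : ℕ,
    ∀ (V : Type) [Fintype V] (T : V → V → V → Prop) (A B S : Finset V) (ε : ℝ), Ext T A B S ε →
      n₀ ≤ Fintype.card V → 0 < ε → ε ≤ 2 / 10 ^ 6 →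
      ∀ W : Finset V, 13 * (#W : ℝ) ≤ 1 / 10 ^ 4 / 2 * Fintype.card V →
      ∃ L F, (∀ y ∈ L, y.1 ∈ B ∧ y.2 ∈ B) ∧ Disjoint F W ∧ #(F ∩ B) = 10 * L.length ∧
        #(F \ B) = 3 * L.length ∧ (L.length : ℝ) ≤ μ * Fintype.card V ∧
        ∀ (r : ℕ) U, (r : ℝ) ≤ μ / 10 ^ 6 * Fintype.card V → Disjoint U F → Disjoint U S →
          #(U ∩ B) = 3 * r → #(U \ B) = r → Sys T L (F ∪ U) := by
  obtain ⟨n₁, hn₁⟩ := exists_sample_linear (δ := 1 / (4 * 10 ^ 4)) (by norm_num) hμ 4 13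
    (by norm_num; linarith)
  refine ⟨n₁ + 5 * 10 ^ 7, fun V _ T A B S ε h hV hε0 hε W hW => ?_⟩
  set n : ℝ := (Fintype.card V : ℝ) with hn
  have hn0 : 0 ≤ n := by rw [hn]; positivity
  choose 𝒜 h𝒜 h𝒜c using fun j : {j : Fin 4 → V // (∀ i, i ≠ 0 → j i ∈ B) ∧ j 0 ∈ A} =>
    h.exists_absFour_family (by omega) hε0 hε hW j.2.1 j.2.2
  obtain ⟨𝓕, hF1, hF2, hF3, hF4⟩ := hn₁ V (by omega) (Fin 13)
    {j : Fin 4 → V // (∀ i, i ≠ 0 → j i ∈ B) ∧ j 0 ∈ A} (by simp)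
    (le_trans (Fintype.card_subtype_le _) (by simp))
    (fun ω => ω ∈ tupleBox A B ∧ Core T ω ∧ (∀ i, ω i ∉ W) ∧ Function.Injective ω) 𝒜
    (fun j ω hω => ⟨(h𝒜 j ω hω).1, (h𝒜 j ω hω).2.1, (h𝒜 j ω hω).2.2.2⟩) h𝒜c
  rw [← hn] at hF1 hF4
  obtain ⟨F, hF⟩ : ∃ F, F = 𝓕.biUnion fun ω => univ.image ω := ⟨_, rfl⟩
  obtain ⟨ends, hends⟩ : ∃ ends : (Fin 13 → V) → List (V × V), ends = fun ω => [(ω 0, ω 9)] :=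
    ⟨_, rfl⟩
  obtain ⟨L, hL⟩ : ∃ L, L = 𝓕.toList.flatMap ends := ⟨_, rfl⟩
  have hLlen : L.length = #𝓕 := by
    rw [hL, List.length_flatMap, List.map_congr_left (g := fun _ => 1)
      (fun ω _ => by simp [hends])]
    simp
  have hcard := fun ω hω => card_image_tupleBox h.disj_AB (hF2 ω hω).1 (hF2 ω hω).2.2.2
  refine ⟨L, F, ?_, ?_, ?_, ?_, by rw [hLlen]; exact hF1, ?_⟩
  · intro y hy
    rw [hL, List.mem_flatMap] at hy
    obtain ⟨ω, hω, hy⟩ := hy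
    rw [mem_toList] at hω
    rw [hends, List.mem_singleton] at hy
    have := mem_tupleBox.1 (hF2 ω hω).1
    rw [hy]
    exact ⟨(this 0).1 (by decide), (this 9).1 (by decide)⟩
  · rw [hF, disjoint_biUnion_left]
    intro ω hω
    rw [disjoint_left]
    intro v hv
    obtain ⟨i, -, rfl⟩ := mem_image.1 hv
    exact (hF2 ω hω).2.2.1 i
  · rw [hF, biUnion_inter, card_biUnion fun ω hω ω' hω' hne =>
      (hF3 ω hω ω' hω' hne).mono inter_subset_left inter_subset_left,
      sum_congr rfl fun ω hω => (hcard ω hω).1, sum_const, hLlen, smul_eq_mul, mul_comm]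
  · rw [hF, sdiff_eq_inter_compl, biUnion_inter, card_biUnion fun ω hω ω' hω' hne =>
      (hF3 ω hω ω' hω' hne).mono inter_subset_left inter_subset_left,
      sum_congr rfl fun ω hω => sdiff_eq_inter_compl (univ.image ω) B ▸ (hcard ω hω).2, sum_const,
      hLlen, smul_eq_mul, mul_comm]
  · intro r U hr hUF hUS hUB hUA
    obtain ⟨Us, h1, h2, h3, h4⟩ := exists_groups Bᶜ 3 r U
      (by rw [← sdiff_eq_inter_compl, hUA]) (by rw [sdiff_compl, ← hUB]; rfl)
    have h5 : ∀ X ∈ Us, X ⊆ U := fun X hX => by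
      rw [← h3]
      exact subset_biUnion_of_mem id (List.mem_toFinset.2 hX)
    have h6 : ∀ ω ∈ 𝓕, univ.image ω ⊆ F := fun ω hω => by
      rw [hF]
      exact subset_biUnion_of_mem (fun ω => univ.image ω) hω
    rw [← h3, hL, hF]
    refine sys_absorb (fun ω hω => ?_) hF3 Us h2 ?_ ?_
    · rw [hends]
      exact (hF2 ω hω).2.1.sys h.tri (hF2 ω hω).2.2.2
    · intro ω hω X hX
      exact (disjoint_of_subset_left (h5 X hX) (disjoint_of_subset_right (h6 ω hω) hUF)).symm
    · intro X hX
      obtain ⟨j, hj, hjX, hj0, hjB⟩ := exists_tuple_of_card (B := B) (X := X)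
        (by rw [sdiff_eq_inter_compl]; exact (h4 X hX).1)
        (by have := (h4 X hX).2; rwa [sdiff_compl] at this)
      have hjA : j 0 ∈ A := by
        rw [mem_sdiff] at hj0
        rcases h.cover (j 0) with h' | h' | h'
        · exact h'
        · exact absurd h' hj0.2
        · exact absurd h' (disjoint_left.1 hUS (h5 X hX hj0.1))
      have h7 : #{ω ∈ 𝓕 | ω ∈ 𝒜 ⟨j, hjB, hjA⟩} ≤
          #{ω ∈ 𝓕 | Sys T (ends ω) (univ.image ω ∪ X)} := by
        refine card_le_card fun ω hω => ?_
        rw [mem_filter] at hω ⊢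
        refine ⟨hω.1, ?_⟩
        have h8 := h𝒜 _ _ hω.2
        rw [hends, ← hjX]
        refine AbsFour.sys h.tri h8.2.1 h8.2.2.1 h8.2.2.2.2 hj ?_
        rw [hjX]
        exact (disjoint_of_subset_left (h5 X hX) (disjoint_of_subset_right (h6 ω hω.1) hUF)).symm
      refine le_trans ?_ h7
      have h10 := hF4 ⟨j, hjB, hjA⟩
      have h11 : (Us.length : ℝ) ≤ 1 / (4 * 10 ^ 4) * μ / 16 * n := by
        rw [h1]
        refine hr.trans (mul_le_mul_of_nonneg_right ?_ hn0)
        linarith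
      exact_mod_cast h11.trans h10

end BalancedFamily

section BalancedClosing

variable {V : Type} [Fintype V] {T : V → V → V → Prop} {A B S : Finset V} {ε : ℝ}

theorem Ext.exists_block (h : Ext T A B S ε) {σ : ℝ} (hσ : 0 < σ) (hε : 24 * ε < σ ^ 2)
    (hε0 : 0 < ε) (hn : 8 ≤ σ * Fintype.card V) {W : Finset V}
    (hA : σ * Fintype.card V ≤ #(A \ W)) (hB : σ * Fintype.card V ≤ #(B \ W)) :
    ∃ a b F, a ∈ B ∧ b ∈ B ∧ Disjoint F W ∧ #(F ∩ B) = 4 ∧ #(F \ B) = 1 ∧ PathOn T a b F := by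
  set n : ℝ := (Fintype.card V : ℝ) with hn'
  have h1 : 0 < #(A \ W) := by
    have : (0 : ℝ) < #(A \ W) := by linarith
    exact_mod_cast this
  obtain ⟨v, hv⟩ := card_pos.1 h1
  rw [mem_sdiff] at hv
  have hvB : v ∉ B := disjoint_left.1 h.disj_AB hv.1
  obtain ⟨a, b, P, ha, hb, hPZ, hP, hpath⟩ := h.exists_five hvB (Z := B \ W) sdiff_subset
    (fun Y hY hc => h.exists_pair hv.1 (hY.trans sdiff_subset) (by
      have h2 : (#(B \ W) : ℝ) ≤ #Y + 2 := by exact_mod_cast hc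
      have h3 : σ * n / 2 ≤ #Y := by linarith
      have h4 : (σ * n / 2) ^ 2 ≤ (#Y : ℝ) ^ 2 := by
        refine pow_le_pow_left₀ (by linarith) h3 2
      have hn0 : 0 < n := by
        by_contra hc
        push Not at hc
        linarith [mul_nonpos_of_nonneg_of_nonpos hσ.le hc]
      have h5 : 24 * ε * n ^ 2 < σ ^ 2 * n ^ 2 := by
        refine mul_lt_mul_of_pos_right hε (by positivity)
      have h6 : 0 < ε * n ^ 2 := by positivity
      rw [← hn']
      nlinarith))
  have hPB : P ⊆ B := hPZ.trans sdiff_subset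
  have hsp := card_split (P := P) (S := {v}) (B := B) (F := insert v P)
    (by rw [union_comm, insert_eq]) hPB (by simpa using hvB)
  refine ⟨a, b, insert v P, hPB ha, hPB hb, ?_, by rw [hsp.1, hP], by rw [hsp.2]; simp, hpath⟩
  rw [disjoint_insert_left]
  exact ⟨hv.2, disjoint_of_subset_left hPZ sdiff_disjoint⟩

/-- A system of paths which contains `S` and is balanced in the right way can be completed, if some
of its paths can absorb any small balanced set. -/
theorem Ext.exists_closed_of_absorber (h : Ext T A B S ε) {σ : ℝ} (hσ : 0 < σ)
    (hε : 24 * ε < σ ^ 2) (hε0 : 0 < ε) (hn : 8 ≤ σ * Fintype.card V)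
    {L₀ L₁ : List (V × V)} {F₀ F₁ : Finset V} {N r r₀ : ℕ}
    (hσr : σ * Fintype.card V + #S ≤ r₀) (hr : r₀ ≤ r) (hN : 0 < N)
    (hL₀ : ∀ y ∈ L₀, y.1 ∈ B ∧ y.2 ∈ B) (hL₁ : ∀ y ∈ L₁, y.1 ∈ B ∧ y.2 ∈ B)
    (h₀ : Sys T L₀ F₀) (hS : S ⊆ F₀) (hd : Disjoint F₁ F₀)
    (h₁ : ∀ U, Disjoint U F₁ → Disjoint U S → #(U ∩ B) = 3 * r → #(U \ B) = r →
      Sys T L₁ (F₁ ∪ U))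
    (hA : #(F₀ \ B) + #(F₁ \ B) + L₀.length + L₁.length + 2 * N + r + #B = Fintype.card V)
    (hB : #(F₀ ∩ B) + #(F₁ ∩ B) + 2 * L₀.length + 2 * L₁.length + 6 * N + 3 * r = #B) :
    ∃ a b F I, PathOn T a b F ∧ PathIn T b a I ∧ Disjoint F I ∧ F ∪ I = univ := by
  have hKA : ∀ W : Finset V, #(W ∩ B) ≤ #B - 3 * r → σ * Fintype.card V ≤ #(B \ W) := by
    intro W hW
    have e1 := card_inter_add_card_sdiff B W
    rw [inter_comm] at e1
    have e2 : r₀ ≤ #(B \ W) := by omega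
    have e3 : (r₀ : ℝ) ≤ #(B \ W) := by exact_mod_cast e2
    have e4 : (0 : ℝ) ≤ #S := by positivity
    linarith
  have hKB : ∀ W : Finset V, #(W \ B) + #B + r ≤ Fintype.card V →
      σ * Fintype.card V ≤ #(A \ W) := by
    intro W hW
    have e1 : Bᶜ ⊆ (A \ W) ∪ S ∪ (W \ B) := by
      intro v hv
      rw [mem_compl] at hv
      simp only [mem_union, mem_sdiff]
      have := h.cover v
      tauto
    have e2 := (card_le_card e1).trans ((card_union_le _ _).trans
      (Nat.add_le_add_right (card_union_le _ _) _))
    rw [card_compl] at e2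
    have e3 : r₀ ≤ #(A \ W) + #S := by omega
    have e4 : (r₀ : ℝ) ≤ #(A \ W) + #S := by exact_mod_cast e3
    linarith
  obtain ⟨L₂, F₂, hN₂, hL₂, h₂, hd₂, hc₂, hc₂'⟩ := exists_greedy (T := T) (B := B) (E := B) (p := 4)
    (q := 1) (KA := #B - 3 * r) (KB := Fintype.card V - #B - r) (fun W hW hW' =>
      h.exists_block hσ hε hε0 hn (hKB W (by omega)) (hKA W hW)) N (F₀ ∪ F₁)
    (by rw [(card_union_split hd.symm).1]; omega) (by rw [(card_union_split hd.symm).2]; omega)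
  have hs := card_union_split (B := B) hd.symm
  have hs₂ := card_union_split (B := B) hd₂.symm
  have hconn : ∀ a ∈ B, ∀ b ∈ B, ∀ W : Finset V, #(W ∩ B) ≤ #B - 3 * r →
      #(W \ B) ≤ Fintype.card V - #B - r →
      ∃ I, I ⊆ univ ∧ Disjoint I W ∧ #(I ∩ B) = 2 ∧ #(I \ B) = 1 ∧ PathIn T a b I :=
    fun a ha b hb W hW hW' => by
      obtain ⟨I, hI⟩ := h.exists_connector hσ hε hn (hKB W (by omega)) (hKA W hW) ha hb
      exact ⟨I, subset_univ _, hI⟩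
  obtain ⟨x, L, hxL⟩ : ∃ x L, L₀ ++ L₁ ++ L₂ = x :: L := by
    refine List.exists_cons_of_ne_nil ?_
    rintro h0
    have := congrArg List.length h0
    simp only [List.length_append, List.length_nil] at this
    omega
  have hlen := congrArg List.length hxL
  simp only [List.length_append, List.length_cons] at hlen
  have hxB : ∀ y ∈ x :: L, y.1 ∈ B ∧ y.2 ∈ B := by
    rw [← hxL]
    intro y hy
    rw [List.mem_append, List.mem_append] at hy
    rcases hy with (hy | hy) | hy
    · exact hL₀ y hy
    · exact hL₁ y hy
    · exact hL₂ y hy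
  obtain ⟨C, e, -, hCW, hC, hC', he, hlink⟩ := exists_link (T := T) hconn L x (F₀ ∪ F₁ ∪ F₂) hxB
    (by omega) (by omega)
  have hsC := card_union_split (B := B) hCW.symm
  obtain ⟨I, -, hIW, hI, hI', hIp⟩ := hconn e he x.1 (hxB x (by simp)).1 (F₀ ∪ F₁ ∪ F₂ ∪ C)
    (by omega) (by omega)
  have hsI := card_union_split (B := B) hIW.symm
  obtain ⟨Y, hY⟩ : ∃ Y, Y = F₀ ∪ F₁ ∪ F₂ ∪ C ∪ I := ⟨_, rfl⟩
  obtain ⟨U, hU⟩ : ∃ U, U = univ \ Y := ⟨_, rfl⟩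
  rw [← hY] at hsI
  have hUY : Disjoint U Y := by rw [hU]; exact sdiff_disjoint
  have hsU := card_union_split (B := B) hUY
  have hUu : U ∪ Y = univ := by
    rw [hU]
    exact sdiff_union_of_subset (subset_univ _)
  rw [hUu, univ_inter, ← compl_eq_univ_sdiff, card_compl] at hsU
  have hUY' := hUY
  rw [hY] at hUY'
  simp only [disjoint_union_right] at hUY'
  obtain ⟨⟨⟨⟨hU0, hU1⟩, hU2⟩, hUC⟩, hUI⟩ := hUY'
  have hsys₁ := h₁ U hU1 (disjoint_of_subset_right hS hU0) (by omega) (by omega)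
  simp only [disjoint_union_right] at hd₂ hCW hIW
  have hsys : Sys T (x :: L) (F₀ ∪ (F₁ ∪ U) ∪ F₂) := by
    rw [← hxL]
    refine (h₀.append hsys₁ ?_).append h₂ ?_
    · exact disjoint_union_right.2 ⟨hd.symm, hU0.symm⟩
    · simp only [disjoint_union_left]
      exact ⟨hd₂.1.symm, hd₂.2.symm, hU2⟩
  refine ⟨x.1, e, _, I, hlink _ hsys ?_, hIp, ?_, ?_⟩
  · simp only [disjoint_union_left]
    exact ⟨⟨hCW.1.1.symm, hCW.1.2.symm, hUC⟩, hCW.2.symm⟩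
  · simp only [disjoint_union_left]
    exact ⟨⟨⟨hIW.1.1.1.symm, hIW.1.1.2.symm, hUI⟩, hIW.1.2.symm⟩, hIW.2.symm⟩
  · rw [← hUu, hY]
    ext v
    simp only [mem_union]
    tauto

/-- The extremal case. -/
theorem exists_closed_of_ext : ∃ n₀ : ℕ, ∀ (V : Type) [Fintype V] (T : V → V → V → Prop)
    (A B S : Finset V) (ε : ℝ), Ext T A B S ε → n₀ ≤ Fintype.card V → 0 < ε → ε ≤ 1 / 10 ^ 40 →
      1 ≤ ε ^ 2 * Fintype.card V → Even (Fintype.card V) →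
      (∀ b, (Fintype.card V - 1) * (Fintype.card V - 2) +
        2 * (if 4 ∣ Fintype.card V then 2 else 1) ≤
          #(lk T b) + (3 * Fintype.card V / 4) * (3 * Fintype.card V / 4 - 1)) →
      ∃ a b F I, PathOn T a b F ∧ PathIn T b a I ∧ Disjoint F I ∧ F ∪ I = univ := by
  obtain ⟨n₁, hn₁⟩ := exists_balanced_absorber (μ := 1 / 10 ^ 9) (by norm_num) le_rfl
  refine ⟨n₁ + 10 ^ 20, fun V _ T A B S ε h hV hε0 hε hεn hev hdeg => ?_⟩
  obtain ⟨L₀, F₀, h₀, hL₀, hS, hbal, hF₀⟩ := h.exists_special hε0 (by linarith) hεn hev hdeg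
  set n : ℝ := (Fintype.card V : ℝ) with hn
  have hnV : (10 : ℝ) ^ 20 ≤ n := by rw [hn]; exact_mod_cast (by omega : 10 ^ 20 ≤ Fintype.card V)
  have hn0 : 0 ≤ n := by linarith
  have hε2 : ε ^ 2 * n ≤ 1 / 10 ^ 40 * n := by
    refine mul_le_mul_of_nonneg_right ?_ hn0
    nlinarith
  obtain ⟨L₁, F₁, hL₁, hd, hB₁, hA₁, hc₁, habs⟩ := hn₁ V T A B S ε h (by omega) hε0 (by linarith) F₀
    (by rw [← hn]; linarith)
  rw [← hn] at hc₁ habs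
  have hSle := h.S_le
  have hBle := h.B_le
  have hleB := h.le_B
  rw [← hn] at hSle hBle hleB
  have hBV : #B ≤ Fintype.card V := card_le_univ B
  have hF₀' := card_inter_add_card_sdiff F₀ B
  have hF₀'' : ((#(F₀ ∩ B) : ℕ) : ℝ) + #(F₀ \ B) = #F₀ := by exact_mod_cast hF₀'
  have hbal' : ((#(F₀ ∩ B) : ℕ) : ℝ) + 3 * n = 3 * #(F₀ \ B) + L₀.length + 4 * #B := by
    rw [hn]
    exact_mod_cast hbal
  obtain ⟨r₀, hr₀⟩ : ∃ r₀, r₀ = ⌊n / (2 * 10 ^ 15)⌋₊ := ⟨_, rfl⟩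
  have hr₀1 : (r₀ : ℝ) ≤ n / (2 * 10 ^ 15) := hr₀ ▸ Nat.floor_le (by positivity)
  have hr₀2 : n / (2 * 10 ^ 15) < r₀ + 1 := hr₀ ▸ Nat.lt_floor_add_one _
  have hX : #(F₀ \ B) + #(F₁ \ B) + L₀.length + L₁.length + r₀ + #B + 4 ≤ Fintype.card V := by
    have e1 : ((#(F₁ \ B) : ℕ) : ℝ) = 3 * L₁.length := by exact_mod_cast hA₁
    have e2 : (0 : ℝ) ≤ #(F₀ ∩ B) := by positivity
    have e3 : (0 : ℝ) ≤ #(F₀ \ B) := by positivity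
    have e4 : ((#(F₀ \ B) + #(F₁ \ B) + L₀.length + L₁.length + r₀ + #B + 4 : ℕ) : ℝ) ≤ n := by
      push_cast
      linarith
    rw [hn] at e4
    exact_mod_cast e4
  obtain ⟨N, r, hN, hr, hr', hNr⟩ : ∃ N r, 0 < N ∧ r₀ ≤ r ∧ r ≤ r₀ + 1 ∧
      #(F₀ \ B) + #(F₁ \ B) + L₀.length + L₁.length + 2 * N + r + #B = Fintype.card V := by
    obtain ⟨M, hM⟩ := Nat.exists_eq_add_of_le hX
    refine ⟨(M + 4) / 2, r₀ + (M + 4) % 2, by omega, by omega, by omega, by omega⟩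
  refine h.exists_closed_of_absorber (σ := 1 / (4 * 10 ^ 15)) (by norm_num) ?_ hε0 ?_ ?_ hr hN hL₀
    hL₁ h₀ hS hd (fun U hU hUS hUB hUA => habs r U ?_ hU hUS hUB hUA) hNr ?_
  · norm_num
    linarith
  · rw [← hn]
    linarith
  · rw [← hn]
    linarith
  · have : (r : ℝ) ≤ r₀ + 1 := by exact_mod_cast hr'
    linarith
  · omega

end BalancedClosing

section Extraction

variable {V : Type} [Fintype V] {T : V → V → V → Prop}

theorem card_filter_product_le (P : V × V → Prop) (X X' Y Y' : Finset V) :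
    #{p ∈ X ×ˢ Y | P p} ≤ #{p ∈ X' ×ˢ Y' | P p} + #(X \ X') * Fintype.card V +
      Fintype.card V * #(Y \ Y') := by
  have h1 : {p ∈ X ×ˢ Y | P p} ⊆ {p ∈ X' ×ˢ Y' | P p} ∪ (X \ X') ×ˢ univ ∪ univ ×ˢ (Y \ Y') := by
    rintro ⟨x, y⟩ h
    simp only [mem_filter, mem_product, mem_union, mem_sdiff, mem_univ, true_and, and_true] at h ⊢
    tauto
  refine (card_le_card h1).trans ((card_union_le _ _).trans ?_)
  rw [card_product, card_univ]
  refine Nat.add_le_add_right ((card_union_le _ _).trans ?_) _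
  rw [card_product, card_univ]

theorem card_lk_add_missing_le (hT : IsTri T) (b : V) (B : Finset V) :
    #(lk T b) + 2 * #{p ∈ Bᶜ ×ˢ B | ¬ T b p.1 p.2} + #B ^ 2 ≤
      #{p ∈ B ×ˢ B | T b p.1 p.2} + Fintype.card V ^ 2 := by
  have h1 : lk T b ⊆ {p ∈ B ×ˢ B | T b p.1 p.2} ∪ {p ∈ Bᶜ ×ˢ B | T b p.1 p.2} ∪
      ({p ∈ Bᶜ ×ˢ B | T b p.1 p.2}.image Prod.swap) ∪ Bᶜ ×ˢ Bᶜ := by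
    rintro ⟨x, y⟩ h
    have h' : T b x y := (mem_filter.1 h).2
    simp only [mem_union, mem_filter, mem_product, mem_compl, mem_image, Prod.exists, Prod.swap_prod_mk,
      Prod.mk.injEq]
    by_cases hx : x ∈ B <;> by_cases hy : y ∈ B
    · simp [hx, hy, h']
    · exact Or.inl (Or.inr ⟨y, x, ⟨⟨hy, hx⟩, hT.swap₂₃ h'⟩, rfl, rfl⟩)
    · simp [hx, hy, h']
    · simp [hx, hy]
  have h2 := (card_le_card h1).trans ((card_union_le _ _).trans (Nat.add_le_add_right
    ((card_union_le _ _).trans (Nat.add_le_add (card_union_le _ _) card_image_le)) _))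
  rw [card_product] at h2
  have h3 := card_filter_add_card_filter_not (s := Bᶜ ×ˢ B) (fun p => T b p.1 p.2)
  rw [card_product] at h3
  have h4 := card_compl_add_card B
  rw [← h4]
  nlinarith

theorem boxCount_eq_sum (B : Finset V) :
    boxCount T B B B = ∑ v ∈ B, #{p ∈ B ×ˢ B | T v p.1 p.2} := by
  rw [boxCount, card_filter, sum_product]
  simp_rw [card_filter]

theorem boxCount_mono {B B' : Finset V} (h : B ⊆ B') : boxCount T B B B ≤ boxCount T B' B' B' :=
  card_le_card (filter_subset_filter _ (product_subset_product h (product_subset_product h h)))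

theorem sum_missing_comm (hT : IsTri T) (A B : Finset V) :
    ∑ v ∈ B, #{p ∈ A ×ˢ B | ¬ T v p.1 p.2} = ∑ a ∈ A, #{p ∈ B ×ˢ B | ¬ T a p.1 p.2} := by
  simp_rw [card_filter, sum_product]
  rw [sum_comm]
  refine sum_congr rfl fun a _ => sum_congr rfl fun v _ => sum_congr rfl fun q _ => ?_
  have : T v a q ↔ T a v q := ⟨hT.swap₁₂, hT.swap₁₂⟩
  rw [this]

theorem card_heavy_le (X : Finset V) (f : V → ℕ) {c M : ℝ} (hM : (∑ v ∈ X, f v : ℕ) ≤ M) :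
    (#{v ∈ X | c < f v} : ℝ) * c ≤ M := by
  refine le_trans ?_ hM
  push_cast
  have h1 : ∑ v ∈ X with c < f v, (f v : ℝ) ≤ ∑ v ∈ X, (f v : ℝ) :=
    sum_le_sum_of_subset_of_nonneg (filter_subset _ _) fun _ _ _ => Nat.cast_nonneg _
  refine le_trans ?_ h1
  rw [← nsmul_eq_mul]
  exact card_nsmul_le_sum _ _ _ fun v hv => (mem_filter.1 hv).2.le

/-- A sparse set of about three quarters of the vertices gives an extremal partition. -/
theorem exists_ext_of_sparse (hT : IsTri T) {ε : ℝ} (hε0 : 0 < ε) (hε : ε ≤ 1 / 1000)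
    (hn : 4 ≤ ε ^ 3 * (Fintype.card V : ℝ))
    (hlk : ∀ a, 7 / 16 * (Fintype.card V : ℝ) ^ 2 - 3 * Fintype.card V ≤ #(lk T a))
    {B₀ : Finset V} (hB₀ : (3 / 4 - ε ^ 3) * (Fintype.card V : ℝ) ≤ #B₀)
    (hbox : (boxCount T B₀ B₀ B₀ : ℝ) ≤ ε ^ 3 * (Fintype.card V : ℝ) ^ 3) :
    ∃ A B S, Ext T A B S ε := by
  set n : ℝ := (Fintype.card V : ℝ) with hn'
  obtain ⟨δ, hδ⟩ : ∃ δ, δ = ε ^ 3 := ⟨_, rfl⟩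
  rw [← hδ] at hn hB₀ hbox
  have hδ0 : 0 < δ := hδ ▸ by positivity
  have hδ1 : δ ≤ ε ^ 2 / 1000 := by
    rw [hδ, pow_succ, div_eq_mul_one_div]
    exact mul_le_mul_of_nonneg_left hε (by positivity)
  have hε2 : ε ^ 2 ≤ ε / 1000 := by
    rw [sq, div_eq_mul_one_div]
    exact mul_le_mul_of_nonneg_left hε hε0.le
  have hn0 : 0 < n := by
    by_contra hc
    push Not at hc
    linarith [mul_nonpos_of_nonneg_of_nonpos hδ0.le hc]
  obtain ⟨B₁, hB₁₀, hB₁le, hB₁ge⟩ : ∃ B₁ ⊆ B₀, (#B₁ : ℝ) ≤ 3 / 4 * n ∧ (3 / 4 - δ) * n ≤ #B₁ := by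
    by_cases hc : (#B₀ : ℝ) ≤ 3 / 4 * n
    · exact ⟨B₀, subset_rfl, hc, hB₀⟩
    · push Not at hc
      obtain ⟨B₁, h1, h2⟩ := exists_subset_card_eq
        (show ⌊3 / 4 * n⌋₊ ≤ #B₀ from Nat.floor_le_of_le hc.le)
      refine ⟨B₁, h1, ?_, ?_⟩
      · rw [h2]
        exact Nat.floor_le (by positivity)
      · rw [h2]
        have := Nat.lt_floor_add_one (3 / 4 * n)
        linarith
  have hbox₁ : (boxCount T B₁ B₁ B₁ : ℝ) ≤ δ * n ^ 3 :=
    le_trans (by exact_mod_cast boxCount_mono hB₁₀) hbox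
  have h3n : 3 * n ≤ δ * n ^ 2 := by
    have := mul_le_mul_of_nonneg_right hn hn0.le
    nlinarith
  have hB₁sq : (9 / 16 - 3 / 2 * δ) * n ^ 2 ≤ (#B₁ : ℝ) ^ 2 := by
    have h1 : 0 ≤ (3 / 4 - δ) * n := by
      refine mul_nonneg ?_ hn0.le
      nlinarith
    have h2 := pow_le_pow_left₀ h1 hB₁ge 2
    refine le_trans ?_ h2
    rw [mul_pow]
    refine mul_le_mul_of_nonneg_right ?_ (by positivity)
    nlinarith [sq_nonneg δ]
  have hmiss : ∀ b, 2 * (#{p ∈ B₁ᶜ ×ˢ B₁ | ¬ T b p.1 p.2} : ℝ) ≤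
      #{p ∈ B₁ ×ˢ B₁ | T b p.1 p.2} + 5 / 2 * δ * n ^ 2 := by
    intro b
    have h1 := card_lk_add_missing_le hT b B₁
    have h2 : (#(lk T b) : ℝ) + 2 * #{p ∈ B₁ᶜ ×ˢ B₁ | ¬ T b p.1 p.2} + (#B₁ : ℝ) ^ 2 ≤
      #{p ∈ B₁ ×ˢ B₁ | T b p.1 p.2} + n ^ 2 := by
      rw [hn']
      exact_mod_cast h1
    have h3 := hlk b
    linarith
  obtain ⟨X₁, hX₁⟩ : ∃ X₁, X₁ = {v ∈ B₁ | ε * n ^ 2 < #{p ∈ B₁ ×ˢ B₁ | T v p.1 p.2}} := ⟨_, rfl⟩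
  obtain ⟨X₂, hX₂⟩ : ∃ X₂, X₂ = {v ∈ B₁ᶜ | ε * n ^ 2 < #{p ∈ B₁ ×ˢ B₁ | ¬ T v p.1 p.2}} :=
    ⟨_, rfl⟩
  have hsum₁ : ((∑ v ∈ B₁, #{p ∈ B₁ ×ˢ B₁ | T v p.1 p.2} : ℕ) : ℝ) ≤ δ * n ^ 3 := by
    rw [← boxCount_eq_sum]
    exact hbox₁
  have hX₁c : (#X₁ : ℝ) ≤ ε ^ 2 * n := by
    have h1 := card_heavy_le (c := ε * n ^ 2) B₁ _ hsum₁
    rw [← hX₁] at h1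
    have h2 : (#X₁ : ℝ) * (ε * n ^ 2) ≤ (ε ^ 2 * n) * (ε * n ^ 2) := h1.trans_eq (by rw [hδ]; ring)
    exact le_of_mul_le_mul_right h2 (by positivity)
  have hX₂c : (#X₂ : ℝ) ≤ 2 * ε ^ 2 * n := by
    have h0 : ((∑ v ∈ B₁ᶜ, #{p ∈ B₁ ×ˢ B₁ | ¬ T v p.1 p.2} : ℕ) : ℝ) ≤ 2 * (δ * n ^ 3) := by
      rw [← sum_missing_comm hT]
      have h1 := sum_le_sum fun b (hb : b ∈ B₁) => hmiss b
      rw [← mul_sum, sum_add_distrib, sum_const, nsmul_eq_mul] at h1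
      have h2 : (#B₁ : ℝ) * (5 / 2 * δ * n ^ 2) ≤ (3 / 4 * n) * (5 / 2 * δ * n ^ 2) :=
        mul_le_mul_of_nonneg_right hB₁le (by positivity)
      have h3 : (3 / 4 * n) * (5 / 2 * δ * n ^ 2) = 15 / 8 * (δ * n ^ 3) := by ring
      have h4 : 0 ≤ δ * n ^ 3 := by positivity
      push_cast at hsum₁ ⊢
      linarith
    have h1 := card_heavy_le (c := ε * n ^ 2) B₁ᶜ _ h0
    rw [← hX₂] at h1
    have h2 : (#X₂ : ℝ) * (ε * n ^ 2) ≤ (2 * ε ^ 2 * n) * (ε * n ^ 2) :=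
      h1.trans_eq (by rw [hδ]; ring)
    exact le_of_mul_le_mul_right h2 (by positivity)
  obtain ⟨B, hB⟩ : ∃ B : Finset V, ∀ v, v ∈ B ↔ (#{p ∈ B₁ ×ˢ B₁ | T v p.1 p.2} : ℝ) ≤ ε * n ^ 2 :=
    ⟨univ.filter fun v => (#{p ∈ B₁ ×ˢ B₁ | T v p.1 p.2} : ℝ) ≤ ε * n ^ 2, fun v => by
      rw [mem_filter, and_iff_right (mem_univ v)]⟩
  obtain ⟨A, hA⟩ : ∃ A : Finset V, ∀ v, v ∈ A ↔ v ∉ B ∧ v ∉ B₁ ∧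
      (#{p ∈ B₁ ×ˢ B₁ | ¬ T v p.1 p.2} : ℝ) ≤ ε * n ^ 2 :=
    ⟨univ.filter fun v => v ∉ B ∧ v ∉ B₁ ∧ (#{p ∈ B₁ ×ˢ B₁ | ¬ T v p.1 p.2} : ℝ) ≤ ε * n ^ 2,
      fun v => by rw [mem_filter, and_iff_right (mem_univ v)]⟩
  have hB₁B : B₁ \ B ⊆ X₁ := by
    intro v hv
    rw [mem_sdiff, hB, not_le] at hv
    rw [hX₁, mem_filter]
    exact hv
  have hBB₁ : B \ B₁ ⊆ X₂ := by
    intro v hv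
    rw [mem_sdiff, hB] at hv
    rw [hX₂, mem_filter, mem_compl]
    refine ⟨hv.2, ?_⟩
    have h1 := card_filter_add_card_filter_not (s := B₁ ×ˢ B₁) (fun p => T v p.1 p.2)
    rw [card_product, ← sq] at h1
    have h2 : (#{p ∈ B₁ ×ˢ B₁ | T v p.1 p.2} : ℝ) + #{p ∈ B₁ ×ˢ B₁ | ¬ T v p.1 p.2} =
      (#B₁ : ℝ) ^ 2 := by exact_mod_cast h1
    have h3 : 2 * ε * n ^ 2 < (9 / 16 - 3 / 2 * δ) * n ^ 2 :=
      mul_lt_mul_of_pos_right (by linarith) (by positivity)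
    linarith
  have hc₁ : (#(B₁ \ B) : ℝ) ≤ ε ^ 2 * n := le_trans (by exact_mod_cast card_le_card hB₁B) hX₁c
  have hc₂ : (#(B \ B₁) : ℝ) ≤ 2 * ε ^ 2 * n := le_trans (by exact_mod_cast card_le_card hBB₁) hX₂c
  have hcard : (#B : ℝ) + #(B₁ \ B) = #B₁ + #(B \ B₁) := by
    have h1 := card_inter_add_card_sdiff B B₁
    have h2 := card_inter_add_card_sdiff B₁ B
    rw [inter_comm] at h2
    have : #B + #(B₁ \ B) = #B₁ + #(B \ B₁) := by omega
    exact_mod_cast this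
  have hprod : ∀ P : V × V → Prop, ∀ X X' Y Y' : Finset V,
      (#{p ∈ X ×ˢ Y | P p} : ℝ) ≤ #{p ∈ X' ×ˢ Y' | P p} + (#(X \ X') + #(Y \ Y')) * n := by
    intro P X X' Y Y'
    have h1 := card_filter_product_le P X X' Y Y'
    have h2 : (#{p ∈ X ×ˢ Y | P p} : ℝ) ≤ #{p ∈ X' ×ˢ Y' | P p} + #(X \ X') * n + n * #(Y \ Y') := by
      rw [hn']
      exact_mod_cast h1
    linarith
  have hδn : δ * n ≤ ε ^ 2 / 1000 * n := mul_le_mul_of_nonneg_right hδ1 hn0.le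
  have hε2n : 0 < ε ^ 2 * n := by positivity
  have hmul₁ := mul_le_mul_of_nonneg_right hc₁ hn0.le
  have hmul₂ := mul_le_mul_of_nonneg_right hc₂ hn0.le
  have hq : ε ^ 2 * n ^ 2 ≤ ε / 1000 * n ^ 2 := mul_le_mul_of_nonneg_right hε2 (by positivity)
  have hq0 : 0 < ε * n ^ 2 := by positivity
  have hδq : δ * n ^ 2 ≤ ε ^ 2 / 1000 * n ^ 2 := mul_le_mul_of_nonneg_right hδ1 (by positivity)
  refine ⟨A, B, univ \ (A ∪ B), hT, ?_, ?_, ?_, ?_, ?_, ?_, ?_, ?_, ?_, ?_, ?_⟩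
  · exact disjoint_left.2 fun v hv => ((hA v).1 hv).1
  · exact disjoint_of_subset_right subset_union_right sdiff_disjoint
  · exact (disjoint_of_subset_right subset_union_left sdiff_disjoint).symm
  · intro v
    simp only [mem_sdiff, mem_univ, mem_union, true_and]
    tauto
  · rw [← hn']
    have : (0 : ℝ) ≤ #(B \ B₁) := by positivity
    linarith
  · rw [← hn']
    have : (0 : ℝ) ≤ #(B₁ \ B) := by positivity
    linarith
  · have h1 : univ \ (A ∪ B) ⊆ X₁ ∪ X₂ := by
      intro v hv
      simp only [mem_sdiff, mem_univ, mem_union, true_and, not_or] at hv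
      rw [mem_union]
      by_cases hv₁ : v ∈ B₁
      · exact Or.inl (hB₁B (mem_sdiff.2 ⟨hv₁, hv.2⟩))
      · refine Or.inr ?_
        rw [hX₂, mem_filter, mem_compl]
        refine ⟨hv₁, ?_⟩
        by_contra hc
        exact hv.1 ((hA v).2 ⟨hv.2, hv₁, not_lt.1 hc⟩)
    have h2 : (#(univ \ (A ∪ B)) : ℝ) ≤ #X₁ + #X₂ := by
      exact_mod_cast (card_le_card h1).trans (card_union_le _ _)
    rw [← hn']
    linarith
  · intro b hb
    rw [hB] at hb
    have h1 : (#{p ∈ A ×ˢ B | ¬ T b p.1 p.2} : ℝ) ≤ #{p ∈ B₁ᶜ ×ˢ B₁ | ¬ T b p.1 p.2} +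
        (#(A \ B₁ᶜ) + #(B \ B₁)) * n := by
      convert hprod (fun p => ¬ T b p.1 p.2) A B₁ᶜ B B₁
    have h2 : A \ B₁ᶜ = ∅ := by
      rw [sdiff_eq_empty_iff_subset]
      intro v hv
      exact mem_compl.2 ((hA v).1 hv).2.1
    rw [h2, card_empty, Nat.cast_zero, zero_add] at h1
    have h3 := hmiss b
    rw [← hn']
    linarith
  · intro a ha
    have h1 : (#{p ∈ B ×ˢ B | ¬ T a p.1 p.2} : ℝ) ≤ #{p ∈ B₁ ×ˢ B₁ | ¬ T a p.1 p.2} +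
        (#(B \ B₁) + #(B \ B₁)) * n := by
      convert hprod (fun p => ¬ T a p.1 p.2) B B₁ B B₁
    have h2 := ((hA a).1 ha).2.2
    rw [← hn']
    linarith
  · intro v hv
    have h1 := hprod (fun p => T v p.1 p.2) B₁ B B₁ B
    have h2 : v ∉ B := by
      simp only [mem_sdiff, mem_univ, mem_union, true_and, not_or] at hv
      exact hv.2
    rw [hB, not_le] at h2
    rw [← hn']
    linarith
  · intro b hb
    have h1 := hprod (fun p => T b p.1 p.2) B B₁ B B₁
    rw [hB] at hb
    rw [← hn']
    linarith

end Extraction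

section Conclusion

variable {n : ℕ} {H : Finset (Finset (Fin n))}

theorem isTri_of_card_eq (hH : ∀ e ∈ H, #e = 3) :
    IsTri fun a b c => ({a, b, c} : Finset (Fin n)) ∈ H where
  swap₁₂ {a b c} h := by
    have : ({b, a, c} : Finset (Fin n)) = {a, b, c} := Finset.insert_comm _ _ _
    simpa only [this] using h
  swap₂₃ {a b c} h := by
    have : ({a, c, b} : Finset (Fin n)) = {a, b, c} := by rw [Finset.pair_comm]
    simpa only [this] using h
  ne {a b c} h := by
    rintro rfl
    have h3 := hH _ h
    have : #({a, c} : Finset (Fin n)) ≤ 2 := card_le_two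
    simp at h3
    omega

theorem two_mul_hdeg_le (hH : ∀ e ∈ H, #e = 3) (v : Fin n) :
    2 * hdeg H v ≤ #(lk (fun a b c => ({a, b, c} : Finset (Fin n)) ∈ H) v) := by
  have hmaps : Set.MapsTo (fun p : Fin n × Fin n => ({v, p.1, p.2} : Finset (Fin n)))
      (lk (fun a b c => ({a, b, c} : Finset (Fin n)) ∈ H) v)
      (H.filter fun e => v ∈ e : Finset (Finset (Fin n))) := by
    intro p hp
    simpa [lk] using hp
  rw [card_eq_sum_card_fiberwise hmaps, hdeg, mul_comm, ← smul_eq_mul]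
  refine card_nsmul_le_sum _ _ _ fun e he => ?_
  obtain ⟨heH, hve⟩ := mem_filter.1 he
  have h2 : #(e.erase v) = 2 := by rw [card_erase_of_mem hve, hH e heH]
  obtain ⟨x, y, hxy, hE⟩ := card_eq_two.1 h2
  have hexy : e = {v, x, y} := by rw [← hE, insert_erase hve]
  have hsub : ({(x, y), (y, x)} : Finset (Fin n × Fin n)) ⊆
      (lk (fun a b c => ({a, b, c} : Finset (Fin n)) ∈ H) v).filter
        fun p => ({v, p.1, p.2} : Finset (Fin n)) = e := by
    have hcomm : ({v, y, x} : Finset (Fin n)) = {v, x, y} := by rw [Finset.pair_comm]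
    intro p hp
    rcases mem_insert.1 hp with rfl | hp
    · simp only [lk, mem_filter, mem_univ, true_and]
      exact ⟨hexy ▸ heH, hexy.symm⟩
    · rw [mem_singleton.1 hp]
      simp only [lk, mem_filter, mem_univ, true_and, hcomm]
      exact ⟨hexy ▸ heH, hexy.symm⟩
  refine (card_pair ?_).symm.le.trans (card_le_card hsub)
  simp [Prod.ext_iff, hxy]

theorem lk_lower_bound (hH : ∀ e ∈ H, #e = 3) {v : Fin n} {c : ℕ}
    (hv : (n - 1).choose 2 - (3 * n / 4).choose 2 + c ≤ hdeg H v) :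
    (n - 1) * (n - 2) + 2 * c ≤
      #(lk (fun a b c => ({a, b, c} : Finset (Fin n)) ∈ H) v) +
        3 * n / 4 * (3 * n / 4 - 1) := by
  have h := two_mul_hdeg_le hH v
  have e (k : ℕ) : 2 * k.choose 2 = k * (k - 1) := by
    rw [Nat.choose_two_right]
    exact Nat.mul_div_cancel' (Nat.even_mul_pred_self k).two_dvd
  have e1 := e (n - 1)
  have e2 := e (3 * n / 4)
  rw [show n - 1 - 1 = n - 2 by omega] at e1
  rw [← e1, ← e2]
  omega

theorem real_lk_lower_bound {x : ℕ} (hn : 4 ≤ n)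
    (h : (n - 1) * (n - 2) ≤ x + 3 * n / 4 * (3 * n / 4 - 1)) :
    7 / 16 * (n : ℝ) ^ 2 - 3 * n ≤ x := by
  have h1 : ((n : ℝ) - 1) * (n - 2) ≤ x + ((3 * n / 4 : ℕ) : ℝ) * ((3 * n / 4 : ℕ) : ℝ) := by
    have h' : (n - 1) * (n - 2) ≤ x + 3 * n / 4 * (3 * n / 4) :=
      h.trans (Nat.add_le_add_left (Nat.mul_le_mul_left _ (Nat.sub_le _ _)) _)
    have := (Nat.cast_le (α := ℝ)).2 h'
    push_cast [Nat.cast_sub (show 1 ≤ n by omega), Nat.cast_sub (show 2 ≤ n by omega)] at this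
    exact_mod_cast this
  have h2 : ((3 * n / 4 : ℕ) : ℝ) ≤ 3 * n / 4 := by
    have := Nat.cast_div_le (α := ℝ) (m := 3 * n) (n := 4)
    push_cast at this
    exact this
  nlinarith [Nat.cast_nonneg (α := ℝ) (3 * n / 4)]

theorem exists_looseHamCycle :
    ∃ n₀ : ℕ, ∀ n : ℕ, n > n₀ → Even n →
      ∀ H : Finset (Finset (Fin n)), (∀ e ∈ H, e.card = 3) →
      (∀ v : Fin n,
        (n - 1).choose 2 - (3 * n / 4).choose 2 + (if 4 ∣ n then 2 else 1) ≤ hdeg H v) →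
      HasLooseHamCycle n H := by
  obtain ⟨ε, hε0, hε, hε'⟩ : ∃ ε : ℝ, 0 < ε ∧ ε ≤ 1 / 10 ^ 40 ∧ ε ≤ 1 / 1000 :=
    ⟨1 / 10 ^ 40, by positivity, le_rfl, by norm_num⟩
  have hν : 0 < ε ^ 3 := by positivity
  obtain ⟨γ, hγ, n₁, hn₁⟩ := exists_closed_of_nonextremal hν
  obtain ⟨n₂, hn₂⟩ := exists_closed_of_ext
  obtain ⟨n₃, hn₃⟩ := exists_nat_ge (3 / γ)
  obtain ⟨n₄, hn₄⟩ := exists_nat_ge (4 / ε ^ 3)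
  refine ⟨n₁ + n₂ + n₃ + n₄ + 4, fun n hn hev H hH hdeg => ?_⟩
  have hcast {k : ℕ} (hk : k ≤ n) : (k : ℝ) ≤ n := by exact_mod_cast hk
  have hnγ : 3 ≤ γ * n := by
    have := (div_le_iff₀ hγ).1 (hn₃.trans (hcast (by omega)))
    linarith
  have hnε : 4 ≤ ε ^ 3 * n := by
    have := (div_le_iff₀ hν).1 (hn₄.trans (hcast (by omega)))
    linarith
  have hnε2 : 1 ≤ ε ^ 2 * n := by
    have : ε ^ 3 * n ≤ ε ^ 2 * n :=
      mul_le_mul_of_nonneg_right (pow_le_pow_of_le_one hε0.le (by linarith) (by norm_num))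
        n.cast_nonneg
    linarith
  have hT := isTri_of_card_eq hH
  have hlk := fun v => lk_lower_bound hH (hdeg v)
  have hlk' := fun v => real_lk_lower_bound (by omega) ((Nat.le_add_right _ _).trans (hlk v))
  have hn0 : (0 : ℝ) ≤ n := n.cast_nonneg
  obtain ⟨a, b, F, I, h₁, h₂, hd, hu⟩ : ∃ a b F I,
      PathOn (fun a b c => ({a, b, c} : Finset (Fin n)) ∈ H) a b F ∧
      PathIn (fun a b c => ({a, b, c} : Finset (Fin n)) ∈ H) b a I ∧
      Disjoint F I ∧ F ∪ I = univ := by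
    by_cases hB : ∀ B : Finset (Fin n), (3 / 4 - ε ^ 3) * n ≤ #B →
        ε ^ 3 * (n : ℝ) ^ 3 < boxCount (fun a b c => ({a, b, c} : Finset (Fin n)) ∈ H) B B B
    · convert hn₁ (Fin n) _ hT (by simp; omega) (by simpa using hev) (fun v => ?_)
        (by simpa only [Fintype.card_fin] using hB)
      rw [Fintype.card_fin]
      refine le_trans ?_ (hlk' v)
      nlinarith
    · push Not at hB
      obtain ⟨B₀, hB₀, hbox⟩ := hB
      obtain ⟨A, B, S, hext⟩ := exists_ext_of_sparse hT hε0 hε'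
        (by simpa only [Fintype.card_fin] using hnε)
        (by simpa only [Fintype.card_fin] using hlk')
        (by simpa only [Fintype.card_fin] using hB₀)
        (by simpa only [Fintype.card_fin] using hbox)
      convert hn₂ (Fin n) _ A B S ε hext (by simp; omega) hε0 hε
        (by simpa only [Fintype.card_fin] using hnε2) (by simpa using hev)
        (by simpa only [Fintype.card_fin] using hlk)
  exact hasLooseHamCycle_of_pathOn h₁ h₂ hd (by convert hu)

end Conclusion

end LooseHam

/-- Minimum vertex degree `C(n-1,2) - C(⌊3n/4⌋,2) + c` forces a loose Hamilton cycle. -/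
theorem stmt_0 :
    ∃ n₀ : ℕ, ∀ n : ℕ, n > n₀ → Even n →
      ∀ H : Finset (Finset (Fin n)), (∀ e ∈ H, e.card = 3) →
      (∀ v : Fin n,
        (n - 1).choose 2 - (3 * n / 4).choose 2 + (if 4 ∣ n then 2 else 1) ≤ hdeg H v) →
      HasLooseHamCycle n H := by
  exact LooseHam.exists_looseHamCycle
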